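/- Under hypotheses (H1)–(H3), for every u₀ ∈ L¹(ℝ^d) there exists u : [0,∞) → L¹(ℝ^d), continuous with respect to the L¹-norm, with u(0) = u₀, which is a distributional solution of the nonlinear Fokker–Planck equation ∂_t u = Σ_{i,j=1}^d ∂_i∂_j(a_ij(x,u)u) − div(b(x,u)u), i.e., for every φ ∈ C_c^∞((0,∞) × ℝ^d): ∫₀^∞ ∫_{ℝ^d} ( u(t,x) ∂_tφ(t,x) + Σ_{i,j=1}^d a_ij(x,u(t,x)) u(t,x) ∂_{x_i}∂_{x_j}φ(t,x) + u(t,x) b(x,u(t,x))·∇_xφ(t,x) ) dx dt = 0; moreover, if u₀ ≥ 0 a.e. on ℝ^d then u(t) ≥ 0 a.e. on ℝ^d for all t ≥ 0, and ∫_{ℝ^d} u(t,x) dx = ∫_{ℝ^d} u₀(x) dx for all t ≥ 0. -/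

import Mathlib

open MeasureTheory Filter

/-- The `i`-th partial derivative of `φ : ℝ^d → ℝ`. -/
noncomputable def pd {d : ℕ} (i : Fin d) (φ : (Fin d → ℝ) → ℝ) (x : Fin d → ℝ) : ℝ :=
  fderiv ℝ φ x (Pi.single i 1)

/-- The second partial derivative `∂_i ∂_j φ`. -/
noncomputable def pd2 {d : ℕ} (i j : Fin d) (φ : (Fin d → ℝ) → ℝ) (x : Fin d → ℝ) : ℝ :=
  pd i (pd j φ) x

/-- Time derivative `∂_t φ` for `φ : ℝ × ℝ^d → ℝ`. -/
noncomputable def pdt {d : ℕ} (φ : ℝ × (Fin d → ℝ) → ℝ) (p : ℝ × (Fin d → ℝ)) : ℝ :=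
  fderiv ℝ φ p ((1 : ℝ), (0 : Fin d → ℝ))

/-- Spatial partial derivative `∂_{x_i} φ` for `φ : ℝ × ℝ^d → ℝ`. -/
noncomputable def pdx {d : ℕ} (i : Fin d) (φ : ℝ × (Fin d → ℝ) → ℝ) (p : ℝ × (Fin d → ℝ)) : ℝ :=
  fderiv ℝ φ p ((0 : ℝ), (Pi.single i 1 : Fin d → ℝ))

/-- Second spatial partial derivative `∂_{x_i}∂_{x_j} φ`. -/
noncomputable def pdxx {d : ℕ} (i j : Fin d) (φ : ℝ × (Fin d → ℝ) → ℝ)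
    (p : ℝ × (Fin d → ℝ)) : ℝ :=
  pdx i (pdx j φ) p

/-- Distributional solution of the nonlinear Fokker–Planck equation
`∂_t u = Σ_{i,j} ∂_i∂_j(a_ij(x,u)u) - div(b(x,u)u)` on `(0,∞) × ℝ^d`. -/
def IsFPESol {d : ℕ} (a : Fin d → Fin d → (Fin d → ℝ) → ℝ → ℝ)
    (b : Fin d → (Fin d → ℝ) → ℝ → ℝ) (u : ℝ → (Fin d → ℝ) → ℝ) : Prop :=
  ∀ φ : ℝ × (Fin d → ℝ) → ℝ, ContDiff ℝ (⊤ : ℕ∞) φ → HasCompactSupport φ →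
    tsupport φ ⊆ {p : ℝ × (Fin d → ℝ) | 0 < p.1} →
    (∫ t in Set.Ioi (0 : ℝ), ∫ x, (u t x * pdt φ (t, x)
      + ∑ i, ∑ j, a i j x (u t x) * u t x * pdxx i j φ (t, x)
      + u t x * ∑ i, b i x (u t x) * pdx i φ (t, x))) = 0

namespace FPE
open Set Topology

section L1
variable {α : Type*} [MeasurableSpace α] {μ : Measure α} {ι : Type*}

lemma L1_norm_sub {f g : α → ℝ} (hf : Integrable f μ) (hg : Integrable g μ) :
    dist (hf.toL1 f) (hg.toL1 g) = ∫ x, |f x - g x| ∂μ := by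
  rw [dist_eq_norm, ← Integrable.toL1_sub, L1.norm_of_fun_eq_integral_norm]
  simp [Real.norm_eq_abs]

lemma L1_complete {l : Filter ι} [NeBot l] {u : ι → α → ℝ} (hu : ∀ m, Integrable (u m) μ)
    (hc : ∀ η > 0, ∃ U ∈ l, ∀ m ∈ U, ∀ m' ∈ U, ∫ x, |u m x - u m' x| ∂μ ≤ η) :
    ∃ v, Integrable v μ ∧ Tendsto (fun m => ∫ x, |u m x - v x| ∂μ) l (𝓝 0) := by
  have hC : Cauchy (l.map fun m => (hu m).toL1 (u m)) := by
    rw [Metric.cauchy_iff]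
    refine ⟨inferInstance, fun ε hε => ?_⟩
    obtain ⟨U, hU, h⟩ := hc (ε / 2) (by positivity)
    refine ⟨_, image_mem_map hU, ?_⟩
    rintro _ ⟨m, hm, rfl⟩ _ ⟨m', hm', rfl⟩
    rw [L1_norm_sub]
    exact (h m hm m' hm').trans_lt (by linarith)
  obtain ⟨v, hv⟩ := CompleteSpace.complete hC
  refine ⟨v, L1.integrable_coeFn v, ?_⟩
  have h2 : Tendsto (fun m => (hu m).toL1 (u m)) l (𝓝 v) := hv
  rw [tendsto_iff_dist_tendsto_zero] at h2
  refine h2.congr fun m => ?_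
  rw [← L1_norm_sub (hu m) (L1.integrable_coeFn v), Integrable.toL1_coeFn]

/-- limit of an `L¹`-convergent family along a filter tending to infinity, along a genuine
subsequence converging also almost everywhere -/
lemma L1_subseq {l : Filter ℕ} [NeBot l] (hl : l ≤ atTop) {u : ℕ → α → ℝ} {v : α → ℝ}
    (hu : ∀ m, Integrable (u m) μ) (hv : Integrable v μ)
    (h : Tendsto (fun m => ∫ x, |u m x - v x| ∂μ) l (𝓝 0)) :
    ∃ s : ℕ → ℕ, Tendsto s atTop atTop ∧
      Tendsto (fun j => ∫ x, |u (s j) x - v x| ∂μ) atTop (𝓝 0) ∧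
      ∀ᵐ x ∂μ, Tendsto (fun j => u (s j) x) atTop (𝓝 (v x)) := by
  have h1 : ∀ j : ℕ, ∃ m, j ≤ m ∧ ∫ x, |u m x - v x| ∂μ ≤ 1 / ((j : ℝ) + 1) := by
    intro j
    have e1 : ∀ᶠ m in l, ∫ x, |u m x - v x| ∂μ < 1 / ((j : ℝ) + 1) :=
      h.eventually (gt_mem_nhds (by positivity))
    have e2 : ∀ᶠ m in l, j ≤ m := hl (eventually_ge_atTop j)
    obtain ⟨m, hm⟩ := (e1.and e2).exists
    exact ⟨m, hm.2, hm.1.le⟩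
  choose s hs1 hs2 using h1
  have hs : Tendsto s atTop atTop := tendsto_atTop_mono hs1 tendsto_id
  have hlim : Tendsto (fun j => ∫ x, |u (s j) x - v x| ∂μ) atTop (𝓝 0) :=
    squeeze_zero (fun j => integral_nonneg fun x => abs_nonneg _) hs2
      tendsto_one_div_add_atTop_nhds_zero_nat
  have hM : TendstoInMeasure μ (fun j => u (s j)) atTop v := by
    apply tendstoInMeasure_of_tendsto_eLpNorm one_ne_zero
      (fun j => (hu (s j)).aestronglyMeasurable) hv.aestronglyMeasurable
    have : ∀ j, eLpNorm (u (s j) - v) 1 μ = ENNReal.ofReal (∫ x, |u (s j) x - v x| ∂μ) := by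
      intro j
      rw [eLpNorm_one_eq_lintegral_enorm,
        ← ofReal_integral_norm_eq_lintegral_enorm ((hu (s j)).sub hv)]
      rfl
    simp_rw [this]
    simpa using ENNReal.tendsto_ofReal hlim
  obtain ⟨t, ht, hta⟩ := hM.exists_seq_tendsto_ae
  exact ⟨s ∘ t, hs.comp ht.tendsto_atTop, hlim.comp ht.tendsto_atTop, hta⟩

lemma L1_abs_integral_sub_le {f g : α → ℝ} (hf : Integrable f μ) (hg : Integrable g μ) :
    |∫ x, f x ∂μ - ∫ x, g x ∂μ| ≤ ∫ x, |f x - g x| ∂μ := by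
  rw [← integral_sub hf hg]
  exact abs_integral_le_integral_abs

lemma L1_triangle {f g k : α → ℝ} (hf : Integrable f μ) (hg : Integrable g μ)
    (hk : Integrable k μ) :
    ∫ x, |f x - k x| ∂μ ≤ ∫ x, |f x - g x| ∂μ + ∫ x, |g x - k x| ∂μ := by
  rw [← integral_add (f := fun x => |f x - g x|) (g := fun x => |g x - k x|)
    (hf.sub hg).abs (hg.sub hk).abs]
  exact integral_mono (hf.sub hk).abs ((hf.sub hg).abs.add (hg.sub hk).abs)
    fun x => abs_sub_le _ _ _

lemma L1_comm (f g : α → ℝ) : ∫ x, |f x - g x| ∂μ = ∫ x, |g x - f x| ∂μ := by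
  simp_rw [abs_sub_comm]

end L1

end FPE

namespace FPE
open Set Topology

section
variable {d : ℕ}

/-- the shear `(w,x) ↦ (w, x + ε w)` preserves measure -/
lemma shear_mp (ε : ℝ) (ν : Measure (Fin d → ℝ)) [SFinite ν] :
    MeasurePreserving (fun p : (Fin d → ℝ) × (Fin d → ℝ) => (p.1, p.2 + ε • p.1))
      (ν.prod volume) (ν.prod volume) := by
  refine MeasurePreserving.skew_product (f := id) (g := fun w x => x + ε • w)
    (MeasurePreserving.id ν) (by fun_prop) ?_
  exact Eventually.of_forall fun w => (measurePreserving_add_right volume (ε • w)).map_eq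

lemma shear_integrable {F : (Fin d → ℝ) × (Fin d → ℝ) → ℝ} (ε : ℝ) {ν : Measure (Fin d → ℝ)}
    [SFinite ν] (hF : Integrable F (ν.prod volume)) :
    Integrable (fun p : (Fin d → ℝ) × (Fin d → ℝ) => F (p.1, p.2 + ε • p.1)) (ν.prod volume) :=
  (shear_mp ε ν).integrable_comp_of_integrable hF

lemma shear_integral {F : (Fin d → ℝ) × (Fin d → ℝ) → ℝ} (ε : ℝ) {ν : Measure (Fin d → ℝ)}
    [SFinite ν] :
    ∫ p, F (p.1, p.2 + ε • p.1) ∂(ν.prod volume) = ∫ p, F p ∂(ν.prod volume) := by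
  have hemb : MeasurableEmbedding
      (fun p : (Fin d → ℝ) × (Fin d → ℝ) => (p.1, p.2 + ε • p.1)) := by
    let e : (Fin d → ℝ) × (Fin d → ℝ) ≃ₜ (Fin d → ℝ) × (Fin d → ℝ) :=
      { toFun := fun p => (p.1, p.2 + ε • p.1)
        invFun := fun p => (p.1, p.2 - ε • p.1)
        left_inv := fun p => by simp
        right_inv := fun p => by simp
        continuous_toFun := by fun_prop
        continuous_invFun := by fun_prop }
    exact e.measurableEmbedding
  exact (shear_mp ε ν).integral_comp hemb F

lemma exists_mollifier (d : ℕ) {δ : ℝ} (hδ : 0 < δ) : ∃ ρ : (Fin d → ℝ) → ℝ,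
    ContDiff ℝ (⊤ : ℕ∞) ρ ∧ HasCompactSupport ρ ∧ (∀ x, 0 ≤ ρ x) ∧ (∀ x, ρ (-x) = ρ x) ∧
    (∫ x, ρ x) = 1 ∧ (∀ x, δ < ‖x‖ → ρ x = 0) := by
  let f : ContDiffBump (0 : Fin d → ℝ) := ⟨δ / 2, δ, by positivity, by linarith⟩
  refine ⟨f.normed volume, f.contDiff_normed, f.hasCompactSupport_normed, f.nonneg_normed,
    f.normed_neg, f.integral_normed, fun x hx => ?_⟩
  have : x ∉ Function.support (f.normed volume) := by
    rw [f.support_normed_eq]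
    simpa using hx.le
  simpa using this

/-- mollified function -/
noncomputable def moll (ρ u : (Fin d → ℝ) → ℝ) (x : Fin d → ℝ) : ℝ := ∫ y, ρ y * u (x + y)

lemma moll_eq (ρ u : (Fin d → ℝ) → ℝ) (x : Fin d → ℝ) : moll ρ u x = ∫ y, ρ (y - x) * u y := by
  unfold moll
  rw [← integral_add_left_eq_self (fun y => ρ (y - x) * u y) x]
  simp

lemma integrable_bdd_mul {α : Type*} [MeasurableSpace α] {μ : Measure α} {f g : α → ℝ} {C : ℝ}
    (hf : Integrable f μ) (hg : AEStronglyMeasurable g μ)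
    (hC : ∀ x, |g x| ≤ C) : Integrable (fun x => g x * f x) μ :=
  hf.bdd_mul hg (Eventually.of_forall fun x => by simpa using hC x)

lemma compactL1 {ι : Type*} (l : Ultrafilter ι) {u : ι → (Fin d → ℝ) → ℝ}
    (hu : ∀ m, Integrable (u m)) {C : ℝ} (hC : ∀ m, ∫ x, |u m x| ≤ C)
    (tight : ∀ η > 0, ∃ r : ℝ, ∀ᶠ m in (l : Filter ι), ∫ x in {x | r < ‖x‖}, |u m x| ≤ η)
    (tr : ∀ r : ℝ, ∀ η > 0, ∃ δ > 0, ∀ᶠ m in (l : Filter ι), ∀ y : Fin d → ℝ, ‖y‖ ≤ δ →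
      ∫ x in Metric.closedBall 0 r, |u m (x + y) - u m x| ≤ η) :
    ∃ v, Integrable v ∧ Tendsto (fun m => ∫ x, |u m x - v x|) (l : Filter ι) (𝓝 0) := by
  apply L1_complete hu
  intro η hη
  obtain ⟨r, hr⟩ := tight (η / 6) (by positivity)
  obtain ⟨δ, hδ, hδ'⟩ := tr r (η / 6) (by positivity)
  obtain ⟨ρ, hρ1, hρ2, hρ0, -, hρi, hρs⟩ := exists_mollifier d hδ
  obtain ⟨L, hL⟩ := ContDiff.lipschitzWith_of_hasCompactSupport hρ2 hρ1 (by simp)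
  have hρint : Integrable ρ := hρ1.continuous.integrable_of_hasCompactSupport hρ2
  obtain ⟨Mρ, hMρ⟩ := hρ2.exists_bound_of_continuous hρ1.continuous
  set B : Set (Fin d → ℝ) := Metric.closedBall 0 r with hB
  have hBm : MeasurableSet B := Metric.isClosed_closedBall.measurableSet
  have hBf : volume B ≠ ⊤ := measure_closedBall_lt_top.ne
  have hIntρ : ∀ m x, Integrable fun y => ρ (y - x) * u m y := fun m x =>
    integrable_bdd_mul (hu m) (by
      exact (hρ1.continuous.comp (by fun_prop : Continuous fun y => y - x)).aestronglyMeasurable)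
      (fun y => hMρ _)
  -- equi-Lipschitz
  have hLip : ∀ m x x', |moll ρ (u m) x - moll ρ (u m) x'| ≤ L * C * ‖x - x'‖ := by
    intro m x x'
    rw [moll_eq, moll_eq]
    refine (L1_abs_integral_sub_le (hIntρ m x) (hIntρ m x')).trans ?_
    calc _ ≤ ∫ y, L * ‖x - x'‖ * |u m y| := by
          refine integral_mono ((hIntρ m x).sub (hIntρ m x')).abs ((hu m).abs.const_mul _)
            fun y => ?_
          simp only
          rw [← sub_mul, abs_mul]
          gcongr
          have := hL.dist_le_mul (y - x) (y - x')
          rw [Real.dist_eq, dist_eq_norm] at this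
          have e : y - x - (y - x') = -(x - x') := by abel
          rw [e, norm_neg] at this
          exact this
      _ = L * ‖x - x'‖ * ∫ y, |u m y| := integral_const_mul _ _
      _ ≤ L * ‖x - x'‖ * C := by gcongr; exact hC m
      _ = _ := by ring
  -- closeness
  have hjoint : ∀ m, Integrable (fun p : (Fin d → ℝ) × (Fin d → ℝ) => ρ p.1 * u m (p.2 + p.1))
      (volume.prod volume) := fun m => by
    have := shear_integrable 1 (hρint.mul_prod (hu m))
    simpa using this
  have hjoint0 : ∀ m, Integrable (fun p : (Fin d → ℝ) × (Fin d → ℝ) => ρ p.1 * u m p.2)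
      (volume.prod volume) := fun m => hρint.mul_prod (hu m)
  have hmollint : ∀ m, Integrable (moll ρ (u m)) := fun m => by
    exact (hjoint m).integral_prod_right
  have hclose : ∀ᶠ m in (l : Filter ι), ∫ x in B, |u m x - moll ρ (u m) x| ≤ η / 6 := by
    filter_upwards [hδ'] with m hm
    have hJ : Integrable (fun p : (Fin d → ℝ) × (Fin d → ℝ) =>
        ρ p.1 * |u m (p.2 + p.1) - u m p.2|) (volume.prod (volume.restrict B)) := by
      have h0 : Integrable (fun p : (Fin d → ℝ) × (Fin d → ℝ) =>
        |ρ p.1 * u m (p.2 + p.1) - ρ p.1 * u m p.2|) (volume.prod volume) :=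
        ((hjoint m).sub (hjoint0 m)).abs
      have h1 : Integrable (fun p : (Fin d → ℝ) × (Fin d → ℝ) =>
        |ρ p.1 * u m (p.2 + p.1) - ρ p.1 * u m p.2|) (volume.prod (volume.restrict B)) := by
        have e : (volume : Measure (Fin d → ℝ)).prod (volume.restrict B) =
            ((volume : Measure (Fin d → ℝ)).prod volume).restrict (univ ×ˢ B) := by
          rw [← Measure.prod_restrict, Measure.restrict_univ]
        rw [e]
        exact h0.integrableOn
      refine h1.congr (Eventually.of_forall fun p => ?_)
      simp only
      rw [← mul_sub, abs_mul, abs_of_nonneg (hρ0 _)]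
    have hrow : ∀ᵐ x, Integrable fun y => ρ y * u m (x + y) := by
      exact (hjoint m).prod_left_ae
    calc ∫ x in B, |u m x - moll ρ (u m) x|
        ≤ ∫ x in B, ∫ y, ρ y * |u m (x + y) - u m x| := by
          refine integral_mono_ae ((hu m).sub (hmollint m)).abs.integrableOn
            hJ.integral_prod_right (ae_restrict_of_ae ?_)
          filter_upwards [hrow] with x hx
          have e1 : u m x = ∫ y, ρ y * u m x := by rw [integral_mul_const, hρi, one_mul]
          have e2 : |u m x - moll ρ (u m) x| ≤ ∫ y, |ρ y * u m x - ρ y * u m (x + y)| := by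
            conv_lhs => rw [e1]
            exact L1_abs_integral_sub_le (hρint.mul_const _) hx
          refine e2.trans (le_of_eq (integral_congr_ae (Eventually.of_forall fun y => ?_)))
          simp only
          rw [← mul_sub, abs_mul, abs_of_nonneg (hρ0 _), abs_sub_comm]
      _ = ∫ y, ∫ x in B, ρ y * |u m (x + y) - u m x| := (integral_integral_swap
            (f := fun y x => ρ y * |u m (x + y) - u m x|) hJ).symm
      _ ≤ ∫ y, ρ y * (η / 6) := by
          refine integral_mono hJ.integral_prod_left (hρint.mul_const _) fun y => ?_
          simp only
          rw [integral_const_mul]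
          by_cases hy : ‖y‖ ≤ δ
          · exact mul_le_mul_of_nonneg_left (hm y hy) (hρ0 y)
          · rw [hρs y (not_le.1 hy)]; simp
      _ = η / 6 := by rw [integral_mul_const, hρi, one_mul]
  -- uniform convergence on the ball
  have hC0 : 0 ≤ C := by
    obtain ⟨m, -⟩ := hclose.exists
    exact le_trans (integral_nonneg fun x => abs_nonneg _) (hC m)
  set V : ℝ := volume.real B with hV
  have hV0 : 0 ≤ V := measureReal_nonneg
  set κ : ℝ := η / (12 * (V + 1)) with hκ
  have hκ0 : 0 < κ := by positivity
  have hunif : ∃ U ∈ (l : Filter ι), ∀ m ∈ U, ∀ m' ∈ U, ∀ x ∈ B,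
      |moll ρ (u m) x - moll ρ (u m') x| ≤ 4 * κ := by
    have hLC : 0 ≤ L * C := mul_nonneg L.2 hC0
    set s : ℝ := κ / (L * C + 1)
    have hs0 : 0 < s := by positivity
    obtain ⟨t, htB, htf, hcov⟩ := (isCompact_closedBall (0 : Fin d → ℝ) r).finite_cover_balls hs0
    have hpt : ∀ x, ∃ y, Tendsto (fun m => moll ρ (u m) x) (l : Filter ι) (𝓝 y) := by
      intro x
      have hb : ∀ m, moll ρ (u m) x ∈ Icc (-(Mρ * C)) (Mρ * C) := by
        intro m
        have hM0 : 0 ≤ Mρ := (norm_nonneg _).trans (hMρ 0)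
        rw [mem_Icc, ← abs_le, moll_eq]
        calc _ ≤ ∫ y, |ρ (y - x) * u m y| := abs_integral_le_integral_abs
          _ ≤ ∫ y, Mρ * |u m y| := by
              refine integral_mono (hIntρ m x).abs ((hu m).abs.const_mul _) fun y => ?_
              simp only
              rw [abs_mul]
              gcongr
              exact hMρ _
          _ ≤ _ := by rw [integral_const_mul]; gcongr; exact hC m
      obtain ⟨y, -, hy⟩ := (isCompact_Icc (a := -(Mρ * C)) (b := Mρ * C)).ultrafilter_le_nhds
        (l.map fun m => moll ρ (u m) x)
        (by
          rw [le_principal_iff, Ultrafilter.coe_map, mem_map]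
          exact Eventually.of_forall hb)
      exact ⟨y, hy⟩
    choose y hy using hpt
    refine ⟨{m | ∀ x ∈ t, |moll ρ (u m) x - y x| < κ}, ?_, ?_⟩
    · exact (eventually_all_finite htf).2 fun x _ => by
        have := (hy x).eventually (Metric.ball_mem_nhds (y x) hκ0)
        simpa [Metric.mem_ball, Real.dist_eq] using this
    · intro m hm m' hm' x hx
      obtain ⟨z, hz, hxz⟩ := mem_iUnion₂.1 (hcov hx)
      rw [Metric.mem_ball, dist_eq_norm] at hxz
      have h1 := hLip m x z
      have h2 := hLip m' z x
      have h3 := (hm z hz).le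
      have h4 := (hm' z hz).le
      have h5 : L * C * ‖x - z‖ ≤ κ := by
        calc L * C * ‖x - z‖ ≤ (L * C + 1) * s := by
              gcongr; linarith
          _ = κ := by simp only [s]; field_simp
      rw [norm_sub_rev z x] at h2
      rw [abs_le] at *
      constructor <;> linarith [h1.1, h1.2, h2.1, h2.2, h3.1, h3.2, h4.1, h4.2]
  obtain ⟨U, hU, hUn⟩ := hunif
  refine ⟨U ∩ ({m | ∫ x in B, |u m x - moll ρ (u m) x| ≤ η / 6} ∩
    {m | ∫ x in {x | r < ‖x‖}, |u m x| ≤ η / 6}), inter_mem hU (inter_mem hclose hr), ?_⟩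
  rintro m ⟨hm1, hm2, hm3⟩ m' ⟨hm1', hm2', hm3'⟩
  have hBc : Bᶜ = {x | r < ‖x‖} := by
    ext x; simp [hB]
  rw [← integral_add_compl (f := fun x => |u m x - u m' x|) hBm ((hu m).sub (hu m')).abs, hBc]
  have e1 : ∫ x in {x : Fin d → ℝ | r < ‖x‖}, |u m x - u m' x| ≤ η / 6 + η / 6 := by
    refine le_trans ?_ (add_le_add hm3 hm3')
    rw [← integral_add (hu m).abs.integrableOn (hu m').abs.integrableOn]
    exact integral_mono ((hu m).sub (hu m')).abs.integrableOn
      ((hu m).abs.add (hu m').abs).integrableOn fun x => abs_sub _ _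
  have e2 : ∫ x in B, |u m x - u m' x| ≤ η / 6 + η / 6 + 4 * κ * V := by
    have t1 := L1_triangle (μ := volume.restrict B) (hu m).integrableOn
      (hmollint m).integrableOn (hu m').integrableOn
    have t2 := L1_triangle (μ := volume.restrict B) (hmollint m).integrableOn
      (hmollint m').integrableOn (hu m').integrableOn
    have t3 : ∫ x in B, |moll ρ (u m) x - moll ρ (u m') x| ≤ 4 * κ * V := by
      calc _ ≤ ∫ x in B, 4 * κ := by
            refine setIntegral_mono_on ((hmollint m).sub (hmollint m')).abs.integrableOn
              (integrableOn_const hBf) hBm fun x hx => hUn m hm1 m' hm1' x hx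
        _ = _ := by rw [setIntegral_const, smul_eq_mul, mul_comm]
    have t4 := hm2'
    change ∫ x in B, |u m x - moll ρ (u m) x| ≤ η / 6 at hm2
    change ∫ x in B, |u m' x - moll ρ (u m') x| ≤ η / 6 at t4
    rw [L1_comm] at t4
    linarith
  have e3 : 4 * κ * V ≤ η / 3 := by
    rw [hκ]
    have : 4 * (η / (12 * (V + 1))) * V = η / 3 * (V / (V + 1)) := by field_simp; ring
    rw [this]
    have : V / (V + 1) ≤ 1 := by rw [div_le_one (by positivity)]; linarith
    nlinarith
  linarith

end
end FPE

namespace FPE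
open Set Topology

lemma L1_fixed {α : Type*} [MeasurableSpace α] {μ : Measure α} {T : (α → ℝ) → (α → ℝ)} {q : ℝ}
    (hq0 : 0 ≤ q) (hq : q < 1)
    (hT : ∀ u, Integrable u μ → Integrable (T u) μ)
    (hc : ∀ u v, Integrable u μ → Integrable v μ →
      ∫ x, |T u x - T v x| ∂μ ≤ q * ∫ x, |u x - v x| ∂μ) :
    ∃ u, Integrable u μ ∧ ∀ᵐ x ∂μ, u x = T u x := by
  let Φ : (α →₁[μ] ℝ) → (α →₁[μ] ℝ) := fun f => (hT f (L1.integrable_coeFn f)).toL1 (T f)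
  have hΦ : ContractingWith ⟨q, hq0⟩ Φ := by
    refine ⟨by exact_mod_cast hq, LipschitzWith.of_dist_le_mul fun f g => ?_⟩
    have h1 := hc f g (L1.integrable_coeFn f) (L1.integrable_coeFn g)
    rw [← L1_norm_sub (L1.integrable_coeFn f) (L1.integrable_coeFn g),
      ← L1_norm_sub (hT f (L1.integrable_coeFn f)) (hT g (L1.integrable_coeFn g)),
      Integrable.toL1_coeFn, Integrable.toL1_coeFn] at h1
    exact h1
  let f := ContractingWith.fixedPoint Φ hΦ
  refine ⟨f, L1.integrable_coeFn f, ?_⟩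
  have h1 : Φ f = f := ContractingWith.fixedPoint_isFixedPt hΦ
  have h2 := (hT f (L1.integrable_coeFn f)).coeFn_toL1
  have h3 : (Φ f : α → ℝ) =ᵐ[μ] T f := h2
  rw [h1] at h3
  exact h3

section
variable {d : ℕ}

lemma shear_aesm {φ : (Fin d → ℝ) → ℝ} (ε : ℝ) {ν : Measure (Fin d → ℝ)} [SFinite ν]
    (hφ : AEStronglyMeasurable φ volume) :
    AEStronglyMeasurable (fun p : (Fin d → ℝ) × (Fin d → ℝ) => φ (p.2 + ε • p.1))
      (ν.prod volume) := by
  have h : AEStronglyMeasurable (fun p : (Fin d → ℝ) × (Fin d → ℝ) => φ p.2) (ν.prod volume) :=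
    hφ.comp_snd
  exact h.comp_measurePreserving (shear_mp ε ν)

lemma weakform {ν : Measure (Fin d → ℝ)} [IsFiniteMeasure ν] {z g : (Fin d → ℝ) → ℝ}
    {H : (Fin d → ℝ) × (Fin d → ℝ) → ℝ} {h' ε : ℝ} (hz : Integrable z) (hg : Integrable g)
    (hH : Integrable H (ν.prod volume))
    (heq : ∀ᵐ x, z x + h' * (∫ w, H (w, x) ∂ν - ∫ w, H (w, x + (-ε) • w) ∂ν) = g x)
    {φ : (Fin d → ℝ) → ℝ} (hφ : AEStronglyMeasurable φ volume) {C : ℝ} (hC : ∀ x, |φ x| ≤ C) :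
    (∫ x, φ x * z x) - (∫ x, φ x * g x) =
      h' * ∫ p, H p * (φ (p.2 + ε • p.1) - φ p.2) ∂(ν.prod volume) := by
  have hHs := shear_integrable (-ε) hH
  have i1 : Integrable (fun p : (Fin d → ℝ) × (Fin d → ℝ) => φ p.2 * H p) (ν.prod volume) :=
    integrable_bdd_mul hH hφ.comp_snd fun p => hC _
  have i2 : Integrable (fun p : (Fin d → ℝ) × (Fin d → ℝ) => φ p.2 * H (p.1, p.2 + (-ε) • p.1))
      (ν.prod volume) :=
    integrable_bdd_mul hHs hφ.comp_snd fun p => hC _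
  have i3 : Integrable (fun p : (Fin d → ℝ) × (Fin d → ℝ) => φ (p.2 + ε • p.1) * H p)
      (ν.prod volume) :=
    integrable_bdd_mul hH (shear_aesm ε hφ) fun p => hC _
  have j1 : Integrable fun x => φ x * ∫ w, H (w, x) ∂ν :=
    integrable_bdd_mul hH.integral_prod_right hφ hC
  have j2 : Integrable fun x => φ x * ∫ w, H (w, x + (-ε) • w) ∂ν :=
    integrable_bdd_mul hHs.integral_prod_right hφ hC
  have e1 : ∫ p, φ p.2 * H p ∂(ν.prod volume) = ∫ x, φ x * ∫ w, H (w, x) ∂ν := by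
    rw [integral_prod_symm _ i1]
    simp_rw [integral_const_mul]
  have e2 : ∫ p, φ p.2 * H (p.1, p.2 + (-ε) • p.1) ∂(ν.prod volume) =
      ∫ x, φ x * ∫ w, H (w, x + (-ε) • w) ∂ν := by
    rw [integral_prod_symm _ i2]
    simp_rw [integral_const_mul]
  have e3 : ∫ p, φ p.2 * H (p.1, p.2 + (-ε) • p.1) ∂(ν.prod volume) =
      ∫ p, φ (p.2 + ε • p.1) * H p ∂(ν.prod volume) := by
    rw [← shear_integral ε]
    simp
  have e4 : ∫ p, H p * (φ (p.2 + ε • p.1) - φ p.2) ∂(ν.prod volume) =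
      ∫ p, φ (p.2 + ε • p.1) * H p ∂(ν.prod volume) - ∫ p, φ p.2 * H p ∂(ν.prod volume) := by
    rw [← integral_sub i3 i1]
    congr 1; ext p; ring
  rw [e4, ← e3, e2, e1, ← integral_sub j2 j1, ← integral_const_mul,
    ← integral_sub (integrable_bdd_mul hz hφ hC) (integrable_bdd_mul hg hφ hC)]
  refine integral_congr_ae ?_
  filter_upwards [heq] with x hx
  rw [← hx]; ring

lemma kato {ν : Measure (Fin d → ℝ)} [IsFiniteMeasure ν] {z g : (Fin d → ℝ) → ℝ}
    {H : (Fin d → ℝ) × (Fin d → ℝ) → ℝ} {h' ε : ℝ} (hh' : 0 ≤ h') (hz : Integrable z)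
    (hg : Integrable g) (hH : Integrable H (ν.prod volume))
    (heq : ∀ᵐ x, z x + h' * (∫ w, H (w, x) ∂ν - ∫ w, H (w, x + (-ε) • w) ∂ν) = g x)
    (hs : ∀ w x, (0 ≤ z x → 0 ≤ H (w, x)) ∧ (z x ≤ 0 → H (w, x) ≤ 0))
    {φ : (Fin d → ℝ) → ℝ} (hφ : AEStronglyMeasurable φ volume) {C : ℝ} (hC : ∀ x, |φ x| ≤ C)
    (hφ0 : ∀ x, 0 ≤ φ x) :
    (∫ x, φ x * |z x|) ≤ (∫ x, φ x * |g x|) +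
      h' * ∫ p, |H p| * (φ (p.2 + ε • p.1) - φ p.2) ∂(ν.prod volume) := by
  have hHa := hH.abs
  have hHs := shear_integrable (-ε) hHa
  set g' : (Fin d → ℝ) → ℝ := fun x =>
    |z x| + h' * (∫ w, |H (w, x)| ∂ν - ∫ w, |H (w, x + (-ε) • w)| ∂ν) with hg'
  have ig' : Integrable g' :=
    hz.abs.add ((hHa.integral_prod_right.sub hHs.integral_prod_right).const_mul h')
  have hw := weakform (ε := ε) (h' := h') hz.abs ig' hHa (Eventually.of_forall fun x => rfl) hφ hC
  have hle : ∀ᵐ x, g' x ≤ |g x| := by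
    filter_upwards [heq] with x hx
    have a1 : |z x| + h' * ∫ w, |H (w, x)| ∂ν = |z x + h' * ∫ w, H (w, x) ∂ν| := by
      rcases le_total 0 (z x) with h0 | h0
      · have : ∫ w, |H (w, x)| ∂ν = ∫ w, H (w, x) ∂ν := by
          congr 1; ext w; exact abs_of_nonneg ((hs w x).1 h0)
        rw [this, abs_of_nonneg h0, abs_of_nonneg]
        have : 0 ≤ ∫ w, H (w, x) ∂ν := integral_nonneg fun w => (hs w x).1 h0
        positivity
      · have e : ∫ w, |H (w, x)| ∂ν = -∫ w, H (w, x) ∂ν := by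
          rw [← integral_neg]
          congr 1; ext w; exact abs_of_nonpos ((hs w x).2 h0)
        have : 0 ≤ -∫ w, H (w, x) ∂ν := by
          rw [← e]; exact integral_nonneg fun w => abs_nonneg _
        rw [e, abs_of_nonpos h0, abs_of_nonpos]
        · ring
        · nlinarith
    have a2 : |∫ w, H (w, x + (-ε) • w) ∂ν| ≤ ∫ w, |H (w, x + (-ε) • w)| ∂ν :=
      abs_integral_le_integral_abs
    have a3 : z x + h' * ∫ w, H (w, x) ∂ν = g x + h' * ∫ w, H (w, x + (-ε) • w) ∂ν := by
      rw [← hx]; ring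
    have a4 : |g x + h' * ∫ w, H (w, x + (-ε) • w) ∂ν| ≤
        |g x| + h' * |∫ w, H (w, x + (-ε) • w) ∂ν| := by
      refine (abs_add_le _ _).trans ?_
      rw [abs_mul, abs_of_nonneg hh']
    have a5 := mul_le_mul_of_nonneg_left a2 hh'
    simp only [hg']
    rw [mul_sub]
    rw [a3] at a1
    linarith
  have h3 : ∫ x, φ x * g' x ≤ ∫ x, φ x * |g x| := by
    refine integral_mono_ae (integrable_bdd_mul ig' hφ hC) (integrable_bdd_mul hg.abs hφ hC) ?_
    filter_upwards [hle] with x hx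
    exact mul_le_mul_of_nonneg_left hx (hφ0 x)
  linarith

/-- admissible monotone kernels -/
structure Ker (k : (Fin d → ℝ) → (Fin d → ℝ) → ℝ → ℝ) (c Λ : ℝ) : Prop where
  cont : Continuous fun p : (Fin d → ℝ) × (Fin d → ℝ) × ℝ => k p.1 p.2.1 p.2.2
  zero : ∀ w x, k w x 0 = 0
  c0 : 0 < c
  low : ∀ w x u v, u ≤ v → c * (v - u) ≤ k w x v - k w x u
  up : ∀ w x u v, u ≤ v → k w x v - k w x u ≤ Λ * (v - u)

namespace Ker
variable {k : (Fin d → ℝ) → (Fin d → ℝ) → ℝ → ℝ} {c Λ : ℝ}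

lemma cL (hk : Ker k c Λ) : c ≤ Λ := by
  have h1 := hk.low 0 0 0 1 zero_le_one
  have h2 := hk.up 0 0 0 1 zero_le_one
  linarith

lemma L0 (hk : Ker k c Λ) : 0 < Λ := hk.c0.trans_le hk.cL

lemma abs_sub (hk : Ker k c Λ) (w x u v) : |k w x u - k w x v| ≤ Λ * |u - v| := by
  have := hk.c0
  rcases le_total u v with h | h
  · have h1 := hk.low w x u v h
    have h2 := hk.up w x u v h
    have : 0 ≤ c * (v - u) := mul_nonneg hk.c0.le (by linarith)
    rw [abs_sub_comm, abs_sub_comm u, abs_of_nonneg (by linarith), abs_of_nonneg (by linarith)]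
    exact h2
  · have h1 := hk.low w x v u h
    have h2 := hk.up w x v u h
    have : 0 ≤ c * (u - v) := mul_nonneg hk.c0.le (by linarith)
    rw [abs_of_nonneg (by linarith), abs_of_nonneg (by linarith)]
    exact h2

lemma abs_le (hk : Ker k c Λ) (w x u) : |k w x u| ≤ Λ * |u| := by
  simpa [hk.zero] using hk.abs_sub w x u 0

lemma mono (hk : Ker k c Λ) (w x) {u v} (h : u ≤ v) : k w x u ≤ k w x v := by
  have h1 := hk.low w x u v h
  have : 0 ≤ c * (v - u) := mul_nonneg hk.c0.le (by linarith)
  linarith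

lemma integrable (hk : Ker k c Λ) {ν : Measure (Fin d → ℝ)} [IsFiniteMeasure ν]
    {u : (Fin d → ℝ) → ℝ} (hu : Integrable u) :
    Integrable (fun p : (Fin d → ℝ) × (Fin d → ℝ) => k p.1 p.2 (u p.2)) (ν.prod volume) := by
  have h1 : Integrable (fun p : (Fin d → ℝ) × (Fin d → ℝ) => Λ * |u p.2|) (ν.prod volume) :=
    (hu.abs.comp_snd ν).const_mul Λ
  refine h1.mono' ?_ (Eventually.of_forall fun p => hk.abs_le _ _ _)
  exact hk.cont.comp_aestronglyMeasurable
    (measurable_fst.aestronglyMeasurable.prodMk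
      (measurable_snd.aestronglyMeasurable.prodMk hu.aestronglyMeasurable.comp_snd))

lemma integrable_row (hk : Ker k c Λ) {ν : Measure (Fin d → ℝ)} [IsFiniteMeasure ν]
    (x : Fin d → ℝ) (s : ℝ) : Integrable (fun w => k w x s) ν := by
  refine (integrable_const (Λ * |s|)).mono' ?_ (Eventually.of_forall fun p => hk.abs_le _ _ _)
  exact (hk.cont.comp (by fun_prop : Continuous fun w : Fin d → ℝ => (w, x, s))).aestronglyMeasurable

end Ker

/-- `u` solves the nonlocal resolvent equation with datum `f` -/
def Res (k : (Fin d → ℝ) → (Fin d → ℝ) → ℝ → ℝ) (ν : Measure (Fin d → ℝ)) (h' ε : ℝ)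
    (u f : (Fin d → ℝ) → ℝ) : Prop :=
  ∀ᵐ x, u x + h' * (∫ w, k w x (u x) ∂ν -
    ∫ w, k w (x + (-ε) • w) (u (x + (-ε) • w)) ∂ν) = f x

section
variable {k : (Fin d → ℝ) → (Fin d → ℝ) → ℝ → ℝ} {c Λ : ℝ} {ν : Measure (Fin d → ℝ)}
  [IsFiniteMeasure ν] {h' ε : ℝ} {u v f g : (Fin d → ℝ) → ℝ}

lemma Res_exists (hk : Ker k c Λ) (hh' : 0 ≤ h') (hf : Integrable f) :
    ∃ u, Integrable u ∧ Res k ν h' ε u f := by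
  set V := ν.real univ with hV
  have hV0 : 0 ≤ V := measureReal_nonneg
  have hΛ := hk.L0
  set τ : ℝ := 1 / (Λ * (V + 1)) with hτ
  have hτ0 : 0 < τ := by positivity
  have hτ1 : τ * (Λ * V) ≤ 1 := by
    rw [hτ, one_div_mul_eq_div, div_le_one (by positivity)]
    nlinarith
  let G : ((Fin d → ℝ) → ℝ) → (Fin d → ℝ) → ℝ := fun u x => ∫ w, k w x (u x) ∂ν
  let S : ((Fin d → ℝ) → ℝ) → (Fin d → ℝ) → ℝ := fun u x =>
    ∫ w, k w (x + (-ε) • w) (u (x + (-ε) • w)) ∂ν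
  have iG : ∀ u, Integrable u → Integrable (G u) := fun u hu =>
    (hk.integrable (ν := ν) hu).integral_prod_right
  have iS : ∀ u, Integrable u → Integrable (S u) := fun u hu =>
    (shear_integrable (-ε) (hk.integrable (ν := ν) hu)).integral_prod_right
  let T : ((Fin d → ℝ) → ℝ) → (Fin d → ℝ) → ℝ := fun u x =>
    (τ + h')⁻¹ * (τ * f x + h' * (u x - τ * (G u x - S u x)))
  have iT : ∀ u, Integrable u → Integrable (T u) := fun u hu =>
    ((hf.const_mul τ).add ((hu.sub (((iG u hu).sub (iS u hu)).const_mul τ)).const_mul h')).const_mul _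
  have hq : (τ + h')⁻¹ * h' < 1 := by
    rw [inv_mul_eq_div, div_lt_one (by positivity)]; linarith
  obtain ⟨u, hu, hfix⟩ := L1_fixed (T := T) (μ := volume) (q := (τ + h')⁻¹ * h')
    (by positivity) hq iT (by
      intro u v hu hv
      set D : (Fin d → ℝ) × (Fin d → ℝ) → ℝ := fun p => |k p.1 p.2 (u p.2) - k p.1 p.2 (v p.2)|
        with hD
      have iD : Integrable D (ν.prod volume) :=
        ((hk.integrable (ν := ν) hu).sub (hk.integrable (ν := ν) hv)).abs
      have iDs := shear_integrable (-ε) iD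
      have rowu := (shear_integrable (-ε) (hk.integrable (ν := ν) hu)).prod_left_ae
      have rowv := (shear_integrable (-ε) (hk.integrable (ν := ν) hv)).prod_left_ae
      have key : ∀ᵐ x, |T u x - T v x| ≤ (τ + h')⁻¹ * h' *
          (|u x - v x| - τ * (∫ w, D (w, x) ∂ν) + τ * ∫ w, D (w, x + (-ε) • w) ∂ν) := by
        filter_upwards [rowu, rowv] with x hxu hxv
        have b1 : |u x - v x - τ * (G u x - G v x)| = |u x - v x| - τ * ∫ w, D (w, x) ∂ν := by
          have hsub : G u x - G v x = ∫ w, (k w x (u x) - k w x (v x)) ∂ν :=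
            (integral_sub (hk.integrable_row x _) (hk.integrable_row x _)).symm
          have hup : ∫ w, D (w, x) ∂ν ≤ Λ * V * |u x - v x| := by
            calc _ ≤ ∫ w, Λ * |u x - v x| ∂ν :=
                  integral_mono ((hk.integrable_row x _).sub (hk.integrable_row x _)).abs
                    (integrable_const _) fun w => hk.abs_sub _ _ _ _
              _ = _ := by rw [integral_const, smul_eq_mul]; ring
          have hup2 : τ * ∫ w, D (w, x) ∂ν ≤ |u x - v x| := by
            calc _ ≤ τ * (Λ * V * |u x - v x|) := by gcongr
              _ = τ * (Λ * V) * |u x - v x| := by ring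
              _ ≤ 1 * |u x - v x| := by gcongr
              _ = _ := one_mul _
          rcases le_total (v x) (u x) with h0 | h0
          · have : ∫ w, D (w, x) ∂ν = G u x - G v x := by
              rw [hsub]; congr 1; ext w
              exact abs_of_nonneg (sub_nonneg.2 (hk.mono w x h0))
            rw [this] at hup2 ⊢
            rw [abs_of_nonneg (a := u x - v x) (by linarith)] at hup2 ⊢
            rw [abs_of_nonneg (by linarith)]
          · have : ∫ w, D (w, x) ∂ν = -(G u x - G v x) := by
              rw [hsub, ← integral_neg]; congr 1; ext w
              exact abs_of_nonpos (sub_nonpos.2 (hk.mono w x h0))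
            rw [this] at hup2 ⊢
            rw [abs_of_nonpos (a := u x - v x) (by linarith)] at hup2 ⊢
            rw [abs_of_nonpos (by linarith)]
            ring
        have b2 : |S u x - S v x| ≤ ∫ w, D (w, x + (-ε) • w) ∂ν :=
          L1_abs_integral_sub_le hxu hxv
        have b3 : T u x - T v x = (τ + h')⁻¹ * h' *
            ((u x - v x - τ * (G u x - G v x)) + τ * (S u x - S v x)) := by
          simp only [T]; ring
        rw [b3, abs_mul, abs_of_nonneg (by positivity : (0 : ℝ) ≤ (τ + h')⁻¹ * h')]
        refine mul_le_mul_of_nonneg_left ?_ (by positivity)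
        refine (abs_add_le _ _).trans ?_
        rw [b1, abs_mul, abs_of_pos hτ0]
        gcongr
      have i1 : Integrable fun x => |u x - v x| - τ * (∫ w, D (w, x) ∂ν) :=
        (hu.sub hv).abs.sub (iD.integral_prod_right.const_mul τ)
      have i2 : Integrable fun x => τ * ∫ w, D (w, x + (-ε) • w) ∂ν :=
        iDs.integral_prod_right.const_mul τ
      refine (integral_mono_ae ((iT u hu).sub (iT v hv)).abs ((i1.add i2).const_mul _) key).trans ?_
      rw [integral_const_mul]
      refine mul_le_mul_of_nonneg_left (le_of_eq ?_) (by positivity)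
      simp only [Pi.add_apply]
      rw [integral_add i1 i2, integral_sub (f := fun x => |u x - v x|) (hu.sub hv).abs
        (iD.integral_prod_right.const_mul τ), integral_const_mul, integral_const_mul]
      have s1 := integral_prod_symm _ iD
      have s2 := integral_prod_symm _ iDs
      rw [shear_integral (-ε), s1] at s2
      rw [s2]; ring)
  refine ⟨u, hu, ?_⟩
  filter_upwards [hfix] with x hx
  change u x + h' * (G u x - S u x) = f x
  have hpos : τ + h' ≠ 0 := by positivity
  simp only [T] at hx
  have h2 : (τ + h') * u x = τ * f x + h' * (u x - τ * (G u x - S u x)) := by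
    conv_lhs => rw [hx]
    rw [← mul_assoc, mul_inv_cancel₀ hpos, one_mul]
  have h3 : τ * (u x + h' * (G u x - S u x)) = τ * f x := by linarith
  exact mul_left_cancel₀ hτ0.ne' h3

lemma Res_weak (hk : Ker k c Λ) (hu : Integrable u) (hf : Integrable f)
    (h : Res k ν h' ε u f) {φ : (Fin d → ℝ) → ℝ} (hφ : AEStronglyMeasurable φ volume) {C : ℝ}
    (hC : ∀ x, |φ x| ≤ C) :
    (∫ x, φ x * u x) - (∫ x, φ x * f x) = h' * ∫ p : (Fin d → ℝ) × (Fin d → ℝ),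
      k p.1 p.2 (u p.2) * (φ (p.2 + ε • p.1) - φ p.2) ∂(ν.prod volume) :=
  weakform hu hf (hk.integrable hu) h hφ hC

lemma Res_kato (hk : Ker k c Λ) (hh' : 0 ≤ h') (hu : Integrable u) (hf : Integrable f)
    (h : Res k ν h' ε u f) {φ : (Fin d → ℝ) → ℝ} (hφ : AEStronglyMeasurable φ volume) {C : ℝ}
    (hC : ∀ x, |φ x| ≤ C) (hφ0 : ∀ x, 0 ≤ φ x) :
    (∫ x, φ x * |u x|) ≤ (∫ x, φ x * |f x|) + h' * ∫ p : (Fin d → ℝ) × (Fin d → ℝ),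
      |k p.1 p.2 (u p.2)| * (φ (p.2 + ε • p.1) - φ p.2) ∂(ν.prod volume) := by
  refine kato hh' hu hf (hk.integrable hu) h (fun w x => ⟨fun h0 => ?_, fun h0 => ?_⟩) hφ hC hφ0
  · simpa [hk.zero] using hk.mono w x h0
  · simpa [hk.zero] using hk.mono w x h0

lemma Res_contr (hk : Ker k c Λ) (hh' : 0 ≤ h') (hu : Integrable u) (hf : Integrable f)
    (h : Res k ν h' ε u f) (hv : Integrable v) (hg : Integrable g) (h2 : Res k ν h' ε v g) :
    ∫ x, |u x - v x| ≤ ∫ x, |f x - g x| := by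
  have iu := hk.integrable (ν := ν) hu
  have iv := hk.integrable (ν := ν) hv
  have := kato (φ := fun _ => 1) (C := 1) (ε := ε) hh' (hu.sub hv) (hf.sub hg) (iu.sub iv) (by
      filter_upwards [h, h2, (shear_integrable (-ε) iu).prod_left_ae,
        (shear_integrable (-ε) iv).prod_left_ae] with x hx1 hx2 hx3 hx4
      simp only [Pi.sub_apply]
      rw [integral_sub (hk.integrable_row x _) (hk.integrable_row x _), integral_sub hx3 hx4,
        ← hx1, ← hx2]
      ring) (fun w x => ⟨fun h0 => ?_, fun h0 => ?_⟩) aestronglyMeasurable_const (by simp) (by simp)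
  · simpa using this
  · have h0' : v x ≤ u x := by simpa using h0
    simpa using hk.mono w x h0'
  · have h0' : u x ≤ v x := by simpa using h0
    simpa using hk.mono w x h0'

end
end
end FPE

namespace FPE
open Set Topology

/-- truncation -/
noncomputable def Tr (κ s : ℝ) : ℝ := max (-κ) (min s κ)

lemma Tr_cont (κ : ℝ) : Continuous (Tr κ) := by unfold Tr; fun_prop

lemma Tr_abs {κ : ℝ} (hκ : 0 ≤ κ) (s : ℝ) : |Tr κ s| ≤ κ := by
  unfold Tr; rw [abs_le]
  exact ⟨le_max_left _ _, max_le (by linarith) (min_le_right _ _)⟩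

lemma Tr_cases {κ : ℝ} (hκ : 0 ≤ κ) (s : ℝ) :
    (s < -κ ∧ Tr κ s = -κ) ∨ (-κ ≤ s ∧ s ≤ κ ∧ Tr κ s = s) ∨ (κ < s ∧ Tr κ s = κ) := by
  unfold Tr
  rcases lt_or_ge s (-κ) with h | h
  · left; refine ⟨h, ?_⟩; rw [min_eq_left (by linarith), max_eq_left h.le]
  · rcases le_or_gt s κ with h2 | h2
    · right; left; refine ⟨h, h2, ?_⟩; rw [min_eq_left h2, max_eq_right h]
    · right; right; refine ⟨h2, ?_⟩; rw [min_eq_right h2.le, max_eq_right (by linarith)]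

lemma Tr_le_abs {κ : ℝ} (hκ : 0 ≤ κ) (s : ℝ) : |Tr κ s| ≤ |s| := by
  rcases Tr_cases hκ s with ⟨h, e⟩ | ⟨h, h2, e⟩ | ⟨h, e⟩ <;> rw [e]
  · rw [abs_neg, abs_of_nonneg hκ, abs_of_neg (by linarith)]; linarith
  · rw [abs_of_nonneg hκ, abs_of_pos (by linarith)]; linarith

lemma Tr_sq {κ : ℝ} (hκ : 0 ≤ κ) (s : ℝ) : Tr κ s ^ 2 ≤ Tr κ s * s := by
  rcases Tr_cases hκ s with ⟨h, e⟩ | ⟨h, h2, e⟩ | ⟨h, e⟩ <;> rw [e] <;> nlinarith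

lemma Tr_mono (κ : ℝ) {s t : ℝ} (h : s ≤ t) : Tr κ s ≤ Tr κ t := by
  unfold Tr; gcongr

lemma Tr_sub {κ : ℝ} (hκ : 0 ≤ κ) {s t : ℝ} (h : s ≤ t) : Tr κ t - Tr κ s ≤ t - s := by
  rcases Tr_cases hκ s with ⟨h1, e⟩ | ⟨h1, h2, e⟩ | ⟨h1, e⟩ <;>
  rcases Tr_cases hκ t with ⟨h1', e'⟩ | ⟨h1', h2', e'⟩ | ⟨h1', e'⟩ <;> rw [e, e'] <;> linarith

lemma Tr_tendsto (s : ℝ) : Tendsto (fun n : ℕ => Tr n s) atTop (𝓝 s) := by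
  apply tendsto_const_nhds.congr'
  filter_upwards [tendsto_natCast_atTop_atTop.eventually_ge_atTop |s|] with n hn
  rcases Tr_cases (Nat.cast_nonneg n) s with ⟨h, e⟩ | ⟨h, h2, e⟩ | ⟨h, e⟩
  · rw [abs_le] at hn; linarith
  · exact e.symm
  · rw [abs_le] at hn; linarith

section
variable {d : ℕ} {k : (Fin d → ℝ) → (Fin d → ℝ) → ℝ → ℝ} {c Λ : ℝ} {ν : Measure (Fin d → ℝ)}
  [IsFiniteMeasure ν] {h' ε : ℝ} {u f : (Fin d → ℝ) → ℝ}

lemma Ker.low' (hk : Ker k c Λ) {κ : ℝ} (hκ : 0 ≤ κ) (w x : Fin d → ℝ) (s t : ℝ) :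
    c * (Tr κ t - Tr κ s) ^ 2 ≤ (k w x t - k w x s) * (Tr κ t - Tr κ s) := by
  have hc := hk.c0
  rcases le_total s t with h | h
  · have h1 := hk.low w x s t h
    have h2 := Tr_sub hκ h
    have h3 := Tr_mono κ h
    have h4 : c * (Tr κ t - Tr κ s) ≤ c * (t - s) := by gcongr
    nlinarith
  · have h1 := hk.low w x t s h
    have h2 := Tr_sub hκ h
    have h3 := Tr_mono κ h
    have h4 : c * (Tr κ s - Tr κ t) ≤ c * (s - t) := by gcongr
    nlinarith

lemma Res_energy (hk : Ker k c Λ) (hν : MeasurePreserving (fun w : Fin d → ℝ => -w) ν ν)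
    (hh' : 0 ≤ h') (hu : Integrable u) (hf : Integrable f) (hf2 : MemLp f 2)
    (h : Res k ν h' ε u f) {C₀ : ℝ} {S : Set (Fin d → ℝ)} (hS : MeasurableSet S)
    (hSf : volume S ≠ ⊤)
    (hsk : ∀ᵐ w ∂ν, ∀ x q, |k (-w) (x + ε • w) q - k w x q| ≤ S.indicator (fun _ => C₀) x)
    {κ : ℝ} (hκ : 0 ≤ κ) :
    1 / 2 * (∫ x, Tr κ (u x) ^ 2) + h' * c / 4 * (∫ p : (Fin d → ℝ) × (Fin d → ℝ),
      (Tr κ (u (p.2 + ε • p.1)) - Tr κ (u p.2)) ^ 2 ∂(ν.prod volume)) ≤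
    1 / 2 * (∫ x, f x ^ 2) + h' * (C₀ ^ 2 / (4 * c) * (ν.real univ * volume.real S)) := by
  have hc := hk.c0
  set v : (Fin d → ℝ) → ℝ := fun x => Tr κ (u x) with hv
  have vm : AEStronglyMeasurable v volume := (Tr_cont κ).comp_aestronglyMeasurable hu.1
  have vb : ∀ x, |v x| ≤ κ := fun x => Tr_abs hκ _
  have vi : Integrable v := hu.abs.mono' vm (Eventually.of_forall fun x => Tr_le_abs hκ _)
  have v2 : Integrable fun x => v x ^ 2 := by
    simp_rw [pow_two]; exact integrable_bdd_mul vi vm vb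
  have hw := Res_weak hk hu hf h vm vb
  set F : (Fin d → ℝ) × (Fin d → ℝ) → ℝ := fun p => k p.1 p.2 (u p.2) with hF
  have iF : Integrable F (ν.prod volume) := hk.integrable hu
  set Δ : (Fin d → ℝ) × (Fin d → ℝ) → ℝ := fun p => v (p.2 + ε • p.1) - v p.2 with hΔ
  have Δm : AEStronglyMeasurable Δ (ν.prod volume) := (shear_aesm ε vm).sub vm.comp_snd
  have Δb : ∀ p, |Δ p| ≤ 2 * κ := fun p => by
    refine (_root_.abs_sub _ _).trans ?_
    linarith [vb (p.2 + ε • p.1), vb p.2]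
  have Δi : Integrable Δ (ν.prod volume) :=
    (shear_integrable ε (vi.comp_snd ν)).sub (vi.comp_snd ν)
  have Δ2 : Integrable (fun p => Δ p ^ 2) (ν.prod volume) := by
    simp_rw [pow_two]; exact integrable_bdd_mul Δi Δm Δb
  -- the flip
  set ψ : (Fin d → ℝ) × (Fin d → ℝ) → (Fin d → ℝ) × (Fin d → ℝ) :=
    fun p => (-p.1, p.2 + ε • p.1) with hψ
  have ψmp : MeasurePreserving ψ (ν.prod volume) (ν.prod volume) :=
    (hν.prod (MeasurePreserving.id volume)).comp (shear_mp ε ν)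
  have Δψ : ∀ p, Δ (ψ p) = -Δ p := fun p => by simp [hΔ, hψ]
  have iFΔ : Integrable (fun p => F p * Δ p) (ν.prod volume) := by
    simp_rw [mul_comm (F _)]; exact integrable_bdd_mul iF Δm Δb
  have iFψ : Integrable (fun p => F (ψ p)) (ν.prod volume) := ψmp.integrable_comp_of_integrable iF
  have iFψΔ : Integrable (fun p => F (ψ p) * Δ p) (ν.prod volume) := by
    simp_rw [mul_comm (F _)]; exact integrable_bdd_mul iFψ Δm Δb
  have flip : ∫ p, F p * Δ p ∂(ν.prod volume) = -∫ p, F (ψ p) * Δ p ∂(ν.prod volume) := by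
    have := ψmp.map_eq
    conv_lhs => rw [← this]
    rw [integral_map ψmp.measurable.aemeasurable (by rw [this]; exact iFΔ.1), ← integral_neg]
    congr 1; ext p; rw [Δψ]; ring
  have iS : Integrable (fun p : (Fin d → ℝ) × (Fin d → ℝ) =>
      S.indicator (fun _ => C₀ ^ 2 / (2 * c)) p.2) (ν.prod volume) :=
    ((integrable_indicator_iff hS).2 (integrableOn_const hSf)).comp_snd ν
  have key : ∫ p, (c / 2 * Δ p ^ 2 - S.indicator (fun _ => C₀ ^ 2 / (2 * c)) p.2) ∂(ν.prod volume) ≤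
      ∫ p, (F (ψ p) * Δ p - F p * Δ p) ∂(ν.prod volume) := by
    refine integral_mono_ae ((Δ2.const_mul _).sub iS) (iFψΔ.sub iFΔ) ?_
    filter_upwards [Measure.quasiMeasurePreserving_fst.ae hsk] with p hp
    have a1 := hk.low' hκ (-p.1) (p.2 + ε • p.1) (u p.2) (u (p.2 + ε • p.1))
    have a2 := hp p.2 (u p.2)
    set e := k (-p.1) (p.2 + ε • p.1) (u p.2) - k p.1 p.2 (u p.2) with he
    have a3 : F (ψ p) * Δ p - F p * Δ p =
        (k (-p.1) (p.2 + ε • p.1) (u (p.2 + ε • p.1)) - k (-p.1) (p.2 + ε • p.1) (u p.2)) * Δ p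
          + e * Δ p := by
      simp only [hF, hψ, he]; ring
    have a4 : e ^ 2 / (2 * c) ≤ S.indicator (fun _ => C₀ ^ 2 / (2 * c)) p.2 := by
      by_cases hx : p.2 ∈ S
      · rw [indicator_of_mem hx] at a2 ⊢
        rw [← sq_abs e]
        gcongr
      · rw [indicator_of_notMem hx] at a2 ⊢
        have : e = 0 := abs_nonpos_iff.1 a2
        simp [this]
    have a5 : -(c / 2 * Δ p ^ 2) - e ^ 2 / (2 * c) ≤ e * Δ p := by
      have : e * Δ p + c / 2 * Δ p ^ 2 + e ^ 2 / (2 * c) = (c * Δ p + e) ^ 2 / (2 * c) := by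
        field_simp; ring
      have : 0 ≤ (c * Δ p + e) ^ 2 / (2 * c) := by positivity
      linarith
    change c * Δ p ^ 2 ≤ _ * Δ p at a1
    rw [a3]
    linarith
  have Sint : ∫ p : (Fin d → ℝ) × (Fin d → ℝ), S.indicator (fun _ => C₀ ^ 2 / (2 * c)) p.2
      ∂(ν.prod volume) = C₀ ^ 2 / (2 * c) * (ν.real univ * volume.real S) := by
    rw [integral_prod _ iS]
    simp only [integral_indicator hS, integral_const, smul_eq_mul, measureReal_restrict_apply_univ]
    ring
  rw [integral_sub (Δ2.const_mul _) iS, integral_sub iFψΔ iFΔ, Sint, integral_const_mul] at key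
  have hI : ∫ p, F p * Δ p ∂(ν.prod volume) ≤ -(c / 4) * (∫ p, Δ p ^ 2 ∂(ν.prod volume)) +
      C₀ ^ 2 / (4 * c) * (ν.real univ * volume.real S) := by
    have : C₀ ^ 2 / (4 * c) = C₀ ^ 2 / (2 * c) / 2 := by field_simp; ring
    rw [this]
    linarith
  have hI2 := mul_le_mul_of_nonneg_left hI hh'
  have f2 : Integrable fun x => f x ^ 2 := hf2.integrable_sq
  have b1 : ∫ x, v x ^ 2 ≤ ∫ x, v x * u x :=
    integral_mono v2 (integrable_bdd_mul hu vm vb) fun x => Tr_sq hκ _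
  have b2 : ∫ x, v x * f x ≤ 1 / 2 * (∫ x, v x ^ 2) + 1 / 2 * (∫ x, f x ^ 2) := by
    rw [← integral_const_mul, ← integral_const_mul, ← integral_add (v2.const_mul _) (f2.const_mul _)]
    refine integral_mono (integrable_bdd_mul hf vm vb) ((v2.const_mul _).add (f2.const_mul _))
      fun x => ?_
    simp only [Pi.add_apply]
    nlinarith [sq_nonneg (v x - f x)]
  change _ = h' * ∫ p, F p * Δ p ∂(ν.prod volume) at hw
  change 1 / 2 * (∫ x, v x ^ 2) + h' * c / 4 * (∫ p, Δ p ^ 2 ∂(ν.prod volume)) ≤ _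
  linarith

end
end FPE

namespace FPE
open Set Topology

section
variable {α : Type*} [MeasurableSpace α] {μ : Measure α}

/-- the `L²` norm -/
noncomputable def n2 (μ : Measure α) (f : α → ℝ) : ℝ := Real.sqrt (∫ x, f x ^ 2 ∂μ)

lemma n2_nonneg (f : α → ℝ) : 0 ≤ n2 μ f := Real.sqrt_nonneg _

lemma n2_sq (f : α → ℝ) : n2 μ f ^ 2 = ∫ x, f x ^ 2 ∂μ :=
  Real.sq_sqrt (integral_nonneg fun x => sq_nonneg _)

lemma eLpNorm_two {f : α → ℝ} (hf : MemLp f 2 μ) :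
    eLpNorm f 2 μ = ENNReal.ofReal (n2 μ f) := by
  rw [hf.eLpNorm_eq_integral_rpow_norm (by norm_num) (by norm_num)]
  congr 1
  rw [n2, Real.sqrt_eq_rpow]
  simp

lemma n2_eq {f : α → ℝ} (hf : MemLp f 2 μ) : n2 μ f = (eLpNorm f 2 μ).toReal := by
  rw [eLpNorm_two hf, ENNReal.toReal_ofReal (n2_nonneg f)]

lemma n2_add {f g : α → ℝ} (hf : MemLp f 2 μ) (hg : MemLp g 2 μ) :
    n2 μ (fun x => f x + g x) ≤ n2 μ f + n2 μ g := by
  have h : MemLp (fun x => f x + g x) 2 μ := hf.add hg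
  rw [n2_eq h, n2_eq hf, n2_eq hg, ← ENNReal.toReal_add hf.2.ne hg.2.ne]
  exact ENNReal.toReal_mono (ENNReal.add_ne_top.2 ⟨hf.2.ne, hg.2.ne⟩)
    (eLpNorm_add_le hf.1 hg.1 (by norm_num))

lemma integral_sq_le_of_eLpNorm {f : α → ℝ} (hf : AEStronglyMeasurable f μ) {K : ℝ} (hK : 0 ≤ K)
    (h : eLpNorm f 2 μ ≤ ENNReal.ofReal K) : MemLp f 2 μ ∧ ∫ x, f x ^ 2 ∂μ ≤ K ^ 2 := by
  have hm : MemLp f 2 μ := ⟨hf, h.trans_lt ENNReal.ofReal_lt_top⟩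
  refine ⟨hm, ?_⟩
  rw [eLpNorm_two hm, ENNReal.ofReal_le_ofReal_iff hK] at h
  rw [← n2_sq]
  have := n2_nonneg (μ := μ) f
  gcongr

lemma eLpNorm_le_of_integral_sq {f : α → ℝ} (hf : MemLp f 2 μ) {K : ℝ} (hK : 0 ≤ K)
    (h : ∫ x, f x ^ 2 ∂μ ≤ K ^ 2) : eLpNorm f 2 μ ≤ ENNReal.ofReal K := by
  rw [eLpNorm_two hf]
  apply ENNReal.ofReal_le_ofReal
  rw [n2]
  exact Real.sqrt_le_iff.2 ⟨hK, h⟩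

/-- Fatou in `L²`. -/
lemma fatou2 {f : ℕ → α → ℝ} {g : α → ℝ} (hf : ∀ n, AEStronglyMeasurable (f n) μ)
    {K : ENNReal} (hK : ∀ n, eLpNorm (f n) 2 μ ≤ K)
    (h : ∀ᵐ x ∂μ, Tendsto (fun n => f n x) atTop (𝓝 (g x))) : eLpNorm g 2 μ ≤ K := by
  refine (Lp.eLpNorm_lim_le_liminf_eLpNorm hf g h).trans ?_
  refine (liminf_le_liminf (Eventually.of_forall hK)).trans ?_
  simp

lemma cauchy_schwarz {f g : α → ℝ} (hf : MemLp f 2 μ) (hg : MemLp g 2 μ) :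
    |∫ x, f x * g x ∂μ| ≤ n2 μ f * n2 μ g := by
  have hfg : Integrable (fun x => f x * g x) μ := hf.integrable_mul hg
  set A := ∫ x, f x ^ 2 ∂μ
  set B := ∫ x, g x ^ 2 ∂μ
  set P := ∫ x, f x * g x ∂μ
  have key : ∀ t : ℝ, 0 ≤ B * (t * t) + 2 * P * t + A := by
    intro t
    have : ∫ x, (f x + t * g x) ^ 2 ∂μ = B * (t * t) + 2 * P * t + A := by
      have e : ∀ x, (f x + t * g x) ^ 2 = (t * t) * g x ^ 2 + (2 * t) * (f x * g x) + f x ^ 2 := by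
        intro x; ring
      simp_rw [e]
      have i1 : Integrable (fun x => (t * t) * g x ^ 2 + (2 * t) * (f x * g x)) μ :=
        (hg.integrable_sq.const_mul _).add (hfg.const_mul _)
      rw [integral_add i1 hf.integrable_sq,
        integral_add (hg.integrable_sq.const_mul _) (hfg.const_mul _), integral_const_mul,
        integral_const_mul]
      ring
    rw [← this]
    exact integral_nonneg fun x => sq_nonneg _
  have := discrim_le_zero key
  rw [discrim] at this
  have h2 : P ^ 2 ≤ (n2 μ f * n2 μ g) ^ 2 := by
    rw [mul_pow, n2_sq, n2_sq]
    change P ^ 2 ≤ A * B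
    nlinarith
  exact abs_le_of_sq_le_sq h2 (mul_nonneg (n2_nonneg _) (n2_nonneg _))

end

section
variable {d : ℕ}

lemma memLp_transl {v : (Fin d → ℝ) → ℝ} (hv : MemLp v 2) (y : Fin d → ℝ) :
    MemLp (fun x => v (x + y)) 2 :=
  hv.comp_measurePreserving (measurePreserving_add_right volume y)

lemma transl_bound {v : (Fin d → ℝ) → ℝ} (hv2 : MemLp v 2) {ε R K : ℝ}
    (hε : 0 < ε) (hR : 0 < R) (hK : 0 ≤ K)
    (hi : Integrable (fun p : (Fin d → ℝ) × (Fin d → ℝ) => (v (p.2 + ε • p.1) - v p.2) ^ 2)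
      ((volume.restrict (Metric.closedBall 0 R)).prod volume))
    (h : ∫ p : (Fin d → ℝ) × (Fin d → ℝ), (v (p.2 + ε • p.1) - v p.2) ^ 2
      ∂((volume.restrict (Metric.closedBall 0 R)).prod volume) ≤ ε ^ 2 * K) (y : Fin d → ℝ) :
    n2 volume (fun x => v (x + y) - v x) ≤
      Real.sqrt (4 * K / volume.real (Metric.closedBall (0 : Fin d → ℝ) (R / 2))) *
        (2 * ‖y‖ / R + ε) := by
  set N : (Fin d → ℝ) → ℝ := fun y => n2 volume (fun x => v (x + y) - v x) with hN
  set W := Metric.closedBall (0 : Fin d → ℝ) R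
  set W' := Metric.closedBall (0 : Fin d → ℝ) (R / 2)
  have hWm : MeasurableSet W := Metric.isClosed_closedBall.measurableSet
  have hWm' : MeasurableSet W' := Metric.isClosed_closedBall.measurableSet
  have mem : ∀ y, MemLp (fun x => v (x + y) - v x) 2 := fun y => (memLp_transl hv2 y).sub hv2
  have N0 : ∀ y, 0 ≤ N y := fun y => n2_nonneg _
  have Nadd : ∀ y z, N (y + z) ≤ N y + N z := by
    intro y z
    have h1 : MemLp (fun x => v (x + z + y) - v (x + z)) 2 :=
      (mem y).comp_measurePreserving (measurePreserving_add_right volume z)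
    have h2 := n2_add h1 (mem z)
    have e1 : n2 volume (fun x => v (x + z + y) - v (x + z)) = N y := by
      simp only [hN, n2]
      rw [integral_add_right_eq_self (fun x => (v (x + y) - v x) ^ 2) z]
    rw [e1] at h2
    refine le_trans (le_of_eq ?_) h2
    simp only [hN]
    congr 1; ext x
    rw [add_comm y z, add_assoc]; ring
  have Nneg : ∀ y, N (-y) = N y := by
    intro y
    simp only [hN, n2]
    rw [← integral_add_right_eq_self (fun x => (v (x + -y) - v x) ^ 2) y]
    congr 2; ext x
    rw [add_neg_cancel_right]; ring
  have Nmul : ∀ (m : ℕ) y, N ((m : ℝ) • y) ≤ m * N y := by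
    intro m y
    induction m with
    | zero => simp [hN, n2]
    | succ m ih =>
      push_cast
      rw [add_smul, one_smul]
      refine (Nadd _ _).trans ?_
      linarith
  set V' := volume.real W' with hV'
  have hV'0 : 0 < V' := by
    rw [hV', measureReal_def]
    exact ENNReal.toReal_pos (Metric.measure_closedBall_pos volume _ (by positivity)).ne'
      measure_closedBall_lt_top.ne
  -- one-cell estimate
  have cell : ∀ z : Fin d → ℝ, ‖z‖ ≤ R / 2 → N (ε • z) ≤ ε * Real.sqrt (4 * K / V') := by
    intro z hz
    set g : (Fin d → ℝ) → ℝ := W.indicator fun w => N (ε • w) ^ 2 with hg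
    have ig : Integrable g := by
      rw [hg, integrable_indicator_iff hWm]
      refine (hi.integral_prod_left).congr (Eventually.of_forall fun w => ?_)
      simp only [hN, n2_sq]
    have hgi : ∫ w, g w ≤ ε ^ 2 * K := by
      rw [hg, integral_indicator hWm]
      rw [integral_prod _ hi] at h
      refine le_trans (le_of_eq ?_) h
      simp only [hN, n2_sq]
    have g0 : ∀ w, 0 ≤ g w := fun w => indicator_nonneg (fun _ _ => sq_nonneg _) w
    have pt : ∀ w, W'.indicator (fun _ => N (ε • z) ^ 2) w ≤ 2 * g (w + z) + 2 * g w := by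
      intro w
      by_cases hw : w ∈ W'
      · rw [indicator_of_mem hw]
        have hw' : ‖w‖ ≤ R / 2 := by simpa [W'] using hw
        have m1 : w ∈ W := by simp only [W, mem_closedBall_zero_iff]; linarith
        have m2 : w + z ∈ W := by
          simp only [W, mem_closedBall_zero_iff]
          linarith [norm_add_le w z]
        rw [hg, indicator_of_mem m1, indicator_of_mem m2]
        have h1 : N (ε • z) ≤ N (ε • (w + z)) + N (ε • w) := by
          have := Nadd (ε • (w + z)) (-(ε • w))
          rw [Nneg] at this
          refine le_trans (le_of_eq ?_) this
          congr 1; rw [smul_add]; abel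
        have := N0 (ε • z)
        have := N0 (ε • w)
        have := N0 (ε • (w + z))
        nlinarith [sq_nonneg (N (ε • (w + z)) - N (ε • w))]
      · rw [indicator_of_notMem hw]
        linarith [g0 w, g0 (w + z)]
    have i1 : Integrable (fun w => g (w + z)) := ig.comp_add_right z
    have h2 := integral_mono ((integrable_indicator_iff hWm').2
      (integrableOn_const measure_closedBall_lt_top.ne)) ((i1.const_mul 2).add (ig.const_mul 2)) pt
    simp only [Pi.add_apply] at h2
    rw [integral_indicator hWm', setIntegral_const, integral_add (i1.const_mul 2) (ig.const_mul 2),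
      integral_const_mul, integral_const_mul, integral_add_right_eq_self g z, smul_eq_mul] at h2
    have h3 : N (ε • z) ^ 2 ≤ ε ^ 2 * (4 * K / V') := by
      have : ε ^ 2 * (4 * K / V') = (4 * (ε ^ 2 * K)) / V' := by ring
      rw [this, le_div_iff₀ hV'0]
      change V' * _ ≤ _ at h2
      linarith
    have h4 : N (ε • z) ^ 2 ≤ (ε * Real.sqrt (4 * K / V')) ^ 2 := by
      rw [mul_pow, Real.sq_sqrt (by positivity)]
      exact h3
    exact le_of_sq_le_sq h4 (by positivity)
  set K1 := Real.sqrt (4 * K / V')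
  have hK1 : 0 ≤ K1 := Real.sqrt_nonneg _
  set m : ℕ := ⌈2 * ‖y‖ / (ε * R)⌉₊ with hm
  by_cases hy : y = 0
  · subst hy
    simp only [hN, n2]
    simp
    positivity
  have hmpos : 0 < m := Nat.ceil_pos.2 (by have := norm_pos_iff.2 hy; positivity)
  have hm0 : (0 : ℝ) < m := by exact_mod_cast hmpos
  have hm1 : 2 * ‖y‖ / (ε * R) ≤ m := Nat.le_ceil _
  have hm2 : (m : ℝ) < 2 * ‖y‖ / (ε * R) + 1 := Nat.ceil_lt_add_one (by positivity)
  have e : y = (m : ℝ) • (ε • ((1 / (m * ε)) • y)) := by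
    rw [smul_smul, smul_smul]
    have : (m : ℝ) * (ε * (1 / (m * ε))) = 1 := by field_simp
    rw [← mul_assoc] at this
    rw [this, one_smul]
  have hcell := cell ((1 / (m * ε)) • y) (by
    rw [norm_smul, Real.norm_of_nonneg (by positivity)]
    rw [div_le_iff₀ (by positivity)] at hm1
    rw [one_div_mul_eq_div, div_le_iff₀ (by positivity)]
    linarith)
  change N y ≤ _
  calc N y = N ((m : ℝ) • (ε • ((1 / (m * ε)) • y))) := by rw [← e]
    _ ≤ m * N (ε • ((1 / (m * ε)) • y)) := Nmul _ _
    _ ≤ m * (ε * K1) := by gcongr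
    _ ≤ (2 * ‖y‖ / (ε * R) + 1) * (ε * K1) := by gcongr
    _ = K1 * (2 * ‖y‖ / R + ε) := by field_simp

instance finW (R : ℝ) :
    IsFiniteMeasure (volume.restrict (Metric.closedBall (0 : Fin d → ℝ) R)) :=
  ⟨by rw [Measure.restrict_apply_univ]; exact measure_closedBall_lt_top⟩

lemma neg_mp (R : ℝ) : MeasurePreserving (fun w : Fin d → ℝ => -w)
    (volume.restrict (Metric.closedBall 0 R)) (volume.restrict (Metric.closedBall 0 R)) := by
  have := (Measure.measurePreserving_neg (volume : Measure (Fin d → ℝ))).restrict_preimage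
    (s := Metric.closedBall 0 R) Metric.isClosed_closedBall.measurableSet
  have e : Neg.neg ⁻¹' Metric.closedBall (0 : Fin d → ℝ) R = Metric.closedBall 0 R := by
    ext w; simp
  rw [e] at this
  exact this

/-- the uniform (in ε) `L²` and translation bounds of the resolvent -/
lemma Res_L2 {k : (Fin d → ℝ) → (Fin d → ℝ) → ℝ → ℝ} {c Λ h ε R : ℝ} {u f : (Fin d → ℝ) → ℝ}
    (hk : Ker k c Λ) (hh : 0 < h) (hε : 0 < ε) (hR : 0 < R)
    (hu : Integrable u) (hf : Integrable f) (hf2 : MemLp f 2)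
    (hr : Res k (volume.restrict (Metric.closedBall 0 R)) (h / ε ^ 2) ε u f) {C₀ : ℝ}
    {S : Set (Fin d → ℝ)} (hS : MeasurableSet S) (hSf : volume S ≠ ⊤)
    (hsk : ∀ᵐ w ∂(volume.restrict (Metric.closedBall 0 R)), ∀ x q,
      |k (-w) (x + ε • w) q - k w x q| ≤ S.indicator (fun _ => ε * C₀) x) :
    ∃ Q : ℝ, Q = 1 / 2 * (∫ x, f x ^ 2) + h * (C₀ ^ 2 / (4 * c) *
      ((volume.restrict (Metric.closedBall (0 : Fin d → ℝ) R)).real univ * volume.real S)) ∧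
      eLpNorm u 2 volume ≤ ENNReal.ofReal (Real.sqrt (2 * Q)) ∧
      ∀ y, eLpNorm (fun x => u (x + y) - u x) 2 volume ≤ ENNReal.ofReal
        (Real.sqrt (4 * (4 * Q / (h * c)) / volume.real (Metric.closedBall (0 : Fin d → ℝ) (R / 2))) *
        (2 * ‖y‖ / R + ε)) := by
  have hc := hk.c0
  refine ⟨_, rfl, ?_⟩
  set Q := 1 / 2 * (∫ x, f x ^ 2) + h * (C₀ ^ 2 / (4 * c) *
      ((volume.restrict (Metric.closedBall (0 : Fin d → ℝ) R)).real univ * volume.real S)) with hQ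
  have hQ0 : 0 ≤ Q := by
    have : 0 ≤ ∫ x, f x ^ 2 := integral_nonneg fun x => sq_nonneg _
    positivity
  have en := fun n : ℕ => Res_energy hk (neg_mp R) (by positivity) hu hf hf2 hr hS hSf hsk
    (Nat.cast_nonneg n)
  set v : ℕ → (Fin d → ℝ) → ℝ := fun n x => Tr n (u x) with hv
  have vm : ∀ n, AEStronglyMeasurable (v n) volume := fun n =>
    (Tr_cont n).comp_aestronglyMeasurable hu.1
  have vb : ∀ n x, |v n x| ≤ n := fun n x => Tr_abs (Nat.cast_nonneg n) _
  have vi : ∀ n, Integrable (v n) := fun n =>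
    hu.abs.mono' (vm n) (Eventually.of_forall fun x => Tr_le_abs (Nat.cast_nonneg n) _)
  have v2 : ∀ n, MemLp (v n) 2 := fun n => by
    rw [memLp_two_iff_integrable_sq (vm n)]
    simp_rw [pow_two]; exact integrable_bdd_mul (vi n) (vm n) (vb n)
  have hlim : ∀ x, Tendsto (fun n => v n x) atTop (𝓝 (u x)) := fun x => Tr_tendsto _
  have en2 : ∀ n, 1 / 2 * (∫ x, v n x ^ 2) + h / ε ^ 2 * c / 4 *
      (∫ p : (Fin d → ℝ) × (Fin d → ℝ), (v n (p.2 + ε • p.1) - v n p.2) ^ 2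
        ∂((volume.restrict (Metric.closedBall 0 R)).prod volume)) ≤ Q := by
    intro n
    refine (en n).trans (le_of_eq ?_)
    rw [hQ]; field_simp
  have p0 : ∀ n, 0 ≤ ∫ p : (Fin d → ℝ) × (Fin d → ℝ), (v n (p.2 + ε • p.1) - v n p.2) ^ 2
        ∂((volume.restrict (Metric.closedBall 0 R)).prod volume) := fun n =>
    integral_nonneg fun x => sq_nonneg _
  have q0 : ∀ n, 0 ≤ ∫ x, v n x ^ 2 := fun n => integral_nonneg fun x => sq_nonneg _
  constructor
  · refine fatou2 vm (fun n => ?_) (Eventually.of_forall hlim)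
    refine eLpNorm_le_of_integral_sq (v2 n) (Real.sqrt_nonneg _) ?_
    rw [Real.sq_sqrt (by positivity)]
    have : 0 ≤ h / ε ^ 2 * c / 4 := by positivity
    nlinarith [en2 n, mul_nonneg this (p0 n)]
  · intro y
    have mp := measurePreserving_add_right (volume : Measure (Fin d → ℝ)) y
    refine fatou2 (f := fun n x => v n (x + y) - v n x)
      (fun n => ((memLp_transl (v2 n) y).sub (v2 n)).1) (fun n => ?_)
      (Eventually.of_forall fun x => (hlim _).sub (hlim _))
    have m2 : MemLp (fun x => v n (x + y) - v n x) 2 := (memLp_transl (v2 n) y).sub (v2 n)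
    rw [eLpNorm_two m2]
    apply ENNReal.ofReal_le_ofReal
    refine transl_bound (v2 n) hε hR (by positivity) ?_ ?_ y
    · have i1 := (vi n).comp_snd (volume.restrict (Metric.closedBall (0 : Fin d → ℝ) R))
      have i2 := (shear_integrable ε i1).sub i1
      simp_rw [pow_two]
      refine integrable_bdd_mul (C := 2 * n) i2 i2.1 fun p => ?_
      refine (_root_.abs_sub _ _).trans ?_
      linarith [vb n (p.2 + ε • p.1), vb n p.2]
    · have h1 := en2 n
      have h2 := q0 n
      have h3 : h / ε ^ 2 * c / 4 *
        (∫ p : (Fin d → ℝ) × (Fin d → ℝ), (v n (p.2 + ε • p.1) - v n p.2) ^ 2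
        ∂((volume.restrict (Metric.closedBall 0 R)).prod volume)) ≤ Q := by linarith
      have h4 : h / ε ^ 2 * c / 4 = (h * c) / (4 * ε ^ 2) := by field_simp
      rw [h4, div_mul_eq_mul_div, div_le_iff₀ (by positivity)] at h3
      have h5 : ε ^ 2 * (4 * Q / (h * c)) = Q * (4 * ε ^ 2) / (h * c) := by ring
      rw [h5, le_div_iff₀ (by positivity)]
      linarith

end
end FPE

namespace FPE
open Set Topology

section
variable {d : ℕ}

/-- test functions with bounds -/
structure Tst (φ : (Fin d → ℝ) → ℝ) (C0 C1 : ℝ) : Prop where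
  smooth : ContDiff ℝ 2 φ
  b0 : ∀ x, |φ x| ≤ C0
  b1 : ∀ i x, |pd i φ x| ≤ C1
  b2 : ∀ i j x, |pd2 i j φ x| ≤ C1
  lip : ∀ i j x y, |pd2 i j φ x - pd2 i j φ y| ≤ C1 * ‖x - y‖

lemma fderiv_eq_sum (φ : (Fin d → ℝ) → ℝ) (x w : Fin d → ℝ) :
    fderiv ℝ φ x w = ∑ i, w i * pd i φ x := by
  conv_lhs => rw [pi_eq_sum_univ' w]
  rw [map_sum]
  refine Finset.sum_congr rfl fun i _ => ?_
  rw [map_smul, smul_eq_mul, pd]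

lemma contDiff_pd {n : WithTop ℕ∞} {φ : (Fin d → ℝ) → ℝ} (i : Fin d) {m : WithTop ℕ∞}
    (h : ContDiff ℝ n φ) (hm : m + 1 ≤ n) : ContDiff ℝ m (pd i φ) := by
  unfold pd
  exact (h.fderiv_right hm).clm_apply contDiff_const

lemma line_deriv {φ : (Fin d → ℝ) → ℝ} (h : Differentiable ℝ φ) (x w : Fin d → ℝ) (s : ℝ) :
    HasDerivAt (fun s : ℝ => φ (x + s • w)) (∑ i, w i * pd i φ (x + s • w)) s := by
  rw [← fderiv_eq_sum]
  have h1 : HasFDerivAt φ (fderiv ℝ φ (x + s • w)) (x + s • w) := (h _).hasFDerivAt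
  have h2 : HasDerivAt (fun s : ℝ => x + s • w) w s := by
    simpa using ((hasDerivAt_id s).smul_const w).const_add x
  exact h1.comp_hasDerivAt s h2

namespace Tst
variable {φ : (Fin d → ℝ) → ℝ} {C0 C1 : ℝ}

lemma cont (h : Tst φ C0 C1) : Continuous φ := h.smooth.continuous
lemma aesm (h : Tst φ C0 C1) : AEStronglyMeasurable φ volume := h.cont.aestronglyMeasurable
lemma pd_smooth (h : Tst φ C0 C1) (i : Fin d) : ContDiff ℝ 1 (pd i φ) :=
  contDiff_pd i h.smooth (by norm_num)
lemma pd_cont (h : Tst φ C0 C1) (i : Fin d) : Continuous (pd i φ) := (h.pd_smooth i).continuous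
lemma pd2_cont (h : Tst φ C0 C1) (i j : Fin d) : Continuous (pd2 i j φ) :=
  (contDiff_pd (m := 0) i (h.pd_smooth j) (by norm_num)).continuous

lemma C0_nonneg (h : Tst φ C0 C1) : 0 ≤ C0 := (abs_nonneg _).trans (h.b0 0)

lemma taylor (h : Tst φ C0 C1) (hC1 : 0 ≤ C1) {ε R : ℝ} (hε : 0 ≤ ε) {x w : Fin d → ℝ}
    (hw : ‖w‖ ≤ R) :
    |φ (x + ε • w) - φ x - ε * ∑ i, w i * pd i φ x - ε ^ 2 / 2 * ∑ i, ∑ j, w i * w j * pd2 i j φ x|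
      ≤ (d : ℝ) ^ 2 * R ^ 3 * C1 * ε ^ 3 := by
  have hR : 0 ≤ R := (norm_nonneg _).trans hw
  have hwi : ∀ i, |w i| ≤ R := fun i => (norm_le_pi_norm w i).trans hw
  set D2 := ∑ i, ∑ j, w i * w j * pd2 i j φ x with hD2
  set D1 := ∑ i, w i * pd i φ x with hD1
  have hd1 : Differentiable ℝ φ := h.smooth.differentiable (by norm_num)
  have hd2 : ∀ i, Differentiable ℝ (pd i φ) := fun i => (h.pd_smooth i).differentiable (by norm_num)
  set g1 : ℝ → ℝ := fun s => ∑ i, w i * pd i φ (x + s • w) with hg1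
  set g2 : ℝ → ℝ := fun s => ∑ i, ∑ j, w i * w j * pd2 i j φ (x + s • w) with hg2
  have e1 : ∀ s, HasDerivAt (fun s : ℝ => φ (x + s • w)) (g1 s) s := line_deriv hd1 x w
  have e2 : ∀ s, HasDerivAt g1 (g2 s) s := by
    intro s
    have : g2 s = ∑ j, w j * ∑ i, w i * pd i (pd j φ) (x + s • w) := by
      simp only [hg2, Finset.mul_sum]
      rw [Finset.sum_comm]
      refine Finset.sum_congr rfl fun i _ => Finset.sum_congr rfl fun j _ => ?_
      simp only [pd2]; ring
    rw [this]
    exact HasDerivAt.fun_sum fun j _ => (line_deriv (hd2 j) x w s).const_mul (w j)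
  set K := (d : ℝ) ^ 2 * R ^ 3 * C1 with hK
  have hK0 : 0 ≤ K := by positivity
  have b2 : ∀ s ∈ Icc 0 ε, |g2 s - D2| ≤ K * ε := by
    intro s hs
    simp only [hg2, hD2]
    rw [← Finset.sum_sub_distrib]
    simp_rw [← Finset.sum_sub_distrib, ← mul_sub]
    refine (Finset.abs_sum_le_sum_abs _ _).trans ?_
    calc _ ≤ ∑ i : Fin d, ∑ j : Fin d, R * R * (C1 * (ε * R)) := by
          refine Finset.sum_le_sum fun i _ => (Finset.abs_sum_le_sum_abs _ _).trans ?_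
          refine Finset.sum_le_sum fun j _ => ?_
          rw [abs_mul, abs_mul]
          gcongr
          · exact hwi i
          · exact hwi j
          · refine (h.lip i j _ _).trans ?_
            gcongr
            rw [add_sub_cancel_left, norm_smul, Real.norm_of_nonneg hs.1]
            have := hs.2
            gcongr
      _ = K * ε := by
          simp only [Finset.sum_const, Finset.card_univ, Fintype.card_fin, nsmul_eq_mul, hK]
          ring
  have b1 : ∀ s ∈ Icc 0 ε, |g1 s - D1 - s * D2| ≤ K * ε * ε := by
    intro s hs
    have := norm_image_sub_le_of_norm_deriv_le_segment' (f := fun s => g1 s - s * D2)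
      (f' := fun s => g2 s - D2) (a := 0) (b := ε) (C := K * ε)
      (fun s _ => ((e2 s).sub ((hasDerivAt_id s).mul_const D2)).hasDerivWithinAt.congr_deriv
        (by simp)) (fun s hs => b2 s (Ico_subset_Icc_self hs)) s hs
    rw [Real.norm_eq_abs] at this
    have e0 : g1 0 = D1 := by simp [hg1, hD1]
    calc _ = |g1 s - s * D2 - (g1 0 - 0 * D2)| := by rw [e0]; congr 1; ring
      _ ≤ K * ε * (s - 0) := this
      _ ≤ K * ε * ε := by
        have := hs.2
        rw [sub_zero]
        gcongr
  have := norm_image_sub_le_of_norm_deriv_le_segment'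
      (f := fun s => φ (x + s • w) - s * D1 - s ^ 2 / 2 * D2)
      (f' := fun s => g1 s - D1 - s * D2) (a := 0) (b := ε) (C := K * ε * ε)
      (fun s _ => (((e1 s).sub ((hasDerivAt_id s).mul_const D1)).sub
        (((hasDerivAt_pow 2 s).div_const 2).mul_const D2)).hasDerivWithinAt.congr_deriv
        (by simp)) (fun s hs => b1 s (Ico_subset_Icc_self hs)) ε (right_mem_Icc.2 hε)
  rw [Real.norm_eq_abs] at this
  calc _ = |φ (x + ε • w) - ε * D1 - ε ^ 2 / 2 * D2 -
        (φ (x + (0 : ℝ) • w) - 0 * D1 - 0 ^ 2 / 2 * D2)| := by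
        congr 1; simp; ring
    _ ≤ K * ε * ε * (ε - 0) := this
    _ = K * ε ^ 3 := by ring

end Tst

lemma pd_zero_of_compact {φ : (Fin d → ℝ) → ℝ} (i : Fin d) (h : HasCompactSupport φ) :
    HasCompactSupport (pd i φ) := by
  have h1 : HasCompactSupport (fun x => fderiv ℝ φ x) := h.fderiv ℝ
  exact h1.comp_left (g := fun L : (Fin d → ℝ) →L[ℝ] ℝ => L (Pi.single i 1)) (by simp)

lemma pd_const (i : Fin d) (a : ℝ) : pd i (fun _ : Fin d → ℝ => a) = fun _ => 0 := by
  ext x; simp [pd]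

lemma tst_const (a : ℝ) : Tst (fun _ : Fin d → ℝ => a) |a| 0 where
  smooth := contDiff_const
  b0 := fun _ => le_rfl
  b1 := fun i x => by simp [pd_const]
  b2 := fun i j x => by simp [pd2, pd_const]
  lip := fun i j x y => by simp [pd2, pd_const]

/-- compactly supported smooth functions are test functions -/
lemma tst_of_compact {φ : (Fin d → ℝ) → ℝ} (h : ContDiff ℝ 3 φ) (hc : HasCompactSupport φ) :
    ∃ C0 C1, 0 ≤ C1 ∧ Tst φ C0 C1 := by
  obtain ⟨C0, hC0⟩ := hc.exists_bound_of_continuous h.continuous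
  have s1 : ∀ i, ContDiff ℝ 2 (pd i φ) := fun i => contDiff_pd i h (by norm_num)
  have s2 : ∀ i j, ContDiff ℝ 1 (pd2 i j φ) := fun i j => contDiff_pd i (s1 j) (by norm_num)
  have c1 : ∀ i, HasCompactSupport (pd i φ) := fun i => pd_zero_of_compact i hc
  have c2 : ∀ i j, HasCompactSupport (pd2 i j φ) := fun i j => pd_zero_of_compact i (c1 j)
  choose A hA using fun i => (c1 i).exists_bound_of_continuous (s1 i).continuous
  choose B hB using fun i j => (c2 i j).exists_bound_of_continuous (s2 i j).continuous
  choose L hL using fun i j => ContDiff.lipschitzWith_of_hasCompactSupport (c2 i j) (s2 i j)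
    (by norm_num)
  set C1 : ℝ := ∑ i, |A i| + ∑ i, ∑ j, |B i j| + ∑ i, ∑ j, (L i j : ℝ) with hC1
  have a0 : 0 ≤ ∑ i, |A i| := Finset.sum_nonneg fun i _ => abs_nonneg _
  have b0 : 0 ≤ ∑ i, ∑ j, |B i j| :=
    Finset.sum_nonneg fun i _ => Finset.sum_nonneg fun j _ => abs_nonneg _
  have l0 : 0 ≤ ∑ i, ∑ j, (L i j : ℝ) :=
    Finset.sum_nonneg fun i _ => Finset.sum_nonneg fun j _ => (L i j).2
  refine ⟨C0, C1, by positivity, h.of_le (by norm_num), hC0, fun i x => ?_, fun i j x => ?_,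
    fun i j x y => ?_⟩
  · have h1 := Finset.single_le_sum (f := fun i => |A i|) (fun i _ => abs_nonneg _)
      (Finset.mem_univ i)
    have h2 := (hA i x).trans (le_abs_self _)
    rw [Real.norm_eq_abs] at h2
    linarith
  · have h1 := Finset.single_le_sum (f := fun i => ∑ j, |B i j|)
      (fun i _ => Finset.sum_nonneg fun j _ => abs_nonneg _) (Finset.mem_univ i)
    have h3 := Finset.single_le_sum (f := fun j => |B i j|) (fun i _ => abs_nonneg _)
      (Finset.mem_univ j)
    have h2 := (hB i j x).trans (le_abs_self _)
    rw [Real.norm_eq_abs] at h2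
    linarith
  · have h1 := Finset.single_le_sum (f := fun i => ∑ j, (L i j : ℝ))
      (fun i _ => Finset.sum_nonneg fun j _ => (L i j).2) (Finset.mem_univ i)
    have h3 := Finset.single_le_sum (f := fun j => (L i j : ℝ)) (fun j _ => (L i j).2)
      (Finset.mem_univ j)
    have h2 := (hL i j).dist_le_mul x y
    rw [Real.dist_eq, dist_eq_norm] at h2
    refine h2.trans ?_
    gcongr
    linarith

lemma pd_scale {φ : (Fin d → ℝ) → ℝ} (h : Differentiable ℝ φ) (i : Fin d) (s : ℝ) :
    pd i (fun x => φ (s • x)) = fun x => s * pd i φ (s • x) := by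
  ext x
  have h2 : HasFDerivAt (fun x : Fin d → ℝ => s • x) (s • ContinuousLinearMap.id ℝ (Fin d → ℝ)) x :=
    (hasFDerivAt_id x).const_smul s
  have h1 : HasFDerivAt (fun x => φ (s • x)) _ x := (h (s • x)).hasFDerivAt.comp x h2
  rw [pd, h1.fderiv]
  simp [pd]

lemma pd_sub {φ ψ : (Fin d → ℝ) → ℝ} (h : Differentiable ℝ φ) (h' : Differentiable ℝ ψ)
    (i : Fin d) : pd i (fun x => φ x - ψ x) = fun x => pd i φ x - pd i ψ x := by
  ext x
  rw [pd, fderiv_fun_sub (h x) (h' x)]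
  rfl

lemma pd_constmul {φ : (Fin d → ℝ) → ℝ} (h : Differentiable ℝ φ) (a : ℝ)
    (i : Fin d) : pd i (fun x => a * φ x) = fun x => a * pd i φ x := by
  ext x
  rw [pd, fderiv_const_mul (h x)]
  rfl

/-- scaled tail cutoffs -/
lemma exists_cut (d : ℕ) : ∃ C : ℝ, 0 ≤ C ∧ ∀ r : ℝ, 1 ≤ r → ∃ φ : (Fin d → ℝ) → ℝ,
    Tst φ 1 (C / r) ∧ (∀ x, 0 ≤ φ x) ∧ (∀ x, φ x ≤ 1) ∧ (∀ x, 2 * r ≤ ‖x‖ → φ x = 1) ∧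
    (∀ x, ‖x‖ ≤ r → φ x = 0) := by
  let f : ContDiffBump (0 : Fin d → ℝ) := ⟨1, 2, by norm_num, by norm_num⟩
  have fs : ContDiff ℝ 3 f := f.contDiff
  obtain ⟨C0, C, hC, hf⟩ := tst_of_compact fs f.hasCompactSupport
  refine ⟨C, hC, fun r hr => ⟨fun x => 1 - f (r⁻¹ • x), ?_, ?_, ?_, ?_, ?_⟩⟩
  · have hr0 : 0 < r := by linarith
    have hri : r⁻¹ ≤ 1 := inv_le_one_of_one_le₀ hr
    have hd : Differentiable ℝ f := fs.differentiable (by norm_num)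
    have hd' : ∀ i, Differentiable ℝ (pd i f) := fun i =>
      (hf.pd_smooth i).differentiable (by norm_num)
    have hsc : ∀ ψ : (Fin d → ℝ) → ℝ, Differentiable ℝ ψ →
        Differentiable ℝ fun x => ψ (r⁻¹ • x) := fun ψ h =>
      h.comp (differentiable_id.const_smul r⁻¹)
    have e1 : ∀ i, pd i (fun x => 1 - f (r⁻¹ • x)) = fun x => (-r⁻¹) * pd i f (r⁻¹ • x) := by
      intro i
      rw [pd_sub (differentiable_const _) (hsc _ hd), pd_const, pd_scale hd]
      ext x; ring
    have e2 : ∀ i j x, pd2 i j (fun x => 1 - f (r⁻¹ • x)) x = (-r⁻¹ * r⁻¹) * pd2 i j f (r⁻¹ • x) := by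
      intro i j x
      rw [pd2, e1, pd_constmul (hsc _ (hd' j)), pd_scale (hd' j)]
      simp only [pd2]; ring
    have hr1 : r⁻¹ * r⁻¹ ≤ r⁻¹ := by
      have : 0 < r⁻¹ := by positivity
      nlinarith
    refine ⟨?_, fun x => ?_, fun i x => ?_, fun i j x => ?_, fun i j x y => ?_⟩
    · exact contDiff_const.sub ((fs.of_le (by norm_num)).comp (contDiff_const_smul r⁻¹))
    · rw [abs_le]; constructor <;> linarith [f.nonneg (x := r⁻¹ • x), f.le_one (x := r⁻¹ • x)]
    · rw [e1, abs_mul, abs_neg, abs_of_pos (by positivity), div_eq_inv_mul]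
      gcongr
      exact hf.b1 _ _
    · rw [e2, abs_mul, abs_mul, abs_neg, abs_of_pos (by positivity), div_eq_inv_mul]
      gcongr
      exact hf.b2 _ _ _
    · rw [e2, e2, ← mul_sub, abs_mul, abs_mul, abs_neg, abs_of_pos (by positivity), div_eq_inv_mul]
      calc _ ≤ r⁻¹ * (C * ‖x - y‖) := by
            gcongr
            refine (hf.lip _ _ _ _).trans ?_
            rw [← smul_sub, norm_smul, Real.norm_of_nonneg (by positivity)]
            gcongr
            calc r⁻¹ * ‖x - y‖ ≤ 1 * ‖x - y‖ := by gcongr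
              _ = _ := one_mul _
        _ = _ := by ring
  · intro x; linarith [f.le_one (x := r⁻¹ • x)]
  · intro x; linarith [f.nonneg (x := r⁻¹ • x)]
  · intro x hx
    have : f (r⁻¹ • x) = 0 := f.zero_of_le_dist (by
      rw [dist_zero_right, norm_smul, Real.norm_of_nonneg (by positivity)]
      change 2 ≤ _
      rw [inv_mul_eq_div, le_div_iff₀ (by linarith)]
      exact hx)
    simp only [this]; ring
  · intro x hx
    have : f (r⁻¹ • x) = 1 := f.one_of_mem_closedBall (by
      rw [mem_closedBall_zero_iff, norm_smul, Real.norm_of_nonneg (by positivity)]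
      change _ ≤ (1 : ℝ)
      rw [inv_mul_eq_div, div_le_iff₀ (by linarith)]
      linarith)
    simp only [this]; ring

end
end FPE

namespace FPE
open Set Topology

section
variable {d : ℕ}

/-- the (dual) operator `Σ A_ij(x,s) ∂_ij φ + Σ B_i(x,s) ∂_i φ` -/
noncomputable def Lop (A : Fin d → Fin d → (Fin d → ℝ) → ℝ → ℝ) (B : Fin d → (Fin d → ℝ) → ℝ → ℝ)
    (φ : (Fin d → ℝ) → ℝ) (x : Fin d → ℝ) (s : ℝ) : ℝ :=
  (∑ i, ∑ j, A i j x s * pd2 i j φ x) + ∑ i, B i x s * pd i φ x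

/-- kernel consistent with the operator -/
structure AdmK (A : Fin d → Fin d → (Fin d → ℝ) → ℝ → ℝ) (B : Fin d → (Fin d → ℝ) → ℝ → ℝ)
    (R c Λ C₀ : ℝ) (S : Set (Fin d → ℝ)) (ε : ℝ) (k : (Fin d → ℝ) → (Fin d → ℝ) → ℝ → ℝ) :
    Prop where
  ker : Ker k c Λ
  m1 : ∀ x s j, ∫ w in Metric.closedBall (0 : Fin d → ℝ) R, k w x s * w j = ε * B j x s
  m2 : ∀ x s i j, ∫ w in Metric.closedBall (0 : Fin d → ℝ) R, k w x s * (w i * w j) = 2 * A i j x s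
  sk : ∀ᵐ w ∂(volume.restrict (Metric.closedBall (0 : Fin d → ℝ) R)), ∀ x q,
      |k (-w) (x + ε • w) q - k w x q| ≤ S.indicator (fun _ => ε * C₀) x

/-- admissible pair of coefficients -/
def Adm (A : Fin d → Fin d → (Fin d → ℝ) → ℝ → ℝ) (B : Fin d → (Fin d → ℝ) → ℝ → ℝ) : Prop :=
  ∃ (R c Λ C₀ : ℝ) (S : Set (Fin d → ℝ)) (ε₀ : ℝ), 0 < R ∧ 0 < ε₀ ∧ MeasurableSet S ∧
    volume S ≠ ⊤ ∧ ∀ ε, 0 < ε → ε ≤ ε₀ → ∃ k, AdmK A B R c Λ C₀ S ε k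

variable {A : Fin d → Fin d → (Fin d → ℝ) → ℝ → ℝ} {B : Fin d → (Fin d → ℝ) → ℝ → ℝ}
  {R c Λ C₀ : ℝ} {S : Set (Fin d → ℝ)} {ε : ℝ} {k : (Fin d → ℝ) → (Fin d → ℝ) → ℝ → ℝ}
  {φ : (Fin d → ℝ) → ℝ} {C0 C1 : ℝ}

lemma Ker.integrable_row_mul (hk : Ker k c Λ) {ν : Measure (Fin d → ℝ)} [IsFiniteMeasure ν]
    (x : Fin d → ℝ) (s : ℝ) {g : (Fin d → ℝ) → ℝ} (hg : Continuous g) {C : ℝ}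
    (hC : ∀ᵐ w ∂ν, |g w| ≤ C) : Integrable (fun w => k w x s * g w) ν := by
  refine ((hk.integrable_row (ν := ν) x s).bdd_mul hg.aestronglyMeasurable hC).congr
    (Eventually.of_forall fun w => mul_comm _ _)

lemma ae_ball (R : ℝ) : ∀ᵐ w ∂(volume.restrict (Metric.closedBall (0 : Fin d → ℝ) R)), ‖w‖ ≤ R := by
  filter_upwards [ae_restrict_mem Metric.isClosed_closedBall.measurableSet] with w hw
  simpa using hw

lemma cons_bound (hK : AdmK A B R c Λ C₀ S ε k) (hφ : Tst φ C0 C1) (hC1 : 0 ≤ C1) (hε : 0 < ε)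
    (x : Fin d → ℝ) (s : ℝ) :
    |(∫ w in Metric.closedBall (0 : Fin d → ℝ) R, k w x s * (φ (x + ε • w) - φ x)) -
      ε ^ 2 * Lop A B φ x s| ≤
      (d : ℝ) ^ 2 * R ^ 3 * Λ * volume.real (Metric.closedBall (0 : Fin d → ℝ) R) * C1 * ε ^ 3
        * |s| := by
  set ν := volume.restrict (Metric.closedBall (0 : Fin d → ℝ) R) with hν
  have hb : ∀ᵐ w ∂ν, ‖w‖ ≤ R := ae_ball R
  have hbi : ∀ i, ∀ᵐ w ∂ν, |w i| ≤ R := fun i => by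
    filter_upwards [hb] with w hw
    exact (norm_le_pi_norm w i).trans hw
  have i1 : ∀ j, Integrable (fun w => k w x s * w j) ν := fun j =>
    hK.ker.integrable_row_mul x s (continuous_apply j) (hbi j)
  have i2 : ∀ i j, Integrable (fun w => k w x s * (w i * w j)) ν := fun i j => by
    refine hK.ker.integrable_row_mul (C := R * R) x s (by fun_prop) ?_
    filter_upwards [hbi i, hbi j] with w h1 h2
    rw [abs_mul]
    have := abs_nonneg (w i)
    have hR0 : 0 ≤ R := this.trans h1
    gcongr
  have i0 : Integrable (fun w => k w x s * (φ (x + ε • w) - φ x)) ν := by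
    refine hK.ker.integrable_row_mul (C := C0 + C0) x s ?_ (Eventually.of_forall fun w => ?_)
    · exact (hφ.cont.comp (by fun_prop)).sub continuous_const
    · exact (_root_.abs_sub _ _).trans (add_le_add (hφ.b0 _) (hφ.b0 _))
  have J1 : ∫ w, k w x s * (∑ j, w j * pd j φ x) ∂ν = ε * ∑ j, B j x s * pd j φ x := by
    have : ∀ w : Fin d → ℝ, k w x s * (∑ j, w j * pd j φ x) =
        ∑ j, k w x s * w j * pd j φ x := fun w => by
      rw [Finset.mul_sum]; exact Finset.sum_congr rfl fun j _ => by ring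
    simp_rw [this]
    rw [integral_finsetSum _ fun j _ => (i1 j).mul_const _]
    simp_rw [integral_mul_const, hν, hK.m1, Finset.mul_sum]
    exact Finset.sum_congr rfl fun j _ => by ring
  have J2 : ∫ w, k w x s * (∑ i, ∑ j, w i * w j * pd2 i j φ x) ∂ν =
      2 * ∑ i, ∑ j, A i j x s * pd2 i j φ x := by
    have : ∀ w : Fin d → ℝ, k w x s * (∑ i, ∑ j, w i * w j * pd2 i j φ x) =
        ∑ i, ∑ j, k w x s * (w i * w j) * pd2 i j φ x := fun w => by
      simp_rw [Finset.mul_sum]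
      exact Finset.sum_congr rfl fun i _ => Finset.sum_congr rfl fun j _ => by ring
    simp_rw [this]
    rw [integral_finsetSum _ fun i _ => integrable_finset_sum _ fun j _ => (i2 i j).mul_const _]
    simp_rw [fun i => integral_finsetSum Finset.univ
      (f := fun j w => k w x s * (w i * w j) * pd2 i j φ x)
      fun j _ => (i2 i j).mul_const _]
    simp_rw [integral_mul_const, hν, hK.m2, Finset.mul_sum]
    exact Finset.sum_congr rfl fun i _ => Finset.sum_congr rfl fun j _ => by ring
  have i1' : Integrable (fun w => k w x s * (∑ j, w j * pd j φ x)) ν := by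
    have : ∀ w : Fin d → ℝ, k w x s * (∑ j, w j * pd j φ x) =
        ∑ j, k w x s * w j * pd j φ x := fun w => by
      rw [Finset.mul_sum]; exact Finset.sum_congr rfl fun j _ => by ring
    simp_rw [this]
    exact integrable_finset_sum _ fun j _ => (i1 j).mul_const _
  have i2' : Integrable (fun w => k w x s * (∑ i, ∑ j, w i * w j * pd2 i j φ x)) ν := by
    have : ∀ w : Fin d → ℝ, k w x s * (∑ i, ∑ j, w i * w j * pd2 i j φ x) =
        ∑ i, ∑ j, k w x s * (w i * w j) * pd2 i j φ x := fun w => by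
      simp_rw [Finset.mul_sum]
      exact Finset.sum_congr rfl fun i _ => Finset.sum_congr rfl fun j _ => by ring
    simp_rw [this]
    exact integrable_finset_sum _ fun i _ => integrable_finset_sum _ fun j _ =>
      (i2 i j).mul_const _
  have e : (∫ w, k w x s * (φ (x + ε • w) - φ x) ∂ν) - ε ^ 2 * Lop A B φ x s =
      ∫ w, k w x s * (φ (x + ε • w) - φ x - ε * (∑ j, w j * pd j φ x) -
        ε ^ 2 / 2 * (∑ i, ∑ j, w i * w j * pd2 i j φ x)) ∂ν := by
    have : ∀ w : Fin d → ℝ, k w x s * (φ (x + ε • w) - φ x - ε * (∑ j, w j * pd j φ x) -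
        ε ^ 2 / 2 * (∑ i, ∑ j, w i * w j * pd2 i j φ x)) =
        k w x s * (φ (x + ε • w) - φ x) - ε * (k w x s * (∑ j, w j * pd j φ x)) -
        ε ^ 2 / 2 * (k w x s * (∑ i, ∑ j, w i * w j * pd2 i j φ x)) := fun w => by ring
    simp_rw [this]
    have i3 : Integrable (fun w => k w x s * (φ (x + ε • w) - φ x) -
      ε * (k w x s * (∑ j, w j * pd j φ x))) ν := i0.sub (i1'.const_mul _)
    rw [integral_sub i3 (i2'.const_mul _), integral_sub i0 (i1'.const_mul _), integral_const_mul,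
      integral_const_mul, J1, J2, Lop]
    ring
  rw [e]
  have hΛ := hK.ker.L0
  have := norm_integral_le_of_norm_le_const (μ := ν) (C := Λ * |s| * ((d : ℝ) ^ 2 * R ^ 3 * C1 * ε ^ 3))
    (f := fun w => k w x s * (φ (x + ε • w) - φ x - ε * (∑ j, w j * pd j φ x) -
        ε ^ 2 / 2 * (∑ i, ∑ j, w i * w j * pd2 i j φ x))) (by
      filter_upwards [hb] with w hw
      rw [Real.norm_eq_abs, abs_mul]
      have h1 := hK.ker.abs_le w x s
      have h2 := hφ.taylor hC1 hε.le (x := x) hw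
      gcongr)
  rw [Real.norm_eq_abs] at this
  refine this.trans (le_of_eq ?_)
  rw [hν, measureReal_restrict_apply_univ]
  ring

lemma Lop_abs {L : ℝ} (hL : 0 ≤ L) (hA : ∀ i j x s, |A i j x s| ≤ L * |s|)
    (hB : ∀ i x s, |B i x s| ≤ L * |s|) (hφ : Tst φ C0 C1) (x : Fin d → ℝ) (s : ℝ) :
    |Lop A B φ x s| ≤ ((d : ℝ) ^ 2 + d) * L * C1 * |s| := by
  unfold Lop
  refine (abs_add_le _ _).trans ?_
  have h1 : |∑ i, ∑ j, A i j x s * pd2 i j φ x| ≤ ∑ i : Fin d, ∑ j : Fin d, L * |s| * C1 := by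
    refine (Finset.abs_sum_le_sum_abs _ _).trans (Finset.sum_le_sum fun i _ => ?_)
    refine (Finset.abs_sum_le_sum_abs _ _).trans (Finset.sum_le_sum fun j _ => ?_)
    rw [abs_mul]
    exact mul_le_mul (hA i j x s) (hφ.b2 i j x) (abs_nonneg _) (by positivity)
  have h2 : |∑ i, B i x s * pd i φ x| ≤ ∑ i : Fin d, L * |s| * C1 := by
    refine (Finset.abs_sum_le_sum_abs _ _).trans (Finset.sum_le_sum fun i _ => ?_)
    rw [abs_mul]
    exact mul_le_mul (hB i x s) (hφ.b1 i x) (abs_nonneg _) (by positivity)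
  simp only [Finset.sum_const, Finset.card_univ, Fintype.card_fin, nsmul_eq_mul] at h1 h2
  nlinarith

lemma Lop_lip {L : ℝ} (hL : 0 ≤ L) (hA : ∀ i j x s t, |A i j x s - A i j x t| ≤ L * |s - t|)
    (hB : ∀ i x s t, |B i x s - B i x t| ≤ L * |s - t|) (hφ : Tst φ C0 C1) (x : Fin d → ℝ)
    (s t : ℝ) : |Lop A B φ x s - Lop A B φ x t| ≤ ((d : ℝ) ^ 2 + d) * L * C1 * |s - t| := by
  have e : Lop A B φ x s - Lop A B φ x t = (∑ i, ∑ j, (A i j x s - A i j x t) * pd2 i j φ x) +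
      ∑ i, (B i x s - B i x t) * pd i φ x := by
    unfold Lop
    simp_rw [sub_mul, Finset.sum_sub_distrib]
    ring
  rw [e]
  refine (abs_add_le _ _).trans ?_
  have h1 : |∑ i, ∑ j, (A i j x s - A i j x t) * pd2 i j φ x| ≤
      ∑ i : Fin d, ∑ j : Fin d, L * |s - t| * C1 := by
    refine (Finset.abs_sum_le_sum_abs _ _).trans (Finset.sum_le_sum fun i _ => ?_)
    refine (Finset.abs_sum_le_sum_abs _ _).trans (Finset.sum_le_sum fun j _ => ?_)
    rw [abs_mul]
    exact mul_le_mul (hA i j x s t) (hφ.b2 i j x) (abs_nonneg _) (by positivity)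
  have h2 : |∑ i, (B i x s - B i x t) * pd i φ x| ≤ ∑ i : Fin d, L * |s - t| * C1 := by
    refine (Finset.abs_sum_le_sum_abs _ _).trans (Finset.sum_le_sum fun i _ => ?_)
    rw [abs_mul]
    exact mul_le_mul (hB i x s t) (hφ.b1 i x) (abs_nonneg _) (by positivity)
  simp only [Finset.sum_const, Finset.card_univ, Fintype.card_fin, nsmul_eq_mul] at h1 h2
  nlinarith

lemma Adm_lip (hAd : Adm A B) : ∃ L, 0 ≤ L ∧
    (∀ i j x s t, |A i j x s - A i j x t| ≤ L * |s - t|) ∧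
    (∀ i x s t, |B i x s - B i x t| ≤ L * |s - t|) := by
  obtain ⟨R, c, Λ, C₀, S, ε₀, hR, hε, -, -, h⟩ := hAd
  obtain ⟨k, hK⟩ := h ε₀ hε le_rfl
  set ν := volume.restrict (Metric.closedBall (0 : Fin d → ℝ) R) with hν
  have hΛ := hK.ker.L0
  have hV : 0 ≤ ν.real univ := measureReal_nonneg
  have hb : ∀ᵐ w ∂ν, ‖w‖ ≤ R := ae_ball R
  have gen : ∀ (g : (Fin d → ℝ) → ℝ) (M : ℝ), 0 ≤ M → Continuous g → (∀ᵐ w ∂ν, |g w| ≤ M) →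
      ∀ x s t, |(∫ w, k w x s * g w ∂ν) - ∫ w, k w x t * g w ∂ν| ≤ Λ * M * ν.real univ * |s - t| := by
    intro g M hM hg hgM x s t
    have i1 := hK.ker.integrable_row_mul x s hg hgM
    have i2 := hK.ker.integrable_row_mul x t hg hgM
    rw [← integral_sub i1 i2]
    have := norm_integral_le_of_norm_le_const (μ := ν) (C := Λ * |s - t| * M)
      (f := fun w => k w x s * g w - k w x t * g w) (by
        filter_upwards [hgM] with w hw
        rw [Real.norm_eq_abs, ← sub_mul, abs_mul]
        have h1 := hK.ker.abs_sub w x s t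
        gcongr)
    rw [Real.norm_eq_abs] at this
    refine this.trans (le_of_eq (by ring))
  refine ⟨Λ * (R * R) * ν.real univ + Λ * R * ν.real univ / ε₀, by positivity, ?_, ?_⟩
  · intro i j x s t
    have h1 := gen (fun w => w i * w j) (R * R) (by positivity) (by fun_prop) (by
      filter_upwards [hb] with w hw
      rw [abs_mul]
      have h1 := (norm_le_pi_norm w i).trans hw
      have h2 := (norm_le_pi_norm w j).trans hw
      rw [Real.norm_eq_abs] at h1 h2
      gcongr) x s t
    rw [hν, hK.m2, hK.m2, ← hν, ← mul_sub, abs_mul, abs_two] at h1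
    have : 0 ≤ Λ * R * ν.real univ / ε₀ * |s - t| := by positivity
    have := abs_nonneg (A i j x s - A i j x t)
    rw [add_mul]
    linarith
  · intro i x s t
    have h1 := gen (fun w => w i) R hR.le (by fun_prop) (by
      filter_upwards [hb] with w hw
      exact (norm_le_pi_norm w i).trans hw) x s t
    rw [hν, hK.m1, hK.m1, ← hν, ← mul_sub, abs_mul, abs_of_pos hε] at h1
    have h2 : |B i x s - B i x t| ≤ Λ * R * ν.real univ / ε₀ * |s - t| := by
      rw [div_mul_eq_mul_div, le_div_iff₀ hε]; linarith
    have : 0 ≤ Λ * (R * R) * ν.real univ * |s - t| := by positivity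
    rw [add_mul]
    linarith

lemma Lop_cont (cA : ∀ i j, Continuous fun p : (Fin d → ℝ) × ℝ => A i j p.1 p.2)
    (cB : ∀ i, Continuous fun p : (Fin d → ℝ) × ℝ => B i p.1 p.2) (hφ : Tst φ C0 C1) :
    Continuous fun p : (Fin d → ℝ) × ℝ => Lop A B φ p.1 p.2 := by
  have h1 : ∀ i j, Continuous fun p : (Fin d → ℝ) × ℝ => pd2 i j φ p.1 := fun i j =>
    (hφ.pd2_cont i j).comp continuous_fst
  have h2 : ∀ i, Continuous fun p : (Fin d → ℝ) × ℝ => pd i φ p.1 := fun i =>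
    (hφ.pd_cont i).comp continuous_fst
  unfold Lop
  fun_prop

lemma comp_aesm (F : (Fin d → ℝ) → ℝ → ℝ)
    (hF : Continuous fun p : (Fin d → ℝ) × ℝ => F p.1 p.2) {u : (Fin d → ℝ) → ℝ}
    (hu : AEStronglyMeasurable u volume) :
    AEStronglyMeasurable (fun x => F x (u x)) volume := by
  have hm : AEStronglyMeasurable (fun x : Fin d → ℝ => (x, u x)) volume :=
    AEStronglyMeasurable.prodMk (f := fun x : Fin d → ℝ => x) aestronglyMeasurable_id hu
  exact hF.comp_aestronglyMeasurable hm

lemma Lop_aesm (cA : ∀ i j, Continuous fun p : (Fin d → ℝ) × ℝ => A i j p.1 p.2)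
    (cB : ∀ i, Continuous fun p : (Fin d → ℝ) × ℝ => B i p.1 p.2) (hφ : Tst φ C0 C1)
    {u : (Fin d → ℝ) → ℝ} (hu : AEStronglyMeasurable u volume) :
    AEStronglyMeasurable (fun x => Lop A B φ x (u x)) volume :=
  comp_aesm (fun x s => Lop A B φ x s) (Lop_cont cA cB hφ) hu

lemma Lop_integrable (cA : ∀ i j, Continuous fun p : (Fin d → ℝ) × ℝ => A i j p.1 p.2)
    (cB : ∀ i, Continuous fun p : (Fin d → ℝ) × ℝ => B i p.1 p.2) {L : ℝ} (hL : 0 ≤ L)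
    (hA : ∀ i j x s, |A i j x s| ≤ L * |s|)
    (hB : ∀ i x s, |B i x s| ≤ L * |s|) (hφ : Tst φ C0 C1)
    {u : (Fin d → ℝ) → ℝ} (hu : Integrable u) :
    Integrable (fun x => Lop A B φ x (u x)) := by
  refine (hu.abs.const_mul (((d : ℝ) ^ 2 + d) * L * C1)).mono' (Lop_aesm cA cB hφ hu.1)
    (Eventually.of_forall fun x => ?_)
  rw [Real.norm_eq_abs]
  exact Lop_abs hL hA hB hφ x (u x)

lemma weak_eps (hK : AdmK A B R c Λ C₀ S ε k) (hφ : Tst φ C0 C1) (hC1 : 0 ≤ C1) (hε : 0 < ε)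
    (cA : ∀ i j, Continuous fun p : (Fin d → ℝ) × ℝ => A i j p.1 p.2)
    (cB : ∀ i, Continuous fun p : (Fin d → ℝ) × ℝ => B i p.1 p.2) {L : ℝ} (hL : 0 ≤ L)
    (hA : ∀ i j x s, |A i j x s| ≤ L * |s|) (hB : ∀ i x s, |B i x s| ≤ L * |s|)
    {h : ℝ} (hh : 0 < h) {u f : (Fin d → ℝ) → ℝ} (hu : Integrable u) (hf : Integrable f)
    (hr : Res k (volume.restrict (Metric.closedBall 0 R)) (h / ε ^ 2) ε u f) :
    |(∫ x, φ x * u x) - (∫ x, φ x * f x) - h * ∫ x, Lop A B φ x (u x)| ≤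
      h * ((d : ℝ) ^ 2 * R ^ 3 * Λ * volume.real (Metric.closedBall (0 : Fin d → ℝ) R) * C1 * ε) *
        ∫ x, |u x| := by
  set ν := volume.restrict (Metric.closedBall (0 : Fin d → ℝ) R) with hν
  set V := volume.real (Metric.closedBall (0 : Fin d → ℝ) R)
  rw [Res_weak hK.ker hu hf hr hφ.aesm hφ.b0]
  have ip : Integrable (fun p : (Fin d → ℝ) × (Fin d → ℝ) =>
      k p.1 p.2 (u p.2) * (φ (p.2 + ε • p.1) - φ p.2)) (ν.prod volume) := by
    refine ((hK.ker.integrable (ν := ν) hu).bdd_mul (c := C0 + C0)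
      ((shear_aesm ε hφ.aesm).sub hφ.aesm.comp_snd) (Eventually.of_forall fun p => ?_)).congr
      (Eventually.of_forall fun w => mul_comm _ _)
    exact (_root_.abs_sub _ _).trans (add_le_add (hφ.b0 _) (hφ.b0 _))
  rw [integral_prod_symm _ ip]
  have iL := Lop_integrable cA cB hL hA hB hφ hu
  have e : h / ε ^ 2 * (∫ x, ∫ w, k w x (u x) * (φ (x + ε • w) - φ x) ∂ν) -
      h * (∫ x, Lop A B φ x (u x)) = h / ε ^ 2 * ∫ x,
        ((∫ w, k w x (u x) * (φ (x + ε • w) - φ x) ∂ν) - ε ^ 2 * Lop A B φ x (u x)) := by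
    rw [integral_sub ip.integral_prod_right (iL.const_mul _), integral_const_mul]
    field_simp
  simp only at e ⊢
  rw [e, abs_mul, abs_of_pos (by positivity)]
  have h1 : |∫ x, ((∫ w, k w x (u x) * (φ (x + ε • w) - φ x) ∂ν) - ε ^ 2 * Lop A B φ x (u x))| ≤
      ∫ x, (d : ℝ) ^ 2 * R ^ 3 * Λ * V * C1 * ε ^ 3 * |u x| := by
    rw [← Real.norm_eq_abs]
    refine norm_integral_le_of_norm_le (hu.abs.const_mul _) (Eventually.of_forall fun x => ?_)
    rw [Real.norm_eq_abs]
    exact cons_bound hK hφ hC1 hε x (u x)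
  rw [integral_const_mul] at h1
  calc _ ≤ h / ε ^ 2 * ((d : ℝ) ^ 2 * R ^ 3 * Λ * V * C1 * ε ^ 3 * ∫ x, |u x|) := by gcongr
    _ = _ := by field_simp

lemma kato_eps (hK : AdmK A B R c Λ C₀ S ε k) (hφ : Tst φ C0 C1) (hC1 : 0 ≤ C1) (hε : 0 < ε)
    {L : ℝ} (hL : 0 ≤ L)
    (hA : ∀ i j x s, |A i j x s| ≤ L * |s|) (hB : ∀ i x s, |B i x s| ≤ L * |s|)
    {h : ℝ} (hh : 0 < h) {u f : (Fin d → ℝ) → ℝ} (hu : Integrable u) (hf : Integrable f)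
    (hr : Res k (volume.restrict (Metric.closedBall 0 R)) (h / ε ^ 2) ε u f)
    (hφ0 : ∀ x, 0 ≤ φ x) :
    (∫ x, φ x * |u x|) ≤ (∫ x, φ x * |f x|) + h * ((((d : ℝ) ^ 2 + d) * L +
      (d : ℝ) ^ 2 * R ^ 3 * Λ * volume.real (Metric.closedBall (0 : Fin d → ℝ) R) * ε) * C1) *
        ∫ x, |u x| := by
  set ν := volume.restrict (Metric.closedBall (0 : Fin d → ℝ) R) with hν
  set V := volume.real (Metric.closedBall (0 : Fin d → ℝ) R)
  refine (Res_kato hK.ker (by positivity) hu hf hr hφ.aesm hφ.b0 hφ0).trans ?_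
  refine add_le_add le_rfl ?_
  have ip : Integrable (fun p : (Fin d → ℝ) × (Fin d → ℝ) =>
      |k p.1 p.2 (u p.2)| * (φ (p.2 + ε • p.1) - φ p.2)) (ν.prod volume) := by
    refine ((hK.ker.integrable (ν := ν) hu).abs.bdd_mul (c := C0 + C0)
      ((shear_aesm ε hφ.aesm).sub hφ.aesm.comp_snd) (Eventually.of_forall fun p => ?_)).congr
      (Eventually.of_forall fun w => mul_comm _ _)
    exact (_root_.abs_sub _ _).trans (add_le_add (hφ.b0 _) (hφ.b0 _))
  rw [integral_prod_symm _ ip]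
  have h1 : ∫ x, ∫ w, |k w x (u x)| * (φ (x + ε • w) - φ x) ∂ν ≤
      ∫ x, (ε ^ 2 * (((d : ℝ) ^ 2 + d) * L * C1) + (d : ℝ) ^ 2 * R ^ 3 * Λ * V * C1 * ε ^ 3) *
        |u x| := by
    refine integral_mono ip.integral_prod_right (hu.abs.const_mul _) fun x => ?_
    have b1 := cons_bound hK hφ hC1 hε x (u x)
    have b2 := Lop_abs hL hA hB hφ x (u x)
    have b3 : |∫ w, k w x (u x) * (φ (x + ε • w) - φ x) ∂ν| ≤
      (ε ^ 2 * (((d : ℝ) ^ 2 + d) * L * C1) + (d : ℝ) ^ 2 * R ^ 3 * Λ * V * C1 * ε ^ 3) *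
        |u x| := by
      have t := abs_sub_abs_le_abs_sub (∫ w, k w x (u x) * (φ (x + ε • w) - φ x) ∂ν)
        (ε ^ 2 * Lop A B φ x (u x))
      rw [abs_mul (ε ^ 2), abs_of_pos (by positivity : (0 : ℝ) < ε ^ 2)] at t
      have := mul_le_mul_of_nonneg_left b2 (by positivity : (0 : ℝ) ≤ ε ^ 2)
      linarith
    rcases le_total 0 (u x) with h0 | h0
    · have : ∀ w, |k w x (u x)| = k w x (u x) := fun w =>
        abs_of_nonneg (by simpa [hK.ker.zero] using hK.ker.mono w x h0)
      simp only [this]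
      exact (le_abs_self _).trans b3
    · have : ∀ w, |k w x (u x)| = -k w x (u x) := fun w =>
        abs_of_nonpos (by simpa [hK.ker.zero] using hK.ker.mono w x h0)
      simp only [this, neg_mul, integral_neg]
      exact (neg_le_abs _).trans b3
  rw [integral_const_mul] at h1
  refine (mul_le_mul_of_nonneg_left h1 (by positivity)).trans (le_of_eq ?_)
  field_simp

end
end FPE

namespace FPE
open Set Topology

section
variable {d : ℕ}

lemma exists_tail {f : (Fin d → ℝ) → ℝ} (hf : Integrable f) {η : ℝ} (hη : 0 < η) :
    ∃ r : ℝ, 1 ≤ r ∧ ∫ x in {x | r < ‖x‖}, |f x| ≤ η := by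
  have hm : ∀ r : ℝ, MeasurableSet {x : Fin d → ℝ | r < ‖x‖} := fun r =>
    (isOpen_lt continuous_const continuous_norm).measurableSet
  have h : Tendsto (fun n : ℕ => ∫ x, {x : Fin d → ℝ | (n : ℝ) < ‖x‖}.indicator (fun x => |f x|) x)
      atTop (𝓝 (∫ x : Fin d → ℝ, (0 : ℝ))) := by
    refine tendsto_integral_of_dominated_convergence (fun x => |f x|)
      (fun n => (hf.abs.indicator (hm n)).1) hf.abs (fun n => Eventually.of_forall fun x => ?_)
      (Eventually.of_forall fun x => ?_)
    · rw [Real.norm_eq_abs]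
      by_cases hx : x ∈ {x : Fin d → ℝ | (n : ℝ) < ‖x‖}
      · rw [indicator_of_mem hx, abs_abs]
      · rw [indicator_of_notMem hx]; simp
    · refine tendsto_const_nhds.congr' ?_
      obtain ⟨N, hN⟩ := exists_nat_ge ‖x‖
      filter_upwards [eventually_ge_atTop N] with n hn
      rw [indicator_of_notMem]
      simp only [mem_setOf_eq, not_lt]
      exact hN.trans (by exact_mod_cast hn)
  rw [integral_zero] at h
  obtain ⟨n, hn1, hn2⟩ := ((h.eventually (eventually_le_nhds hη)).and (eventually_ge_atTop 1)).exists
  refine ⟨n, by exact_mod_cast hn2, ?_⟩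
  rwa [integral_indicator (hm n)] at hn1

lemma cut_le {f φ : (Fin d → ℝ) → ℝ} (hf : Integrable f) (hm : AEStronglyMeasurable φ volume)
    (h0 : ∀ x, 0 ≤ φ x) (h1 : ∀ x, φ x ≤ 1) {r : ℝ} (hr : ∀ x, ‖x‖ ≤ r → φ x = 0) :
    ∫ x, φ x * |f x| ≤ ∫ x in {x | r < ‖x‖}, |f x| := by
  have hms : MeasurableSet {x : Fin d → ℝ | r < ‖x‖} :=
    (isOpen_lt continuous_const continuous_norm).measurableSet
  rw [← integral_indicator hms]
  refine integral_mono (integrable_bdd_mul hf.abs hm (C := 1) fun x => by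
    rw [abs_of_nonneg (h0 x)]; exact h1 x) (hf.abs.indicator hms) fun x => ?_
  by_cases hx : r < ‖x‖
  · simp only [indicator, mem_setOf_eq, hx, if_true]
    exact mul_le_of_le_one_left (abs_nonneg _) (h1 x)
  · simp only [indicator, mem_setOf_eq, hx, if_false]
    rw [hr x (not_lt.1 hx), zero_mul]

lemma le_cut {f φ : (Fin d → ℝ) → ℝ} (hf : Integrable f) (hm : AEStronglyMeasurable φ volume)
    (h0 : ∀ x, 0 ≤ φ x) (h1 : ∀ x, φ x ≤ 1) {r : ℝ} (hr : ∀ x, r ≤ ‖x‖ → φ x = 1) :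
    ∫ x in {x | r < ‖x‖}, |f x| ≤ ∫ x, φ x * |f x| := by
  have hms : MeasurableSet {x : Fin d → ℝ | r < ‖x‖} :=
    (isOpen_lt continuous_const continuous_norm).measurableSet
  rw [← integral_indicator hms]
  refine integral_mono (hf.abs.indicator hms) (integrable_bdd_mul hf.abs hm (C := 1) fun x => by
    rw [abs_of_nonneg (h0 x)]; exact h1 x) fun x => ?_
  by_cases hx : r < ‖x‖
  · simp only [indicator, mem_setOf_eq, hx, if_true]
    rw [hr x hx.le, one_mul]
  · simp only [indicator, mem_setOf_eq, hx, if_false]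
    exact mul_nonneg (h0 x) (abs_nonneg _)

lemma tight_of_kato {ι : Type*} {u : ι → (Fin d → ℝ) → ℝ} (hu : ∀ m, Integrable (u m))
    {f : (Fin d → ℝ) → ℝ} (hf : Integrable f) {K : ℝ}
    (h : ∀ m φ C1, 0 ≤ C1 → Tst φ 1 C1 → (∀ x, 0 ≤ φ x) →
      (∫ x, φ x * |u m x|) ≤ (∫ x, φ x * |f x|) + K * C1) {η : ℝ} (hη : 0 < η) :
    ∃ r : ℝ, ∀ m, ∫ x in {x | r < ‖x‖}, |u m x| ≤ η := by
  obtain ⟨C, hC, hcut⟩ := exists_cut d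
  obtain ⟨r₁, hr1, ht⟩ := exists_tail hf (half_pos hη)
  set r := max r₁ (2 * |K| * C / η) with hr
  have hr1' : 1 ≤ r := hr1.trans (le_max_left _ _)
  obtain ⟨φ, hφ, h0, h1, h2, h3⟩ := hcut r hr1'
  refine ⟨2 * r, fun m => (le_cut (hu m) hφ.aesm h0 h1 h2).trans ((h m φ (C / r) (by positivity)
    hφ h0).trans ?_)⟩
  have e1 := cut_le hf hφ.aesm h0 h1 (r := r₁) fun x hx => h3 x (hx.trans (le_max_left _ _))
  have e2 : K * (C / r) ≤ η / 2 := by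
    rw [← mul_div_assoc, div_le_iff₀ (by linarith)]
    have := le_max_right r₁ (2 * |K| * C / η)
    rw [← hr, div_le_iff₀ hη] at this
    have := mul_le_mul_of_nonneg_right (le_abs_self K) hC
    linarith
  linarith

lemma ball_L1_L2 {v : (Fin d → ℝ) → ℝ} (hv : MemLp v 2) {K : ℝ} (hK : 0 ≤ K)
    (h : ∫ x, v x ^ 2 ≤ K ^ 2) (r : ℝ) :
    ∫ x in Metric.closedBall 0 r, |v x| ≤
      Real.sqrt (volume.real (Metric.closedBall (0 : Fin d → ℝ) r)) * K := by
  have hv' : MemLp (fun x => |v x|) 2 (volume.restrict (Metric.closedBall 0 r)) :=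
    (hv.restrict _).abs
  have := cauchy_schwarz hv' (memLp_const (1 : ℝ))
  simp only [mul_one] at this
  refine (le_abs_self _).trans (this.trans ?_)
  rw [mul_comm]
  refine mul_le_mul ?_ ?_ (n2_nonneg _) (Real.sqrt_nonneg _)
  · unfold n2
    simp
  · unfold n2
    simp only [sq_abs]
    refine Real.sqrt_le_iff.2 ⟨hK, le_trans ?_ h⟩
    exact setIntegral_le_integral hv.integrable_sq (Eventually.of_forall fun x => sq_nonneg _)

lemma fatou_L1 {α ι : Type*} [MeasurableSpace α] {μ : Measure α} {l : Filter ι} [NeBot l]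
    {w : ι → α → ℝ} {v : α → ℝ} (hw : ∀ m, Integrable (w m) μ) (hv : Integrable v μ)
    (h : Tendsto (fun m => ∫ x, |w m x - v x| ∂μ) l (𝓝 0)) {K : ENNReal}
    (hK : ∀ᶠ m in l, eLpNorm (w m) 2 μ ≤ K) : eLpNorm v 2 μ ≤ K := by
  have : ∀ j : ℕ, ∃ m, eLpNorm (w m) 2 μ ≤ K ∧ ∫ x, |w m x - v x| ∂μ ≤ 1 / ((j : ℝ) + 1) := fun j =>
    (hK.and (h.eventually (eventually_le_nhds (by positivity)))).exists
  choose m hm1 hm2 using this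
  have ht : Tendsto (fun j => ∫ x, |w (m j) x - v x| ∂μ) atTop (𝓝 0) :=
    squeeze_zero (fun j => integral_nonneg fun x => abs_nonneg _) hm2
      tendsto_one_div_add_atTop_nhds_zero_nat
  obtain ⟨s, -, -, hae⟩ := L1_subseq le_rfl (fun j => hw (m j)) hv ht
  exact fatou2 (fun j => (hw (m (s j))).1) (fun j => hm1 _) hae

/-- L1 convergence passes to integrals against bounded functions -/
lemma tendsto_bdd_mul {α ι : Type*} [MeasurableSpace α] {μ : Measure α} {l : Filter ι}
    {w : ι → α → ℝ} {v φ : α → ℝ} (hw : ∀ m, Integrable (w m) μ) (hv : Integrable v μ)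
    (h : Tendsto (fun m => ∫ x, |w m x - v x| ∂μ) l (𝓝 0)) (hφ : AEStronglyMeasurable φ μ) {C : ℝ}
    (hC : ∀ x, |φ x| ≤ C) : Tendsto (fun m => ∫ x, φ x * w m x ∂μ) l (𝓝 (∫ x, φ x * v x ∂μ)) := by
  rw [tendsto_iff_dist_tendsto_zero]
  have h2 := h.const_mul C
  rw [mul_zero] at h2
  refine squeeze_zero (fun _ => dist_nonneg) (fun m => ?_) h2
  rw [Real.dist_eq]
  refine (L1_abs_integral_sub_le (integrable_bdd_mul (hw m) hφ hC)
    (integrable_bdd_mul hv hφ hC)).trans ?_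
  rw [← integral_const_mul]
  refine integral_mono ((integrable_bdd_mul (hw m) hφ hC).sub
    (integrable_bdd_mul hv hφ hC)).abs (((hw m).sub hv).abs.const_mul C) fun x => ?_
  simp only [Pi.sub_apply]
  rw [← mul_sub, abs_mul]
  exact mul_le_mul_of_nonneg_right (hC x) (abs_nonneg _)

lemma tendsto_abs_L1 {α ι : Type*} [MeasurableSpace α] {μ : Measure α} {l : Filter ι}
    {w : ι → α → ℝ} {v : α → ℝ} (hw : ∀ m, Integrable (w m) μ) (hv : Integrable v μ)
    (h : Tendsto (fun m => ∫ x, |w m x - v x| ∂μ) l (𝓝 0)) :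
    Tendsto (fun m => ∫ x, |(|w m x| - |v x|)| ∂μ) l (𝓝 0) := by
  refine squeeze_zero (fun _ => integral_nonneg fun x => abs_nonneg _) (fun m => ?_) h
  exact integral_mono ((hw m).abs.sub hv.abs).abs ((hw m).sub hv).abs fun x =>
    abs_abs_sub_abs_le_abs_sub _ _

/-- limit resolvent data -/
structure ResN (A : Fin d → Fin d → (Fin d → ℝ) → ℝ → ℝ) (B : Fin d → (Fin d → ℝ) → ℝ → ℝ)
    (h L : ℝ) (f u : (Fin d → ℝ) → ℝ) : Prop where
  int : Integrable u
  memLp : MemLp u 2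
  weak : ∀ φ C0 C1, 0 ≤ C1 → Tst φ C0 C1 →
    (∫ x, φ x * u x) - (∫ x, φ x * f x) = h * ∫ x, Lop A B φ x (u x)
  kato : ∀ φ C0 C1, 0 ≤ C1 → Tst φ C0 C1 → (∀ x, 0 ≤ φ x) →
    (∫ x, φ x * |u x|) ≤ (∫ x, φ x * |f x|) + h * (((d : ℝ) ^ 2 + d) * L * C1) * ∫ x, |f x|
  tr : ∃ K, 0 ≤ K ∧ ∀ y, n2 volume (fun x => u (x + y) - u x) ≤ K * ‖y‖

lemma integral_transl_abs (u v : (Fin d → ℝ) → ℝ) (y : Fin d → ℝ) :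
    ∫ x, |u (x + y) - v (x + y)| = ∫ x, |u x - v x| :=
  integral_add_right_eq_self (μ := (volume : Measure (Fin d → ℝ))) (fun x => |u x - v x|) y

lemma L1_transl_diff {u v : (Fin d → ℝ) → ℝ} (hu : Integrable u) (hv : Integrable v)
    (y : Fin d → ℝ) : ∫ x, |(u (x + y) - u x) - (v (x + y) - v x)| ≤
      (∫ x, |u x - v x|) + ∫ x, |u x - v x| := by
  have hu' : Integrable (fun x => u (x + y)) := hu.comp_add_right y
  have hv' : Integrable (fun x => v (x + y)) := hv.comp_add_right y
  have i1 : Integrable (fun x => |u (x + y) - v (x + y)|) := (hu'.sub hv').abs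
  have i2 : Integrable (fun x => |u x - v x|) := (hu.sub hv).abs
  have i3 : Integrable (fun x => |u (x + y) - v (x + y)| + |u x - v x|) := i1.add i2
  have e : (∫ x, |u x - v x|) + ∫ x, |u x - v x| =
      ∫ x, (|u (x + y) - v (x + y)| + |u x - v x|) := by
    rw [integral_add i1 i2, integral_transl_abs]
  rw [e]
  refine integral_mono ((hu'.sub hu).sub (hv'.sub hv)).abs i3 fun x => ?_
  have : (u (x + y) - u x) - (v (x + y) - v x) = (u (x + y) - v (x + y)) - (u x - v x) := by ring
  simp only [Pi.sub_apply]
  rw [this]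
  exact _root_.abs_sub _ _

/-- L1 distance bounds pass to the limit -/
lemma L1_dist_limit {α ι : Type*} [MeasurableSpace α] {μ : Measure α} {l : Filter ι} [NeBot l]
    {w w' : ι → α → ℝ} {v v' : α → ℝ} (hw : ∀ m, Integrable (w m) μ) (hv : Integrable v μ)
    (hw' : ∀ m, Integrable (w' m) μ) (hv' : Integrable v' μ)
    (h : Tendsto (fun m => ∫ x, |w m x - v x| ∂μ) l (𝓝 0))
    (h' : Tendsto (fun m => ∫ x, |w' m x - v' x| ∂μ) l (𝓝 0)) {K : ℝ}
    (hK : ∀ᶠ m in l, ∫ x, |w m x - w' m x| ∂μ ≤ K) : ∫ x, |v x - v' x| ∂μ ≤ K := by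
  have ht := (h.add h').add_const K
  rw [add_zero, zero_add] at ht
  refine ge_of_tendsto ht ?_
  filter_upwards [hK] with m hm
  have h1 := L1_triangle hv (hw m) hv'
  have h2 := L1_triangle (hw m) (hw' m) hv'
  rw [L1_comm v (w m)] at h1
  linarith

lemma propN {A : Fin d → Fin d → (Fin d → ℝ) → ℝ → ℝ} {B : Fin d → (Fin d → ℝ) → ℝ → ℝ}
    (hAd : Adm A B)
    (cA : ∀ i j, Continuous fun p : (Fin d → ℝ) × ℝ => A i j p.1 p.2)
    (cB : ∀ i, Continuous fun p : (Fin d → ℝ) × ℝ => B i p.1 p.2) {L : ℝ} (hL : 0 ≤ L)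
    (hA : ∀ i j x s, |A i j x s| ≤ L * |s|) (hB : ∀ i x s, |B i x s| ≤ L * |s|)
    {h : ℝ} (hh : 0 < h) :
    ∃ J : ((Fin d → ℝ) → ℝ) → (Fin d → ℝ) → ℝ,
      (∀ f, Integrable f → MemLp f 2 → ResN A B h L f (J f)) ∧
      ∀ f g, Integrable f → MemLp f 2 → Integrable g → MemLp g 2 →
        ∫ x, |J f x - J g x| ≤ ∫ x, |f x - g x| := by
  obtain ⟨L', hL', lA, lB⟩ := Adm_lip hAd
  obtain ⟨R, c, Λ, C₀, S, ε₀, hR, hε₀, hS, hSf, hk⟩ := hAd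
  set ε : ℕ → ℝ := fun m => ε₀ * (1 / ((m : ℝ) + 1)) with hεdef
  have hε : ∀ m, 0 < ε m := fun m => by positivity
  have hεle : ∀ m, ε m ≤ ε₀ := fun m => by
    refine mul_le_of_le_one_right hε₀.le ?_
    rw [div_le_one (by positivity)]
    linarith [(Nat.cast_nonneg m : (0 : ℝ) ≤ m)]
  have hεt0 : Tendsto ε atTop (𝓝 0) := by
    simpa [hεdef] using tendsto_one_div_add_atTop_nhds_zero_nat.const_mul ε₀
  set l : Ultrafilter ℕ := hyperfilter ℕ with hl
  have hlat : (l : Filter ℕ) ≤ atTop := Nat.hyperfilter_le_atTop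
  have hεt : Tendsto ε l (𝓝 0) := hεt0.mono_left hlat
  choose k hK using fun m => hk (ε m) (hε m) (hεle m)
  set ν := volume.restrict (Metric.closedBall (0 : Fin d → ℝ) R) with hν
  set V := volume.real (Metric.closedBall (0 : Fin d → ℝ) R) with hV
  have hex : ∀ f, ∃ u : ℕ → (Fin d → ℝ) → ℝ, Integrable f → ∀ m, Integrable (u m) ∧
      Res (k m) ν (h / (ε m) ^ 2) (ε m) (u m) f := by
    intro f
    by_cases hf : Integrable f
    · choose u hu using fun m => Res_exists (ν := ν) (h' := h / (ε m) ^ 2) (ε := ε m) (hK m).ker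
        (by have := hε m; positivity) hf
      exact ⟨u, fun _ => hu⟩
    · exact ⟨fun _ _ => 0, fun h => absurd h hf⟩
  choose u hu using hex
  have hΛ : 0 < Λ := (hK 0).ker.L0
  have hc : 0 < c := (hK 0).ker.c0
  set CK := (d : ℝ) ^ 2 * R ^ 3 * Λ * V with hCK
  have hV0 : 0 ≤ V := measureReal_nonneg
  have hCK0 : 0 ≤ CK := by positivity
  have L1b : ∀ f, Integrable f → ∀ m, ∫ x, |u f m x| ≤ ∫ x, |f x| := by
    intro f hf m
    have := kato_eps (hK m) (tst_const (d := d) 1) le_rfl (hε m) hL hA hB hh (hu f hf m).1 hf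
      (hu f hf m).2 (fun _ => zero_le_one)
    simpa using this
  have key : ∀ f, Integrable f → MemLp f 2 → ∃ v, ResN A B h L f v ∧
      Tendsto (fun m => ∫ x, |u f m x - v x|) l (𝓝 0) := by
    intro f hf hf2
    have iu := fun m => (hu f hf m).1
    set F := ∫ x, |f x| with hF
    have hF0 : 0 ≤ F := integral_nonneg fun x => abs_nonneg _
    set Q := 1 / 2 * (∫ x, f x ^ 2) + h * (C₀ ^ 2 / (4 * c) * (ν.real univ * volume.real S)) with hQ
    set Kt := Real.sqrt (4 * (4 * Q / (h * c)) /
      volume.real (Metric.closedBall (0 : Fin d → ℝ) (R / 2))) with hKt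
    have hKt0 : 0 ≤ Kt := Real.sqrt_nonneg _
    have e2 : ∀ m, eLpNorm (u f m) 2 volume ≤ ENNReal.ofReal (Real.sqrt (2 * Q)) := by
      intro m
      obtain ⟨Q', hQ', h1, h2⟩ := Res_L2 (hK m).ker hh (hε m) hR (iu m) hf hf2 (hu f hf m).2 hS hSf
        (hK m).sk
      rw [hQ'] at h1
      exact h1
    have e3 : ∀ m y, eLpNorm (fun x => u f m (x + y) - u f m x) 2 volume ≤
        ENNReal.ofReal (Kt * (2 * ‖y‖ / R + ε m)) := by
      intro m
      obtain ⟨Q', hQ', h1, h2⟩ := Res_L2 (hK m).ker hh (hε m) hR (iu m) hf hf2 (hu f hf m).2 hS hSf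
        (hK m).sk
      rw [hQ'] at h2
      exact h2
    have m2 : ∀ m, MemLp (u f m) 2 := fun m => ⟨(iu m).1, (e2 m).trans_lt ENNReal.ofReal_lt_top⟩
    have it : ∀ m y, Integrable (fun x => u f m (x + y)) := fun m y => (iu m).comp_add_right y
    have kt : ∀ m φ C0 C1, 0 ≤ C1 → Tst φ C0 C1 → (∀ x, 0 ≤ φ x) →
        (∫ x, φ x * |u f m x|) ≤ (∫ x, φ x * |f x|) +
          h * ((((d : ℝ) ^ 2 + d) * L + CK * ε m) * C1) * F := by
      intro m φ C0 C1 hC1 hφ h0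
      refine (kato_eps (hK m) hφ hC1 (hε m) hL hA hB hh (iu m) hf (hu f hf m).2 h0).trans ?_
      refine add_le_add le_rfl (mul_le_mul_of_nonneg_left (L1b f hf m) ?_)
      have := hε m
      positivity
    obtain ⟨v, hv, hlim⟩ := compactL1 l iu (L1b f hf) (fun η hη => by
      obtain ⟨r, hr⟩ := tight_of_kato iu hf (K := h * ((((d : ℝ) ^ 2 + d) * L + CK * ε₀)) * F)
        (fun m φ C1 hC1 hφ h0 => (kt m φ 1 C1 hC1 hφ h0).trans (by
          refine add_le_add le_rfl ?_
          have h5 := hεle m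
          calc _ ≤ h * ((((d : ℝ) ^ 2 + d) * L + CK * ε₀) * C1) * F := by gcongr
            _ = _ := by ring)) hη
      exact ⟨r, Eventually.of_forall hr⟩) (fun r η hη => by
      set Vr := Real.sqrt (volume.real (Metric.closedBall (0 : Fin d → ℝ) r)) with hVr
      have hVr0 : 0 ≤ Vr := Real.sqrt_nonneg _
      set D := 2 * (Vr * Kt * 2 / R + 1) with hD
      have hD0 : 0 < D := by positivity
      refine ⟨η / D, by positivity, ?_⟩
      have ht := hεt.const_mul (Vr * Kt)
      rw [mul_zero] at ht
      filter_upwards [ht.eventually (eventually_le_nhds (half_pos hη))] with m hm y hy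
      have hεm := hε m
      obtain ⟨g1, g2⟩ := integral_sq_le_of_eLpNorm ((it m y).sub (iu m)).1
        (K := Kt * (2 * ‖y‖ / R + ε m)) (by positivity) (e3 m y)
      refine (ball_L1_L2 g1 (by positivity) g2 r).trans ?_
      rw [← hVr]
      have q : Vr * Kt * 2 / R * ‖y‖ ≤ η / 2 := by
        calc _ ≤ (D / 2) * (η / D) := by
              refine mul_le_mul ?_ hy (norm_nonneg _) (by positivity)
              rw [hD]; linarith
          _ = η / 2 := by field_simp
      calc Vr * (Kt * (2 * ‖y‖ / R + ε m)) = Vr * Kt * 2 / R * ‖y‖ + Vr * Kt * ε m := by ring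
        _ ≤ η := by linarith)
    refine ⟨v, ⟨hv, ?_, ?_, ?_, ?_⟩, hlim⟩
    · exact ⟨hv.1, (fatou_L1 iu hv hlim (Eventually.of_forall e2)).trans_lt ENNReal.ofReal_lt_top⟩
    · intro φ C0 C1 hC1 hφ
      have t1 := tendsto_bdd_mul iu hv hlim hφ.aesm hφ.b0
      have t2 : Tendsto (fun m => ∫ x, Lop A B φ x (u f m x)) l (𝓝 (∫ x, Lop A B φ x (v x))) := by
        rw [tendsto_iff_dist_tendsto_zero]
        have h2 := hlim.const_mul (((d : ℝ) ^ 2 + d) * L' * C1)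
        rw [mul_zero] at h2
        refine squeeze_zero (fun _ => dist_nonneg) (fun m => ?_) h2
        rw [Real.dist_eq]
        have i1 := Lop_integrable cA cB hL hA hB hφ (iu m)
        have i2 := Lop_integrable cA cB hL hA hB hφ hv
        refine (L1_abs_integral_sub_le i1 i2).trans ?_
        rw [← integral_const_mul]
        exact integral_mono (i1.sub i2).abs (((iu m).sub hv).abs.const_mul _) fun x =>
          Lop_lip hL' lA lB hφ x _ _
      have t3 : Tendsto (fun m => (∫ x, φ x * u f m x) - (∫ x, φ x * f x) -
          h * ∫ x, Lop A B φ x (u f m x)) l (𝓝 ((∫ x, φ x * v x) - (∫ x, φ x * f x) -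
          h * ∫ x, Lop A B φ x (v x))) := (t1.sub_const _).sub (t2.const_mul h)
      have t4 : Tendsto (fun m => (∫ x, φ x * u f m x) - (∫ x, φ x * f x) -
          h * ∫ x, Lop A B φ x (u f m x)) l (𝓝 0) := by
        have := hεt.const_mul (h * CK * C1 * F)
        rw [mul_zero] at this
        refine squeeze_zero_norm (fun m => ?_) this
        rw [Real.norm_eq_abs]
        refine (weak_eps (hK m) hφ hC1 (hε m) cA cB hL hA hB hh (iu m) hf (hu f hf m).2).trans ?_
        have h5 := L1b f hf m
        have := hε m
        calc _ ≤ h * (CK * C1 * ε m) * F := by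
              exact mul_le_mul_of_nonneg_left h5 (by positivity)
          _ = _ := by ring
      have := tendsto_nhds_unique t3 t4
      linarith
    · intro φ C0 C1 hC1 hφ h0
      have t1 := tendsto_bdd_mul (fun m => (iu m).abs) hv.abs (tendsto_abs_L1 iu hv hlim)
        hφ.aesm hφ.b0
      have t2 : Tendsto (fun m => (∫ x, φ x * |f x|) +
          h * ((((d : ℝ) ^ 2 + d) * L + CK * ε m) * C1) * F) l (𝓝 ((∫ x, φ x * |f x|) +
          h * ((((d : ℝ) ^ 2 + d) * L + CK * 0) * C1) * F)) :=
        ((((hεt.const_mul CK).const_add _).mul_const C1).const_mul h).mul_const F |>.const_add _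
      have := le_of_tendsto_of_tendsto' t1 t2 fun m => kt m φ C0 C1 hC1 hφ h0
      simpa using this
    · refine ⟨Kt * (2 / R), by positivity, fun y => ?_⟩
      have itv : Integrable (fun x => v (x + y)) := hv.comp_add_right y
      have hlim2 : Tendsto (fun m => ∫ x, |(u f m (x + y) - u f m x) - (v (x + y) - v x)|) l (𝓝 0) := by
        have := hlim.add hlim
        rw [add_zero] at this
        refine squeeze_zero (fun _ => integral_nonneg fun x => abs_nonneg _) (fun m => ?_) this
        exact L1_transl_diff (iu m) hv y
      have hδ : ∀ δ > 0, n2 volume (fun x => v (x + y) - v x) ≤ Kt * (2 * ‖y‖ / R) + δ := by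
        intro δ hδ
        have ht := hεt.const_mul Kt
        rw [mul_zero] at ht
        have := fatou_L1 (fun m => (it m y).sub (iu m)) (itv.sub hv) hlim2
          (K := ENNReal.ofReal (Kt * (2 * ‖y‖ / R) + δ)) (by
            filter_upwards [ht.eventually (eventually_le_nhds hδ)] with m hm
            refine (e3 m y).trans (ENNReal.ofReal_le_ofReal ?_)
            linarith)
        have h0 : 0 ≤ Kt * (2 * ‖y‖ / R) + δ := by positivity
        obtain ⟨-, g2⟩ := integral_sq_le_of_eLpNorm (itv.sub hv).1 h0 this
        exact Real.sqrt_le_iff.2 ⟨h0, g2⟩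
      have := le_of_forall_pos_le_add hδ
      refine this.trans (le_of_eq (by ring))
  choose! J hJ1 hJ2 using key
  refine ⟨J, hJ1, fun f g hf hf2 hg hg2 => ?_⟩
  refine L1_dist_limit (fun m => (hu f hf m).1) (hJ1 f hf hf2).int (fun m => (hu g hg m).1)
    (hJ1 g hg hg2).int (hJ2 f hf hf2) (hJ2 g hg hg2) (Eventually.of_forall fun m => ?_)
  exact Res_contr (hK m).ker (by have := hε m; positivity) (hu f hf m).1 hf (hu f hf m).2
    (hu g hg m).1 hg (hu g hg m).2

end
end FPE

namespace FPE
open Set Topology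

section
variable {d : ℕ}

/-- convolution -/
noncomputable def cv (w ρ : (Fin d → ℝ) → ℝ) (x : Fin d → ℝ) : ℝ := ∫ y, w y * ρ (x - y)

open scoped Convolution in
lemma cv_conv (w ρ : (Fin d → ℝ) → ℝ) :
    cv w ρ = convolution w ρ (ContinuousLinearMap.lsmul ℝ ℝ) volume := rfl

lemma cv_contDiff {w ρ : (Fin d → ℝ) → ℝ} (hw : LocallyIntegrable w) {n : ℕ∞}
    (hρ : ContDiff ℝ n ρ) (hc : HasCompactSupport ρ) : ContDiff ℝ n (cv w ρ) := by
  rw [cv_conv]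
  exact hc.contDiff_convolution_right _ hw hρ

lemma pd_cv {w ρ : (Fin d → ℝ) → ℝ} (hw : LocallyIntegrable w)
    (hρ : ContDiff ℝ 1 ρ) (hc : HasCompactSupport ρ) (i : Fin d) :
    pd i (cv w ρ) = cv w (pd i ρ) := by
  ext x
  have h := hc.hasFDerivAt_convolution_right (ContinuousLinearMap.lsmul ℝ ℝ) hw hρ x
  rw [← cv_conv] at h
  unfold pd
  have h2 := convolution_precompR_apply (𝕜 := ℝ) (L := ContinuousLinearMap.lsmul ℝ ℝ) (μ := volume) hw (hc.fderiv (𝕜 := ℝ)) (hρ.continuous_fderiv one_ne_zero) x (Pi.single i 1)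
  rw [h.fderiv, h2]
  rfl

lemma cv_bound {w ρ : (Fin d → ℝ) → ℝ} (hw : Integrable w) {C : ℝ}
    (hC : ∀ x, |ρ x| ≤ C) (x : Fin d → ℝ) : |cv w ρ x| ≤ C * ∫ y, |w y| := by
  unfold cv
  rw [← integral_const_mul, ← Real.norm_eq_abs]
  refine norm_integral_le_of_norm_le (hw.abs.const_mul C) (Eventually.of_forall fun y => ?_)
  rw [Real.norm_eq_abs, abs_mul, mul_comm]
  exact mul_le_mul_of_nonneg_right (hC _) (abs_nonneg _)

lemma cv_integrable {w ρ : (Fin d → ℝ) → ℝ} (hw : Integrable w) (hρ : Continuous ρ) {C : ℝ}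
    (hC : ∀ x, |ρ x| ≤ C) (x : Fin d → ℝ) : Integrable (fun y => w y * ρ (x - y)) := by
  refine (integrable_bdd_mul hw (g := fun y => ρ (x - y)) (Continuous.aestronglyMeasurable
    (by fun_prop)) fun y => hC _).congr (Eventually.of_forall fun y => mul_comm _ _)

lemma cv_lip {w ρ : (Fin d → ℝ) → ℝ} (hw : Integrable w) (hρ : Continuous ρ) {C C' : ℝ}
    (hC' : ∀ x, |ρ x| ≤ C')
    (hC : ∀ x y, |ρ x - ρ y| ≤ C * ‖x - y‖) (x z : Fin d → ℝ) :
    |cv w ρ x - cv w ρ z| ≤ (C * ∫ y, |w y|) * ‖x - z‖ := by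
  unfold cv
  rw [← integral_sub (cv_integrable hw hρ hC' x) (cv_integrable hw hρ hC' z), mul_right_comm,
    ← integral_const_mul, ← Real.norm_eq_abs]
  refine norm_integral_le_of_norm_le (hw.abs.const_mul _) (Eventually.of_forall fun y => ?_)
  rw [Real.norm_eq_abs, ← mul_sub, abs_mul, mul_comm]
  refine mul_le_mul_of_nonneg_right ?_ (abs_nonneg _)
  have := hC (x - y) (z - y)
  rwa [sub_sub_sub_cancel_right] at this

lemma cv_tst {w ρ : (Fin d → ℝ) → ℝ} (hw : Integrable w)
    (hρ : ContDiff ℝ 3 ρ) (hc : HasCompactSupport ρ) : ∃ C0 C1, 0 ≤ C1 ∧ Tst (cv w ρ) C0 C1 := by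
  obtain ⟨C0, C1, hC1, h⟩ := tst_of_compact hρ hc
  have hwl := hw.locallyIntegrable
  have hw0 : 0 ≤ ∫ y, |w y| := integral_nonneg fun _ => abs_nonneg _
  have e1 : ∀ i, pd i (cv w ρ) = cv w (pd i ρ) := fun i => pd_cv hwl (hρ.of_le (by norm_num)) hc i
  have e2 : ∀ i j, pd2 i j (cv w ρ) = cv w (pd2 i j ρ) := fun i j => by
    have : pd2 i j (cv w ρ) = pd i (pd j (cv w ρ)) := rfl
    rw [this, e1 j, pd_cv hwl (h.pd_smooth j) (pd_zero_of_compact j hc) i]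
    rfl
  refine ⟨C0 * ∫ y, |w y|, C1 * ∫ y, |w y|, by positivity, ?_, ?_, ?_, ?_, ?_⟩
  · exact (cv_contDiff hwl (n := 2) (hρ.of_le (by norm_num)) hc)
  · exact cv_bound hw h.b0
  · intro i x
    rw [e1]; exact cv_bound hw (h.b1 i) x
  · intro i j x
    rw [e2]; exact cv_bound hw (h.b2 i j) x
  · intro i j x y
    rw [e2]; exact cv_lip hw (h.pd2_cont i j) (h.b2 i j) (h.lip i j) x y

/-- mollifier at scale `δ` -/
structure Mol (ρ : (Fin d → ℝ) → ℝ) (δ : ℝ) : Prop where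
  smooth : ContDiff ℝ (⊤ : ℕ∞) ρ
  comp : HasCompactSupport ρ
  nonneg : ∀ x, 0 ≤ ρ x
  even : ∀ x, ρ (-x) = ρ x
  mass : (∫ x, ρ x) = 1
  supp : ∀ x, δ < ‖x‖ → ρ x = 0

lemma exists_Mol (d : ℕ) {δ : ℝ} (hδ : 0 < δ) : ∃ ρ : (Fin d → ℝ) → ℝ, Mol ρ δ := by
  obtain ⟨ρ, h1, h2, h3, h4, h5, h6⟩ := exists_mollifier d hδ
  exact ⟨ρ, h1, h2, h3, h4, h5, h6⟩

namespace Mol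
variable {ρ : (Fin d → ℝ) → ℝ} {δ : ℝ}

lemma cont (h : Mol ρ δ) : Continuous ρ := h.smooth.continuous
lemma integrable (h : Mol ρ δ) : Integrable ρ := h.cont.integrable_of_hasCompactSupport h.comp
lemma bdd (h : Mol ρ δ) : ∃ C, ∀ x, |ρ x| ≤ C := h.comp.exists_bound_of_continuous h.cont
lemma smooth' (h : Mol ρ δ) (n : ℕ) : ContDiff ℝ n ρ :=
  h.smooth.of_le (by exact_mod_cast le_top)

lemma int_row (h : Mol ρ δ) {w : (Fin d → ℝ) → ℝ} (hw : LocallyIntegrable w) (x : Fin d → ℝ) :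
    Integrable (fun y => w y * ρ (x - y)) := by
  have := h.comp.convolutionExists_right (ContinuousLinearMap.lsmul ℝ ℝ) hw h.cont x
  exact this

/-- Jensen -/
lemma jensen (h : Mol ρ δ) {w : (Fin d → ℝ) → ℝ} (hw : MemLp w 2) (x : Fin d → ℝ) :
    (cv w ρ x) ^ 2 ≤ ∫ y, w y ^ 2 * ρ (x - y) := by
  have hs : Continuous (fun y => Real.sqrt (ρ (x - y))) := by
    have := h.cont
    fun_prop
  have hss : ∀ y, Real.sqrt (ρ (x - y)) ^ 2 = ρ (x - y) := fun y => Real.sq_sqrt (h.nonneg _)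
  have hr : Integrable (fun y => ρ (x - y)) := h.integrable.comp_sub_left x
  have hg : MemLp (fun y => Real.sqrt (ρ (x - y))) 2 := by
    rw [memLp_two_iff_integrable_sq hs.aestronglyMeasurable]
    simpa [hss] using hr
  obtain ⟨C, hC⟩ := h.bdd
  have hi : Integrable (fun y => w y ^ 2 * ρ (x - y)) := cv_integrable hw.integrable_sq h.cont hC x
  have hf : MemLp (fun y => w y * Real.sqrt (ρ (x - y))) 2 := by
    refine (memLp_two_iff_integrable_sq (hw.1.mul hs.aestronglyMeasurable)).2 ?_
    simpa [mul_pow, hss] using hi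
  have := cauchy_schwarz hf hg
  have e : ∫ y, w y * Real.sqrt (ρ (x - y)) * Real.sqrt (ρ (x - y)) = cv w ρ x := by
    refine integral_congr_ae (Eventually.of_forall fun y => ?_)
    simp only
    rw [mul_assoc, ← sq, hss]
  rw [e] at this
  have h2 : |cv w ρ x| ^ 2 ≤ (n2 volume (fun y => w y * Real.sqrt (ρ (x - y)))
    * n2 volume (fun y => Real.sqrt (ρ (x - y)))) ^ 2 := by gcongr
  rw [sq_abs, mul_pow, n2_sq, n2_sq] at h2
  simp only [mul_pow, hss] at h2
  rwa [integral_sub_left_eq_self ρ volume x, h.mass, mul_one] at h2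

lemma cv_memLp (h : Mol ρ δ) {w : (Fin d → ℝ) → ℝ} (hw : MemLp w 2) :
    MemLp (cv w ρ) 2 ∧ ∫ x, cv w ρ x ^ 2 ≤ ∫ x, w x ^ 2 := by
  have hwl : LocallyIntegrable w := hw.locallyIntegrable (by norm_num)
  have hc : Continuous (cv w ρ) := (cv_contDiff (n := 1) hwl (h.smooth' 1) h.comp).continuous
  have hi := (hw.integrable_sq).convolution_integrand (ContinuousLinearMap.lsmul ℝ ℝ) h.integrable
  have hi2 : Integrable (fun x => ∫ y, w y ^ 2 * ρ (x - y)) := hi.integral_prod_left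
  have he : ∫ x, ∫ y, w y ^ 2 * ρ (x - y) = ∫ x, w x ^ 2 := by
    have := integral_convolution (μ := volume) (ν := volume) (ContinuousLinearMap.lsmul ℝ ℝ) (hw.integrable_sq) h.integrable
    rw [h.mass] at this
    simpa [convolution] using this
  have hi3 : Integrable (fun x => cv w ρ x ^ 2) :=
    hi2.mono' (hc.pow 2).aestronglyMeasurable (Eventually.of_forall fun x => by
      rw [Real.norm_eq_abs, abs_of_nonneg (sq_nonneg _)]; exact h.jensen hw x)
  refine ⟨(memLp_two_iff_integrable_sq hc.aestronglyMeasurable).2 hi3, ?_⟩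
  rw [← he]
  exact integral_mono hi3 hi2 fun x => h.jensen hw x

end Mol

/-- translation continuity in L2 -/
lemma transl_cont {g : (Fin d → ℝ) → ℝ} (hg : MemLp g 2) {η : ℝ} (hη : 0 < η) :
    ∃ δ > 0, ∀ y, ‖y‖ ≤ δ → ∫ x, (g (x + y) - g x) ^ 2 ≤ η ^ 2 := by
  haveI : Fact ((2 : ENNReal) ≠ ⊤) := ⟨by norm_num⟩
  have hc : Continuous fun y : Fin d → ℝ => DomAddAct.mk y +ᵥ hg.toLp g := by
    fun_prop
  have h0 := (Metric.continuous_iff.1 hc) 0 η hη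
  obtain ⟨δ, hδ, h⟩ := h0
  refine ⟨δ / 2, by positivity, fun y hy => ?_⟩
  have h1 := h y (by rw [dist_zero_right]; linarith)
  have e0 : DomAddAct.mk (0 : Fin d → ℝ) +ᵥ hg.toLp g = hg.toLp g := by
    rw [DomAddAct.mk_zero, zero_vadd]
  rw [e0, DomAddAct.mk_vadd_toLp, Lp.dist_def] at h1
  have h2 : MemLp (fun x => g (x + y) - g x) 2 := (memLp_transl hg y).sub hg
  have e1 : eLpNorm (fun x => g (x + y) - g x) 2 volume ≤ ENNReal.ofReal η := by
    have e2 : eLpNorm (fun x => g (x + y) - g x) 2 volume =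
        eLpNorm (fun x => (MemLp.toLp _ (hg.comp_measurePreserving (measurePreserving_vadd y volume)) : Lp ℝ 2 volume) x - hg.toLp g x) 2 volume := by
      refine eLpNorm_congr_ae ?_
      filter_upwards [MemLp.coeFn_toLp hg, MemLp.coeFn_toLp (hg.comp_measurePreserving
        (measurePreserving_vadd y volume))] with x hx1 hx2
      rw [hx1, hx2]
      simp [add_comm]
    rw [e2]
    have h3 := (ENNReal.lt_ofReal_iff_toReal_lt ?_).2 h1
    · exact h3.le
    · exact ((Lp.memLp _).sub (Lp.memLp _)).2.ne
  exact (integral_sq_le_of_eLpNorm h2.1 hη.le e1).2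

lemma cv_comm (w ρ : (Fin d → ℝ) → ℝ) (x : Fin d → ℝ) : cv w ρ x = ∫ z, ρ z * w (x - z) := by
  unfold cv
  rw [← integral_sub_left_eq_self (fun z => ρ z * w (x - z)) volume x]
  simp [mul_comm]

/-- convergence of mollifications in L2 -/
lemma cv_approx {g : (Fin d → ℝ) → ℝ} (hg : MemLp g 2) {η : ℝ} (hη : 0 < η) :
    ∃ δ₀ > 0, ∀ δ ρ, δ ≤ δ₀ → Mol ρ δ → ∫ x, (cv g ρ x - g x) ^ 2 ≤ η ^ 2 := by
  obtain ⟨δ₀, hδ₀, h⟩ := transl_cont hg hη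
  refine ⟨δ₀, hδ₀, fun δ ρ hδ hρ => ?_⟩
  obtain ⟨m1, m2⟩ := hρ.cv_memLp hg
  have i1 := m1.integrable_sq
  have i2 := hg.integrable_sq
  have i3 : Integrable (fun x => g x * cv g ρ x) := hg.integrable_mul m1
  have e1 : ∫ x, (cv g ρ x - g x) ^ 2 =
      (∫ x, cv g ρ x ^ 2) - 2 * (∫ x, g x * cv g ρ x) + ∫ x, g x ^ 2 := by
    have : ∀ x, (cv g ρ x - g x) ^ 2 = cv g ρ x ^ 2 - 2 * (g x * cv g ρ x) + g x ^ 2 :=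
      fun x => by ring
    simp_rw [this]
    have i4 : Integrable (fun x => cv g ρ x ^ 2 - 2 * (g x * cv g ρ x)) := i1.sub (i3.const_mul 2)
    rw [integral_add i4 i2, integral_sub i1 (i3.const_mul 2), integral_const_mul]
  have key : (∫ x, g x ^ 2) - η ^ 2 / 2 ≤ ∫ x, g x * cv g ρ x := by
    have hsq : Integrable (fun p : (Fin d → ℝ) × (Fin d → ℝ) => ρ p.1 * g p.2 ^ 2)
        (volume.prod volume) := hρ.integrable.mul_prod i2
    have hsq' : Integrable (fun p : (Fin d → ℝ) × (Fin d → ℝ) => ρ p.1 * g (p.2 - p.1) ^ 2)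
        (volume.prod volume) := by
      have := shear_integrable (-1) hsq
      simpa [sub_eq_add_neg] using this
    have am : AEStronglyMeasurable (fun p : (Fin d → ℝ) × (Fin d → ℝ) => g (p.2 - p.1))
        (volume.prod volume) := by
      have := shear_aesm (-1) (ν := volume) hg.1
      simpa [sub_eq_add_neg] using this
    have hH : Integrable (fun p : (Fin d → ℝ) × (Fin d → ℝ) => ρ p.1 * (g p.2 * g (p.2 - p.1)))
        (volume.prod volume) := by
      refine (hsq.add hsq').mono' (hρ.cont.aestronglyMeasurable.comp_fst.mul
        (hg.1.comp_snd.mul am)) (Eventually.of_forall fun p => ?_)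
      simp only [Pi.add_apply]
      rw [Real.norm_eq_abs, abs_mul, abs_of_nonneg (hρ.nonneg _), abs_mul, ← mul_add]
      refine mul_le_mul_of_nonneg_left ?_ (hρ.nonneg _)
      rw [← sq_abs (g p.2), ← sq_abs (g (p.2 - p.1))]
      nlinarith [sq_nonneg (|g p.2| - |g (p.2 - p.1)|), sq_nonneg (|g p.2|), sq_nonneg (|g (p.2 - p.1)|)]
    have e2 : ∫ x, g x * cv g ρ x = ∫ z, ∫ x, ρ z * (g x * g (x - z)) := by
      rw [← integral_prod _ hH, integral_prod_symm _ hH]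
      refine integral_congr_ae (Eventually.of_forall fun x => ?_)
      simp only
      rw [cv_comm, ← integral_const_mul]
      refine integral_congr_ae (Eventually.of_forall fun z => ?_)
      simp only
      ring
    rw [e2]
    have e3 : (∫ x, g x ^ 2) - η ^ 2 / 2 = ∫ z, ρ z * ((∫ x, g x ^ 2) - η ^ 2 / 2) := by
      rw [integral_mul_const, hρ.mass, one_mul]
    rw [e3]
    refine integral_mono (hρ.integrable.mul_const _) hH.integral_prod_left fun z => ?_
    simp only
    rw [integral_const_mul]
    by_cases hz : ‖z‖ ≤ δ₀
    · refine mul_le_mul_of_nonneg_left ?_ (hρ.nonneg _)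
      have hz' := h (-z) (by rwa [norm_neg])
      have mt := memLp_transl hg (-z)
      have j1 : Integrable (fun x => g (x + -z) ^ 2) := mt.integrable_sq
      have j2 : Integrable (fun x => g x * g (x + -z)) := hg.integrable_mul mt
      have e4 : ∫ x, (g (x + -z) - g x) ^ 2 =
          (∫ x, g (x + -z) ^ 2) - 2 * (∫ x, g x * g (x + -z)) + ∫ x, g x ^ 2 := by
        have : ∀ x, (g (x + -z) - g x) ^ 2 = g (x + -z) ^ 2 - 2 * (g x * g (x + -z)) + g x ^ 2 :=
          fun x => by ring
        simp_rw [this]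
        have i4 : Integrable (fun x => g (x + -z) ^ 2 - 2 * (g x * g (x + -z))) :=
          j1.sub (j2.const_mul 2)
        rw [integral_add i4 i2, integral_sub j1 (j2.const_mul 2), integral_const_mul]
      have e5 : ∫ x, g (x + -z) ^ 2 = ∫ x, g x ^ 2 :=
        integral_add_right_eq_self (μ := (volume : Measure (Fin d → ℝ))) (fun x => g x ^ 2) (-z)
      simp only [sub_eq_add_neg] at *
      linarith
    · rw [hρ.supp z (lt_of_le_of_lt hδ (not_le.1 hz))]
      simp
  linarith

lemma cv_pair {W g σ : (Fin d → ℝ) → ℝ} (hW : MemLp W 2) (hg : MemLp g 2) (hσ : Continuous σ)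
    (hc : HasCompactSupport σ) {s : ℝ} (hs : ∀ x, σ (-x) = s * σ x) :
    ∫ x, W x * cv g σ x = s * ∫ y, g y * cv W σ y := by
  have hσi : Integrable (fun x => |σ x|) := (hσ.integrable_of_hasCompactSupport hc).abs
  have h1 : Integrable (fun p : (Fin d → ℝ) × (Fin d → ℝ) => g p.2 ^ 2 * |σ (p.1 - p.2)|)
      (volume.prod volume) :=
    (hg.integrable_sq).convolution_integrand (ContinuousLinearMap.lsmul ℝ ℝ) hσi
  have hσi' : Integrable (fun x => |σ (-x)|) := hσi.comp_neg
  have h2 : Integrable (fun p : (Fin d → ℝ) × (Fin d → ℝ) => W p.1 ^ 2 * |σ (p.1 - p.2)|)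
      (volume.prod volume) := by
    have := ((hW.integrable_sq).convolution_integrand (ContinuousLinearMap.lsmul ℝ ℝ) hσi').swap
    refine this.congr (Eventually.of_forall fun p => ?_)
    simp
  have hF : Integrable (fun p : (Fin d → ℝ) × (Fin d → ℝ) => W p.1 * (g p.2 * σ (p.1 - p.2)))
      (volume.prod volume) := by
    have ms : Continuous fun p : (Fin d → ℝ) × (Fin d → ℝ) => σ (p.1 - p.2) := by fun_prop
    refine (h1.add h2).mono' (hW.1.comp_fst.mul (hg.1.comp_snd.mul ms.aestronglyMeasurable))
      (Eventually.of_forall fun p => ?_)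
    simp only [Pi.add_apply]
    rw [Real.norm_eq_abs, abs_mul, abs_mul, ← add_mul, ← mul_assoc]
    refine mul_le_mul_of_nonneg_right ?_ (abs_nonneg _)
    rw [← sq_abs (g p.2), ← sq_abs (W p.1)]
    nlinarith [sq_nonneg (|g p.2| - |W p.1|), sq_nonneg (|g p.2|), sq_nonneg (|W p.1|)]
  have e1 : ∫ x, W x * cv g σ x = ∫ x, ∫ y, W x * (g y * σ (x - y)) := by
    refine integral_congr_ae (Eventually.of_forall fun x => ?_)
    simp only [cv]
    rw [integral_const_mul]
  rw [e1, ← integral_prod _ hF, integral_prod_symm _ hF, ← integral_const_mul]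
  refine integral_congr_ae (Eventually.of_forall fun y => ?_)
  simp only [cv]
  rw [← mul_assoc, ← integral_const_mul]
  refine integral_congr_ae (Eventually.of_forall fun x => ?_)
  simp only
  have := hs (y - x)
  rw [neg_sub] at this
  rw [this]
  ring

lemma hilbert_weak {H : Type*} [NormedAddCommGroup H] [InnerProductSpace ℝ H] [CompleteSpace H]
    {ι : Type*} (l : Ultrafilter ι) (D : ι → H) {K : ℝ} (hD : ∀ k, ‖D k‖ ≤ K) :
    ∃ g : H, ∀ φ, Tendsto (fun k => inner ℝ (D k) φ) l (𝓝 (inner ℝ g φ)) := by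
  have hb : ∀ φ k, |inner ℝ (D k) φ| ≤ K * ‖φ‖ := fun φ k =>
    (abs_real_inner_le_norm _ _).trans (mul_le_mul_of_nonneg_right (hD k) (norm_nonneg _))
  have hex : ∀ φ, ∃ c : ℝ, Tendsto (fun k => inner ℝ (D k) φ) l (𝓝 c) := by
    intro φ
    have hc : IsCompact (Icc (-(K * ‖φ‖)) (K * ‖φ‖)) := isCompact_Icc
    obtain ⟨c, -, h⟩ := hc.ultrafilter_le_nhds (l.map (fun k => inner ℝ (D k) φ)) (by
      rw [le_principal_iff]
      refine Filter.mem_map.2 (Filter.mem_of_superset Filter.univ_mem fun k _ => ?_)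
      exact abs_le.1 (hb φ k))
    exact ⟨c, h⟩
  choose c hc using hex
  let ℓ : H →ₗ[ℝ] ℝ :=
    { toFun := c
      map_add' := fun φ ψ => by
        refine tendsto_nhds_unique (hc (φ + ψ)) ?_
        simp_rw [inner_add_right]
        exact (hc φ).add (hc ψ)
      map_smul' := fun a φ => by
        refine tendsto_nhds_unique (hc (a • φ)) ?_
        simp_rw [real_inner_smul_right]
        exact (hc φ).const_mul a }
  let L := ℓ.mkContinuous K (fun φ => by
    have h1 : Tendsto (fun k => ‖inner ℝ (D k) φ‖) l (𝓝 ‖c φ‖) := (hc φ).norm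
    show ‖c φ‖ ≤ _
    exact le_of_tendsto h1 (Eventually.of_forall fun k => hb φ k))
  refine ⟨(InnerProductSpace.toDual ℝ H).symm L, fun φ => ?_⟩
  rw [InnerProductSpace.toDual_symm_apply]
  exact hc φ

lemma weak_L2 {ι α : Type*} [MeasurableSpace α] {μ : Measure α} (l : Ultrafilter ι)
    (D : ι → α → ℝ) {K : ℝ} (hD : ∀ k, MemLp (D k) 2 μ) (hK : ∀ k, n2 μ (D k) ≤ K) :
    ∃ g, MemLp g 2 μ ∧ ∀ φ, MemLp φ 2 μ →
      Tendsto (fun k => ∫ x, D k x * φ x ∂μ) l (𝓝 (∫ x, g x * φ x ∂μ)) := by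
  obtain ⟨g, hg⟩ := hilbert_weak (K := K) l (fun k => (hD k).toLp (D k)) (fun k => by
    rw [Lp.norm_toLp, ← n2_eq (hD k)]
    exact hK k)
  refine ⟨g, Lp.memLp g, fun φ hφ => ?_⟩
  have h := hg (hφ.toLp φ)
  have e : ∀ f : α → ℝ, ∀ hf : MemLp f 2 μ, inner ℝ (hf.toLp f) (hφ.toLp φ) = ∫ x, f x * φ x ∂μ := by
    intro f hf
    rw [L2.inner_def]
    refine integral_congr_ae ?_
    filter_upwards [hf.coeFn_toLp, hφ.coeFn_toLp] with x h1 h2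
    rw [h1, h2]
    simp [mul_comm]
  simp_rw [e] at h
  rw [← e _ (Lp.memLp g), Lp.toLp_coeFn]
  exact h

end
end FPE

namespace FPE
open Set Topology

section
variable {d : ℕ}

/-- weak partial derivative -/
def IsWD (i : Fin d) (W w : (Fin d → ℝ) → ℝ) : Prop :=
  ∀ ψ : (Fin d → ℝ) → ℝ, ContDiff ℝ 1 ψ → HasCompactSupport ψ →
    ∫ x, W x * pd i ψ x = -∫ x, w x * ψ x

lemma memLp_of_compact {ψ : (Fin d → ℝ) → ℝ} (h : Continuous ψ) (hc : HasCompactSupport ψ) :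
    MemLp ψ 2 := h.memLp_of_hasCompactSupport hc

lemma n2_neg_shift (W : (Fin d → ℝ) → ℝ) (ψ : (Fin d → ℝ) → ℝ) (y : Fin d → ℝ) :
    ∫ x, W (x + y) * ψ x = ∫ x, W x * ψ (x - y) := by
  rw [← integral_add_right_eq_self (μ := volume) (fun x => W x * ψ (x - y)) y]
  simp

lemma mul_int {f g : (Fin d → ℝ) → ℝ} (hf : MemLp f 2) (hg : MemLp g 2) :
    Integrable (fun x => f x * g x) := MemLp.integrable_mul hf hg

lemma slope_tendsto {ψ : (Fin d → ℝ) → ℝ} (hψ : ContDiff ℝ 1 ψ) (i : Fin d) (x : Fin d → ℝ)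
    {t : ℕ → ℝ} (ht : Tendsto t atTop (𝓝 0)) (ht0 : ∀ k, t k ≠ 0) :
    Tendsto (fun k => (ψ (x - t k • Pi.single i (1:ℝ)) - ψ x) / t k) atTop (𝓝 (-pd i ψ x)) := by
  have h := line_deriv (hψ.differentiable one_ne_zero) x (-Pi.single i (1:ℝ)) 0
  rw [hasDerivAt_iff_tendsto_slope] at h
  have h2 := h.comp (tendsto_nhdsWithin_iff.2 ⟨ht, Eventually.of_forall fun k => ht0 k⟩)
  have e : (∑ j, (-Pi.single i (1:ℝ) : Fin d → ℝ) j * pd j ψ (x + (0:ℝ) • (-Pi.single i (1:ℝ)))) =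
      - pd i ψ x := by
    rw [Finset.sum_eq_single i]
    · simp
    · intro j _ hj
      simp [hj]
    · simp
  rw [e] at h2
  refine h2.congr fun k => ?_
  simp only [Function.comp, slope_def_field]
  simp [sub_eq_add_neg]

lemma slope_bound {ψ : (Fin d → ℝ) → ℝ} (hψ : ContDiff ℝ 1 ψ) (hc : HasCompactSupport ψ) :
    ∃ C r : ℝ, 0 ≤ C ∧ ∀ x y : Fin d → ℝ, ‖y‖ ≤ 1 →
      |ψ (x - y) - ψ x| ≤ (Metric.closedBall (0 : Fin d → ℝ) r).indicator (fun _ => C) x * ‖y‖ := by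
  obtain ⟨K, hK⟩ := ContDiff.lipschitzWith_of_hasCompactSupport hc hψ one_ne_zero
  obtain ⟨r, hr⟩ := hc.isCompact.isBounded.subset_closedBall (0 : Fin d → ℝ)
  have hz : ∀ x, r < ‖x‖ → ψ x = 0 := fun x hx => by
    by_contra h
    have := hr (subset_tsupport _ h)
    simp at this
    linarith
  refine ⟨K, r + 1, K.2, fun x y hy => ?_⟩
  by_cases hx : x ∈ Metric.closedBall (0 : Fin d → ℝ) (r + 1)
  · rw [indicator_of_mem hx]
    have := hK.dist_le_mul (x - y) x
    rw [Real.dist_eq, dist_eq_norm] at this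
    simpa using this
  · rw [indicator_of_notMem hx]
    have hx' : r + 1 < ‖x‖ := by simpa using hx
    have h2 : ‖x‖ - ‖y‖ ≤ ‖x - y‖ := norm_sub_norm_le x y
    rw [hz x (by linarith), hz (x - y) (by linarith)]
    simp

lemma wd_of_weak {i : Fin d} {W w : (Fin d → ℝ) → ℝ} (hW : MemLp W 2) {l : Filter ℕ} [NeBot l]
    (hl : l ≤ atTop) {t : ℕ → ℝ} (ht : Tendsto t atTop (𝓝 0)) (ht0 : ∀ k, t k ≠ 0)
    (h : ∀ ψ : (Fin d → ℝ) → ℝ, ContDiff ℝ 1 ψ → HasCompactSupport ψ →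
      Tendsto (fun k => ∫ x, (W (x + t k • Pi.single i (1:ℝ)) - W x) / t k * ψ x) l
        (𝓝 (∫ x, w x * ψ x))) : IsWD i W w := by
  intro ψ hψ hc
  have hψ2 := memLp_of_compact hψ.continuous hc
  have e : ∀ k, ∫ x, (W (x + t k • Pi.single i (1:ℝ)) - W x) / t k * ψ x =
      ∫ x, W x * ((ψ (x - t k • Pi.single i (1:ℝ)) - ψ x) / t k) := by
    intro k
    have hψ3 : MemLp (fun x => ψ (x - t k • Pi.single i (1:ℝ))) 2 := by
      have := memLp_transl hψ2 (-(t k • Pi.single i (1:ℝ)))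
      simpa [sub_eq_add_neg] using this
    have i1 := mul_int (memLp_transl hW (t k • Pi.single i (1:ℝ))) hψ2
    have i2 := mul_int hW hψ2
    have i3 := mul_int hW hψ3
    calc _ = ∫ x, (W (x + t k • Pi.single i (1:ℝ)) * ψ x - W x * ψ x) / t k := by
          congr 1; ext x; ring
      _ = ∫ x, (W x * ψ (x - t k • Pi.single i (1:ℝ)) - W x * ψ x) / t k := by
          rw [integral_div, integral_div, integral_sub i1 i2, integral_sub i3 i2, n2_neg_shift]
      _ = _ := by congr 1; ext x; ring
  obtain ⟨C, r, hC0, hC⟩ := slope_bound hψ hc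
  have lim : Tendsto (fun k => ∫ x, W x * ((ψ (x - t k • Pi.single i (1:ℝ)) - ψ x) / t k)) atTop
      (𝓝 (∫ x, W x * (-pd i ψ x))) := by
    have hind : MemLp ((Metric.closedBall (0 : Fin d → ℝ) r).indicator (fun _ => C)) 2 := by
      refine memLp_indicator_const 2 Metric.isClosed_closedBall.measurableSet C (Or.inr ?_)
      exact (isCompact_closedBall _ _).measure_ne_top
    refine tendsto_integral_filter_of_dominated_convergence
      (fun x => |W x * (Metric.closedBall (0 : Fin d → ℝ) r).indicator (fun _ => C) x|) ?_ ?_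
      (mul_int hW hind).abs ?_
    · refine Eventually.of_forall fun k => hW.1.mul ?_
      refine Continuous.aestronglyMeasurable ?_
      have := hψ.continuous
      fun_prop
    · have hs : ∀ᶠ k in atTop, |t k| ≤ 1 := by
        have := ht.eventually (Metric.closedBall_mem_nhds (0:ℝ) one_pos)
        filter_upwards [this] with k hk
        simpa using hk
      filter_upwards [hs] with k hk
      refine Eventually.of_forall fun x => ?_
      have hn : ‖t k • (Pi.single i (1:ℝ) : Fin d → ℝ)‖ = |t k| := by
        rw [norm_smul]; simp [Pi.norm_single]
      have := hC x (t k • Pi.single i (1:ℝ)) (by rw [hn]; exact hk)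
      rw [hn] at this
      rw [Real.norm_eq_abs, abs_mul, abs_mul, abs_div]
      refine mul_le_mul_of_nonneg_left ?_ (abs_nonneg _)
      rw [div_le_iff₀ (abs_pos.2 (ht0 k))]
      exact this.trans (mul_le_mul_of_nonneg_right (le_abs_self _) (abs_nonneg _))
    · refine Eventually.of_forall fun x => ?_
      exact (slope_tendsto hψ i x ht ht0).const_mul _
  have h2 := h ψ hψ hc
  simp_rw [e] at h2
  have := tendsto_nhds_unique h2 (lim.mono_left hl)
  rw [this]
  simp [integral_neg]

end
end FPE

namespace FPE
open Set Topology

section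
variable {d : ℕ}

structure WS (i : Fin d) (u g : (Fin d → ℝ) → ℝ) (t : ℕ → ℝ) (l : Filter ℕ) : Prop where
  lim : Tendsto t atTop (𝓝 0)
  ne : ∀ k, t k ≠ 0
  ae : ∀ᵐ x, Tendsto (fun k => u (x + t k • Pi.single i (1:ℝ))) atTop (𝓝 (u x))
  bd : ∃ K, ∀ k, n2 volume (fun x => (u (x + t k • Pi.single i (1:ℝ)) - u x) / t k) ≤ K
  wk : ∀ φ, MemLp φ 2 → Tendsto
    (fun k => ∫ x, (u (x + t k • Pi.single i (1:ℝ)) - u x) / t k * φ x) l (𝓝 (∫ x, g x * φ x))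

lemma memLp_quot {u : (Fin d → ℝ) → ℝ} (hu : MemLp u 2) (y : Fin d → ℝ) (s : ℝ) :
    MemLp (fun x => (u (x + y) - u x) / s) 2 := by
  have := ((memLp_transl hu y).sub hu).const_mul (s⁻¹)
  refine (memLp_congr_ae (Eventually.of_forall fun x => ?_)).1 this
  simp only [Pi.sub_apply]
  rw [div_eq_inv_mul]

lemma exists_WS {u : (Fin d → ℝ) → ℝ} (hu : MemLp u 2) {K : ℝ}
    (hK : ∀ y, n2 volume (fun x => u (x + y) - u x) ≤ K * ‖y‖) (i : Fin d) :
    ∃ g t, MemLp g 2 ∧ WS i u g t (hyperfilter ℕ) := by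
  set e : Fin d → ℝ := Pi.single i (1:ℝ) with he
  have hn : ‖e‖ = 1 := by simp [he, Pi.norm_single]
  set t₀ : ℕ → ℝ := fun k => 1 / ((k:ℝ) + 1) with ht₀
  have t₀pos : ∀ k, 0 < t₀ k := fun k => by simp only [ht₀]; positivity
  have t₀lim : Tendsto t₀ atTop (𝓝 0) := tendsto_one_div_add_atTop_nhds_zero_nat
  have hm : TendstoInMeasure volume (fun k x => u (x + t₀ k • e)) atTop u := by
    refine tendstoInMeasure_of_tendsto_eLpNorm (p := 2) two_ne_zero
      (fun k => (memLp_transl hu _).1) hu.1 ?_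
    have hh : ∀ k, eLpNorm ((fun x => u (x + t₀ k • e)) - u) 2 volume ≤ ENNReal.ofReal (K * t₀ k) := by
      intro k
      have h1 : MemLp (fun x => u (x + t₀ k • e) - u x) 2 := (memLp_transl hu _).sub hu
      have h2 := eLpNorm_two h1
      show eLpNorm (fun x => u (x + t₀ k • e) - u x) 2 volume ≤ _
      rw [h2]
      refine ENNReal.ofReal_le_ofReal ((hK _).trans (le_of_eq ?_))
      rw [norm_smul, hn, Real.norm_of_nonneg (t₀pos k).le, mul_one]
    refine tendsto_of_tendsto_of_tendsto_of_le_of_le tendsto_const_nhds ?_ (fun _ => bot_le) hh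
    have := ENNReal.tendsto_ofReal (t₀lim.const_mul K)
    simpa using this
  obtain ⟨s, hs, hae⟩ := hm.exists_seq_tendsto_ae
  set t : ℕ → ℝ := fun k => t₀ (s k) with htd
  have tpos : ∀ k, 0 < t k := fun k => t₀pos _
  have bd : ∀ k, n2 volume (fun x => (u (x + t k • e) - u x) / t k) ≤ K := by
    intro k
    have h1 := hK (t k • e)
    rw [norm_smul, hn, Real.norm_of_nonneg (tpos k).le, mul_one] at h1
    have : n2 volume (fun x => (u (x + t k • e) - u x) / t k) =
        n2 volume (fun x => u (x + t k • e) - u x) / t k := by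
      unfold n2
      simp_rw [div_pow]
      rw [integral_div, Real.sqrt_div' _ (sq_nonneg _), Real.sqrt_sq (tpos k).le]
    rw [this, div_le_iff₀ (tpos k)]
    exact h1
  obtain ⟨g, hg, hw⟩ := weak_L2 (hyperfilter ℕ) (fun k x => (u (x + t k • e) - u x) / t k)
    (fun k => memLp_quot hu _ _) bd
  exact ⟨g, t, hg, t₀lim.comp hs.tendsto_atTop, fun k => (tpos k).ne', hae, ⟨K, bd⟩, hw⟩

noncomputable def Qbar (M : (Fin d → ℝ) → ℝ → ℝ) (x : Fin d → ℝ) (s s' : ℝ) : ℝ :=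
  ∫ θ in (0:ℝ)..1, M x (s + θ * (s' - s))

noncomputable def Pbar (P : (Fin d → ℝ) → ℝ → ℝ) (e x : Fin d → ℝ) (s t : ℝ) : ℝ :=
  ∫ θ in (0:ℝ)..1, P (x + (θ * t) • e) s

variable {F M P : (Fin d → ℝ) → ℝ → ℝ}

lemma Qbar_cont (cM : Continuous fun p : (Fin d → ℝ) × ℝ => M p.1 p.2) :
    Continuous fun p : (Fin d → ℝ) × ℝ × ℝ => Qbar M p.1 p.2.1 p.2.2 := by
  unfold Qbar
  refine intervalIntegral.continuous_parametric_intervalIntegral_of_continuous' (μ := volume)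
    (f := fun (p : (Fin d → ℝ) × ℝ × ℝ) θ => M p.1 (p.2.1 + θ * (p.2.2 - p.2.1))) ?_ 0 1
  exact cM.comp (f := fun q : ((Fin d → ℝ) × ℝ × ℝ) × ℝ =>
    (q.1.1, q.1.2.1 + q.2 * (q.1.2.2 - q.1.2.1))) (by fun_prop)

lemma Pbar_cont (cP : Continuous fun p : (Fin d → ℝ) × ℝ => P p.1 p.2) (e : Fin d → ℝ) :
    Continuous fun p : (Fin d → ℝ) × ℝ × ℝ => Pbar P e p.1 p.2.1 p.2.2 := by
  unfold Pbar
  refine intervalIntegral.continuous_parametric_intervalIntegral_of_continuous' (μ := volume)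
    (f := fun (p : (Fin d → ℝ) × ℝ × ℝ) θ => P (p.1 + (θ * p.2.2) • e) p.2.1) ?_ 0 1
  exact cP.comp (f := fun q : ((Fin d → ℝ) × ℝ × ℝ) × ℝ =>
    (q.1.1 + (q.2 * q.1.2.2) • e, q.1.2.1)) (by fun_prop)

lemma Qbar_eq (cM : Continuous fun p : (Fin d → ℝ) × ℝ => M p.1 p.2)
    (hM : ∀ x s, HasDerivAt (F x) (M x s) s) (x : Fin d → ℝ) (s s' : ℝ) :
    F x s' - F x s = Qbar M x s s' * (s' - s) := by
  have hd : ∀ θ ∈ uIcc (0:ℝ) 1, HasDerivAt (fun θ => F x (s + θ * (s' - s)))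
      (M x (s + θ * (s' - s)) * (s' - s)) θ := by
    intro θ _
    have h1 : HasDerivAt (fun θ : ℝ => s + θ * (s' - s)) (s' - s) θ := by
      simpa using ((hasDerivAt_id θ).mul_const (s' - s)).const_add s
    exact (hM x _).comp θ h1
  have hc : Continuous fun θ : ℝ => M x (s + θ * (s' - s)) * (s' - s) := by
    refine Continuous.mul ?_ continuous_const
    exact cM.comp (f := fun θ : ℝ => (x, s + θ * (s' - s))) (by fun_prop)
  have := intervalIntegral.integral_eq_sub_of_hasDerivAt hd (hc.intervalIntegrable _ _)
  rw [intervalIntegral.integral_mul_const] at this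
  unfold Qbar
  rw [this]
  simp

lemma Pbar_eq (cP : Continuous fun p : (Fin d → ℝ) × ℝ => P p.1 p.2) {e : Fin d → ℝ}
    (hP : ∀ x s t, HasDerivAt (fun t : ℝ => F (x + t • e) s) (P (x + t • e) s) t)
    (x : Fin d → ℝ) (s t : ℝ) :
    F (x + t • e) s - F x s = Pbar P e x s t * t := by
  have hd : ∀ θ ∈ uIcc (0:ℝ) 1, HasDerivAt (fun θ => F (x + (θ * t) • e) s)
      (P (x + (θ * t) • e) s * t) θ := by
    intro θ _
    have h1 : HasDerivAt (fun θ : ℝ => θ * t) t θ := by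
      simpa using ((hasDerivAt_id θ).mul_const t)
    exact HasDerivAt.comp (h₂ := fun t : ℝ => F (x + t • e) s) θ (hP x s (θ * t)) h1
  have hc : Continuous fun θ : ℝ => P (x + (θ * t) • e) s * t := by
    refine Continuous.mul ?_ continuous_const
    exact cP.comp (f := fun θ : ℝ => (x + (θ * t) • e, s)) (by fun_prop)
  have := intervalIntegral.integral_eq_sub_of_hasDerivAt hd (hc.intervalIntegrable _ _)
  rw [intervalIntegral.integral_mul_const] at this
  unfold Pbar
  rw [this]
  simp

lemma Qbar_bd {L : ℝ} (hL : ∀ x s, |M x s| ≤ L) (x : Fin d → ℝ) (s s' : ℝ) :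
    |Qbar M x s s'| ≤ L := by
  have := intervalIntegral.norm_integral_le_of_norm_le_const (a := (0:ℝ)) (b := 1) (C := L)
    (f := fun θ => M x (s + θ * (s' - s))) (fun θ _ => hL _ _)
  simpa [Qbar] using this

lemma Pbar_bd {C : ℝ} (hC : ∀ x s, |P x s| ≤ C * |s|) (e x : Fin d → ℝ) (s t : ℝ) :
    |Pbar P e x s t| ≤ C * |s| := by
  have := intervalIntegral.norm_integral_le_of_norm_le_const (a := (0:ℝ)) (b := 1) (C := C * |s|)
    (f := fun θ => P (x + (θ * t) • e) s) (fun θ _ => hC _ _)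
  simpa [Pbar] using this

lemma memLp_of_le {f g : (Fin d → ℝ) → ℝ} (hg : MemLp g 2) (hf : AEStronglyMeasurable f volume)
    {C : ℝ} (h : ∀ x, |f x| ≤ C * |g x|) : MemLp f 2 :=
  MemLp.of_le_mul hg hf (Eventually.of_forall h)

lemma chain_wd {i : Fin d} {u g : (Fin d → ℝ) → ℝ} {t : ℕ → ℝ} {l : Filter ℕ} [NeBot l]
    (hl : l ≤ atTop) (hu : MemLp u 2) (hg : MemLp g 2) (ws : WS i u g t l)
    (cF : Continuous fun p : (Fin d → ℝ) × ℝ => F p.1 p.2)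
    (cM : Continuous fun p : (Fin d → ℝ) × ℝ => M p.1 p.2)
    (cP : Continuous fun p : (Fin d → ℝ) × ℝ => P p.1 p.2)
    (hM : ∀ x s, HasDerivAt (F x) (M x s) s)
    (hP : ∀ x s t, HasDerivAt (fun t : ℝ => F (x + t • Pi.single i (1:ℝ)) s)
      (P (x + t • Pi.single i (1:ℝ)) s) t)
    {L L' C : ℝ} (hL : ∀ x s, |M x s| ≤ L) (hL' : ∀ x s, |F x s| ≤ L' * |s|)
    (hC : ∀ x s, |P x s| ≤ C * |s|) :
    IsWD i (fun x => F x (u x)) (fun x => M x (u x) * g x + P x (u x)) := by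
  have hW : MemLp (fun x => F x (u x)) 2 := memLp_of_le hu (comp_aesm F cF hu.1) (fun x => hL' _ _)
  refine wd_of_weak hW hl ws.lim ws.ne ?_
  intro ψ hψ hc
  have hψ2 := memLp_of_compact hψ.continuous hc
  set e : Fin d → ℝ := Pi.single i (1:ℝ) with he
  set D : ℕ → (Fin d → ℝ) → ℝ := fun k x => (u (x + t k • e) - u x) / t k with hD
  set Q : ℕ → (Fin d → ℝ) → ℝ := fun k x => Qbar M (x + t k • e) (u x) (u (x + t k • e)) with hQ
  set E : ℕ → (Fin d → ℝ) → ℝ := fun k x => Pbar P e x (u x) (t k) with hE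
  have D2 : ∀ k, MemLp (D k) 2 := fun k => memLp_quot hu _ _
  have Qm : ∀ k, AEStronglyMeasurable (Q k) volume := by
    intro k
    have h1 : AEStronglyMeasurable (fun x => (x + t k • e, u x, u (x + t k • e))) volume :=
      (Continuous.aestronglyMeasurable (by fun_prop)).prodMk (hu.1.prodMk (memLp_transl hu _).1)
    exact (Qbar_cont cM).comp_aestronglyMeasurable h1
  have Em : ∀ k, AEStronglyMeasurable (E k) volume := by
    intro k
    have h1 : AEStronglyMeasurable (fun x : Fin d → ℝ => (x, u x, t k)) volume :=
      (Continuous.aestronglyMeasurable (by fun_prop)).prodMk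
        (hu.1.prodMk aestronglyMeasurable_const)
    exact (Pbar_cont cP e).comp_aestronglyMeasurable h1
  have Mm : AEStronglyMeasurable (fun x => M x (u x)) volume := comp_aesm M cM hu.1
  have Pm : AEStronglyMeasurable (fun x => P x (u x)) volume := comp_aesm P cP hu.1
  have Qψ2 : ∀ k, MemLp (fun x => Q k x * ψ x) 2 := fun k =>
    memLp_of_le (C := L) hψ2 ((Qm k).mul hψ2.1) (fun x => by
      rw [abs_mul]; exact mul_le_mul_of_nonneg_right (Qbar_bd hL _ _ _) (abs_nonneg _))
  have Mψ2 : MemLp (fun x => M x (u x) * ψ x) 2 :=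
    memLp_of_le (C := L) hψ2 (Mm.mul hψ2.1) (fun x => by
      rw [abs_mul]; exact mul_le_mul_of_nonneg_right (hL _ _) (abs_nonneg _))
  have E2 : ∀ k, MemLp (E k) 2 := fun k => memLp_of_le hu (Em k) (fun x => Pbar_bd hC _ _ _ _)
  have P2 : MemLp (fun x => P x (u x)) 2 := memLp_of_le hu Pm (fun x => hC _ _)
  have key : ∀ k, ∫ x, (F (x + t k • e) (u (x + t k • e)) - F x (u x)) / t k * ψ x =
      (∫ x, D k x * (M x (u x) * ψ x)) + (∫ x, D k x * (Q k x * ψ x - M x (u x) * ψ x)) +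
        ∫ x, E k x * ψ x := by
    intro k
    have i1 := mul_int (D2 k) Mψ2
    have i2 : Integrable (fun x => D k x * (Q k x * ψ x - M x (u x) * ψ x)) :=
      mul_int (D2 k) ((Qψ2 k).sub Mψ2)
    have i3 := mul_int (E2 k) hψ2
    have i12 : Integrable (fun x => D k x * (M x (u x) * ψ x) +
      D k x * (Q k x * ψ x - M x (u x) * ψ x)) := i1.add i2
    rw [← integral_add i1 i2, ← integral_add i12 i3]
    refine integral_congr_ae (Eventually.of_forall fun x => ?_)
    simp only
    have h1 := Qbar_eq cM hM (x + t k • e) (u x) (u (x + t k • e))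
    have h2 := Pbar_eq cP hP x (u x) (t k)
    have h3 : F (x + t k • e) (u (x + t k • e)) - F x (u x) =
        Q k x * (u (x + t k • e) - u x) + E k x * t k := by
      simp only [hQ, hE]; rw [← h1, ← h2]; ring
    rw [h3]
    simp only [hD]
    have := ws.ne k
    field_simp
    ring
  have l1 := ws.wk _ Mψ2
  have l2 : Tendsto (fun k => ∫ x, D k x * (Q k x * ψ x - M x (u x) * ψ x)) atTop (𝓝 0) := by
    obtain ⟨K, hK⟩ := ws.bd
    have s2 : Tendsto (fun k => n2 volume (fun x => Q k x * ψ x - M x (u x) * ψ x)) atTop (𝓝 0) := by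
      have : Tendsto (fun k => ∫ x, (Q k x * ψ x - M x (u x) * ψ x) ^ 2) atTop
          (𝓝 (∫ x : Fin d → ℝ, (0:ℝ))) := by
        refine tendsto_integral_filter_of_dominated_convergence
          (fun x => (2 * L) ^ 2 * ψ x ^ 2) ?_ ?_ ?_ ?_
        · exact Eventually.of_forall fun k => (((Qψ2 k).sub Mψ2).1).pow 2
        · refine Eventually.of_forall fun k => Eventually.of_forall fun x => ?_
          rw [Real.norm_eq_abs, abs_pow, sq_abs, ← sub_mul, mul_pow]
          refine mul_le_mul_of_nonneg_right ?_ (sq_nonneg _)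
          rw [← sq_abs]
          refine pow_le_pow_left₀ (abs_nonneg _) ?_ 2
          have h1 := Qbar_bd hL (x + t k • e) (u x) (u (x + t k • e))
          have h2 := hL x (u x)
          have h3 := abs_sub (Q k x) (M x (u x))
          linarith
        · exact ((memLp_two_iff_integrable_sq hψ2.1).1 hψ2).const_mul _
        · filter_upwards [ws.ae] with x hx
          have hx2 : Tendsto (fun k => (x + t k • e, u x, u (x + t k • e))) atTop
              (𝓝 (x, u x, u x)) := by
            refine Tendsto.prodMk_nhds ?_ (tendsto_const_nhds.prodMk_nhds hx)
            have := (ws.lim.smul_const e).const_add x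
            simpa using this
          have h3 := ((Qbar_cont cM).tendsto (x, u x, u x)).comp hx2
          have h4 : Qbar M x (u x) (u x) = M x (u x) := by simp [Qbar]
          have h5 : Tendsto (fun k => Q k x) atTop (𝓝 (M x (u x))) := by
            rw [← h4]; exact h3
          have h6 := ((h5.mul_const (ψ x)).sub_const (M x (u x) * ψ x)).pow 2
          simpa using h6
      rw [integral_zero] at this
      have h7 := (Real.continuous_sqrt.tendsto 0).comp this
      rw [Real.sqrt_zero] at h7
      exact h7
    refine squeeze_zero_norm (fun k => ?_) (by simpa using s2.const_mul K)
    rw [Real.norm_eq_abs]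
    refine (cauchy_schwarz (D2 k) ((Qψ2 k).sub Mψ2)).trans ?_
    exact mul_le_mul_of_nonneg_right (hK k) (n2_nonneg _)
  have l3 : Tendsto (fun k => ∫ x, E k x * ψ x) atTop (𝓝 (∫ x, P x (u x) * ψ x)) := by
    refine tendsto_integral_filter_of_dominated_convergence (fun x => C * |u x * ψ x|) ?_ ?_ ?_ ?_
    · exact Eventually.of_forall fun k => (Em k).mul hψ2.1
    · refine Eventually.of_forall fun k => Eventually.of_forall fun x => ?_
      rw [Real.norm_eq_abs, abs_mul, abs_mul, ← mul_assoc]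
      exact mul_le_mul_of_nonneg_right (Pbar_bd hC _ _ _ _) (abs_nonneg _)
    · exact (mul_int hu hψ2).abs.const_mul C
    · refine Eventually.of_forall fun x => ?_
      have hx2 : Tendsto (fun k => (x, u x, t k)) atTop (𝓝 (x, u x, 0)) :=
        tendsto_const_nhds.prodMk_nhds (tendsto_const_nhds.prodMk_nhds ws.lim)
      have h3 := ((Pbar_cont cP e).tendsto (x, u x, 0)).comp hx2
      have h4 : Pbar P e x (u x) 0 = P x (u x) := by simp [Pbar]
      have h5 : Tendsto (fun k => E k x) atTop (𝓝 (P x (u x))) := by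
        rw [← h4]; exact h3
      exact h5.mul_const _
  have tot := (l1.add (l2.mono_left hl)).add (l3.mono_left hl)
  have i1 := mul_int hg Mψ2
  have i2 := mul_int P2 hψ2
  rw [add_zero, ← integral_add i1 i2] at tot
  have e2 : ∫ x, (M x (u x) * g x + P x (u x)) * ψ x =
      ∫ x, (g x * (M x (u x) * ψ x) + P x (u x) * ψ x) := by
    congr 1; ext x; ring
  rw [e2]
  refine tot.congr fun k => ?_
  exact (key k).symm

end
end FPE

namespace FPE
open Set Topology

section
variable {d : ℕ}

lemma memLp_locInt {w : (Fin d → ℝ) → ℝ} (hw : MemLp w 2) : LocallyIntegrable w :=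
  hw.locallyIntegrable (by norm_num)

lemma pd_refl {ρ : (Fin d → ℝ) → ℝ} (h : Differentiable ℝ ρ) (i : Fin d) (x y : Fin d → ℝ) :
    pd i (fun y => ρ (x - y)) y = - pd i ρ (x - y) := by
  unfold pd
  have h1 : HasFDerivAt (fun y : Fin d → ℝ => x - y) (-ContinuousLinearMap.id ℝ (Fin d → ℝ)) y :=
    (hasFDerivAt_id y).const_sub x
  have h2 := (h (x - y)).hasFDerivAt.comp y h1
  have h3 : fderiv ℝ (fun y => ρ (x - y)) y = _ := h2.fderiv
  rw [h3]
  simp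

lemma wd_cv {ρ : (Fin d → ℝ) → ℝ} {δ : ℝ} (hρ : Mol ρ δ) {i : Fin d} {W w : (Fin d → ℝ) → ℝ}
    (hW : MemLp W 2) (h : IsWD i W w) : pd i (cv W ρ) = cv w ρ := by
  rw [pd_cv (memLp_locInt hW) (hρ.smooth' 1) hρ.comp]
  ext x
  have hψ : ContDiff ℝ 1 (fun y => ρ (x - y)) :=
    (hρ.smooth' 1).comp (contDiff_const.sub contDiff_id)
  have hc : HasCompactSupport (fun y => ρ (x - y)) :=
    hρ.comp.comp_homeomorph (Homeomorph.subLeft x)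
  have := h _ hψ hc
  unfold cv
  have h2 : ∀ y, W y * pd i ρ (x - y) = -(W y * pd i (fun y => ρ (x - y)) y) := by
    intro y
    rw [pd_refl ((hρ.smooth' 1).differentiable one_ne_zero)]
    ring
  simp_rw [h2]
  rw [integral_neg, this, neg_neg]

lemma pd_odd {ρ : (Fin d → ℝ) → ℝ} (h : Differentiable ℝ ρ) (he : ∀ x, ρ (-x) = ρ x) (i : Fin d)
    (x : Fin d → ℝ) : pd i ρ (-x) = (-1) * pd i ρ x := by
  have := pd_refl h i 0 x
  simp only [zero_sub, he] at this
  rw [← neg_eq_iff_eq_neg.2 this]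
  ring

lemma mol_seq (d : ℕ) : ∃ ρ : ℕ → (Fin d → ℝ) → ℝ, ∀ k, Mol (ρ k) (1 / ((k:ℝ) + 1)) := by
  choose ρ h using fun k : ℕ => exists_Mol d (δ := 1 / ((k:ℝ) + 1)) (by positivity)
  exact ⟨ρ, h⟩

lemma cv_n2 {ρ : ℕ → (Fin d → ℝ) → ℝ} (hρ : ∀ k, Mol (ρ k) (1 / ((k:ℝ) + 1)))
    {g : (Fin d → ℝ) → ℝ} (hg : MemLp g 2) :
    Tendsto (fun k => n2 volume (fun x => cv g (ρ k) x - g x)) atTop (𝓝 0) := by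
  rw [Metric.tendsto_atTop]
  intro η hη
  obtain ⟨δ₀, hδ, h⟩ := cv_approx hg (half_pos hη)
  have : ∀ᶠ k : ℕ in atTop, 1 / ((k:ℝ) + 1) < δ₀ :=
    tendsto_one_div_add_atTop_nhds_zero_nat.eventually (gt_mem_nhds hδ)
  obtain ⟨N, hN⟩ := eventually_atTop.1 this
  refine ⟨N, fun k hk => ?_⟩
  have := h _ _ (hN k hk).le (hρ k)
  rw [Real.dist_eq, sub_zero, abs_of_nonneg (n2_nonneg _)]
  have h2 : n2 volume (fun x => cv g (ρ k) x - g x) ≤ η / 2 := by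
    unfold n2
    rw [Real.sqrt_le_left (by linarith)]
    exact this
  linarith

lemma cv_lim {ρ : ℕ → (Fin d → ℝ) → ℝ} (hρ : ∀ k, Mol (ρ k) (1 / ((k:ℝ) + 1)))
    {f g : (Fin d → ℝ) → ℝ} (hf : MemLp f 2) (hg : MemLp g 2) :
    Tendsto (fun k => ∫ x, f x * cv g (ρ k) x) atTop (𝓝 (∫ x, f x * g x)) := by
  rw [tendsto_iff_norm_sub_tendsto_zero]
  refine squeeze_zero (fun _ => norm_nonneg _) (fun k => ?_)
    (by simpa using (cv_n2 hρ hg).const_mul (n2 volume f))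
  have hc := ((hρ k).cv_memLp hg).1
  rw [← integral_sub (mul_int hf hc) (mul_int hf hg), Real.norm_eq_abs]
  have := cauchy_schwarz hf (hc.sub hg)
  refine le_trans (le_of_eq ?_) this
  congr 2
  ext x
  simp only [Pi.sub_apply]
  ring

/-- regularity package for coefficients at level n -/
structure Nice (A M P : Fin d → Fin d → (Fin d → ℝ) → ℝ → ℝ) (B : Fin d → (Fin d → ℝ) → ℝ → ℝ)
    (L c C L' : ℝ) : Prop where
  cA : ∀ i j, Continuous fun p : (Fin d → ℝ) × ℝ => A i j p.1 p.2
  cM : ∀ i j, Continuous fun p : (Fin d → ℝ) × ℝ => M i j p.1 p.2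
  cP : ∀ i j, Continuous fun p : (Fin d → ℝ) × ℝ => P i j p.1 p.2
  cB : ∀ i, Continuous fun p : (Fin d → ℝ) × ℝ => B i p.1 p.2
  dM : ∀ i j x s, HasDerivAt (A i j x) (M i j x s) s
  dP : ∀ i j x s t, HasDerivAt (fun t : ℝ => A i j (x + t • Pi.single i (1:ℝ)) s)
      (P i j (x + t • Pi.single i (1:ℝ)) s) t
  bM : ∀ i j x s, |M i j x s| ≤ L'
  bA : ∀ i j x s, |A i j x s| ≤ L * |s|
  bB : ∀ i x s, |B i x s| ≤ L * |s|
  bP : ∀ i j x s, |P i j x s| ≤ C * |s|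
  bB' : ∀ i x s, |B i x s| ≤ C * |s|
  ell : ∀ x s (ξ : Fin d → ℝ), c * ∑ i, ξ i ^ 2 ≤ ∑ i, ∑ j, M i j x s * ξ i * ξ j

variable {A M P : Fin d → Fin d → (Fin d → ℝ) → ℝ → ℝ} {B : Fin d → (Fin d → ℝ) → ℝ → ℝ}
    {L c C L' : ℝ}


lemma sq_int_le {f : ℝ → ℝ} (hf : Continuous f) :
    (∫ s in (0:ℝ)..1, f s) ^ 2 ≤ ∫ s in (0:ℝ)..1, f s ^ 2 := by
  set m := ∫ s in (0:ℝ)..1, f s with hm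
  have h0 : 0 ≤ ∫ s in (0:ℝ)..1, (f s - m) ^ 2 :=
    intervalIntegral.integral_nonneg zero_le_one fun s _ => sq_nonneg _
  have i1 : IntervalIntegrable (fun s => f s ^ 2) volume 0 1 := (hf.pow 2).intervalIntegrable _ _
  have i2 : IntervalIntegrable (fun s => 2 * m * f s) volume 0 1 :=
    (continuous_const.mul hf).intervalIntegrable _ _
  have i3 : IntervalIntegrable (fun s => f s ^ 2 - 2 * m * f s) volume 0 1 := i1.sub i2
  have e : ∫ s in (0:ℝ)..1, (f s - m) ^ 2 = ∫ s in (0:ℝ)..1, ((f s ^ 2 - 2 * m * f s) + m ^ 2) := by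
    congr 1; ext s; ring
  rw [e, intervalIntegral.integral_add i3 (by simp), intervalIntegral.integral_sub i1 i2,
    intervalIntegral.integral_const_mul, ← hm] at h0
  simp at h0
  nlinarith

lemma line_mp (y : Fin d → ℝ) (ν : Measure ℝ) [SFinite ν] :
    MeasurePreserving (fun p : ℝ × (Fin d → ℝ) => (p.1, p.2 + p.1 • y))
      (ν.prod volume) (ν.prod volume) := by
  refine MeasurePreserving.skew_product (g := fun s x => x + s • y) (MeasurePreserving.id ν)
    (by fun_prop) ?_
  exact Eventually.of_forall fun s => (measurePreserving_add_right volume (s • y)).map_eq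

lemma line_int {H : (Fin d → ℝ) → ℝ} (hH : Integrable H) (y : Fin d → ℝ) :
    Integrable (fun x => ∫ s in (0:ℝ)..1, H (x + s • y)) ∧
    ∫ x, ∫ s in (0:ℝ)..1, H (x + s • y) = ∫ x, H x := by
  have hF : Integrable (fun p : ℝ × (Fin d → ℝ) => H p.2)
      ((volume.restrict (Ioc (0:ℝ) 1)).prod volume) := hH.comp_snd _
  have h2 := (line_mp y (volume.restrict (Ioc (0:ℝ) 1))).integrable_comp_of_integrable hF
  have h3 : Integrable (fun p : ℝ × (Fin d → ℝ) => H (p.2 + p.1 • y))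
      ((volume.restrict (Ioc (0:ℝ) 1)).prod volume) := h2
  have e : ∀ x, ∫ s in (0:ℝ)..1, H (x + s • y) = ∫ s in Ioc (0:ℝ) 1, H (x + s • y) :=
    fun x => intervalIntegral.integral_of_le zero_le_one
  simp_rw [e]
  refine ⟨h3.integral_prod_right, ?_⟩
  rw [← integral_prod_symm _ h3, integral_prod _ h3]
  have : ∀ s : ℝ, ∫ x, H (x + s • y) = ∫ x, H x := fun s =>
    integral_add_right_eq_self (μ := volume) H (s • y)
  simp [this]

lemma transl_smooth {v : (Fin d → ℝ) → ℝ} (hv : ContDiff ℝ 1 v)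
    (hg : ∀ i, MemLp (pd i v) 2) (y : Fin d → ℝ) :
    ∫ x, (v (x + y) - v x) ^ 2 ≤ ‖y‖ ^ 2 * (d * ∑ i, ∫ x, pd i v x ^ 2) := by
  have cpd : ∀ i, Continuous (pd i v) := fun i =>
      (contDiff_pd (m := 0) i hv (by norm_num)).continuous
  set H : (Fin d → ℝ) → ℝ := fun x => ‖y‖ ^ 2 * (d * ∑ i, pd i v x ^ 2) with hH
  have i1 : ∀ i, Integrable (fun x => pd i v x ^ 2) := fun i =>
    (memLp_two_iff_integrable_sq (hg i).1).1 (hg i)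
  have iH : Integrable H := ((integrable_finset_sum _ fun i _ => i1 i).const_mul _).const_mul _
  have pw : ∀ x, (v (x + y) - v x) ^ 2 ≤ ∫ s in (0:ℝ)..1, H (x + s • y) := by
    intro x
    have hc : Continuous fun s : ℝ => ∑ i, y i * pd i v (x + s • y) := by
      refine continuous_finset_sum _ fun i _ => continuous_const.mul ((cpd i).comp (by fun_prop))
    have hcH : Continuous fun s : ℝ => H (x + s • y) := by
      refine continuous_const.mul (continuous_const.mul (continuous_finset_sum _ fun i _ => ?_))
      exact ((cpd i).comp (by fun_prop)).pow 2
    have h1 := intervalIntegral.integral_eq_sub_of_hasDerivAt (a := (0:ℝ)) (b := 1)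
      (fun s _ => line_deriv (hv.differentiable one_ne_zero) x y s) (hc.intervalIntegrable _ _)
    simp only [one_smul, zero_smul, add_zero] at h1
    rw [← h1]
    refine (sq_int_le hc).trans ?_
    refine intervalIntegral.integral_mono_on zero_le_one ((hc.pow 2).intervalIntegrable _ _)
      (hcH.intervalIntegrable _ _) fun s _ => ?_
    have h2 := Finset.sum_mul_sq_le_sq_mul_sq Finset.univ y (fun i => pd i v (x + s • y))
    refine h2.trans ?_
    simp only [hH]
    rw [← mul_assoc]
    refine mul_le_mul_of_nonneg_right ?_ (Finset.sum_nonneg fun i _ => sq_nonneg _)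
    have : ∀ i ∈ Finset.univ, y i ^ 2 ≤ ‖y‖ ^ 2 := fun i _ => by
      rw [← sq_abs]
      exact pow_le_pow_left₀ (abs_nonneg _) (norm_le_pi_norm y i) 2
    have h3 := Finset.sum_le_card_nsmul _ _ _ this
    simp at h3
    linarith
  obtain ⟨j1, j2⟩ := line_int iH y
  calc _ ≤ ∫ x, ∫ s in (0:ℝ)..1, H (x + s • y) :=
        integral_mono_of_nonneg (Eventually.of_forall fun x => sq_nonneg _) j1
          (Eventually.of_forall pw)
    _ = ∫ x, H x := j2
    _ = _ := by
        simp only [hH]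
        rw [integral_const_mul, integral_const_mul, integral_finsetSum _ fun i _ => i1 i]

lemma n2_transl (f : (Fin d → ℝ) → ℝ) (y : Fin d → ℝ) :
    n2 volume (fun x => f (x + y)) = n2 volume f := by
  unfold n2
  rw [integral_add_right_eq_self (μ := volume) (fun x => f x ^ 2) y]

lemma n2_sub {α : Type*} [MeasurableSpace α] {μ : Measure α} {f g : α → ℝ} (hf : MemLp f 2 μ)
    (hg : MemLp g 2 μ) : n2 μ (fun x => f x - g x) ≤ n2 μ f + n2 μ g := by
  have := n2_add hf hg.neg
  simpa [n2, sub_eq_add_neg] using this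

lemma transl_of_wd {u : (Fin d → ℝ) → ℝ} (hu : MemLp u 2) {g : Fin d → (Fin d → ℝ) → ℝ}
    (hg : ∀ i, MemLp (g i) 2) (hw : ∀ i, IsWD i u (g i)) (y : Fin d → ℝ) :
    ∫ x, (u (x + y) - u x) ^ 2 ≤ ‖y‖ ^ 2 * (d * ∑ i, ∫ x, g i x ^ 2) := by
  obtain ⟨ρ, hρ⟩ := mol_seq d
  set K := ‖y‖ ^ 2 * (d * ∑ i, ∫ x, g i x ^ 2) with hK
  have hK0 : 0 ≤ K := by
    have : 0 ≤ ∑ i, ∫ x, g i x ^ 2 := Finset.sum_nonneg fun i _ => integral_nonneg fun x => sq_nonneg _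
    positivity
  have h1 : ∀ k, n2 volume (fun x => cv u (ρ k) (x + y) - cv u (ρ k) x) ≤ Real.sqrt K := by
    intro k
    have p1 : ∀ i, pd i (cv u (ρ k)) = cv (g i) (ρ k) := fun i => wd_cv (hρ k) hu (hw i)
    have hs : ContDiff ℝ 1 (cv u (ρ k)) :=
      cv_contDiff (n := 1) (memLp_locInt hu) ((hρ k).smooth' 1) (hρ k).comp
    have := transl_smooth hs (fun i => by rw [p1]; exact ((hρ k).cv_memLp (hg i)).1) y
    refine Real.sqrt_le_sqrt (this.trans ?_)
    refine mul_le_mul_of_nonneg_left (mul_le_mul_of_nonneg_left ?_ (Nat.cast_nonneg _)) (sq_nonneg _)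
    refine Finset.sum_le_sum fun i _ => ?_
    rw [p1]
    exact ((hρ k).cv_memLp (hg i)).2
  have h2 : ∀ k, n2 volume (fun x => u (x + y) - u x) ≤ Real.sqrt K +
      (n2 volume (fun x => cv u (ρ k) x - u x) + n2 volume (fun x => cv u (ρ k) x - u x)) := by
    intro k
    have hv := ((hρ k).cv_memLp hu).1
    have m1 : MemLp (fun x => cv u (ρ k) (x + y) - cv u (ρ k) x) 2 := (memLp_transl hv y).sub hv
    have m2 : MemLp (fun x => cv u (ρ k) x - u x) 2 := hv.sub hu
    have m3 : MemLp (fun x => cv u (ρ k) (x + y) - u (x + y)) 2 := memLp_transl m2 y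
    have m4 : MemLp (fun x => (cv u (ρ k) (x + y) - u (x + y)) - (cv u (ρ k) x - u x)) 2 := m3.sub m2
    have t1 := n2_sub m1 m4
    have t2 := n2_sub m3 m2
    have t3 := n2_transl (fun x => cv u (ρ k) x - u x) y
    have e : (fun x => u (x + y) - u x) = fun x => (cv u (ρ k) (x + y) - cv u (ρ k) x) -
        ((cv u (ρ k) (x + y) - u (x + y)) - (cv u (ρ k) x - u x)) := by
      ext x; ring
    rw [e]
    refine t1.trans (add_le_add (h1 k) (t2.trans (le_of_eq ?_)))
    rw [t3]
  have h3 : Tendsto (fun k => Real.sqrt K +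
      (n2 volume (fun x => cv u (ρ k) x - u x) + n2 volume (fun x => cv u (ρ k) x - u x))) atTop
      (𝓝 (Real.sqrt K)) := by
    have := ((cv_n2 hρ hu).add (cv_n2 hρ hu)).const_add (Real.sqrt K)
    simpa using this
  have h4 := ge_of_tendsto' h3 h2
  have h5 := n2_sq (μ := volume) (fun x => u (x + y) - u x)
  rw [← h5]
  have := pow_le_pow_left₀ (n2_nonneg _) h4 2
  rwa [Real.sq_sqrt hK0] at this

lemma energy_id {h : ℝ} {f u : (Fin d → ℝ) → ℝ} (hN : Nice A M P B L c C L') (hf : MemLp f 2)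
    (hr : ResN A B h L f u) : ∃ g : Fin d → (Fin d → ℝ) → ℝ, (∀ i, MemLp (g i) 2) ∧
      (∀ i, IsWD i u (g i)) ∧
      (∫ x, u x * u x) - (∫ x, f x * u x) =
        h * ((∑ i, ∑ j, -∫ x, g j x * (M i j x (u x) * g i x + P i j x (u x))) +
          ∑ i, ∫ x, B i x (u x) * g i x) := by
  obtain ⟨K, -, hK⟩ := hr.tr
  have hu := hr.memLp
  choose g t hg ws using exists_WS hu hK
  have w0 : ∀ i, IsWD i u (g i) := by
    intro i
    have := chain_wd (F := fun _ s => s) (M := fun _ _ => 1) (P := fun _ _ => 0) (L := 1) (L' := 1)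
      (C := 0) Nat.hyperfilter_le_atTop hu (hg i) (ws i) continuous_snd continuous_const
      continuous_const (fun x s => hasDerivAt_id s) (fun x s t => hasDerivAt_const _ _) (by simp)
      (by simp) (by simp)
    simpa using this
  have w1 : ∀ i j, IsWD i (fun x => A i j x (u x)) (fun x => M i j x (u x) * g i x + P i j x (u x)) :=
    fun i j => chain_wd Nat.hyperfilter_le_atTop hu (hg i) (ws i) (hN.cA i j) (hN.cM i j)
      (hN.cP i j) (hN.dM i j) (hN.dP i j) (hN.bM i j) (hN.bA i j) (hN.bP i j)
  have A2 : ∀ i j, MemLp (fun x => A i j x (u x)) 2 := fun i j =>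
    memLp_of_le hu (comp_aesm (A i j) (hN.cA i j) hu.1) (fun x => hN.bA _ _ _ _)
  have B2 : ∀ i, MemLp (fun x => B i x (u x)) 2 := fun i =>
    memLp_of_le hu (comp_aesm (B i) (hN.cB i) hu.1) (fun x => hN.bB _ _ _)
  have P2 : ∀ i j, MemLp (fun x => P i j x (u x)) 2 := fun i j =>
    memLp_of_le hu (comp_aesm (P i j) (hN.cP i j) hu.1) (fun x => hN.bP _ _ _ _)
  have M2 : ∀ i j, MemLp (fun x => M i j x (u x) * g i x) 2 := fun i j =>
    memLp_of_le (C := L') (hg i) ((comp_aesm (M i j) (hN.cM i j) hu.1).mul (hg i).1) (fun x => by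
      rw [abs_mul]; exact mul_le_mul_of_nonneg_right (hN.bM _ _ _ _) (abs_nonneg _))
  have w2 : ∀ i j, MemLp (fun x => M i j x (u x) * g i x + P i j x (u x)) 2 := fun i j =>
    (M2 i j).add (P2 i j)
  refine ⟨g, hg, w0, ?_⟩
  obtain ⟨ρ, hρ⟩ := mol_seq d
  have idk : ∀ k, (∫ x, u x * cv u (ρ k) x) - (∫ x, f x * cv u (ρ k) x) =
      h * ((∑ i, ∑ j, -∫ x, g j x * cv (fun x => M i j x (u x) * g i x + P i j x (u x)) (ρ k) x) +
          ∑ i, ∫ x, B i x (u x) * cv (g i) (ρ k) x) := by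
    intro k
    obtain ⟨C0, C1, hC1, hT⟩ := cv_tst hr.int ((hρ k).smooth' 3) (hρ k).comp
    have hwk := hr.weak _ C0 C1 hC1 hT
    have e1 : ∀ v : (Fin d → ℝ) → ℝ, ∫ x, cv u (ρ k) x * v x = ∫ x, v x * cv u (ρ k) x := by
      intro v; congr 1; ext x; ring
    rw [e1, e1] at hwk
    rw [hwk]
    congr 1
    have p1 : ∀ i, pd i (cv u (ρ k)) = cv (g i) (ρ k) := fun i => wd_cv (hρ k) hu (w0 i)
    have cpd : ∀ i, Continuous (pd i (ρ k)) := fun i =>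
      (contDiff_pd (m := 0) i ((hρ k).smooth' 1) (by norm_num)).continuous
    have p2 : ∀ i j, pd2 i j (cv u (ρ k)) = cv (g j) (pd i (ρ k)) := by
      intro i j
      have : pd2 i j (cv u (ρ k)) = pd i (pd j (cv u (ρ k))) := rfl
      rw [this, p1, pd_cv (memLp_locInt (hg j)) ((hρ k).smooth' 1) (hρ k).comp]
    have q1 : ∀ i j, ∫ x, A i j x (u x) * pd2 i j (cv u (ρ k)) x =
        -∫ x, g j x * cv (fun x => M i j x (u x) * g i x + P i j x (u x)) (ρ k) x := by
      intro i j
      rw [p2, cv_pair (A2 i j) (hg j) (cpd i) (pd_zero_of_compact i (hρ k).comp) (s := -1)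
        (fun x => pd_odd (((hρ k).smooth' 1).differentiable one_ne_zero) (hρ k).even i x)]
      rw [← wd_cv (hρ k) (A2 i j) (w1 i j),
        pd_cv (memLp_locInt (A2 i j)) ((hρ k).smooth' 1) (hρ k).comp]
      ring
    have j1 : ∀ i j, Integrable (fun x => A i j x (u x) * pd2 i j (cv u (ρ k)) x) := by
      intro i j
      have hAi : Integrable (fun x => A i j x (u x)) := by
        refine (hr.int.abs.const_mul L).mono' (comp_aesm (A i j) (hN.cA i j) hu.1) ?_
        exact Eventually.of_forall fun x => hN.bA _ _ _ _
      have := integrable_bdd_mul hAi (hT.pd2_cont i j).aestronglyMeasurable (hT.b2 i j)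
      simpa [mul_comm] using this
    have j2 : ∀ i, Integrable (fun x => B i x (u x) * pd i (cv u (ρ k)) x) := by
      intro i
      have hAi : Integrable (fun x => B i x (u x)) := by
        refine (hr.int.abs.const_mul L).mono' (comp_aesm (B i) (hN.cB i) hu.1) ?_
        exact Eventually.of_forall fun x => hN.bB _ _ _
      have := integrable_bdd_mul hAi (hT.pd_cont i).aestronglyMeasurable (hT.b1 i)
      simpa [mul_comm] using this
    unfold Lop
    have j3 : Integrable (fun x => ∑ i, ∑ j, A i j x (u x) * pd2 i j (cv u (ρ k)) x) :=
      integrable_finset_sum _ fun i _ => integrable_finset_sum _ fun j _ => j1 i j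
    have j4 : Integrable (fun x => ∑ i, B i x (u x) * pd i (cv u (ρ k)) x) :=
      integrable_finset_sum _ fun i _ => j2 i
    rw [integral_add j3 j4, integral_finsetSum _ (fun i _ =>
      integrable_finset_sum _ fun j _ => j1 i j), integral_finsetSum _ (fun i _ => j2 i)]
    congr 1
    · refine Finset.sum_congr rfl fun i _ => ?_
      rw [integral_finsetSum _ (fun j _ => j1 i j)]
      exact Finset.sum_congr rfl fun j _ => q1 i j
    · exact Finset.sum_congr rfl fun i _ => by rw [p1]
  have lL : Tendsto (fun k => (∫ x, u x * cv u (ρ k) x) - (∫ x, f x * cv u (ρ k) x)) atTop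
      (𝓝 ((∫ x, u x * u x) - (∫ x, f x * u x))) := (cv_lim hρ hu hu).sub (cv_lim hρ hf hu)
  have lR : Tendsto (fun k => h * ((∑ i, ∑ j, -∫ x, g j x *
        cv (fun x => M i j x (u x) * g i x + P i j x (u x)) (ρ k) x) +
          ∑ i, ∫ x, B i x (u x) * cv (g i) (ρ k) x)) atTop
      (𝓝 (h * ((∑ i, ∑ j, -∫ x, g j x * (M i j x (u x) * g i x + P i j x (u x))) +
          ∑ i, ∫ x, B i x (u x) * g i x))) := by
    refine Tendsto.const_mul _ (Tendsto.add ?_ ?_)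
    · exact tendsto_finset_sum _ fun i _ => tendsto_finset_sum _ fun j _ =>
        (cv_lim hρ (hg j) (w2 i j)).neg
    · exact tendsto_finset_sum _ fun i _ => cv_lim hρ (B2 i) (hg i)
  simp_rw [idk] at lL
  exact tendsto_nhds_unique lL lR

lemma energy_pt (hN : Nice A M P B L c C L') (hc : 0 < c) (hC : 0 ≤ C) (x : Fin d → ℝ) (s : ℝ)
    (ξ : Fin d → ℝ) :
    (∑ i, ∑ j, -(ξ j * (M i j x s * ξ i + P i j x s))) + ∑ i, B i x s * ξ i ≤
      -(c / 2) * ∑ i, ξ i ^ 2 + d * ((d + 1) * C) ^ 2 / (2 * c) * s ^ 2 := by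
  have h1 := hN.ell x s ξ
  have e1 : ∑ i, ∑ j, -(ξ j * (M i j x s * ξ i + P i j x s)) =
      -(∑ i, ∑ j, M i j x s * ξ i * ξ j) - ∑ j, ∑ i, ξ j * P i j x s := by
    rw [Finset.sum_comm (f := fun j i => ξ j * P i j x s), ← Finset.sum_neg_distrib,
      ← Finset.sum_sub_distrib]
    refine Finset.sum_congr rfl fun i _ => ?_
    rw [← Finset.sum_neg_distrib, ← Finset.sum_sub_distrib]
    refine Finset.sum_congr rfl fun j _ => ?_
    ring
  rw [e1]
  have h2 : ∀ j, B j x s * ξ j - ∑ i, ξ j * P i j x s ≤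
      c / 2 * ξ j ^ 2 + ((d + 1) * C) ^ 2 / (2 * c) * s ^ 2 := by
    intro j
    have h3 : |B j x s - ∑ i, P i j x s| ≤ (d + 1) * C * |s| := by
      have a1 := hN.bB' j x s
      have a2 : |∑ i, P i j x s| ≤ d * (C * |s|) := by
        refine (Finset.abs_sum_le_sum_abs _ _).trans ?_
        refine (Finset.sum_le_card_nsmul _ _ _ fun i _ => hN.bP i j x s).trans ?_
        simp
      have := abs_sub (B j x s) (∑ i, P i j x s)
      linarith
    rw [← Finset.mul_sum]
    have h4 : B j x s * ξ j - ξ j * ∑ i, P i j x s ≤ |ξ j| * ((d + 1) * C * |s|) := by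
      have : B j x s * ξ j - ξ j * ∑ i, P i j x s = ξ j * (B j x s - ∑ i, P i j x s) := by ring
      rw [this]
      refine (le_abs_self _).trans ?_
      rw [abs_mul]
      exact mul_le_mul_of_nonneg_left h3 (abs_nonneg _)
    refine h4.trans ?_
    rw [← sq_abs (ξ j), ← sq_abs s]
    have h5 : c / 2 * |ξ j| ^ 2 + ((d + 1) * C) ^ 2 / (2 * c) * |s| ^ 2 -
        |ξ j| * ((d + 1) * C * |s|) = (c * |ξ j| - (d + 1) * C * |s|) ^ 2 / (2 * c) := by
      field_simp; ring
    have h6 : 0 ≤ (c * |ξ j| - (d + 1) * C * |s|) ^ 2 / (2 * c) := by positivity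
    linarith
  have h7 := Finset.sum_le_sum fun j (_ : j ∈ Finset.univ) => h2 j
  rw [Finset.sum_sub_distrib, Finset.sum_add_distrib, ← Finset.mul_sum] at h7
  simp only [Finset.sum_const, Finset.card_univ, Fintype.card_fin, nsmul_eq_mul] at h7
  have e8 : (d:ℝ) * (((d + 1) * C) ^ 2 / (2 * c) * s ^ 2) =
    d * ((d + 1) * C) ^ 2 / (2 * c) * s ^ 2 := by ring
  rw [e8] at h7
  linarith

lemma energy {h : ℝ} {f u : (Fin d → ℝ) → ℝ} (hN : Nice A M P B L c C L') (hc : 0 < c)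
    (hC : 0 ≤ C) (hh : 0 < h) (hf : MemLp f 2)
    (hr : ResN A B h L f u) : ∃ G : ℝ, 0 ≤ G ∧
      (∀ y, ∫ x, (u (x + y) - u x) ^ 2 ≤ ‖y‖ ^ 2 * (d * G)) ∧
      (1 - h * (d * ((d + 1) * C) ^ 2 / c)) * (∫ x, u x ^ 2) + h * c * G ≤ ∫ x, f x ^ 2 := by
  obtain ⟨g, hg, hw, he⟩ := energy_id hN hf hr
  have hu := hr.memLp
  refine ⟨∑ i, ∫ x, g i x ^ 2, Finset.sum_nonneg fun i _ => integral_nonneg fun x => sq_nonneg _,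
    transl_of_wd hu hg hw, ?_⟩
  have B2 : ∀ i, MemLp (fun x => B i x (u x)) 2 := fun i =>
    memLp_of_le hu (comp_aesm (B i) (hN.cB i) hu.1) (fun x => hN.bB _ _ _)
  have P2 : ∀ i j, MemLp (fun x => P i j x (u x)) 2 := fun i j =>
    memLp_of_le hu (comp_aesm (P i j) (hN.cP i j) hu.1) (fun x => hN.bP _ _ _ _)
  have M2 : ∀ i j, MemLp (fun x => M i j x (u x) * g i x) 2 := fun i j =>
    memLp_of_le (C := L') (hg i) ((comp_aesm (M i j) (hN.cM i j) hu.1).mul (hg i).1) (fun x => by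
      rw [abs_mul]; exact mul_le_mul_of_nonneg_right (hN.bM _ _ _ _) (abs_nonneg _))
  have w2 : ∀ i j, MemLp (fun x => M i j x (u x) * g i x + P i j x (u x)) 2 := fun i j =>
    (M2 i j).add (P2 i j)
  have j1 : ∀ i j, Integrable (fun x => -(g j x * (M i j x (u x) * g i x + P i j x (u x)))) :=
    fun i j => (mul_int (hg j) (w2 i j)).neg
  have j2 : ∀ i, Integrable (fun x => B i x (u x) * g i x) := fun i => mul_int (B2 i) (hg i)
  have j3 : Integrable (fun x => ∑ i, ∑ j, -(g j x * (M i j x (u x) * g i x + P i j x (u x)))) :=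
    integrable_finset_sum _ fun i _ => integrable_finset_sum _ fun j _ => j1 i j
  have j4 : Integrable (fun x => ∑ i, B i x (u x) * g i x) := integrable_finset_sum _ fun i _ => j2 i
  have su : Integrable (fun x => u x ^ 2) := (memLp_two_iff_integrable_sq hu.1).1 hu
  have sf : Integrable (fun x => f x ^ 2) := (memLp_two_iff_integrable_sq hf.1).1 hf
  have sg : ∀ i, Integrable (fun x => g i x ^ 2) := fun i =>
    (memLp_two_iff_integrable_sq (hg i).1).1 (hg i)
  have sgs : Integrable (fun x => ∑ i, g i x ^ 2) := integrable_finset_sum _ fun i _ => sg i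
  have key : (∑ i, ∑ j, -∫ x, g j x * (M i j x (u x) * g i x + P i j x (u x))) +
          (∑ i, ∫ x, B i x (u x) * g i x) ≤
      -(c / 2) * (∑ i, ∫ x, g i x ^ 2) + d * ((d + 1) * C) ^ 2 / (2 * c) * ∫ x, u x ^ 2 := by
    have e1 : (∑ i, ∑ j, -∫ x, g j x * (M i j x (u x) * g i x + P i j x (u x))) +
          (∑ i, ∫ x, B i x (u x) * g i x) =
        ∫ x, ((∑ i, ∑ j, -(g j x * (M i j x (u x) * g i x + P i j x (u x)))) +
          ∑ i, B i x (u x) * g i x) := by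
      rw [integral_add j3 j4, integral_finsetSum _ (fun i _ =>
        integrable_finset_sum _ fun j _ => j1 i j), integral_finsetSum _ (fun i _ => j2 i)]
      congr 1
      refine Finset.sum_congr rfl fun i _ => ?_
      rw [integral_finsetSum _ (fun j _ => j1 i j)]
      exact Finset.sum_congr rfl fun j _ => by rw [integral_neg]
    have e2 : -(c / 2) * (∑ i, ∫ x, g i x ^ 2) + d * ((d + 1) * C) ^ 2 / (2 * c) * (∫ x, u x ^ 2) =
        ∫ x, (-(c / 2) * (∑ i, g i x ^ 2) + d * ((d + 1) * C) ^ 2 / (2 * c) * u x ^ 2) := by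
      rw [integral_add (sgs.const_mul _) (su.const_mul _), integral_const_mul, integral_const_mul,
        integral_finsetSum _ (fun i _ => sg i)]
    rw [e1, e2]
    refine integral_mono (j3.add j4) ((sgs.const_mul _).add (su.const_mul _)) fun x => ?_
    exact energy_pt hN hc hC x (u x) (fun i => g i x)
  have cs : ∫ x, f x * u x ≤ (1 / 2) * (∫ x, u x ^ 2) + (1 / 2) * ∫ x, f x ^ 2 := by
    rw [← integral_const_mul, ← integral_const_mul,
      ← integral_add (su.const_mul _) (sf.const_mul _)]
    refine integral_mono (mul_int hf hu) ((su.const_mul _).add (sf.const_mul _)) fun x => ?_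
    simp only [Pi.add_apply]
    nlinarith [sq_nonneg (f x - u x)]
  have eu : ∫ x, u x * u x = ∫ x, u x ^ 2 := by congr 1; ext x; ring
  rw [eu] at he
  have k2 := mul_le_mul_of_nonneg_left key hh.le
  rw [← he] at k2
  have e3 : (d:ℝ) * ((d + 1) * C) ^ 2 / (2 * c) = (d * ((d + 1) * C) ^ 2 / c) / 2 := by
    field_simp
  rw [e3] at k2
  nlinarith

end
end FPE

namespace FPE
open Set Topology
open scoped MatrixOrder

section
variable {d : ℕ}

lemma cov {S : Matrix (Fin d) (Fin d) ℝ} (hS : S.det ≠ 0) (G : (Fin d → ℝ) → ℝ) :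
    (∫ y, G (S.mulVec y)) = |S.det|⁻¹ * ∫ w, G w := by
  have hu : IsUnit S.det := isUnit_iff_ne_zero.2 hS
  have hc : ∀ T : Matrix (Fin d) (Fin d) ℝ, Continuous fun y : Fin d → ℝ => T.mulVec y :=
    fun T => (Matrix.mulVecLin T).continuous_of_finiteDimensional
  let e : (Fin d → ℝ) ≃ₜ (Fin d → ℝ) :=
    { toFun := S.mulVec
      invFun := S⁻¹.mulVec
      left_inv := fun y => by
        simp [Matrix.mulVec_mulVec, Matrix.nonsing_inv_mul S hu]
      right_inv := fun y => by
        simp [Matrix.mulVec_mulVec, Matrix.mul_nonsing_inv S hu]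
      continuous_toFun := hc S
      continuous_invFun := hc S⁻¹ }
  have h := Real.map_matrix_volume_pi_eq_smul_volume_pi hS
  have h2 : (∫ w, G w ∂(Measure.map (Matrix.toLin' S) volume)) = ∫ y, G (S.mulVec y) :=
    e.measurableEmbedding.integral_map G
  rw [← h2, h, integral_smul_measure, ENNReal.toReal_ofReal (abs_nonneg _), abs_inv, smul_eq_mul]

noncomputable def eta (r : ℝ) : ℝ := Real.smoothTransition (1 - r)

lemma eta_zero {r : ℝ} (h : 1 ≤ r) : eta r = 0 :=
  Real.smoothTransition.zero_of_nonpos (by linarith)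

lemma eta_nonneg (r : ℝ) : 0 ≤ eta r := Real.smoothTransition.nonneg _

lemma eta_le_one (r : ℝ) : eta r ≤ 1 := Real.smoothTransition.le_one _

lemma eta_contDiff : ContDiff ℝ 1 eta :=
  Real.smoothTransition.contDiff.comp (contDiff_const.sub contDiff_id)

lemma eta_cont : Continuous eta := eta_contDiff.continuous

lemma eta_pos {r : ℝ} (h : r < 1) : 0 < eta r :=
  Real.smoothTransition.pos_of_pos (by linarith)

noncomputable def Fe (y : Fin d → ℝ) : ℝ := eta (∑ i, y i ^ 2)

lemma Fe_cont : Continuous (Fe (d := d)) := eta_cont.comp (by fun_prop)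

lemma Fe_comp : HasCompactSupport (Fe (d := d)) := by
  refine HasCompactSupport.intro (isCompact_closedBall (0 : Fin d → ℝ) 1) fun y hy => ?_
  refine eta_zero ?_
  by_contra h
  push Not at h
  refine hy ?_
  rw [mem_closedBall_zero_iff, pi_norm_le_iff_of_nonneg zero_le_one]
  intro i
  rw [Real.norm_eq_abs, ← abs_one, ← sq_le_sq]
  have := Finset.single_le_sum (f := fun i => y i ^ 2) (fun i _ => sq_nonneg (y i))
    (Finset.mem_univ i)
  nlinarith

lemma Fe_int (k l : Fin d) : Integrable fun y : Fin d → ℝ => Fe y * (y k * y l) :=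
  (Fe_cont.mul (by fun_prop)).integrable_of_hasCompactSupport Fe_comp.mul_right

lemma iso_off {F : (Fin d → ℝ) → ℝ}
    (hF : ∀ (D : Fin d → ℝ), (∀ i, |D i| = 1) → ∀ y : Fin d → ℝ, F (fun i => D i * y i) = F y)
    {k l : Fin d} (h : k ≠ l) : (∫ y : Fin d → ℝ, F y * (y k * y l)) = 0 := by
  set D : Fin d → ℝ := fun i => if i = k then -1 else 1
  have hdet : (Matrix.diagonal D).det = -1 := by
    rw [Matrix.det_diagonal, Finset.prod_ite_eq']
    simp
  have h1 := cov (S := Matrix.diagonal D) (by rw [hdet]; norm_num)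
    (fun y => F y * (y k * y l))
  have h2 : ∀ y : Fin d → ℝ, F ((Matrix.diagonal D).mulVec y) = F y := by
    intro y
    rw [← hF D (fun i => by by_cases hi : i = k <;> simp [D, hi]) y]
    congr 1
    funext i
    rw [Matrix.mulVec_diagonal]
  have h3 : (∫ y : Fin d → ℝ, F ((Matrix.diagonal D).mulVec y) *
      ((Matrix.diagonal D).mulVec y k * (Matrix.diagonal D).mulVec y l)) =
      ∫ y : Fin d → ℝ, -(F y * (y k * y l)) := by
    refine integral_congr_ae (Eventually.of_forall fun y => ?_)
    simp only [h2, Matrix.mulVec_diagonal]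
    simp [D, h.symm]
  rw [h3, hdet, integral_neg] at h1
  norm_num at h1
  linarith

lemma iso_diag {F : (Fin d → ℝ) → ℝ}
    (hF : ∀ (σ : Equiv.Perm (Fin d)) (y : Fin d → ℝ), F (fun i => y (σ i)) = F y)
    (k l : Fin d) : (∫ y : Fin d → ℝ, F y * (y k * y k)) =
    ∫ y : Fin d → ℝ, F y * (y l * y l) := by
  set σ := Equiv.swap k l
  have hdet : |(σ.permMatrix ℝ).det| = 1 := by
    rw [Matrix.det_permutation]
    rcases Int.units_eq_one_or (Equiv.Perm.sign σ) with h | h <;> simp [h]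
  have h1 := cov (S := σ.permMatrix ℝ) (by intro h; rw [h] at hdet; simp at hdet)
    (fun y => F y * (y l * y l))
  rw [hdet] at h1
  simp only [inv_one, one_mul] at h1
  rw [← h1]
  refine integral_congr_ae (Eventually.of_forall fun y => ?_)
  simp only [Matrix.permMatrix_mulVec, Function.comp]
  have h2 : σ l = k := Equiv.swap_apply_right k l
  simp only [Function.comp_def, hF, h2]

lemma Fe_off {k l : Fin d} (h : k ≠ l) : (∫ y : Fin d → ℝ, Fe y * (y k * y l)) = 0 := by
  refine iso_off (fun D hD y => ?_) h
  unfold Fe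
  congr 1
  refine Finset.sum_congr rfl fun i _ => ?_
  rw [mul_pow, ← sq_abs (D i), hD, one_pow, one_mul]

lemma Fe_diag (k l : Fin d) : (∫ y : Fin d → ℝ, Fe y * (y k * y k)) =
    ∫ y : Fin d → ℝ, Fe y * (y l * y l) := by
  refine iso_diag (fun σ y => ?_) k l
  unfold Fe
  congr 1
  exact Equiv.sum_comp σ fun i => y i ^ 2

lemma ball_moment (hd : 1 ≤ d) {R : ℝ} (hR : 0 < R) : ∃ m : ℝ, 0 < m ∧ ∀ k l : Fin d,
    (∫ y in Metric.closedBall (0 : Fin d → ℝ) R, y k * y l) = if k = l then m else 0 := by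
  set i₀ : Fin d := ⟨0, hd⟩
  set F : (Fin d → ℝ) → ℝ := fun y => if ∀ i, |y i| ≤ R then 1 else 0 with hFd
  have hmem : ∀ y : Fin d → ℝ, y ∈ Metric.closedBall (0 : Fin d → ℝ) R ↔ ∀ i, |y i| ≤ R := by
    intro y
    rw [mem_closedBall_zero_iff, pi_norm_le_iff_of_nonneg hR.le]
    rfl
  have hF : ∀ k l : Fin d, (∫ y in Metric.closedBall (0 : Fin d → ℝ) R, y k * y l) =
      ∫ y, F y * (y k * y l) := by
    intro k l
    rw [← integral_indicator Metric.isClosed_closedBall.measurableSet]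
    congr 1
    funext y
    by_cases hy : ∀ i, |y i| ≤ R
    · rw [indicator_of_mem ((hmem y).2 hy)]
      simp only [hFd, if_pos hy, one_mul]
    · rw [indicator_of_notMem (fun h => hy ((hmem y).1 h))]
      simp only [hFd, if_neg hy, zero_mul]
  refine ⟨∫ y in Metric.closedBall (0 : Fin d → ℝ) R, y i₀ * y i₀, ?_, fun k l => ?_⟩
  · rw [setIntegral_pos_iff_support_of_nonneg_ae (f := fun y : Fin d → ℝ => y i₀ * y i₀)
      (Eventually.of_forall fun y => mul_self_nonneg (y i₀))]
    · obtain ⟨p, hp0, hpn⟩ : ∃ p : Fin d → ℝ, p i₀ = R / 2 ∧ ‖p‖ ≤ R / 2 :=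
        ⟨fun _ => R / 2, rfl, by
          rw [pi_norm_le_iff_of_nonneg (by linarith)]
          intro i
          rw [Real.norm_eq_abs, abs_of_pos (by linarith)]⟩
      have hop : IsOpen (Metric.ball p (R/2)) := Metric.isOpen_ball
      refine (hop.measure_pos volume ⟨_, Metric.mem_ball_self (by linarith)⟩).trans_le
        (measure_mono fun y hy => ⟨?_, ?_⟩)
      · have h1 := (norm_le_pi_norm (y - p) i₀).trans_lt (mem_ball_iff_norm.1 hy)
        rw [Pi.sub_apply, hp0, Real.norm_eq_abs] at h1
        have := abs_lt.1 h1
        rw [Function.mem_support]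
        have : 0 < y i₀ := by linarith
        positivity
      · have h3 := mem_ball_iff_norm.1 hy
        have h4 := norm_add_le (y - p) p
        rw [sub_add_cancel] at h4
        rw [mem_closedBall_zero_iff]
        linarith
    · exact (Continuous.continuousOn (by fun_prop)).integrableOn_compact (isCompact_closedBall _ _)
  · rw [hF, hF]
    split_ifs with h
    · subst h
      refine iso_diag (fun σ y => ?_) _ _
      have : (∀ i, |y (σ i)| ≤ R) ↔ ∀ i, |y i| ≤ R := σ.forall_congr_left.trans (by simp)
      simp only [hFd, this]
    · refine iso_off (fun D hD y => ?_) h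
      have : (∀ i, |D i * y i| ≤ R) ↔ ∀ i, |y i| ≤ R := by
        simp only [abs_mul, hD, one_mul]
      simp only [hFd, this]

lemma Fe_kappa (hd : 1 ≤ d) : ∃ κ : ℝ, 0 < κ ∧
    ∀ k l : Fin d, (∫ y : Fin d → ℝ, Fe y * (y k * y l)) = if k = l then κ else 0 := by
  set i₀ : Fin d := ⟨0, hd⟩
  refine ⟨∫ y : Fin d → ℝ, Fe y * (y i₀ * y i₀), ?_, fun k l => ?_⟩
  · refine Continuous.integral_pos_of_hasCompactSupport_nonneg_nonzero
      (x := Pi.single i₀ (1/2)) (Fe_cont.mul (by fun_prop)) Fe_comp.mul_right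
      (fun y => mul_nonneg (eta_nonneg _) (mul_self_nonneg _)) ?_
    have : (∑ i, (Pi.single i₀ (1/2) : Fin d → ℝ) i ^ 2) = 1/4 := by
      rw [Finset.sum_eq_single i₀]
      · simp; norm_num
      · intro j _ hj; simp [hj]
      · simp
    have h2 : 0 < Fe (Pi.single i₀ (1/2) : Fin d → ℝ) := by
      unfold Fe; rw [this]; exact eta_pos (by norm_num)
    simp only [Pi.single_eq_same]
    positivity
  · split_ifs with h
    · subst h; exact Fe_diag _ _
    · exact Fe_off h

lemma kern_moment {κ : ℝ}
    (hκ : ∀ k l : Fin d, (∫ y : Fin d → ℝ, Fe y * (y k * y l)) = if k = l then κ else 0)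
    {N : Matrix (Fin d) (Fin d) ℝ} (hN : N.PosDef) {R : ℝ} (hR : 0 ≤ R)
    (hNR : ∀ i, N i i ≤ R ^ 2) (i j : Fin d) :
    (∫ w in Metric.closedBall (0 : Fin d → ℝ) R,
      eta (w ⬝ᵥ N⁻¹.mulVec w) * (w i * w j)) = Real.sqrt N.det * κ * N i j := by
  set S := CFC.sqrt N with hSdef
  have hSS : S * S = N := CFC.sqrt_mul_sqrt_self N hN.posSemidef.nonneg
  have hSp : S.PosSemidef := Matrix.nonneg_iff_posSemidef.1 (CFC.sqrt_nonneg N)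
  have hST : S.transpose = S := by
    have := hSp.1
    rw [Matrix.IsHermitian, Matrix.conjTranspose_eq_transpose_of_trivial] at this
    exact this
  have hdd : S.det * S.det = N.det := by rw [← Matrix.det_mul, hSS]
  have hNd : 0 < N.det := hN.det_pos
  have hSd : S.det ≠ 0 := by
    intro h; rw [h] at hdd; simp at hdd; linarith
  have hu : IsUnit S.det := isUnit_iff_ne_zero.2 hSd
  have habs : |S.det| = Real.sqrt N.det := by
    rw [← hdd, Real.sqrt_mul_self_eq_abs]
  have hNinv : N⁻¹ = S⁻¹ * S⁻¹ := by rw [← hSS, Matrix.mul_inv_rev]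
  have hq : ∀ y : Fin d → ℝ, (S.mulVec y) ⬝ᵥ N⁻¹.mulVec (S.mulVec y) = ∑ i, y i ^ 2 := by
    intro y
    have e1 : N⁻¹.mulVec (S.mulVec y) = S⁻¹.mulVec y := by
      rw [Matrix.mulVec_mulVec, hNinv, Matrix.mul_assoc, Matrix.nonsing_inv_mul S hu,
        Matrix.mul_one]
    have e2 : S.mulVec y = Matrix.vecMul y S := by
      conv_lhs => rw [← hST]
      rw [Matrix.mulVec_transpose]
    rw [e1, e2, ← Matrix.dotProduct_mulVec, Matrix.mulVec_mulVec, Matrix.mul_nonsing_inv S hu,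
      Matrix.one_mulVec]
    simp [dotProduct, sq]
  have hrow : ∀ k l, (∑ m, S k m * S l m) = N k l := by
    intro k l
    rw [← hSS, Matrix.mul_apply]
    refine Finset.sum_congr rfl fun m _ => ?_
    rw [show S m l = S l m from congrFun (congrFun hST l) m]
  have hsup : ∀ w : Fin d → ℝ, w ∉ Metric.closedBall (0 : Fin d → ℝ) R →
      eta (w ⬝ᵥ N⁻¹.mulVec w) * (w i * w j) = 0 := by
    intro w hw
    rw [mem_closedBall_zero_iff, pi_norm_le_iff_of_nonneg hR] at hw
    push Not at hw
    obtain ⟨k, hk⟩ := hw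
    set y := S⁻¹.mulVec w
    have hy : S.mulVec y = w := by
      simp [y, Matrix.mulVec_mulVec, Matrix.mul_nonsing_inv S hu]
    rw [← hy, hq, eta_zero, zero_mul]
    by_contra hlt
    push Not at hlt
    have hwk : w k = ∑ m, S k m * y m := by rw [← hy]; rfl
    have hcs := Finset.sum_mul_sq_le_sq_mul_sq Finset.univ (fun m => S k m) y
    have hNk : (∑ m, S k m ^ 2) = N k k := by
      rw [← hrow]; exact Finset.sum_congr rfl fun m _ => sq _
    rw [← hwk, hNk] at hcs
    have h1 : R ^ 2 < (w k) ^ 2 := by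
      rw [Real.norm_eq_abs] at hk
      rw [← sq_abs (w k)]
      nlinarith
    have h0 : 0 ≤ N k k := by rw [← hNk]; positivity
    have := hNR k
    have hy0 : 0 ≤ ∑ m, y m ^ 2 := by positivity
    nlinarith
  rw [setIntegral_eq_integral_of_forall_compl_eq_zero hsup]
  have hcov := cov hSd (fun w => eta (w ⬝ᵥ N⁻¹.mulVec w) * (w i * w j))
  have h5 : (∫ y : Fin d → ℝ, eta (S.mulVec y ⬝ᵥ N⁻¹.mulVec (S.mulVec y)) *
      (S.mulVec y i * S.mulVec y j)) = κ * N i j := by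
    have e : ∀ y : Fin d → ℝ, eta (S.mulVec y ⬝ᵥ N⁻¹.mulVec (S.mulVec y)) *
      (S.mulVec y i * S.mulVec y j) = ∑ k, ∑ l, (S i k * S j l) * (Fe y * (y k * y l)) := by
      intro y
      rw [hq]
      change Fe y * ((∑ k, S i k * y k) * (∑ l, S j l * y l)) = _
      rw [Finset.sum_mul_sum, Finset.mul_sum]
      refine Finset.sum_congr rfl fun k _ => ?_
      rw [Finset.mul_sum]
      exact Finset.sum_congr rfl fun l _ => by ring
    simp_rw [e]
    rw [integral_finsetSum _ fun k _ => integrable_finset_sum _ fun l _ => (Fe_int k l).const_mul _]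
    have : ∀ k, (∫ y : Fin d → ℝ, ∑ l, (S i k * S j l) * (Fe y * (y k * y l))) =
        S i k * S j k * κ := by
      intro k
      rw [integral_finsetSum _ fun l _ => (Fe_int k l).const_mul _]
      simp_rw [integral_const_mul, hκ]
      simp
    simp_rw [this]
    rw [← Finset.sum_mul, hrow, mul_comm]
  rw [h5, habs] at hcov
  have hs : 0 < Real.sqrt N.det := Real.sqrt_pos.2 hNd
  rw [mul_assoc, hcov, ← mul_assoc, mul_inv_cancel₀ hs.ne', one_mul]

end
end FPE

namespace FPE
open Set Topology
open scoped MatrixOrder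

section
variable {d : ℕ}

/-- level-n coefficients: smooth, elliptic, constant outside of a compact set -/
structure Lvl (A M : Fin d → Fin d → (Fin d → ℝ) → ℝ → ℝ) (B : Fin d → (Fin d → ℝ) → ℝ → ℝ)
    (Mc : Fin d → Fin d → ℝ) (c0 r0 : ℝ) : Prop where
  hc0 : 0 < c0
  hr0 : 0 ≤ r0
  mC : ∀ i j, ContDiff ℝ 1 fun p : (Fin d → ℝ) × ℝ => M i j p.1 p.2
  msym : ∀ i j x s, M i j x s = M j i x s
  ell : ∀ x s (ξ : Fin d → ℝ), c0 * ∑ i, ξ i ^ 2 ≤ ∑ i, ∑ j, M i j x s * ξ i * ξ j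
  mconst : ∀ i j x s, (r0 < ‖x‖ ∨ r0 < |s|) → M i j x s = Mc i j
  A0 : ∀ i j x, A i j x 0 = 0
  dM : ∀ i j x s, HasDerivAt (A i j x) (M i j x s) s
  bC : ∀ i, ContDiff ℝ 1 fun p : (Fin d → ℝ) × ℝ => B i p.1 p.2
  B0 : ∀ i x, B i x 0 = 0
  bconst : ∀ i x s, (r0 < ‖x‖ ∨ r0 < |s|) → B i x s = 0

variable {A M : Fin d → Fin d → (Fin d → ℝ) → ℝ → ℝ} {B : Fin d → (Fin d → ℝ) → ℝ → ℝ}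
    {Mc : Fin d → Fin d → ℝ} {c0 r0 : ℝ}

lemma Lvl.B_lip (hL : Lvl A M B Mc c0 r0) : ∃ K, 0 ≤ K ∧
    ∀ i x s t, |B i x s - B i x t| ≤ K * |s - t| := by
  have h1 : ∀ i, ∃ C, LipschitzWith C fun p : (Fin d → ℝ) × ℝ => B i p.1 p.2 := by
    intro i
    refine ContDiff.lipschitzWith_of_hasCompactSupport (𝕂 := ℝ) ?_ (hL.bC i) one_ne_zero
    refine HasCompactSupport.intro (isCompact_closedBall (0 : (Fin d → ℝ) × ℝ) r0) fun p hp => ?_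
    rw [mem_closedBall_zero_iff, Prod.norm_def, max_le_iff, not_and_or, not_le, not_le] at hp
    exact hL.bconst i _ _ hp
  choose C hC using h1
  refine ⟨∑ i, (C i : ℝ), Finset.sum_nonneg fun i _ => (C i).2, fun i x s t => ?_⟩
  have := (hC i).dist_le_mul (x, s) (x, t)
  rw [Real.dist_eq, Prod.dist_eq] at this
  simp only [dist_self] at this
  rw [max_eq_right dist_nonneg, Real.dist_eq] at this
  refine this.trans (mul_le_mul_of_nonneg_right ?_ (abs_nonneg _))
  exact Finset.single_le_sum (f := fun i => (C i : ℝ)) (fun i _ => (C i).2) (Finset.mem_univ i)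

lemma Lvl.A_eq (hL : Lvl A M B Mc c0 r0) (i j : Fin d) (x : Fin d → ℝ) (s : ℝ) :
    (∫ r in (0:ℝ)..s, M i j x r) = A i j x s := by
  rw [intervalIntegral.integral_eq_sub_of_hasDerivAt (fun r _ => hL.dM i j x r), hL.A0, sub_zero]
  exact ((hL.mC i j).continuous.comp (Continuous.prodMk_right x)).intervalIntegrable _ _

/-- clamp -/
noncomputable def clp (R y : ℝ) : ℝ := max (-R) (min R y)

lemma clp_cont (R : ℝ) : Continuous (clp R) := by unfold clp; fun_prop

lemma clp_abs {R : ℝ} (hR : 0 ≤ R) (y : ℝ) : |clp R y| ≤ R := by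
  unfold clp
  rw [abs_le]
  exact ⟨le_max_left _ _, max_le (by linarith) (min_le_left _ _)⟩

lemma clp_eq {R y : ℝ} (h : |y| ≤ R) : clp R y = y := by
  unfold clp
  have := abs_le.1 h
  rw [min_eq_right this.2, max_eq_right this.1]

lemma odd_int {R : ℝ} {g : (Fin d → ℝ) → ℝ} (hg : ∀ w, ‖w‖ ≤ R → g (-w) = - g w) :
    (∫ w in Metric.closedBall (0 : Fin d → ℝ) R, g w) = 0 := by
  have h1 : (∫ w in Metric.closedBall (0 : Fin d → ℝ) R, g (-w)) =
      ∫ w in Metric.closedBall (0 : Fin d → ℝ) R, g w :=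
    (neg_mp R).integral_comp (Homeomorph.neg (Fin d → ℝ)).measurableEmbedding g
  have h2 : (∫ w in Metric.closedBall (0 : Fin d → ℝ) R, g (-w)) =
      ∫ w in Metric.closedBall (0 : Fin d → ℝ) R, -g w :=
    setIntegral_congr_fun Metric.isClosed_closedBall.measurableSet
      fun w hw => hg w (by simpa using hw)
  rw [integral_neg] at h2
  linarith

lemma cball_int {R : ℝ} {g : (Fin d → ℝ) → ℝ} (hg : Continuous g) :
    Integrable g (volume.restrict (Metric.closedBall (0 : Fin d → ℝ) R)) :=
  hg.continuousOn.integrableOn_compact (isCompact_closedBall _ _)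

lemma swap_int {R s : ℝ} {g : (Fin d → ℝ) → ℝ → ℝ}
    (hg : Continuous fun p : (Fin d → ℝ) × ℝ => g p.1 p.2) :
    (∫ w in Metric.closedBall (0 : Fin d → ℝ) R, ∫ r in (0:ℝ)..s, g w r) =
      ∫ r in (0:ℝ)..s, ∫ w in Metric.closedBall (0 : Fin d → ℝ) R, g w r := by
  simp_rw [intervalIntegral.intervalIntegral_eq_integral_uIoc, integral_smul]
  congr 1
  refine integral_integral_swap (f := g) ?_
  rw [Measure.prod_restrict]
  refine IntegrableOn.mono_set (t := Metric.closedBall (0 : Fin d → ℝ) R ×ˢ uIcc 0 s) ?_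
    (prod_mono le_rfl uIoc_subset_uIcc)
  exact hg.continuousOn.integrableOn_compact ((isCompact_closedBall _ _).prod isCompact_uIcc)

set_option maxHeartbeats 1000000 in
lemma adm_of_phi (hL : Lvl A M B Mc c0 r0) {R m c2 Φm K : ℝ} (hR : 0 < R) (hm : 0 < m)
    (hmom0 : ∀ k l : Fin d,
      (∫ y in Metric.closedBall (0 : Fin d → ℝ) R, y k * y l) = if k = l then m else 0)
    {Φ : (Fin d → ℝ) → (Fin d → ℝ) → ℝ → ℝ}
    (hc : Continuous fun p : (Fin d → ℝ) × (Fin d → ℝ) × ℝ => Φ p.1 p.2.1 p.2.2)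
    (hc2 : 0 < c2) (hlo : ∀ w x r, c2 ≤ Φ w x r) (hup : ∀ w x r, Φ w x r ≤ Φm)
    (hev : ∀ w x r, Φ (-w) x r = Φ w x r)
    (hmom : ∀ x r i j,
      (∫ w in Metric.closedBall (0 : Fin d → ℝ) R, Φ w x r * (w i * w j)) = 2 * M i j x r)
    (hK : 0 ≤ K)
    (hlip : ∀ w x r ε, ‖w‖ ≤ R → ‖x‖ ≤ r0 + R → |r| ≤ r0 → 0 < ε → ε ≤ 1 →
      |Φ w (x + ε • w) r - Φ w x r| ≤ ε * K)
    (hconst : ∀ w x x' r, (r0 < ‖x‖ ∨ r0 < |r|) → (r0 < ‖x'‖ ∨ r0 < |r|) → Φ w x r = Φ w x' r) :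
    Adm A B := by
  obtain ⟨KB, hKB, hB⟩ := hL.B_lip
  have hr0 := hL.hr0
  have hBm : ∀ i x s, |B i x s| ≤ KB * r0 := by
    intro i x s
    by_cases h : r0 < |s|
    · rw [hL.bconst i x s (Or.inr h), abs_zero]; positivity
    · have := hB i x s 0
      rw [hL.B0, sub_zero, sub_zero] at this
      exact this.trans (mul_le_mul_of_nonneg_left (not_lt.1 h) hKB)
  set q : ℝ := d * (R * (KB / m)) with hq
  have hq0 : 0 ≤ q := by positivity
  set C₀ : ℝ := 2 * r0 * K + 2 * (d * (R * (KB * r0 / m))) with hC0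
  refine ⟨R, c2 / 2, Φm + c2, C₀, Metric.closedBall 0 (r0 + R), min 1 (c2 / (2 * (q + 1))), hR,
    by positivity, Metric.isClosed_closedBall.measurableSet, measure_closedBall_lt_top.ne,
    fun ε hε hε1 => ?_⟩
  have hε1' : ε ≤ 1 := hε1.trans (min_le_left _ _)
  have hεq : ε * q ≤ c2 / 2 := by
    have h1 := hε1.trans (min_le_right _ _)
    rw [le_div_iff₀ (by positivity)] at h1
    nlinarith
  have hΦr : ∀ w x, Continuous fun r => Φ w x r := fun w x =>
    hc.comp (continuous_const.prodMk (continuous_const.prodMk continuous_id))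
  have hΦi : ∀ w x s t, IntervalIntegrable (fun r => Φ w x r) volume s t := fun w x s t =>
    (hΦr w x).intervalIntegrable _ _
  set β : (Fin d → ℝ) → (Fin d → ℝ) → ℝ → ℝ := fun w x s => ∫ r in (0:ℝ)..s, Φ w x r with hβ
  set E : (Fin d → ℝ) → (Fin d → ℝ) → ℝ → ℝ :=
    fun w x s => ∑ i, clp R (w i) * (B i x s / m) with hE
  have hβc : Continuous fun p : (Fin d → ℝ) × (Fin d → ℝ) × ℝ => β p.1 p.2.1 p.2.2 := by
    refine intervalIntegral.continuous_parametric_intervalIntegral_of_continuous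
      (f := fun (p : (Fin d → ℝ) × (Fin d → ℝ) × ℝ) r => Φ p.1 p.2.1 r) ?_ (by fun_prop)
    exact hc.comp (by fun_prop : Continuous fun z : ((Fin d → ℝ) × (Fin d → ℝ) × ℝ) × ℝ =>
      (z.1.1, z.1.2.1, z.2))
  have hEc : Continuous fun p : (Fin d → ℝ) × (Fin d → ℝ) × ℝ => E p.1 p.2.1 p.2.2 := by
    refine continuous_finset_sum _ fun i _ => ?_
    have h1 : Continuous fun p : (Fin d → ℝ) × (Fin d → ℝ) × ℝ => B i p.2.1 p.2.2 :=
      (hL.bC i).continuous.comp continuous_snd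
    have h2 : Continuous fun p : (Fin d → ℝ) × (Fin d → ℝ) × ℝ => clp R (p.1 i) :=
      (clp_cont R).comp (by fun_prop)
    exact h2.mul (h1.div_const m)
  have hElip : ∀ w x u v, |E w x v - E w x u| ≤ q * |v - u| := by
    intro w x u v
    simp only [hE, ← Finset.sum_sub_distrib]
    refine (Finset.abs_sum_le_sum_abs _ _).trans ?_
    have : ∀ i ∈ (Finset.univ : Finset (Fin d)), |clp R (w i) * (B i x v / m) -
        clp R (w i) * (B i x u / m)| ≤ R * (KB / m) * |v - u| := by
      intro i _
      rw [← mul_sub, ← sub_div, abs_mul, abs_div, abs_of_pos hm]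
      calc _ ≤ R * (KB * |v - u| / m) := by
            gcongr
            · exact clp_abs hR.le _
            · exact hB i x v u
        _ = _ := by ring
    refine (Finset.sum_le_sum this).trans (le_of_eq ?_)
    simp [hq]; ring
  have hEb : ∀ w x s, |E w x s| ≤ d * (R * (KB * r0 / m)) := by
    intro w x s
    simp only [hE]
    refine (Finset.abs_sum_le_sum_abs _ _).trans ?_
    have : ∀ i ∈ (Finset.univ : Finset (Fin d)), |clp R (w i) * (B i x s / m)| ≤
        R * (KB * r0 / m) := by
      intro i _
      rw [abs_mul, abs_div, abs_of_pos hm]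
      gcongr
      · exact clp_abs hR.le _
      · exact hBm i x s
    refine (Finset.sum_le_sum this).trans (le_of_eq ?_)
    simp
  have hβsub : ∀ w x u v, β w x v - β w x u = ∫ r in u..v, Φ w x r := fun w x u v =>
    intervalIntegral.integral_interval_sub_left (hΦi w x 0 v) (hΦi w x 0 u)
  have hβlo : ∀ w x u v, u ≤ v → c2 * (v - u) ≤ β w x v - β w x u := by
    intro w x u v huv
    rw [hβsub]
    have := intervalIntegral.integral_mono_on huv
      (intervalIntegrable_const (c := c2)) (hΦi w x u v) fun r _ => hlo w x r
    rw [intervalIntegral.integral_const, smul_eq_mul, mul_comm] at this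
    exact this
  have hβup : ∀ w x u v, u ≤ v → β w x v - β w x u ≤ Φm * (v - u) := by
    intro w x u v huv
    rw [hβsub]
    have := intervalIntegral.integral_mono_on huv (hΦi w x u v)
      (intervalIntegrable_const (c := Φm)) fun r _ => hup w x r
    rw [intervalIntegral.integral_const, smul_eq_mul, mul_comm] at this
    exact this
  have hβev : ∀ w x s, β (-w) x s = β w x s := fun w x s => by simp only [hβ, hev]
  have hEodd : ∀ w x s, ‖w‖ ≤ R → E (-w) x s = - E w x s := by
    intro w x s hw
    simp only [hE, ← Finset.sum_neg_distrib]
    refine Finset.sum_congr rfl fun i _ => ?_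
    have h1 : |w i| ≤ R := (norm_le_pi_norm w i).trans hw
    rw [clp_eq h1, clp_eq (by simpa using h1)]
    simp
  have hβw : ∀ x s, Continuous fun w => β w x s := fun x s =>
    hβc.comp (by fun_prop : Continuous fun w : Fin d → ℝ => (w, x, s))
  have hEw : ∀ x s, Continuous fun w => E w x s := fun x s =>
    hEc.comp (by fun_prop : Continuous fun w : Fin d → ℝ => (w, x, s))
  refine ⟨fun w x s => β w x s + ε * E w x s, ⟨⟨hβc.add (continuous_const.mul hEc), ?_, by positivity,
    ?_, ?_⟩, ?_, ?_, ?_⟩⟩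
  · intro w x
    simp [hβ, hE, hL.B0]
  · intro w x u v huv
    have h1 := hβlo w x u v huv
    have h2 := abs_le.1 (hElip w x u v)
    rw [abs_of_nonneg (sub_nonneg.2 huv)] at h2
    have h3 := mul_le_mul_of_nonneg_right hεq (sub_nonneg.2 huv)
    nlinarith
  · intro w x u v huv
    have h1 := hβup w x u v huv
    have h2 := abs_le.1 (hElip w x u v)
    rw [abs_of_nonneg (sub_nonneg.2 huv)] at h2
    have h3 := mul_le_mul_of_nonneg_right hεq (sub_nonneg.2 huv)
    have h4 : 0 ≤ c2 * (v - u) := mul_nonneg hc2.le (sub_nonneg.2 huv)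
    nlinarith
  · intro x s j
    have e1 : (∫ w in Metric.closedBall (0 : Fin d → ℝ) R, β w x s * w j) = 0 :=
      odd_int fun w hw => by rw [hβev]; simp
    have e2 : (∫ w in Metric.closedBall (0 : Fin d → ℝ) R, ε * E w x s * w j) = ε * B j x s := by
      have : (∫ w in Metric.closedBall (0 : Fin d → ℝ) R, ε * E w x s * w j) =
          ∫ w in Metric.closedBall (0 : Fin d → ℝ) R, ∑ i, (ε * (B i x s / m)) * (w i * w j) := by
        refine setIntegral_congr_fun Metric.isClosed_closedBall.measurableSet fun w hw => ?_
        have hw' : ‖w‖ ≤ R := by simpa using hw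
        simp only [hE, Finset.mul_sum, Finset.sum_mul]
        refine Finset.sum_congr rfl fun i _ => ?_
        rw [clp_eq ((norm_le_pi_norm w i).trans hw')]
        ring
      rw [this, integral_finsetSum _ fun i _ => cball_int (by fun_prop)]
      simp_rw [integral_const_mul, hmom0]
      simp
      field_simp
    have := integral_add (cball_int (R := R) (g := fun w => β w x s * w j)
      ((hβw x s).mul (by fun_prop)))
      (cball_int (R := R) (g := fun w => ε * E w x s * w j)
      ((continuous_const.mul (hEw x s)).mul (by fun_prop)))
    rw [e1, e2, zero_add] at this
    rw [← this]
    congr 1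
    funext w
    ring
  · intro x s i j
    have e1 : (∫ w in Metric.closedBall (0 : Fin d → ℝ) R, ε * E w x s * (w i * w j)) = 0 :=
      odd_int fun w hw => by rw [hEodd w x s hw]; simp
    have e2 : (∫ w in Metric.closedBall (0 : Fin d → ℝ) R, β w x s * (w i * w j)) =
        2 * A i j x s := by
      have : ∀ w : Fin d → ℝ, β w x s * (w i * w j) = ∫ r in (0:ℝ)..s, Φ w x r * (w i * w j) := by
        intro w
        rw [intervalIntegral.integral_mul_const]
      simp_rw [this]
      rw [swap_int]
      · simp_rw [hmom]
        rw [intervalIntegral.integral_const_mul, hL.A_eq]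
      · have : Continuous fun p : (Fin d → ℝ) × ℝ => Φ p.1 x p.2 :=
          hc.comp (by fun_prop : Continuous fun p : (Fin d → ℝ) × ℝ => (p.1, x, p.2))
        exact this.mul (by fun_prop)
    have := integral_add (cball_int (R := R) (g := fun w => β w x s * (w i * w j))
      ((hβw x s).mul (by fun_prop)))
      (cball_int (R := R) (g := fun w => ε * E w x s * (w i * w j))
      ((continuous_const.mul (hEw x s)).mul (by fun_prop)))
    rw [e1, e2, add_zero] at this
    rw [← this]
    congr 1
    funext w
    ring
  · filter_upwards [ae_ball R] with w hw x s
    have hεw : ‖ε • w‖ ≤ R := by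
      rw [norm_smul, Real.norm_eq_abs, abs_of_pos hε]
      nlinarith [norm_nonneg w]
    rw [hβev]
    by_cases hx : x ∈ Metric.closedBall (0 : Fin d → ℝ) (r0 + R)
    · rw [indicator_of_mem hx]
      have hx' : ‖x‖ ≤ r0 + R := by simpa using hx
      have h1 : |β w (x + ε • w) s - β w x s| ≤ 2 * r0 * (ε * K) := by
        have e : β w (x + ε • w) s - β w x s =
            ∫ r in (0:ℝ)..s, (Φ w (x + ε • w) r - Φ w x r) :=
          (intervalIntegral.integral_sub (hΦi _ _ _ _) (hΦi _ _ _ _)).symm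
        rw [e, ← Real.norm_eq_abs]
        refine intervalIntegral.norm_integral_le_integral_norm_uIoc.trans ?_
        have hpt : ∀ r, ‖Φ w (x + ε • w) r - Φ w x r‖ ≤
            (Icc (-r0) r0).indicator (fun _ => ε * K) r := by
          intro r
          by_cases hr : |r| ≤ r0
          · rw [indicator_of_mem (mem_Icc.2 (abs_le.1 hr))]
            exact hlip w x r ε hw hx' hr hε hε1'
          · rw [hconst w (x + ε • w) x r (Or.inr (not_le.1 hr)) (Or.inr (not_le.1 hr)), sub_self,
              norm_zero]
            exact indicator_nonneg (fun _ _ => by positivity) _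
        have hind : Integrable ((Icc (-r0) r0).indicator (fun _ : ℝ => ε * K)) :=
          (integrable_indicator_iff measurableSet_Icc).2
            (integrableOn_const (hs := measure_Icc_lt_top.ne))
        calc _ ≤ ∫ r in uIoc 0 s, (Icc (-r0) r0).indicator (fun _ => ε * K) r := by
              refine integral_mono_of_nonneg (Eventually.of_forall fun r => norm_nonneg _)
                hind.integrableOn (Eventually.of_forall hpt)
          _ ≤ ∫ r, (Icc (-r0) r0).indicator (fun _ => ε * K) r := by
              refine setIntegral_le_integral hind (Eventually.of_forall fun r => ?_)
              exact indicator_nonneg (fun _ _ => by positivity) _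
          _ = _ := by
              rw [integral_indicator measurableSet_Icc, setIntegral_const, Measure.real,
                Real.volume_Icc, ENNReal.toReal_ofReal (by linarith), smul_eq_mul]
              ring
      have h2 := hEb (-w) (x + ε • w) s
      have h3 := hEb w x s
      have h4 := abs_le.1 h1
      have h5 := abs_le.1 h2
      have h6 := abs_le.1 h3
      have h7 : |E (-w) (x + ε • w) s - E w x s| ≤ 2 * (d * (R * (KB * r0 / m))) :=
        (abs_sub _ _).trans (by linarith)
      calc _ = |(β w (x + ε • w) s - β w x s) + ε * (E (-w) (x + ε • w) s - E w x s)| := by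
            congr 1; ring
        _ ≤ _ := abs_add_le _ _
        _ ≤ 2 * r0 * (ε * K) + ε * (2 * (d * (R * (KB * r0 / m)))) := by
            rw [abs_mul, abs_of_pos hε]
            gcongr
        _ = _ := by rw [hC0]; ring
    · rw [indicator_of_notMem hx]
      have hx' : r0 + R < ‖x‖ := by simpa using hx
      have h1 : r0 < ‖x + ε • w‖ := by
        have := norm_sub_le (x + ε • w) (ε • w)
        rw [add_sub_cancel_right] at this
        linarith
      have h2 : r0 < ‖x‖ := by linarith
      have e1 : β w (x + ε • w) s = β w x s := by
        simp only [hβ]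
        congr 1
        funext r
        exact hconst w _ _ r (Or.inl h1) (Or.inl h2)
      have e2 : ∀ w y, r0 < ‖y‖ → E w y s = 0 := by
        intro w y hy
        simp only [hE]
        refine Finset.sum_eq_zero fun i _ => ?_
        rw [hL.bconst i y s (Or.inl hy)]
        simp
      rw [e1, e2 _ _ h1, e2 _ _ h2]
      simp

end
end FPE

namespace FPE
open Set Topology
open scoped MatrixOrder

section
variable {d : ℕ}
variable {A M : Fin d → Fin d → (Fin d → ℝ) → ℝ → ℝ} {B : Fin d → (Fin d → ℝ) → ℝ → ℝ}
    {Mc : Fin d → Fin d → ℝ} {c0 r0 : ℝ}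

lemma bdd_of_const {f : (Fin d → ℝ) → ℝ → ℝ} (hf : Continuous fun p : (Fin d → ℝ) × ℝ => f p.1 p.2)
    {a : ℝ} (h : ∀ x s, (r0 < ‖x‖ ∨ r0 < |s|) → f x s = a) : ∃ C, 0 ≤ C ∧ ∀ x s, |f x s| ≤ C := by
  obtain ⟨C, hC⟩ := (isCompact_closedBall (0 : (Fin d → ℝ) × ℝ) r0).exists_bound_of_continuousOn
    hf.continuousOn
  refine ⟨max C |a|, le_max_of_le_right (abs_nonneg _), fun x s => ?_⟩
  by_cases hp : ((x, s) : (Fin d → ℝ) × ℝ) ∈ Metric.closedBall (0 : (Fin d → ℝ) × ℝ) r0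
  · exact (hC _ hp).trans (le_max_left _ _)
  · rw [mem_closedBall_zero_iff, Prod.norm_def, max_le_iff, not_and_or, not_le, not_le] at hp
    rw [h x s hp]
    exact le_max_right _ _

lemma contDiff_det {X : Type*} [NormedAddCommGroup X] [NormedSpace ℝ X]
    {N : X → Matrix (Fin d) (Fin d) ℝ} (h : ∀ i j, ContDiff ℝ 1 fun x => N x i j) :
    ContDiff ℝ 1 fun x => (N x).det := by
  simp_rw [Matrix.det_apply]
  refine ContDiff.sum fun σ _ => ?_
  simp_rw [Units.smul_def, zsmul_eq_mul]
  exact contDiff_const.mul (contDiff_prod fun i _ => h _ _)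

lemma contDiff_inv {X : Type*} [NormedAddCommGroup X] [NormedSpace ℝ X]
    {N : X → Matrix (Fin d) (Fin d) ℝ} (h : ∀ i j, ContDiff ℝ 1 fun x => N x i j)
    (h0 : ∀ x, (N x).det ≠ 0) (i j : Fin d) :
    ContDiff ℝ 1 fun x => (N x)⁻¹ i j := by
  simp_rw [Matrix.inv_def, Ring.inverse_eq_inv', Matrix.smul_apply, smul_eq_mul,
    Matrix.adjugate_apply]
  refine ((contDiff_det h).inv h0).mul (contDiff_det fun k l => ?_)
  simp_rw [Matrix.updateRow_apply]
  split_ifs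
  · exact contDiff_const
  · exact h k l

set_option maxHeartbeats 1000000 in
lemma Lvl.adm (hd : 1 ≤ d) (hL : Lvl A M B Mc c0 r0) : Adm A B := by
  have hc0 := hL.hc0
  have hr0 := hL.hr0
  set θ : ℝ := c0 / 2 with hθ
  have hθ0 : 0 < θ := by positivity
  obtain ⟨κ, hκ, hκm⟩ := Fe_kappa hd
  set N : (Fin d → ℝ) → ℝ → Matrix (Fin d) (Fin d) ℝ :=
    fun x s => Matrix.of fun i j => M i j x s - if i = j then θ else 0 with hN
  set Nc : Matrix (Fin d) (Fin d) ℝ := Matrix.of fun i j => Mc i j - if i = j then θ else 0 with hNc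
  have hNN : ∀ x s i j, N x s i j = M i j x s - if i = j then θ else 0 := fun _ _ _ _ => rfl
  have hNconst : ∀ x s, (r0 < ‖x‖ ∨ r0 < |s|) → N x s = Nc := by
    intro x s h
    ext i j
    simp only [hN, hNc, Matrix.of_apply, hL.mconst i j x s h]
  have hPD : ∀ x s, (N x s).PosDef := by
    intro x s
    refine Matrix.PosDef.of_dotProduct_mulVec_pos ?_ ?_
    · ext i j
      simp only [Matrix.conjTranspose_apply, hNN, star_trivial, hL.msym j i, eq_comm]
    · intro ξ hξ
      have e : star ξ ⬝ᵥ (N x s).mulVec ξ = (∑ i, ∑ j, M i j x s * ξ i * ξ j) - θ * ∑ i, ξ i ^ 2 := by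
        simp only [dotProduct, Matrix.mulVec, hNN, star_trivial, Finset.mul_sum]
        rw [← Finset.sum_sub_distrib]
        refine Finset.sum_congr rfl fun i _ => ?_
        have : θ * ξ i ^ 2 = ∑ j, (if i = j then θ else 0) * ξ i * ξ j := by
          simp; ring
        rw [this, ← Finset.sum_sub_distrib]
        exact Finset.sum_congr rfl fun j _ => by ring
      have hpos : 0 < ∑ i, ξ i ^ 2 := by
        obtain ⟨i, hi⟩ := Function.ne_iff.1 hξ
        refine Finset.sum_pos' (fun i _ => sq_nonneg _) ⟨i, Finset.mem_univ i, ?_⟩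
        have : ξ i ≠ 0 := hi
        positivity
      rw [e]
      have := hL.ell x s ξ
      nlinarith
  have hdet : ∀ x s, 0 < (N x s).det := fun x s => (hPD x s).det_pos
  have hNC : ∀ i j, ContDiff ℝ 1 fun p : (Fin d → ℝ) × ℝ => N p.1 p.2 i j := fun i j =>
    (hL.mC i j).sub contDiff_const
  have hdC := contDiff_det hNC
  -- the radius
  have hb := fun i : Fin d => bdd_of_const (r0 := r0) (f := fun x s => N x s i i) (hNC i i).continuous
    (a := Nc i i) fun x s h => by rw [hNconst x s h]
  choose Cb hCb0 hCb using hb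
  set R : ℝ := 1 + ∑ i, Cb i with hR
  have hs0 : 0 ≤ ∑ i, Cb i := Finset.sum_nonneg fun i _ => hCb0 i
  have hR0 : 0 < R := by linarith
  have hNR : ∀ x s i, N x s i i ≤ R ^ 2 := by
    intro x s i
    have h1 := (le_abs_self _).trans (hCb i x s)
    have h2 := Finset.single_le_sum (f := Cb) (fun i _ => hCb0 i) (Finset.mem_univ i)
    nlinarith
  obtain ⟨m, hm, hmm⟩ := ball_moment hd hR0
  set c2 : ℝ := 2 * θ / m with hc2
  -- the density
  set D : (Fin d → ℝ) → ℝ → ℝ := fun x s => 2 / (κ * Real.sqrt (N x s).det) with hD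
  have hDpos : ∀ x s, 0 < D x s := fun x s => by
    have := Real.sqrt_pos.2 (hdet x s)
    positivity
  have hDC : ContDiff ℝ 1 fun p : (Fin d → ℝ) × ℝ => D p.1 p.2 := by
    refine contDiff_const.div (contDiff_const.mul (hdC.sqrt fun p => (hdet _ _).ne')) fun p => ?_
    have := Real.sqrt_pos.2 (hdet p.1 p.2)
    positivity
  obtain ⟨Dm, hDm0, hDm⟩ := bdd_of_const (r0 := r0) (f := D) hDC.continuous
    (a := 2 / (κ * Real.sqrt Nc.det)) fun x s h => by simp only [hD, hNconst x s h]
  set Q : (Fin d → ℝ) → (Fin d → ℝ) → ℝ → ℝ := fun w x s => w ⬝ᵥ (N x s)⁻¹.mulVec w with hQ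
  have hQC : ContDiff ℝ 1 fun p : (Fin d → ℝ) × (Fin d → ℝ) × ℝ => Q p.1 p.2.1 p.2.2 := by
    simp only [hQ, dotProduct, Matrix.mulVec]
    refine ContDiff.sum fun i _ => ContDiff.mul (by fun_prop) (ContDiff.sum fun j _ => ?_)
    refine ContDiff.mul ?_ (by fun_prop)
    exact (contDiff_inv hNC (fun p => (hdet _ _).ne') i j).comp contDiff_snd
  set Φ : (Fin d → ℝ) → (Fin d → ℝ) → ℝ → ℝ := fun w x s => D x s * eta (Q w x s) + c2 with hΦ
  have hΦC : ContDiff ℝ 1 fun p : (Fin d → ℝ) × (Fin d → ℝ) × ℝ => Φ p.1 p.2.1 p.2.2 :=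
    ((hDC.comp contDiff_snd).mul (eta_contDiff.comp hQC)).add contDiff_const
  obtain ⟨K, hK⟩ := (hΦC.contDiffOn (s := Metric.closedBall 0 R ×ˢ
      (Metric.closedBall (0 : Fin d → ℝ) (r0 + 2 * R) ×ˢ Metric.closedBall (0 : ℝ) r0))).exists_lipschitzOnWith
    one_ne_zero ((convex_closedBall _ _).prod ((convex_closedBall _ _).prod (convex_closedBall _ _)))
    ((isCompact_closedBall _ _).prod ((isCompact_closedBall _ _).prod (isCompact_closedBall _ _)))
  refine adm_of_phi (Φ := Φ) (m := m) (c2 := c2) (Φm := Dm + c2) (K := K * R) hL hR0 hm hmm hΦC.continuous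
    (by positivity) ?_ ?_ ?_ ?_ (by positivity) ?_ ?_
  · intro w x r
    have := mul_nonneg (hDpos x r).le (eta_nonneg (Q w x r))
    simp only [hΦ]; linarith
  · intro w x r
    have h1 := mul_le_mul_of_nonneg_left (eta_le_one (Q w x r)) (hDpos x r).le
    have h2 := (le_abs_self _).trans (hDm x r)
    simp only [hΦ]; linarith
  · intro w x r
    simp [hΦ, hQ, Matrix.mulVec_neg]
  · intro x r i j
    have h1 := kern_moment hκm (hPD x r) hR0.le (hNR x r) i j
    have hQw : Continuous fun w => Q w x r :=
      hQC.continuous.comp (by fun_prop : Continuous fun w : Fin d → ℝ => (w, x, r))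
    have i1 : Integrable (fun w => D x r * (eta (Q w x r) * (w i * w j)))
        (volume.restrict (Metric.closedBall (0 : Fin d → ℝ) R)) :=
      cball_int (continuous_const.mul ((eta_cont.comp hQw).mul (by fun_prop)))
    have i2 : Integrable (fun w : Fin d → ℝ => c2 * (w i * w j))
        (volume.restrict (Metric.closedBall (0 : Fin d → ℝ) R)) := cball_int (by fun_prop)
    have h2 := integral_add i1 i2
    rw [integral_const_mul, integral_const_mul, hmm, h1] at h2
    have h3 : (∫ w in Metric.closedBall (0 : Fin d → ℝ) R, Φ w x r * (w i * w j)) =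
      ∫ w in Metric.closedBall (0 : Fin d → ℝ) R,
        (D x r * (eta (Q w x r) * (w i * w j)) + c2 * (w i * w j)) := by
      congr 1
      funext w
      simp only [hΦ]; ring
    rw [h3, h2]
    have hs := Real.sqrt_pos.2 (hdet x r)
    simp only [hD, hNN, hc2]
    split_ifs <;> field_simp <;> ring
  · intro w x r ε hw hx hr hε hε1
    have hεw : ‖ε • w‖ ≤ ε * R := by
      rw [norm_smul, Real.norm_eq_abs, abs_of_pos hε]
      gcongr
    have hεR : ε * R ≤ R := by nlinarith
    have := hK.dist_le_mul (w, x + ε • w, r) ⟨by simpa using hw, by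
        rw [mem_closedBall_zero_iff]
        linarith [norm_add_le x (ε • w)], by simpa using hr⟩ (w, x, r) ⟨by simpa using hw, by
        rw [mem_closedBall_zero_iff]; linarith, by simpa using hr⟩
    simp only [Prod.dist_eq, dist_self] at this
    rw [Real.dist_eq, dist_eq_norm, add_sub_cancel_left] at this
    rw [max_eq_left (norm_nonneg _), max_eq_right (norm_nonneg _)] at this
    calc _ ≤ _ := this
      _ ≤ K * (ε * R) := by gcongr
      _ = _ := by ring
  · intro w x x' r h h'
    simp only [hΦ, hD, hQ, hNconst x r h, hNconst x' r h']

end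
end FPE

namespace FPE
open Set Topology

section
variable {d : ℕ}

lemma exists_zeta : ∃ Z : ℝ, 0 ≤ Z ∧ ∀ N : ℝ, 0 < N → ∃ ζ : ℝ → ℝ, ContDiff ℝ 2 ζ ∧
    (∀ s, 0 ≤ ζ s) ∧ (∀ s, ζ s ≤ 1) ∧ (∀ s, s ^ 2 ≤ N → ζ s = 1) ∧
    (∃ r, 0 ≤ r ∧ ∀ s, r < |s| → ζ s = 0) ∧ ∀ s, |s * deriv ζ s| ≤ Z / N := by
  have hTs : ContDiff ℝ 2 Real.smoothTransition := Real.smoothTransition.contDiff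
  have hsup : HasCompactSupport (deriv Real.smoothTransition) := by
    refine HasCompactSupport.intro (isCompact_Icc (a := (0:ℝ)) (b := 1)) fun y hy => ?_
    rw [mem_Icc, not_and_or, not_le, not_le] at hy
    rcases hy with hy | hy
    · have : Real.smoothTransition =ᶠ[𝓝 y] fun _ => (0:ℝ) := by
        filter_upwards [eventually_lt_nhds hy] with z hz
        exact Real.smoothTransition.zero_of_nonpos hz.le
      rw [this.deriv_eq]; simp
    · have : Real.smoothTransition =ᶠ[𝓝 y] fun _ => (1:ℝ) := by
        filter_upwards [eventually_gt_nhds hy] with z hz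
        exact Real.smoothTransition.one_of_one_le hz.le
      rw [this.deriv_eq]; simp
  obtain ⟨T, hT⟩ := hsup.exists_bound_of_continuous (hTs.continuous_deriv (by norm_num))
  have hT0 : 0 ≤ T := (norm_nonneg _).trans (hT 0)
  refine ⟨2 * T, by positivity, fun N hN => ?_⟩
  have h1 : ∀ s : ℝ, 0 < 1 + s ^ 2 := fun s => by positivity
  have hin : ContDiff ℝ 2 fun s : ℝ => 2 - Real.log (1 + s ^ 2) / N :=
    contDiff_const.sub ((ContDiff.log (by fun_prop) fun s => (h1 s).ne').div_const N)
  refine ⟨fun s => Real.smoothTransition (2 - Real.log (1 + s ^ 2) / N), hTs.comp hin,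
    fun s => Real.smoothTransition.nonneg _, fun s => Real.smoothTransition.le_one _, ?_, ?_, ?_⟩
  · intro s hs
    refine Real.smoothTransition.one_of_one_le ?_
    have h2 := Real.log_le_sub_one_of_pos (h1 s)
    have : Real.log (1 + s ^ 2) / N ≤ 1 := by rw [div_le_one hN]; linarith
    linarith
  · refine ⟨Real.exp (2 * N), by positivity, fun s hs => ?_⟩
    refine Real.smoothTransition.zero_of_nonpos ?_
    have h2 : 2 * N ≤ Real.log (1 + s ^ 2) := by
      rw [Real.le_log_iff_exp_le (h1 s), ← sq_abs]
      nlinarith [Real.exp_pos (2 * N), sq_nonneg (|s| - 1)]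
    have : 2 ≤ Real.log (1 + s ^ 2) / N := by rw [le_div_iff₀ hN]; exact h2
    linarith
  · intro s
    have hd1 : HasDerivAt (fun s : ℝ => 2 - Real.log (1 + s ^ 2) / N)
        (-((2 * s) / (1 + s ^ 2) / N)) s := by
      have e1 : HasDerivAt (fun s : ℝ => 1 + s ^ 2) (2 * s) s := by
        simpa using (hasDerivAt_pow 2 s).const_add 1
      have e2 := ((e1.log (h1 s).ne').div_const N).const_sub 2
      exact e2
    have hd2 := ((hTs.differentiable (by norm_num) (2 - Real.log (1 + s ^ 2) / N)).hasDerivAt).comp s hd1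
    have hd3 : deriv (fun s => Real.smoothTransition (2 - Real.log (1 + s ^ 2) / N)) s =
      deriv Real.smoothTransition (2 - Real.log (1 + s ^ 2) / N) * (-((2 * s) / (1 + s ^ 2) / N)) :=
      hd2.deriv
    rw [hd3]
    have e : s * (deriv Real.smoothTransition (2 - Real.log (1 + s ^ 2) / N) *
        (-((2 * s) / (1 + s ^ 2) / N))) =
        -(deriv Real.smoothTransition (2 - Real.log (1 + s ^ 2) / N) * (2 * (s ^ 2 / (1 + s ^ 2)) / N)) := by
      ring
    have h3 : s ^ 2 / (1 + s ^ 2) ≤ 1 := by rw [div_le_one (h1 s)]; linarith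
    have h4 : 0 ≤ s ^ 2 / (1 + s ^ 2) := by positivity
    rw [e, abs_neg, abs_mul, abs_of_nonneg (by positivity : 0 ≤ 2 * (s ^ 2 / (1 + s ^ 2)) / N)]
    calc _ ≤ T * (2 * 1 / N) := by
          gcongr
          exact hT _
      _ = _ := by ring

/-- the standing hypotheses -/
structure Hyp (a : Fin d → Fin d → (Fin d → ℝ) → ℝ → ℝ) (b : Fin d → (Fin d → ℝ) → ℝ → ℝ)
    (γ K : ℝ) : Prop where
  sa : ∀ i j, ContDiff ℝ 2 fun p : (Fin d → ℝ) × ℝ => a i j p.1 p.2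
  ba : ∀ i j x r, |a i j x r| ≤ K
  bx : ∀ i j x r, ‖fderiv ℝ (fun y => a i j y r) x‖ ≤ K
  sym : ∀ i j x r, a i j x r = a j i x r
  hγ : 0 < γ
  hK : 0 ≤ K
  ell : ∀ (x ξ : Fin d → ℝ) (r : ℝ),
      γ * ∑ i, ξ i ^ 2 ≤ ∑ i, ∑ j, (a i j x r + r * deriv (fun s => a i j x s) r) * ξ i * ξ j
  sb : ∀ i, ContDiff ℝ 1 fun p : (Fin d → ℝ) × ℝ => b i p.1 p.2
  bb : ∀ i x r, |b i x r| ≤ K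
  zb : ∀ i x, b i x 0 = 0

variable {a : Fin d → Fin d → (Fin d → ℝ) → ℝ → ℝ} {b : Fin d → (Fin d → ℝ) → ℝ → ℝ} {γ K : ℝ}

lemma quad_abs (c : Fin d → Fin d → ℝ) {K : ℝ} (h : ∀ i j, |c i j| ≤ K) (ξ : Fin d → ℝ) :
    |∑ i, ∑ j, c i j * ξ i * ξ j| ≤ d * K * ∑ i, ξ i ^ 2 := by
  have h1 : ∀ i j, |c i j * ξ i * ξ j| ≤ K / 2 * ξ i ^ 2 + K / 2 * ξ j ^ 2 := by
    intro i j
    have hK : 0 ≤ K := (abs_nonneg _).trans (h i j)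
    rw [mul_assoc, abs_mul]
    have h2 : |ξ i * ξ j| ≤ (ξ i ^ 2 + ξ j ^ 2) / 2 := by
      rw [abs_le]
      constructor <;> nlinarith [sq_nonneg (ξ i + ξ j), sq_nonneg (ξ i - ξ j)]
    have := mul_le_mul (h i j) h2 (abs_nonneg _) hK
    linarith
  calc _ ≤ ∑ i, ∑ j, |c i j * ξ i * ξ j| :=
        (Finset.abs_sum_le_sum_abs _ _).trans
          (Finset.sum_le_sum fun i _ => Finset.abs_sum_le_sum_abs _ _)
    _ ≤ ∑ i, ∑ j, (K / 2 * ξ i ^ 2 + K / 2 * ξ j ^ 2) :=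
        Finset.sum_le_sum fun i _ => Finset.sum_le_sum fun j _ => h1 i j
    _ = _ := by
        simp only [Finset.sum_add_distrib, Finset.sum_const, Finset.card_univ, Fintype.card_fin,
          nsmul_eq_mul, ← Finset.mul_sum]
        ring

lemma Hyp.du (H : Hyp a b γ K) (i j : Fin d) (x : Fin d → ℝ) (s : ℝ) :
    HasDerivAt (a i j x) (fderiv ℝ (fun p : (Fin d → ℝ) × ℝ => a i j p.1 p.2) (x, s) (0, 1)) s := by
  have h1 := ((H.sa i j).differentiable (by norm_num) (x, s)).hasFDerivAt
  have h2 : HasDerivAt (fun s : ℝ => ((x, s) : (Fin d → ℝ) × ℝ)) (0, 1) s :=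
    (hasDerivAt_const s x).prodMk (hasDerivAt_id s)
  exact h1.comp_hasDerivAt s h2

lemma Hyp.dx (H : Hyp a b γ K) (i j k : Fin d) (x : Fin d → ℝ) (s : ℝ) :
    pd k (fun y => a i j y s) x =
      fderiv ℝ (fun p : (Fin d → ℝ) × ℝ => a i j p.1 p.2) (x, s) (Pi.single k 1, 0) := by
  have h1 := ((H.sa i j).differentiable (by norm_num) (x, s)).hasFDerivAt
  have h2 : HasFDerivAt (fun y : Fin d → ℝ => ((y, s) : (Fin d → ℝ) × ℝ))
      ((ContinuousLinearMap.id ℝ (Fin d → ℝ)).prod 0) x :=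
    (hasFDerivAt_id x).prodMk (hasFDerivAt_const s x)
  have h3 := HasFDerivAt.comp x h1 h2
  unfold pd
  have h4 : fderiv ℝ (fun y => a i j y s) x = _ := h3.fderiv
  rw [h4]
  simp

set_option maxHeartbeats 2000000 in
lemma levels (H : Hyp a b γ K) (hd : 1 ≤ d) : ∃ L C : ℝ, 0 ≤ L ∧ 0 ≤ C ∧ ∀ n : ℕ,
    ∃ (A M P : Fin d → Fin d → (Fin d → ℝ) → ℝ → ℝ) (B : Fin d → (Fin d → ℝ) → ℝ → ℝ) (L' : ℝ),
      Nice A M P B L (γ / 2) C L' ∧ Adm A B ∧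
      (∀ i j x (s : ℝ), ‖x‖ ≤ n → |s| ≤ n → A i j x s = a i j x s * s) ∧
      (∀ i x (s : ℝ), ‖x‖ ≤ n → |s| ≤ n → B i x s = b i x s * s) := by
  obtain ⟨Z, hZ, hz⟩ := exists_zeta
  obtain ⟨Cχ, hCχ, hcut⟩ := exists_cut d
  have hγ := H.hγ
  have hK := H.hK
  refine ⟨K + 2 * γ, Cχ * (K + γ) + K, by positivity, by positivity, fun n => ?_⟩
  obtain ⟨φ, hφ, hφ0, hφ1, hφout, hφin⟩ := hcut (n + 1) (by linarith [n.cast_nonneg (α := ℝ)])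
  set n0 : ℝ := 2 * Z * (d * (K + γ)) / γ + 1 with hn0
  have hn00 : 0 < n0 := by positivity
  obtain ⟨ζ, hζs, hζ0, hζ1, hζone, ⟨rζ, hrζ, hζout⟩, hζd⟩ := hz (n ^ 2 + n0) (by positivity)
  set χ : (Fin d → ℝ) → ℝ := fun x => 1 - φ x with hχ
  have hχs : ContDiff ℝ 2 χ := contDiff_const.sub hφ.smooth
  have hχ0 : ∀ x, 0 ≤ χ x := fun x => by simp only [hχ]; linarith [hφ1 x]
  have hχ1 : ∀ x, χ x ≤ 1 := fun x => by simp only [hχ]; linarith [hφ0 x]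
  have hχd : ∀ i x, |pd i χ x| ≤ Cχ := by
    intro i x
    have e : pd i χ x = - pd i φ x := by
      simp only [pd, hχ]
      rw [fderiv_const_sub]; simp
    rw [e, abs_neg]
    refine (hφ.b1 i x).trans (div_le_self hCχ ?_)
    linarith [n.cast_nonneg (α := ℝ)]
  set δ : Fin d → Fin d → ℝ := fun i j => if i = j then γ else 0 with hδ
  have hδb : ∀ i j, |δ i j| ≤ γ := by
    intro i j; simp only [hδ]; split_ifs
    · rw [abs_of_pos hγ]
    · simpa using hγ.le
  have hab : ∀ i j x s, |a i j x s - δ i j| ≤ K + γ := fun i j x s =>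
    (abs_sub _ _).trans (add_le_add (H.ba i j x s) (hδb i j))
  set ad : Fin d → Fin d → (Fin d → ℝ) → ℝ → ℝ := fun i j x s =>
    fderiv ℝ (fun p : (Fin d → ℝ) × ℝ => a i j p.1 p.2) (x, s) (0, 1) with had
  have hadC : ∀ i j, ContDiff ℝ 1 fun p : (Fin d → ℝ) × ℝ => ad i j p.1 p.2 := fun i j =>
    ((H.sa i j).fderiv_right (m := 1) (by norm_num)).clm_apply contDiff_const
  have hade : ∀ i j x s, deriv (fun s => a i j x s) s = ad i j x s := fun i j x s =>
    (H.du i j x s).deriv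
  set A : Fin d → Fin d → (Fin d → ℝ) → ℝ → ℝ := fun i j x s =>
    δ i j * s + χ x * (ζ s * (a i j x s - δ i j) * s) with hA
  set M : Fin d → Fin d → (Fin d → ℝ) → ℝ → ℝ := fun i j x s =>
    δ i j + χ x * (ζ s * (a i j x s + s * ad i j x s - δ i j) +
      s * deriv ζ s * (a i j x s - δ i j)) with hM
  set P : Fin d → Fin d → (Fin d → ℝ) → ℝ → ℝ := fun i j x s =>
    ζ s * s * (pd i χ x * (a i j x s - δ i j) + χ x * pd i (fun y => a i j y s) x) with hP
  set B : Fin d → (Fin d → ℝ) → ℝ → ℝ := fun i x s => χ x * ζ s * (b i x s * s) with hB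
  have cχ : ContDiff ℝ 2 fun p : (Fin d → ℝ) × ℝ => χ p.1 := hχs.comp contDiff_fst
  have cζ : ContDiff ℝ 2 fun p : (Fin d → ℝ) × ℝ => ζ p.2 := hζs.comp contDiff_snd
  have cζ' : ContDiff ℝ 1 fun p : (Fin d → ℝ) × ℝ => deriv ζ p.2 := by
    have : ContDiff ℝ 1 (deriv ζ) := hζs.deriv'
    exact this.comp contDiff_snd
  have cs : ∀ n, ContDiff ℝ n fun p : (Fin d → ℝ) × ℝ => p.2 := fun n => contDiff_snd
  have ca1 : ∀ i j, ContDiff ℝ 1 fun p : (Fin d → ℝ) × ℝ => a i j p.1 p.2 := fun i j =>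
    (H.sa i j).of_le (by norm_num)
  have cχ1 := cχ.of_le (m := 1) (by norm_num)
  have cζ1 := cζ.of_le (m := 1) (by norm_num)
  have cM : ∀ i j, ContDiff ℝ 1 fun p : (Fin d → ℝ) × ℝ => M i j p.1 p.2 := fun i j =>
    contDiff_const.add (cχ1.mul ((cζ1.mul (((ca1 i j).add ((cs 1).mul (hadC i j))).sub
      contDiff_const)).add (((cs 1).mul cζ').mul ((ca1 i j).sub contDiff_const))))
  have cB : ∀ i, ContDiff ℝ 1 fun p : (Fin d → ℝ) × ℝ => B i p.1 p.2 := fun i =>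
    (cχ1.mul cζ1).mul ((H.sb i).mul (cs 1))
  set r0 : ℝ := 2 * (n + 1) + rζ with hr0
  have hr00 : 0 ≤ r0 := by positivity
  have hχout : ∀ x, r0 < ‖x‖ → χ x = 0 := fun x hx => by
    simp only [hχ]; rw [hφout x (by push_cast at *; linarith)]; ring
  have hζout' : ∀ s, r0 < |s| → ζ s = 0 := fun s hs =>
    hζout s (lt_of_le_of_lt (by rw [hr0]; have := n.cast_nonneg (α := ℝ); linarith) hs)
  have hζd' : ∀ s, r0 < |s| → deriv ζ s = 0 := fun s hs => by
    have : ζ =ᶠ[𝓝 s] fun _ => (0:ℝ) := by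
      filter_upwards [continuous_abs.continuousAt.eventually (eventually_gt_nhds hs)] with z hz
      exact hζout' z hz
    rw [this.deriv_eq]; simp
  have hdA : ∀ i j x s, HasDerivAt (A i j x) (M i j x s) s := by
    intro i j x s
    have h1 := H.du i j x s
    have h2 := (hζs.differentiable (by norm_num) s).hasDerivAt
    have h3 := ((hasDerivAt_id s).const_mul (δ i j)).add
      (((h2.mul (h1.sub_const (δ i j))).mul (hasDerivAt_id s)).const_mul (χ x))
    refine h3.congr_deriv ?_
    simp only [hM, had, id, Pi.mul_apply]
    ring
  have hmconst : ∀ i j x s, (r0 < ‖x‖ ∨ r0 < |s|) → M i j x s = δ i j := by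
    intro i j x s h
    rcases h with h | h
    · simp only [hM, hχout x h]; ring
    · simp only [hM, hζout' s h, hζd' s h]; ring
  have hell : ∀ x s (ξ : Fin d → ℝ),
      γ / 2 * ∑ i, ξ i ^ 2 ≤ ∑ i, ∑ j, M i j x s * ξ i * ξ j := by
    intro x s ξ
    set X := ∑ i, ξ i ^ 2 with hX
    have hX0 : 0 ≤ X := Finset.sum_nonneg fun i _ => sq_nonneg _
    have e1 : (∑ i, ∑ j, δ i j * ξ i * ξ j) = γ * X := by
      rw [hX, Finset.mul_sum]
      refine Finset.sum_congr rfl fun i _ => ?_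
      simp [hδ]; ring
    set Q1 := ∑ i, ∑ j, (a i j x s + s * ad i j x s) * ξ i * ξ j with hQ1
    have h1 : γ * X ≤ Q1 := by
      have := H.ell x ξ s
      simp only [hade] at this
      exact this
    set Q2 := ∑ i, ∑ j, (a i j x s - δ i j) * ξ i * ξ j with hQ2
    have h2 : |Q2| ≤ d * (K + γ) * X := quad_abs _ (fun i j => hab i j x s) ξ
    have e2 : (∑ i, ∑ j, M i j x s * ξ i * ξ j) =
        γ * X + χ x * (ζ s * (Q1 - γ * X) + s * deriv ζ s * Q2) := by
      rw [← e1, hQ1, hQ2, ← Finset.sum_sub_distrib]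
      simp only [← Finset.sum_sub_distrib, Finset.mul_sum, ← Finset.sum_add_distrib]
      refine Finset.sum_congr rfl fun i _ => Finset.sum_congr rfl fun j _ => ?_
      simp only [hM]; ring
    have h3 := hζd s
    have h4 : |s * deriv ζ s * Q2| ≤ Z / (n ^ 2 + n0) * (d * (K + γ) * X) := by
      rw [abs_mul]
      exact mul_le_mul h3 h2 (abs_nonneg _) (by positivity)
    have h5 : Z / (n ^ 2 + n0) * (d * (K + γ) * X) ≤ γ / 2 * X := by
      have : Z / (n ^ 2 + n0) * (d * (K + γ)) ≤ γ / 2 := by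
        rw [div_mul_eq_mul_div, div_le_iff₀ (by positivity)]
        have e : γ / 2 * (n ^ 2 + n0) = γ / 2 * (n ^ 2 + 1) + Z * (d * (K + γ)) := by
          rw [hn0]; field_simp; ring
        rw [e]
        have : 0 ≤ γ / 2 * ((n : ℝ) ^ 2 + 1) := by positivity
        linarith
      calc _ = Z / (n ^ 2 + n0) * (d * (K + γ)) * X := by ring
        _ ≤ _ := mul_le_mul_of_nonneg_right this hX0
    rw [e2]
    have h6 : 0 ≤ χ x * (ζ s * (Q1 - γ * X)) :=
      mul_nonneg (hχ0 x) (mul_nonneg (hζ0 s) (by linarith))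
    have h7 : |χ x * (s * deriv ζ s * Q2)| ≤ γ / 2 * X := by
      rw [abs_mul, abs_of_nonneg (hχ0 x)]
      calc _ ≤ 1 * (γ / 2 * X) := mul_le_mul (hχ1 x) (h4.trans h5) (abs_nonneg _) zero_le_one
        _ = _ := one_mul _
    have h8 := (abs_le.1 h7).1
    rw [mul_add]
    linarith
  have hLvl : Lvl A M B δ (γ / 2) r0 := by
    refine ⟨by positivity, hr00, cM, ?_, hell, hmconst, ?_, hdA, cB, ?_, ?_⟩
    · intro i j x s
      have e1 : δ i j = δ j i := by simp only [hδ, eq_comm]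
      have e2 : ad i j x s = ad j i x s := by
        rw [← hade, ← hade]
        congr 1
        funext s
        exact H.sym i j x s
      simp only [hM, e1, e2, H.sym i j x s]
    · intro i j x; simp [hA]
    · intro i x; simp [hB]
    · intro i x s h
      rcases h with h | h
      · simp [hB, hχout x h]
      · simp [hB, hζout' s h]
  have hbM := fun i j => bdd_of_const (r0 := r0) (f := M i j) (cM i j).continuous (hmconst i j)
  choose Cm hCm0 hCm using hbM
  have hχζ : ∀ x s, 0 ≤ χ x * ζ s ∧ χ x * ζ s ≤ 1 := fun x s =>
    ⟨mul_nonneg (hχ0 x) (hζ0 s), mul_le_one₀ (hχ1 x) (hζ0 s) (hζ1 s)⟩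
  have hbB : ∀ i x s, |B i x s| ≤ K * |s| := by
    intro i x s
    simp only [hB]
    rw [abs_mul, abs_of_nonneg (hχζ x s).1, abs_mul]
    calc _ ≤ 1 * (K * |s|) := by
          gcongr
          · exact (hχζ x s).2
          · exact H.bb i x s
      _ = _ := one_mul _
  refine ⟨A, M, P, B, ∑ i, ∑ j, Cm i j, ⟨?_, fun i j => (cM i j).continuous, ?_,
    fun i => (cB i).continuous, hdA, ?_, ?_, ?_, ?_, ?_, ?_, hell⟩, hLvl.adm hd, ?_, ?_⟩
  · intro i j
    have := (H.sa i j).continuous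
    have := cχ.continuous
    have := cζ.continuous
    simp only [hA]
    fun_prop
  · intro i j
    have h1 := (H.sa i j).continuous
    have h2 := cχ.continuous
    have h3 := cζ.continuous
    have h4 : Continuous fun p : (Fin d → ℝ) × ℝ => pd i χ p.1 :=
      (contDiff_pd (m := 1) i hχs (by norm_num)).continuous.comp continuous_fst
    have h5 : Continuous fun p : (Fin d → ℝ) × ℝ => pd i (fun y => a i j y p.2) p.1 := by
      simp_rw [H.dx]
      exact (((H.sa i j).fderiv_right (m := 1) (by norm_num)).clm_apply contDiff_const).continuous
    simp only [hP]
    fun_prop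
  · intro i j x s t
    have h1 := line_deriv (hχs.differentiable (by norm_num)) x (Pi.single i 1) t
    have hda : Differentiable ℝ fun y => a i j y s := by
      have := (H.sa i j).differentiable (by norm_num)
      exact this.comp (by fun_prop : Differentiable ℝ fun y : Fin d → ℝ => (y, s))
    have h2 := line_deriv hda x (Pi.single i 1) t
    have e : ∀ g : Fin d → ℝ, (∑ k, (Pi.single i 1 : Fin d → ℝ) k * g k) = g i := fun g => by
      rw [Finset.sum_eq_single i]
      · simp
      · intro k _ hk; simp [hk]
      · simp
    rw [e] at h1 h2
    have h3 := (h1.mul (((h2.sub_const (δ i j)).const_mul (ζ s)).mul_const s)).const_add (δ i j * s)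
    refine h3.congr_deriv ?_
    simp only [hP]
    ring
  · intro i j x s
    refine (hCm i j x s).trans ?_
    refine (Finset.single_le_sum (f := fun j => Cm i j) (fun j _ => hCm0 i j) (Finset.mem_univ j)).trans ?_
    exact Finset.single_le_sum (f := fun i => ∑ j, Cm i j)
      (fun i _ => Finset.sum_nonneg fun j _ => hCm0 i j) (Finset.mem_univ i)
  · intro i j x s
    have e : A i j x s = (δ i j + χ x * ζ s * (a i j x s - δ i j)) * s := by
      simp only [hA]; ring
    rw [e, abs_mul]
    refine mul_le_mul_of_nonneg_right ?_ (abs_nonneg _)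
    refine (abs_add_le _ _).trans ?_
    rw [abs_mul, abs_of_nonneg (hχζ x s).1]
    have h1 : χ x * ζ s * |a i j x s - δ i j| ≤ 1 * (K + γ) :=
      mul_le_mul (hχζ x s).2 (hab i j x s) (abs_nonneg _) zero_le_one
    linarith [hδb i j]
  · intro i x s
    refine (hbB i x s).trans (mul_le_mul_of_nonneg_right ?_ (abs_nonneg _))
    linarith
  · intro i j x s
    simp only [hP]
    rw [abs_mul, abs_mul, abs_of_nonneg (hζ0 s)]
    have h1 : |pd i χ x * (a i j x s - δ i j) + χ x * pd i (fun y => a i j y s) x| ≤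
        Cχ * (K + γ) + K := by
      refine (abs_add_le _ _).trans ?_
      rw [abs_mul, abs_mul, abs_of_nonneg (hχ0 x)]
      have h2 : |pd i (fun y => a i j y s) x| ≤ K := by
        unfold pd
        have := (fderiv ℝ (fun y => a i j y s) x).le_opNorm (Pi.single i 1)
        rw [Real.norm_eq_abs, Pi.norm_single, norm_one, mul_one] at this
        exact this.trans (H.bx i j x s)
      have h3 : |pd i χ x| * |a i j x s - δ i j| ≤ Cχ * (K + γ) :=
        mul_le_mul (hχd i x) (hab i j x s) (abs_nonneg _) hCχ
      have h4 : χ x * |pd i (fun y => a i j y s) x| ≤ 1 * K :=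
        mul_le_mul (hχ1 x) h2 (abs_nonneg _) zero_le_one
      linarith
    calc _ ≤ (1 * |s|) * (Cχ * (K + γ) + K) := by
          gcongr
          exact hζ1 s
      _ = _ := by ring
  · intro i x s
    refine (hbB i x s).trans (mul_le_mul_of_nonneg_right ?_ (abs_nonneg _))
    have : 0 ≤ Cχ * (K + γ) := by positivity
    linarith
  all_goals
    have hχn : ∀ x : Fin d → ℝ, ‖x‖ ≤ n → χ x = 1 := fun x hx => by
      simp only [hχ]; rw [hφin x (by linarith)]; ring
    have hζn : ∀ s : ℝ, |s| ≤ n → ζ s = 1 := fun s hs => by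
      refine hζone s ?_
      rw [← sq_abs]
      nlinarith [abs_nonneg s]
  · intro i j x s hx hs
    simp only [hA, hχn x hx, hζn s hs]; ring
  · intro i x s hx hs
    simp only [hB, hχn x hx, hζn s hs]; ring

end
end FPE

namespace FPE
open Set Topology

section
variable {d : ℕ}

structure Lev (A : Fin d → Fin d → (Fin d → ℝ) → ℝ → ℝ) (B : Fin d → (Fin d → ℝ) → ℝ → ℝ)
    (h L c κ : ℝ) (J : ((Fin d → ℝ) → ℝ) → (Fin d → ℝ) → ℝ) : Prop where
  hh : 0 < h
  hL : 0 ≤ L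
  hc : 0 < c
  hκ : 0 ≤ κ
  cA : ∀ i j, Continuous fun p : (Fin d → ℝ) × ℝ => A i j p.1 p.2
  cB : ∀ i, Continuous fun p : (Fin d → ℝ) × ℝ => B i p.1 p.2
  bA : ∀ i j x s, |A i j x s| ≤ L * |s|
  bB : ∀ i x s, |B i x s| ≤ L * |s|
  res : ∀ f, Integrable f → MemLp f 2 → ResN A B h L f (J f)
  con : ∀ f g, Integrable f → MemLp f 2 → Integrable g → MemLp g 2 →
        ∫ x, |J f x - J g x| ≤ ∫ x, |f x - g x|
  en : ∀ f, Integrable f → MemLp f 2 → ∃ G : ℝ, 0 ≤ G ∧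
      (∀ y, ∫ x, (J f (x + y) - J f x) ^ 2 ≤ ‖y‖ ^ 2 * (d * G)) ∧
      (1 - h * κ) * (∫ x, J f x ^ 2) + h * c * G ≤ ∫ x, f x ^ 2

lemma exists_lev {A M P : Fin d → Fin d → (Fin d → ℝ) → ℝ → ℝ}
    {B : Fin d → (Fin d → ℝ) → ℝ → ℝ} {L c C L' h : ℝ} (hN : Nice A M P B L c C L')
    (hAd : Adm A B) (hL : 0 ≤ L) (hc : 0 < c) (hC : 0 ≤ C) (hh : 0 < h) :
    ∃ J, Lev A B h L c (d * ((d + 1) * C) ^ 2 / c) J := by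
  obtain ⟨J, h1, h2⟩ := propN hAd hN.cA hN.cB hL hN.bA hN.bB hh
  exact ⟨J, hh, hL, hc, by positivity, hN.cA, hN.cB, hN.bA, hN.bB, h1, h2, fun f hf hf2 =>
    energy hN hc hC hh hf2 (h1 f hf hf2)⟩

variable {A : Fin d → Fin d → (Fin d → ℝ) → ℝ → ℝ} {B : Fin d → (Fin d → ℝ) → ℝ → ℝ}
  {h L c κ : ℝ} {J : ((Fin d → ℝ) → ℝ) → (Fin d → ℝ) → ℝ} {f g : (Fin d → ℝ) → ℝ}

lemma Lev.it (H : Lev A B h L c κ J) (hf : Integrable f) (hf2 : MemLp f 2) (k : ℕ) :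
    Integrable (J^[k] f) ∧ MemLp (J^[k] f) 2 := by
  induction k with
  | zero => exact ⟨hf, hf2⟩
  | succ k ih =>
    rw [Function.iterate_succ_apply']
    exact ⟨(H.res _ ih.1 ih.2).int, (H.res _ ih.1 ih.2).memLp⟩

lemma Lev.itcon (H : Lev A B h L c κ J) (hf : Integrable f) (hf2 : MemLp f 2)
    (hg : Integrable g) (hg2 : MemLp g 2) (k : ℕ) :
    ∫ x, |(J^[k] f) x - (J^[k] g) x| ≤ ∫ x, |f x - g x| := by
  induction k with
  | zero => exact le_rfl
  | succ k ih =>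
    rw [Function.iterate_succ_apply', Function.iterate_succ_apply']
    obtain ⟨a, b⟩ := H.it hf hf2 k
    obtain ⟨a', b'⟩ := H.it hg hg2 k
    exact (H.con _ _ a b a' b').trans ih

lemma Lev.ittime (H : Lev A B h L c κ J) (hf : Integrable f) (hf2 : MemLp f 2) (j k : ℕ) :
    ∫ x, |(J^[j + k] f) x - (J^[j] f) x| ≤ ∫ x, |(J^[k] f) x - f x| := by
  rw [Function.iterate_add_apply]
  obtain ⟨a, b⟩ := H.it hf hf2 k
  exact H.itcon a b hf hf2 j

lemma Lev.itL1 (H : Lev A B h L c κ J) (hf : Integrable f) (hf2 : MemLp f 2) (k : ℕ) :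
    ∫ x, |(J^[k] f) x| ≤ ∫ x, |f x| := by
  induction k with
  | zero => exact le_rfl
  | succ k ih =>
    rw [Function.iterate_succ_apply']
    obtain ⟨a, b⟩ := H.it hf hf2 k
    have := (H.res _ a b).kato (fun _ => 1) _ _ le_rfl (tst_const 1) (fun _ => zero_le_one)
    simp only [one_mul, mul_zero, zero_mul, add_zero] at this
    exact this.trans ih

lemma Lev.itmass (H : Lev A B h L c κ J) (hf : Integrable f) (hf2 : MemLp f 2) (k : ℕ) :
    ∫ x, (J^[k] f) x = ∫ x, f x := by
  induction k with
  | zero => rfl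
  | succ k ih =>
    rw [Function.iterate_succ_apply']
    obtain ⟨a, b⟩ := H.it hf hf2 k
    have h1 := (H.res _ a b).weak (fun _ => 1) _ _ le_rfl (tst_const 1)
    have h2 : ∀ x, Lop A B (fun _ => 1) x (J (J^[k] f) x) = 0 := by
      intro x
      have := Lop_abs H.hL H.bA H.bB (tst_const (d := d) 1) x (J (J^[k] f) x)
      simpa using this
    simp only [one_mul, h2, integral_zero, mul_zero] at h1
    linarith

lemma Lev.itweak (H : Lev A B h L c κ J) (hf : Integrable f) (hf2 : MemLp f 2) {φ C0 C1}
    (hC1 : 0 ≤ C1) (hφ : Tst φ C0 C1) (j k : ℕ) :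
    (∫ x, φ x * (J^[j + k] f) x) - (∫ x, φ x * (J^[j] f) x) =
      ∑ i ∈ Finset.range k, h * ∫ x, Lop A B φ x ((J^[j + i + 1] f) x) := by
  induction k with
  | zero => simp
  | succ k ih =>
    rw [Finset.sum_range_succ, ← ih]
    obtain ⟨a, b⟩ := H.it hf hf2 (j + k)
    have h1 := (H.res _ a b).weak φ _ _ hC1 hφ
    rw [← Function.iterate_succ_apply' J] at h1
    have e : j + (k + 1) = (j + k).succ := rfl
    rw [e]
    linarith

lemma Lev.itweak_abs (H : Lev A B h L c κ J) (hf : Integrable f) (hf2 : MemLp f 2) {φ C0 C1}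
    (hC1 : 0 ≤ C1) (hφ : Tst φ C0 C1) (k : ℕ) :
    |(∫ x, φ x * (J^[k] f) x) - (∫ x, φ x * f x)| ≤
      k * h * ((((d : ℝ) ^ 2 + d) * L * C1) * ∫ x, |f x|) := by
  have h0 := H.itweak hf hf2 hC1 hφ 0 k
  simp only [zero_add, Function.iterate_zero, id] at h0
  rw [h0]
  refine (Finset.abs_sum_le_sum_abs _ _).trans ?_
  refine (Finset.sum_le_card_nsmul _ _ (h * ((((d : ℝ) ^ 2 + d) * L * C1) * ∫ x, |f x|))
    fun i _ => ?_).trans ?_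
  · rw [abs_mul, abs_of_pos H.hh]
    refine mul_le_mul_of_nonneg_left ?_ H.hh.le
    obtain ⟨a, b⟩ := H.it hf hf2 (i + 1)
    calc |∫ x, Lop A B φ x ((J^[i + 1] f) x)|
        ≤ ∫ x, |Lop A B φ x ((J^[i + 1] f) x)| := abs_integral_le_integral_abs
      _ ≤ ∫ x, (((d : ℝ) ^ 2 + d) * L * C1) * |(J^[i + 1] f) x| := by
          refine integral_mono (Lop_integrable H.cA H.cB H.hL H.bA H.bB hφ a).abs
            (a.abs.const_mul _) fun x => Lop_abs H.hL H.bA H.bB hφ x _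
      _ = (((d : ℝ) ^ 2 + d) * L * C1) * ∫ x, |(J^[i + 1] f) x| := integral_const_mul _ _
      _ ≤ _ := by
          have := H.hL
          exact mul_le_mul_of_nonneg_left (H.itL1 hf hf2 _) (by positivity)
  · simp; linarith

lemma Lev.itkato (H : Lev A B h L c κ J) (hf : Integrable f) (hf2 : MemLp f 2) {φ C0 C1}
    (hC1 : 0 ≤ C1) (hφ : Tst φ C0 C1) (h0 : ∀ x, 0 ≤ φ x) (k : ℕ) :
    (∫ x, φ x * |(J^[k] f) x|) ≤ (∫ x, φ x * |f x|) +
      k * h * ((((d : ℝ) ^ 2 + d) * L * C1) * ∫ x, |f x|) := by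
  induction k with
  | zero => simp
  | succ k ih =>
    obtain ⟨a, b⟩ := H.it hf hf2 k
    have h1 := (H.res _ a b).kato φ _ _ hC1 hφ h0
    rw [Function.iterate_succ_apply']
    have h2 : h * (((d : ℝ) ^ 2 + d) * L * C1) * (∫ x, |(J^[k] f) x|) ≤
        h * (((d : ℝ) ^ 2 + d) * L * C1) * ∫ x, |f x| := by
      have := H.hL
      have := H.hh
      exact mul_le_mul_of_nonneg_left (H.itL1 hf hf2 _) (by positivity)
    push_cast
    linarith

lemma exp_step {x : ℝ} (h0 : 0 ≤ x) (h1 : x ≤ 1 / 2) : 1 ≤ Real.exp (2 * x) * (1 - x) := by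
  have := Real.add_one_le_exp (2 * x)
  nlinarith

lemma Lev.iten (H : Lev A B h L c κ J) (hf : Integrable f) (hf2 : MemLp f 2)
    (hs : h * κ ≤ 1 / 2) : ∃ G : ℕ → ℝ, (∀ j, 0 ≤ G j) ∧
      (∀ j y, ∫ x, ((J^[j + 1] f) (x + y) - (J^[j + 1] f) x) ^ 2 ≤ ‖y‖ ^ 2 * (d * G j)) ∧
      ∀ k : ℕ, (∫ x, (J^[k] f) x ^ 2) + h * c * ∑ j ∈ Finset.range k, G j ≤
        Real.exp (2 * κ * (k * h)) * ∫ x, f x ^ 2 := by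
  have key : ∀ j : ℕ, ∃ G : ℝ, 0 ≤ G ∧
      (∀ y, ∫ x, ((J^[j + 1] f) (x + y) - (J^[j + 1] f) x) ^ 2 ≤ ‖y‖ ^ 2 * (d * G)) ∧
      (1 - h * κ) * (∫ x, (J^[j + 1] f) x ^ 2) + h * c * G ≤ ∫ x, (J^[j] f) x ^ 2 := by
    intro j
    obtain ⟨a, b⟩ := H.it hf hf2 j
    have := H.en _ a b
    rwa [← Function.iterate_succ_apply' J] at this
  choose G hG0 hG1 hG2 using key
  refine ⟨G, hG0, hG1, fun k => ?_⟩
  have hx0 : 0 ≤ h * κ := mul_nonneg H.hh.le H.hκ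
  have hst := exp_step hx0 hs
  induction k with
  | zero => simp
  | succ k ih =>
    have hg := hG2 k
    have hhc : 0 ≤ h * c := mul_nonneg H.hh.le H.hc.le
    set E1 := ∫ x, (J^[k + 1] f) x ^ 2
    set E := ∫ x, (J^[k] f) x ^ 2
    have hE1 : 0 ≤ E1 := integral_nonneg fun x => sq_nonneg _
    set S := ∑ j ∈ Finset.range k, G j with hS
    have hS0 : 0 ≤ S := Finset.sum_nonneg fun j _ => hG0 j
    rw [Finset.sum_range_succ, ← hS]
    have e : Real.exp (2 * κ * ((k + 1 : ℕ) * h)) =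
        Real.exp (2 * (h * κ)) * Real.exp (2 * κ * (k * h)) := by
      rw [← Real.exp_add]; congr 1; push_cast; ring
    rw [e, mul_assoc (Real.exp (2 * (h * κ)))]
    set e1 := Real.exp (2 * (h * κ))
    have he1 : 1 ≤ e1 := Real.one_le_exp (by linarith)
    refine le_trans ?_ (mul_le_mul_of_nonneg_left ih (by linarith))
    have t1 : e1 * ((1 - h * κ) * E1 + h * c * G k) ≤ e1 * E :=
      mul_le_mul_of_nonneg_left hg (by linarith)
    have t2 : E1 ≤ e1 * (1 - h * κ) * E1 := le_mul_of_one_le_left hE1 hst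
    have t3 : h * c * G k ≤ e1 * (h * c * G k) :=
      le_mul_of_one_le_left (mul_nonneg hhc (hG0 k)) he1
    have t4 : h * c * S ≤ e1 * (h * c * S) := le_mul_of_one_le_left (mul_nonneg hhc hS0) he1
    linarith

lemma Lev.itsq (H : Lev A B h L c κ J) {C0 C1} (hf : Integrable f) (hf2 : MemLp f 2)
    (hC1 : 0 ≤ C1) (hφ : Tst f C0 C1) (hs : h * κ ≤ 1 / 2) (k : ℕ) :
    ∫ x, ((J^[k] f) x - f x) ^ 2 ≤ (Real.exp (2 * κ * (k * h)) - 1) * (∫ x, f x ^ 2) +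
      2 * (k * h * ((((d : ℝ) ^ 2 + d) * L * C1) * ∫ x, |f x|)) := by
  obtain ⟨G, hG0, -, hG⟩ := H.iten hf hf2 hs
  obtain ⟨a, b⟩ := H.it hf hf2 k
  have h1 : ∫ x, (J^[k] f) x ^ 2 ≤ Real.exp (2 * κ * (k * h)) * ∫ x, f x ^ 2 := by
    have := mul_nonneg (mul_nonneg H.hh.le H.hc.le)
      (Finset.sum_nonneg (s := Finset.range k) fun j _ => hG0 j)
    linarith [hG k]
  have h2 := (abs_le.1 (H.itweak_abs hf hf2 hC1 hφ k)).1
  have i1 : Integrable (fun x => (J^[k] f) x ^ 2) := b.integrable_sq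
  have i2 : Integrable (fun x => f x ^ 2) := hf2.integrable_sq
  have i3 : Integrable (fun x => f x * (J^[k] f) x) := hf2.integrable_mul b
  have i4 : Integrable (fun x => f x * f x) := hf2.integrable_mul hf2
  have i5 : Integrable (fun x => (J^[k] f) x ^ 2 - f x ^ 2) := i1.sub i2
  have i6 : Integrable (fun x => 2 * (f x * (J^[k] f) x - f x * f x)) := (i3.sub i4).const_mul 2
  have e : ∫ x, ((J^[k] f) x - f x) ^ 2 = (∫ x, (J^[k] f) x ^ 2) - (∫ x, f x ^ 2) -
      2 * ((∫ x, f x * (J^[k] f) x) - (∫ x, f x * f x)) := by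
    rw [← integral_sub i1 i2, ← integral_sub i3 i4, ← integral_const_mul,
      ← integral_sub i5 i6]
    refine integral_congr_ae (ae_of_all _ fun x => ?_)
    show _ = _
    ring
  rw [e]
  linarith

end
end FPE

namespace FPE
open Set Topology

section
variable {d : ℕ}

structure Fam (A : ℕ → Fin d → Fin d → (Fin d → ℝ) → ℝ → ℝ)
    (B : ℕ → Fin d → (Fin d → ℝ) → ℝ → ℝ)
    (h : ℕ → ℝ) (L c κ : ℝ) (J : ℕ → ((Fin d → ℝ) → ℝ) → (Fin d → ℝ) → ℝ) : Prop where
  lev : ∀ n, Lev (A n) (B n) (h n) L c κ (J n)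
  h0 : Tendsto h atTop (𝓝 0)

variable {A : ℕ → Fin d → Fin d → (Fin d → ℝ) → ℝ → ℝ} {B : ℕ → Fin d → (Fin d → ℝ) → ℝ → ℝ}
  {h : ℕ → ℝ} {L c κ : ℝ} {J : ℕ → ((Fin d → ℝ) → ℝ) → (Fin d → ℝ) → ℝ} {f g : (Fin d → ℝ) → ℝ}

lemma Fam.small (H : Fam A B h L c κ J) {δ : ℝ} (hδ : 0 < δ) :
    ∃ n0, ∀ n ≥ n0, h n ≤ δ ∧ h n * κ ≤ 1 / 2 := by
  have h1 : ∀ᶠ n in atTop, h n < δ := H.h0.eventually (gt_mem_nhds hδ)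
  have h2 : ∀ᶠ n in atTop, h n * κ < 1 / 2 := by
    have := H.h0.mul_const κ
    rw [zero_mul] at this
    exact this.eventually (gt_mem_nhds (by norm_num))
  obtain ⟨n0, hn⟩ := eventually_atTop.1 (h1.and h2)
  exact ⟨n0, fun n hn' => ⟨(hn n hn').1.le, (hn n hn').2.le⟩⟩

lemma Fam.tight (H : Fam A B h L c κ J) (hf : Integrable f) (hf2 : MemLp f 2) (T : ℝ) {η : ℝ}
    (hη : 0 < η) : ∃ r : ℝ, ∀ n k : ℕ, k * h n ≤ T →
      ∫ x in {x | r < ‖x‖}, |((J n)^[k] f) x| ≤ η := by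
  obtain ⟨r, hr⟩ := tight_of_kato (ι := {p : ℕ × ℕ // p.2 * h p.1 ≤ T})
    (u := fun p => (J p.1.1)^[p.1.2] f) (fun p => ((H.lev p.1.1).it hf hf2 _).1) hf
    (K := T * ((((d : ℝ) ^ 2 + d) * L) * ∫ x, |f x|)) (fun p φ C1 hC1 hφ h0 => by
      refine ((H.lev p.1.1).itkato hf hf2 hC1 hφ h0 _).trans ?_
      have hL := (H.lev 0).hL
      have h1 : 0 ≤ ((((d : ℝ) ^ 2 + d) * L * C1) * ∫ x, |f x|) :=
        mul_nonneg (by positivity) (integral_nonneg fun x => abs_nonneg _)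
      have := mul_le_mul_of_nonneg_right p.2 h1
      linarith) hη
  exact ⟨r, fun n k hk => hr ⟨(n, k), hk⟩⟩

lemma compl_ball (r : ℝ) : (Metric.closedBall (0 : Fin d → ℝ) r)ᶜ = {x | r < ‖x‖} := by
  ext x; simp

lemma Fam.mod0 (H : Fam A B h L c κ J) {C0 C1} (hf : Integrable f) (hf2 : MemLp f 2)
    (hC1 : 0 ≤ C1) (hφ : Tst f C0 C1) {ε : ℝ} (hε : 0 < ε) :
    ∃ δ > 0, ∃ n0, ∀ n ≥ n0, ∀ k : ℕ, k * h n ≤ δ → ∫ x, |((J n)^[k] f) x - f x| ≤ ε := by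
  obtain ⟨r, hr⟩ := H.tight hf hf2 1 (η := ε / 4) (by positivity)
  set V := Real.sqrt (volume.real (Metric.closedBall (0 : Fin d → ℝ) r)) with hV
  have hV0 : 0 ≤ V := Real.sqrt_nonneg _
  set K := ε / (2 * (V + 1)) with hK
  have hK0 : 0 < K := by positivity
  have hVK : V * K ≤ ε / 2 := by
    rw [hK, mul_div_assoc', div_le_div_iff₀ (by positivity) (by norm_num)]
    nlinarith
  set E0 := ∫ x, f x ^ 2
  have hE0 : 0 ≤ E0 := integral_nonneg fun x => sq_nonneg _
  set D := (((d : ℝ) ^ 2 + d) * L * C1) * ∫ x, |f x|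
  have hL := (H.lev 0).hL
  have hκ := (H.lev 0).hκ
  have hD : 0 ≤ D := mul_nonneg (by positivity) (integral_nonneg fun x => abs_nonneg _)
  have hcont : Continuous fun t : ℝ => (Real.exp (2 * κ * t) - 1) * E0 + 2 * (t * D) := by fun_prop
  have hev : ∀ᶠ t in 𝓝 (0:ℝ), (Real.exp (2 * κ * t) - 1) * E0 + 2 * (t * D) < K ^ 2 := by
    refine hcont.continuousAt.eventually (gt_mem_nhds ?_)
    simp; positivity
  obtain ⟨δ', hδ', hb⟩ := Metric.eventually_nhds_iff.1 hev
  set δ := min 1 (δ' / 2) with hδ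
  have hδ0 : 0 < δ := by positivity
  have hbδ := hb (y := δ) (by
    rw [Real.dist_eq, sub_zero, abs_of_pos hδ0]
    have := min_le_right 1 (δ' / 2); linarith)
  obtain ⟨n0, hn0⟩ := H.small (δ := 1) one_pos
  refine ⟨δ, hδ0, n0, fun n hn k hk => ?_⟩
  have hk1 : k * h n ≤ 1 := hk.trans (min_le_left _ _)
  obtain ⟨a, b⟩ := (H.lev n).it hf hf2 k
  have hsq := (H.lev n).itsq hf hf2 hC1 hφ (hn0 n hn).2 k
  have hsq' : ∫ x, (((J n)^[k] f) x - f x) ^ 2 ≤ K ^ 2 := by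
    refine hsq.trans (le_trans ?_ hbδ.le)
    have : Real.exp (2 * κ * (k * h n)) ≤ Real.exp (2 * κ * δ) :=
      Real.exp_le_exp.2 (mul_le_mul_of_nonneg_left hk (by positivity))
    have h1 := mul_le_mul_of_nonneg_right (sub_le_sub_right this 1) hE0
    have h2 := mul_le_mul_of_nonneg_right hk hD
    linarith
  have hball := ball_L1_L2 (b.sub hf2) hK0.le hsq' r
  have hi : Integrable (fun x => |((J n)^[k] f) x - f x|) := (a.sub hf).abs
  have hsplit := integral_add_compl (μ := volume)
    (measurableSet_closedBall (x := (0 : Fin d → ℝ)) (ε := r)) hi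
  rw [compl_ball] at hsplit
  have ht : ∫ x in {x : Fin d → ℝ | r < ‖x‖}, |((J n)^[k] f) x - f x| ≤ ε / 4 + ε / 4 := by
    have t1 := hr n k hk1
    have t2 := hr n 0 (by simp)
    simp only [Function.iterate_zero, id] at t2
    refine le_trans ?_ (add_le_add t1 t2)
    rw [← integral_add a.abs.integrableOn hf.abs.integrableOn]
    exact integral_mono hi.integrableOn (a.abs.add hf.abs).integrableOn fun x => abs_sub _ _
  rw [← hsplit]
  simp only [Pi.sub_apply] at hball
  linarith

/-- compactness in `L¹` for test initial data -/
lemma Fam.cpt (H : Fam A B h L c κ J) {C0 C1} (hf : Integrable f) (hf2 : MemLp f 2)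
    (hC1 : 0 ≤ C1) (hφ : Tst f C0 C1) (U : Ultrafilter ℕ) (hU : (U : Filter ℕ) ≤ atTop)
    (k : ℕ → ℕ) {T : ℝ} (hk : ∀ n, k n * h n ≤ T) :
    ∃ v, Integrable v ∧ Tendsto (fun n => ∫ x, |((J n)^[k n] f) x - v x|) U (𝓝 0) := by
  refine compactL1 U (fun n => ((H.lev n).it hf hf2 _).1) (C := ∫ x, |f x|)
    (fun n => (H.lev n).itL1 hf hf2 _) (fun η hη => ?_) (fun r η hη => ?_)
  · obtain ⟨r, hr⟩ := H.tight hf hf2 T hη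
    exact ⟨r, Eventually.of_forall fun n => hr n _ (hk n)⟩
  obtain ⟨τ, hτ, n1, hmod⟩ := H.mod0 hf hf2 hC1 hφ (ε := η / 4) (by positivity)
  obtain ⟨n2, hsm⟩ := H.small (δ := τ / 2) (by positivity)
  have hc := (H.lev 0).hc
  have hκ := (H.lev 0).hκ
  set E := Real.exp (2 * κ * (T + τ)) * ∫ x, f x ^ 2 with hE
  have hE0 : 0 ≤ E := mul_nonneg (Real.exp_pos _).le (integral_nonneg fun x => sq_nonneg _)
  set Γ := 2 * E / (c * τ) with hΓ
  have hΓ0 : 0 ≤ Γ := by positivity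
  set V := Real.sqrt (volume.real (Metric.closedBall (0 : Fin d → ℝ) r)) with hV
  have hV0 : 0 ≤ V := Real.sqrt_nonneg _
  set Q := Real.sqrt (d * Γ) with hQ
  have hQ0 : 0 ≤ Q := Real.sqrt_nonneg _
  have hQ2 : Q ^ 2 = d * Γ := Real.sq_sqrt (by positivity)
  refine ⟨η / (2 * (V * Q + 1)), by positivity, ?_⟩
  have hev : ∀ᶠ n in (U : Filter ℕ), max n1 n2 ≤ n := hU (eventually_ge_atTop _)
  filter_upwards [hev] with n hn y hy
  have hh := (H.lev n).hh
  have hn1 : n1 ≤ n := (le_max_left _ _).trans hn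
  obtain ⟨hs1, hs2⟩ := hsm n ((le_max_right _ _).trans hn)
  obtain ⟨G, hG0, hG1, hG2⟩ := (H.lev n).iten hf hf2 hs2
  set m := ⌊τ / h n⌋₊ with hm
  have hm1 : m * h n ≤ τ := by
    have := Nat.floor_le (a := τ / h n) (by positivity)
    rwa [le_div_iff₀ hh] at this
  have hm2 : τ / 2 ≤ m * h n := by
    have := Nat.lt_floor_add_one (τ / h n)
    rw [div_lt_iff₀ hh, ← hm] at this
    linarith
  have hmpos : 0 < (m : ℝ) := by
    by_contra hcon
    have : (m : ℝ) = 0 := le_antisymm (not_lt.1 hcon) (Nat.cast_nonneg _)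
    rw [this] at hm2; linarith
  have hmpos' : 0 < m := by exact_mod_cast hmpos
  have hsum : h n * c * ∑ i ∈ Finset.range m, G (k n + i) ≤ E := by
    have h1 := hG2 (k n + m)
    have h2 : 0 ≤ ∫ x, ((J n)^[k n + m] f) x ^ 2 := integral_nonneg fun x => sq_nonneg _
    have h3 : ∑ i ∈ Finset.range m, G (k n + i) ≤ ∑ j ∈ Finset.range (k n + m), G j := by
      rw [Finset.sum_range_add]
      linarith [Finset.sum_nonneg (s := Finset.range (k n)) fun j _ => hG0 j]
    have h4 := mul_le_mul_of_nonneg_left h3 (mul_nonneg hh.le hc.le)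
    have h5 : Real.exp (2 * κ * ((k n + m : ℕ) * h n)) * (∫ x, f x ^ 2) ≤ E := by
      refine mul_le_mul_of_nonneg_right (Real.exp_le_exp.2 ?_) (integral_nonneg fun x => sq_nonneg _)
      refine mul_le_mul_of_nonneg_left ?_ (by positivity)
      push_cast; linarith [hk n]
    linarith
  obtain ⟨i, hi, hGi⟩ : ∃ i ∈ Finset.range m, G (k n + i) ≤ Γ := by
    by_contra hcon
    push Not at hcon
    have h1 : ∑ i ∈ Finset.range m, Γ < ∑ i ∈ Finset.range m, G (k n + i) :=
      Finset.sum_lt_sum_of_nonempty (Finset.nonempty_range_iff.2 hmpos'.ne') hcon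
    rw [Finset.sum_const, Finset.card_range, nsmul_eq_mul] at h1
    have h2 := mul_lt_mul_of_pos_left h1 (mul_pos hh hc)
    have h3 : E ≤ h n * c * (m * Γ) := by
      have : h n * c * (m * Γ) = (m * h n) * (2 * E / τ) := by rw [hΓ]; field_simp
      rw [this]
      calc E = τ / 2 * (2 * E / τ) := by field_simp
        _ ≤ _ := mul_le_mul_of_nonneg_right hm2 (by positivity)
    linarith
  rw [Finset.mem_range] at hi
  obtain ⟨a, b⟩ := (H.lev n).it hf hf2 (k n)
  obtain ⟨a', b'⟩ := (H.lev n).it hf hf2 (k n + i + 1)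
  have hd1 : ∫ x, |((J n)^[k n + i + 1] f) x - ((J n)^[k n] f) x| ≤ η / 4 := by
    rw [add_assoc]
    refine ((H.lev n).ittime hf hf2 (k n) (i + 1)).trans (hmod n hn1 _ ?_)
    refine le_trans (mul_le_mul_of_nonneg_right ?_ hh.le) hm1
    exact_mod_cast hi
  set u := (J n)^[k n] f
  set w := (J n)^[k n + i + 1] f
  have aτ : Integrable (fun x => u (x + y)) := a.comp_add_right y
  have aτ' : Integrable (fun x => w (x + y)) := a'.comp_add_right y
  have bτ' : MemLp (fun x => w (x + y)) 2 := b'.comp_measurePreserving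
    (measurePreserving_add_right volume y)
  have hball := ball_L1_L2 (v := fun x => w (x + y) - w x) (bτ'.sub b')
    (K := ‖y‖ * Q) (by positivity) (by
      refine (hG1 _ y).trans ?_
      rw [mul_pow, hQ2]
      exact mul_le_mul_of_nonneg_left (mul_le_mul_of_nonneg_left hGi (by positivity))
        (by positivity)) r
  have hfin : V * (‖y‖ * Q) ≤ η / 2 := by
    calc V * (‖y‖ * Q) = ‖y‖ * (V * Q) := by ring
      _ ≤ η / (2 * (V * Q + 1)) * (V * Q) := mul_le_mul_of_nonneg_right hy (by positivity)
      _ ≤ η / 2 := by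
        rw [div_mul_eq_mul_div, div_le_div_iff₀ (by positivity) (by norm_num)]
        nlinarith [mul_nonneg hV0 hQ0]
  have htd := L1_transl_diff a a' y
  rw [L1_comm u w] at htd
  have i1 : Integrable (fun x => (u (x + y) - u x) - (w (x + y) - w x)) :=
    (aτ.sub a).sub (aτ'.sub a')
  have i2 : Integrable (fun x => w (x + y) - w x) := aτ'.sub a'
  have i3 : Integrable (fun x => u (x + y) - u x) := aτ.sub a
  calc ∫ x in Metric.closedBall 0 r, |u (x + y) - u x|
      ≤ ∫ x in Metric.closedBall 0 r, (|(u (x + y) - u x) - (w (x + y) - w x)| +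
          |w (x + y) - w x|) := by
        refine integral_mono i3.abs.integrableOn (i1.abs.add i2.abs).integrableOn fun x => ?_
        have := abs_add_le ((u (x + y) - u x) - (w (x + y) - w x)) (w (x + y) - w x)
        simpa using this
    _ = (∫ x in Metric.closedBall 0 r, |(u (x + y) - u x) - (w (x + y) - w x)|) +
          ∫ x in Metric.closedBall 0 r, |w (x + y) - w x| :=
        integral_add i1.abs.integrableOn i2.abs.integrableOn
    _ ≤ (∫ x, |(u (x + y) - u x) - (w (x + y) - w x)|) + η / 2 :=
        add_le_add (setIntegral_le_integral i1.abs (ae_of_all _ fun x => abs_nonneg _))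
          (hball.trans hfin)
    _ ≤ η := by linarith

end
end FPE

namespace FPE
open Set Topology

section
variable {d : ℕ}

lemma exists_approx {u₀ : (Fin d → ℝ) → ℝ} (hu : Integrable u₀) :
    ∃ f : ℕ → (Fin d → ℝ) → ℝ, (∀ n, Integrable (f n)) ∧ (∀ n, MemLp (f n) 2) ∧
      (∀ n, ∃ C0 C1, 0 ≤ C1 ∧ Tst (f n) C0 C1) ∧
      Tendsto (fun n => ∫ x, |f n x - u₀ x|) atTop (𝓝 0) := by
  have key : ∀ n : ℕ, ∃ g : (Fin d → ℝ) → ℝ, HasCompactSupport g ∧ ContDiff ℝ 3 g ∧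
      ∫ x, |g x - u₀ x| ≤ 1 / ((n : ℝ) + 1) := by
    intro n
    obtain ⟨g, h1, h2, h3⟩ := MemLp.exist_eLpNorm_sub_le (p := 1) (by simp) le_rfl
      (memLp_one_iff_integrable.2 hu) (ε := 1 / ((n : ℝ) + 1)) (by positivity)
    have hgi : Integrable g := h2.continuous.integrable_of_hasCompactSupport h1
    refine ⟨g, h1, contDiff_infty.1 h2 3, ?_⟩
    rw [L1_comm]
    rw [eLpNorm_one_eq_lintegral_enorm] at h3
    have e : ∫ x, |u₀ x - g x| = (∫⁻ x, ‖u₀ x - g x‖ₑ).toReal := by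
      simp only [← Real.norm_eq_abs]
      exact integral_norm_eq_lintegral_enorm (hu.sub hgi).aestronglyMeasurable
    rw [e]
    exact ENNReal.toReal_le_of_le_ofReal (by positivity) h3
  choose f h1 h2 h3 using key
  refine ⟨f, fun n => (h2 n).continuous.integrable_of_hasCompactSupport (h1 n),
    fun n => (h2 n).continuous.memLp_of_hasCompactSupport (h1 n),
    fun n => tst_of_compact (h2 n) (h1 n), ?_⟩
  exact squeeze_zero (fun n => integral_nonneg fun x => abs_nonneg _) h3
    tendsto_one_div_add_atTop_nhds_zero_nat

variable {A : ℕ → Fin d → Fin d → (Fin d → ℝ) → ℝ → ℝ} {B : ℕ → Fin d → (Fin d → ℝ) → ℝ → ℝ}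
  {h : ℕ → ℝ} {L c κ : ℝ} {J : ℕ → ((Fin d → ℝ) → ℝ) → (Fin d → ℝ) → ℝ}
  {f : ℕ → (Fin d → ℝ) → ℝ} {u₀ : (Fin d → ℝ) → ℝ}

noncomputable def ws (J : ℕ → ((Fin d → ℝ) → ℝ) → (Fin d → ℝ) → ℝ) (h : ℕ → ℝ)
    (f : ℕ → (Fin d → ℝ) → ℝ) (n : ℕ) (t : ℝ) : (Fin d → ℝ) → ℝ := (J n)^[⌊t / h n⌋₊] (f n)

structure Dat (A : ℕ → Fin d → Fin d → (Fin d → ℝ) → ℝ → ℝ)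
    (B : ℕ → Fin d → (Fin d → ℝ) → ℝ → ℝ)
    (h : ℕ → ℝ) (L c κ : ℝ) (J : ℕ → ((Fin d → ℝ) → ℝ) → (Fin d → ℝ) → ℝ)
    (f : ℕ → (Fin d → ℝ) → ℝ) (u₀ : (Fin d → ℝ) → ℝ) : Prop where
  fam : Fam A B h L c κ J
  u0 : Integrable u₀
  i : ∀ n, Integrable (f n)
  m : ∀ n, MemLp (f n) 2
  lim : Tendsto (fun n => ∫ x, |f n x - u₀ x|) atTop (𝓝 0)

lemma Dat.wi (D : Dat A B h L c κ J f u₀) (n : ℕ) (t : ℝ) : Integrable (ws J h f n t) :=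
  ((D.fam.lev n).it (D.i n) (D.m n) _).1

lemma Dat.near (D : Dat A B h L c κ J f u₀) {η : ℝ} (hη : 0 < η) :
    ∃ m, ∀ n ≥ m, ∫ x, |f n x - f m x| ≤ η := by
  obtain ⟨m, hm⟩ := eventually_atTop.1 (D.lim.eventually (gt_mem_nhds (half_pos hη)))
  refine ⟨m, fun n hn => ?_⟩
  have h1 := L1_triangle (D.i n) D.u0 (D.i m)
  rw [L1_comm u₀ (f m)] at h1
  linarith [hm n hn, hm m le_rfl]

lemma Dat.conv (D : Dat A B h L c κ J f u₀) (hT : ∀ n, ∃ C0 C1, 0 ≤ C1 ∧ Tst (f n) C0 C1)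
    (U : Ultrafilter ℕ) (hU : (U : Filter ℕ) ≤ atTop) {t : ℝ} (ht : 0 ≤ t) :
    ∃ v, Integrable v ∧ Tendsto (fun n => ∫ x, |ws J h f n t x - v x|) U (𝓝 0) := by
  refine L1_complete (fun n => D.wi n t) fun η hη => ?_
  obtain ⟨m, hm⟩ := D.near (η := η / 4) (by positivity)
  obtain ⟨C0, C1, hC1, hTm⟩ := hT m
  obtain ⟨v, hv, hlim⟩ := D.fam.cpt (D.i m) (D.m m) hC1 hTm U hU (fun n => ⌊t / h n⌋₊) (T := t)
    (fun n => by
      have hh := (D.fam.lev n).hh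
      have := Nat.floor_le (a := t / h n) (by positivity)
      rwa [le_div_iff₀ hh] at this)
  refine ⟨_, (hlim.eventually (gt_mem_nhds (show (0:ℝ) < η / 4 by positivity))).and
    (hU (eventually_ge_atTop m)), fun n hn n' hn' => ?_⟩
  have key : ∀ n, (∫ x, |((J n)^[⌊t / h n⌋₊] (f m)) x - v x| < η / 4 ∧ m ≤ n) →
      ∫ x, |ws J h f n t x - v x| ≤ η / 2 := by
    intro n hn
    have h1 := L1_triangle (D.wi n t) ((D.fam.lev n).it (D.i m) (D.m m) ⌊t / h n⌋₊).1 hv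
    have h2 := (D.fam.lev n).itcon (D.i n) (D.m n) (D.i m) (D.m m) ⌊t / h n⌋₊
    have h3 := hm n hn.2
    have h4 := hn.1
    unfold ws at h1 ⊢
    linarith
  have h1 := L1_triangle (D.wi n t) hv (D.wi n' t)
  rw [L1_comm v] at h1
  linarith [key n hn, key n' hn']

lemma Dat.equi (D : Dat A B h L c κ J f u₀) (hT : ∀ n, ∃ C0 C1, 0 ≤ C1 ∧ Tst (f n) C0 C1)
    {ε : ℝ} (hε : 0 < ε) : ∃ δ > 0, ∃ n0, ∀ n ≥ n0, ∀ s t, 0 ≤ s → 0 ≤ t → |t - s| ≤ δ →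
      ∫ x, |ws J h f n t x - ws J h f n s x| ≤ ε := by
  obtain ⟨m, hm⟩ := D.near (η := ε / 4) (by positivity)
  obtain ⟨C0, C1, hC1, hTm⟩ := hT m
  obtain ⟨τ, hτ, n1, hmod⟩ := D.fam.mod0 (D.i m) (D.m m) hC1 hTm (ε := ε / 2) (by positivity)
  obtain ⟨n2, hsm⟩ := D.fam.small (δ := τ / 2) (by positivity)
  have key : ∀ n ≥ max m (max n1 n2), ∀ s t, 0 ≤ s → s ≤ t → t - s ≤ τ / 2 →
      ∫ x, |ws J h f n t x - ws J h f n s x| ≤ ε := by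
    intro n hn s t hs hst hts
    have hn1 : m ≤ n := (le_max_left _ _).trans hn
    have hn2 : n1 ≤ n := (le_max_left _ _).trans ((le_max_right _ _).trans hn)
    have hn3 : n2 ≤ n := (le_max_right _ _).trans ((le_max_right _ _).trans hn)
    have hh := (D.fam.lev n).hh
    unfold ws
    have hmono : ⌊s / h n⌋₊ ≤ ⌊t / h n⌋₊ := Nat.floor_mono (by gcongr)
    obtain ⟨k, hk⟩ := Nat.exists_eq_add_of_le hmono
    rw [hk]
    refine ((D.fam.lev n).ittime (D.i n) (D.m n) _ k).trans ?_
    have hkh : k * h n ≤ τ := by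
      have a1 := Nat.floor_le (a := t / h n) (by have := hs.trans hst; positivity)
      have a2 := Nat.lt_floor_add_one (s / h n)
      rw [hk, le_div_iff₀ hh] at a1
      rw [div_lt_iff₀ hh] at a2
      push_cast at a1
      have := (hsm n hn3).1
      linarith
    have b1 := hmod n hn2 k hkh
    have b2 := (D.fam.lev n).itcon (D.i n) (D.m n) (D.i m) (D.m m) k
    have b3 := hm n hn1
    have b4 := L1_triangle ((D.fam.lev n).it (D.i n) (D.m n) k).1
      ((D.fam.lev n).it (D.i m) (D.m m) k).1 (D.i n)
    have b5 := L1_triangle ((D.fam.lev n).it (D.i m) (D.m m) k).1 (D.i m) (D.i n)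
    rw [L1_comm (f m) (f n)] at b5
    linarith
  refine ⟨τ / 2, by positivity, max m (max n1 n2), fun n hn s t hs ht hts => ?_⟩
  rcases le_total s t with hst | hst
  · exact key n hn s t hs hst (le_of_abs_le hts)
  · rw [L1_comm]
    exact key n hn t s ht hst (by rw [abs_sub_comm] at hts; exact le_of_abs_le hts)

theorem Dat.limit (D : Dat A B h L c κ J f u₀) (hT : ∀ n, ∃ C0 C1, 0 ≤ C1 ∧ Tst (f n) C0 C1) :
    ∃ v : ℝ → (Fin d → ℝ) → ℝ, (∀ t, 0 ≤ t → Integrable (v t)) ∧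
      (v 0 =ᵐ[volume] u₀) ∧
      (∀ ε > 0, ∃ δ > 0, ∀ s t, 0 ≤ s → 0 ≤ t → |t - s| ≤ δ → ∫ x, |v t x - v s x| ≤ ε) ∧
      ∃ σ : ℕ → ℕ, Tendsto σ atTop atTop ∧ ∀ T : ℝ, ∀ ε > 0, ∀ᶠ m in atTop, ∀ t, 0 ≤ t → t ≤ T →
        ∫ x, |ws J h f (σ m) t x - v t x| ≤ ε := by
  set U : Ultrafilter ℕ := hyperfilter ℕ
  have hU : (U : Filter ℕ) ≤ atTop := Nat.hyperfilter_le_atTop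
  have hex : ∀ t : ℝ, ∃ v, 0 ≤ t → (Integrable v ∧
      Tendsto (fun n => ∫ x, |ws J h f n t x - v x|) U (𝓝 0)) := by
    intro t
    by_cases ht : 0 ≤ t
    · obtain ⟨v, hv⟩ := D.conv hT U hU ht
      exact ⟨v, fun _ => hv⟩
    · exact ⟨0, fun h => absurd h ht⟩
  choose v hv using hex
  have hmod : ∀ ε > 0, ∃ δ > 0, ∀ s t, 0 ≤ s → 0 ≤ t → |t - s| ≤ δ →
      ∫ x, |v t x - v s x| ≤ ε := by
    intro ε hε
    obtain ⟨δ, hδ, n0, h1⟩ := D.equi hT hε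
    refine ⟨δ, hδ, fun s t hs ht hst => ?_⟩
    refine L1_dist_limit (fun n => D.wi n t) (hv t ht).1 (fun n => D.wi n s) (hv s hs).1
      (hv t ht).2 (hv s hs).2 ?_
    filter_upwards [hU (eventually_ge_atTop n0)] with n hn using h1 n hn s t hs ht hst
  refine ⟨v, fun t ht => (hv t ht).1, ?_, hmod, ?_⟩
  · have h0 : ∫ x, |v 0 x - u₀ x| ≤ 0 := by
      refine L1_dist_limit (fun n => D.wi n 0) (hv 0 le_rfl).1 D.i D.u0 (hv 0 le_rfl).2
        (D.lim.mono_left hU) (Eventually.of_forall fun n => ?_)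
      simp [ws]
    have h1 := le_antisymm h0 (integral_nonneg fun x => abs_nonneg _)
    have hi : Integrable (fun x => |v 0 x - u₀ x|) := ((hv 0 le_rfl).1.sub D.u0).abs
    rw [integral_eq_zero_iff_of_nonneg (fun x => abs_nonneg _) hi] at h1
    filter_upwards [h1] with x hx
    exact sub_eq_zero.1 (abs_eq_zero.1 hx)
  · have huni : ∀ T : ℝ, ∀ ε > 0, ∀ᶠ n in (U : Filter ℕ), ∀ t, 0 ≤ t → t ≤ T →
        ∫ x, |ws J h f n t x - v t x| ≤ ε := by
      intro T ε hε
      obtain ⟨δ1, hδ1, n0, h1⟩ := D.equi hT (ε := ε / 3) (by positivity)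
      obtain ⟨δ2, hδ2, h2⟩ := hmod (ε / 3) (by positivity)
      set δ := min δ1 δ2
      have hδ : 0 < δ := by positivity
      have hfin : ∀ᶠ n in (U : Filter ℕ), ∀ i ∈ Finset.range (⌊T / δ⌋₊ + 1),
          ∫ x, |ws J h f n (i * δ) x - v (i * δ) x| < ε / 3 := by
        rw [Filter.eventually_all_finset]
        intro i _
        exact (hv (i * δ) (by positivity)).2.eventually (gt_mem_nhds (by positivity))
      filter_upwards [hfin, hU (eventually_ge_atTop n0)] with n hn hn0 t ht htT
      have hi : ⌊t / δ⌋₊ < ⌊T / δ⌋₊ + 1 := Nat.lt_succ_of_le (Nat.floor_mono (by gcongr))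
      have a1 := Nat.floor_le (a := t / δ) (by positivity)
      have a2 := Nat.lt_floor_add_one (t / δ)
      rw [le_div_iff₀ hδ] at a1
      rw [div_lt_iff₀ hδ] at a2
      set s : ℝ := ⌊t / δ⌋₊ * δ with hs
      have hs0 : 0 ≤ s := by positivity
      have hts : |t - s| ≤ δ := by rw [abs_le]; constructor <;> linarith
      have b1 := hn _ (Finset.mem_range.2 hi)
      rw [← hs] at b1
      have b2 := h1 n hn0 s t hs0 ht (hts.trans (min_le_left _ _))
      have b3 := h2 s t hs0 ht (hts.trans (min_le_right _ _))
      have b4 := L1_triangle (D.wi n t) (D.wi n s) (hv t ht).1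
      have b5 := L1_triangle (D.wi n s) (hv s hs0).1 (hv t ht).1
      rw [L1_comm (v s)] at b5
      linarith
    have hsel : ∀ m : ℕ, ∃ n, m ≤ n ∧ ∀ t : ℝ, 0 ≤ t → t ≤ m →
        ∫ x, |ws J h f n t x - v t x| ≤ 1 / ((m : ℝ) + 1) := by
      intro m
      have e1 : ∀ᶠ n in (U : Filter ℕ), m ≤ n := hU (eventually_ge_atTop m)
      exact (e1.and (huni m (1 / ((m : ℝ) + 1)) (by positivity))).exists
    choose σ hσ1 hσ2 using hsel
    refine ⟨σ, tendsto_atTop_mono hσ1 tendsto_id, fun T ε hε => ?_⟩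
    have e1 : ∀ᶠ m : ℕ in atTop, 1 / ((m : ℝ) + 1) < ε :=
      tendsto_one_div_add_atTop_nhds_zero_nat.eventually (gt_mem_nhds hε)
    have e2 : ∀ᶠ m : ℕ in atTop, T ≤ m := tendsto_natCast_atTop_atTop.eventually_ge_atTop T
    filter_upwards [e1, e2] with m h1 h2 t ht htT
    exact (hσ2 m t ht (htT.trans h2)).trans h1.le

end
end FPE

namespace FPE
open Set Topology

section
variable {d : ℕ}

structure Cf (A : Fin d → Fin d → (Fin d → ℝ) → ℝ → ℝ) (B : Fin d → (Fin d → ℝ) → ℝ → ℝ)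
    (L : ℝ) : Prop where
  hL : 0 ≤ L
  cA : ∀ i j, Continuous fun p : (Fin d → ℝ) × ℝ => A i j p.1 p.2
  cB : ∀ i, Continuous fun p : (Fin d → ℝ) × ℝ => B i p.1 p.2
  bA : ∀ i j x s, |A i j x s| ≤ L * |s|
  bB : ∀ i x s, |B i x s| ≤ L * |s|

lemma Lev.cf {A : Fin d → Fin d → (Fin d → ℝ) → ℝ → ℝ} {B : Fin d → (Fin d → ℝ) → ℝ → ℝ}
    {h L c κ : ℝ} {J : ((Fin d → ℝ) → ℝ) → (Fin d → ℝ) → ℝ} (H : Lev A B h L c κ J) : Cf A B L :=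
  ⟨H.hL, H.cA, H.cB, H.bA, H.bB⟩

lemma Cf.int {A : Fin d → Fin d → (Fin d → ℝ) → ℝ → ℝ} {B : Fin d → (Fin d → ℝ) → ℝ → ℝ}
    {L : ℝ} (H : Cf A B L) {φ C0 C1} (hφ : Tst φ C0 C1) {u : (Fin d → ℝ) → ℝ} (hu : Integrable u) :
    Integrable (fun x => Lop A B φ x (u x)) := Lop_integrable H.cA H.cB H.hL H.bA H.bB hφ hu

lemma Cf.conts {A : Fin d → Fin d → (Fin d → ℝ) → ℝ → ℝ} {B : Fin d → (Fin d → ℝ) → ℝ → ℝ}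
    {L : ℝ} (H : Cf A B L) {φ C0 C1} (hφ : Tst φ C0 C1) (x : Fin d → ℝ) :
    Continuous (fun s => Lop A B φ x s) := by
  have h1 := Lop_cont H.cA H.cB hφ
  have h2 : Continuous fun s : ℝ => (x, s) := by fun_prop
  exact h1.comp h2

def Agr (A : ℕ → Fin d → Fin d → (Fin d → ℝ) → ℝ → ℝ) (B : ℕ → Fin d → (Fin d → ℝ) → ℝ → ℝ)
    (A' : Fin d → Fin d → (Fin d → ℝ) → ℝ → ℝ) (B' : Fin d → (Fin d → ℝ) → ℝ → ℝ) : Prop :=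
  ∀ R : ℝ, ∀ᶠ m in atTop, ∀ (x : Fin d → ℝ) (s : ℝ), ‖x‖ ≤ R → |s| ≤ R →
    (∀ i j, A m i j x s = A' i j x s) ∧ ∀ i, B m i x s = B' i x s

variable {A : ℕ → Fin d → Fin d → (Fin d → ℝ) → ℝ → ℝ} {B : ℕ → Fin d → (Fin d → ℝ) → ℝ → ℝ}
  {A' : Fin d → Fin d → (Fin d → ℝ) → ℝ → ℝ} {B' : Fin d → (Fin d → ℝ) → ℝ → ℝ}
  {h : ℕ → ℝ} {L L' c κ : ℝ} {J : ℕ → ((Fin d → ℝ) → ℝ) → (Fin d → ℝ) → ℝ}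
  {f : ℕ → (Fin d → ℝ) → ℝ} {u₀ : (Fin d → ℝ) → ℝ}

lemma Lop_conv_ae (H : ∀ n, Cf (A n) (B n) L) (H' : Cf A' B' L) (hA : Agr A B A' B')
    {ψ C0 C1} (hC1 : 0 ≤ C1) (hψ : Tst ψ C0 C1) {u : ℕ → (Fin d → ℝ) → ℝ} {v : (Fin d → ℝ) → ℝ}
    (hu : ∀ n, Integrable (u n)) (hv : Integrable v)
    (h1 : Tendsto (fun n => ∫ x, |u n x - v x|) atTop (𝓝 0))
    (h2 : ∀ᵐ x, Tendsto (fun n => u n x) atTop (𝓝 (v x))) :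
    Tendsto (fun n => ∫ x, Lop (A n) (B n) ψ x (u n x)) atTop (𝓝 (∫ x, Lop A' B' ψ x (v x))) := by
  set D := ((d : ℝ) ^ 2 + d) * L * C1 with hD
  have hL := H'.hL
  have hD0 : 0 ≤ D := by positivity
  set F : ℕ → (Fin d → ℝ) → ℝ := fun n x => Lop (A n) (B n) ψ x (u n x) with hF
  set F' : (Fin d → ℝ) → ℝ := fun x => Lop A' B' ψ x (v x) with hF'
  have iF : ∀ n, Integrable (F n) := fun n => (H n).int hψ (hu n)
  have iF' : Integrable F' := H'.int hψ hv
  have bF : ∀ n x, |F n x| ≤ D * |u n x| := fun n x => Lop_abs hL (H n).bA (H n).bB hψ x _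
  have bF' : ∀ x, |F' x| ≤ D * |v x| := fun x => Lop_abs hL H'.bA H'.bB hψ x _
  have aF : ∀ᵐ x, Tendsto (fun n => F n x) atTop (𝓝 (F' x)) := by
    filter_upwards [h2] with x hx
    have hc : Tendsto (fun n => Lop A' B' ψ x (u n x)) atTop (𝓝 (Lop A' B' ψ x (v x))) := by
      exact ((Cf.conts H' hψ x).tendsto (v x)).comp hx
    refine hc.congr' ?_
    have hb : ∀ᶠ n in atTop, |u n x| < |v x| + 1 :=
      hx.abs.eventually (gt_mem_nhds (by linarith))
    filter_upwards [hb, hA (max ‖x‖ (|v x| + 1))] with n hn hn'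
    obtain ⟨e1, e2⟩ := hn' x (u n x) (le_max_left _ _) (hn.le.trans (le_max_right _ _))
    simp only [hF, Lop, e1, e2]
  set z : ℕ → (Fin d → ℝ) → ℝ := fun n x => max (|F n x - F' x| - D * |u n x - v x|) 0 with hz
  have iz : ∀ n, Integrable (z n) := fun n =>
    (((iF n).sub iF').abs.sub (((hu n).sub hv).abs.const_mul D)).pos_part
  have hz0 : Tendsto (fun n => ∫ x, z n x) atTop (𝓝 (∫ _ : Fin d → ℝ, (0:ℝ))) := by
    refine tendsto_integral_of_dominated_convergence (fun x => 2 * D * |v x|)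
      (fun n => (iz n).aestronglyMeasurable) (hv.abs.const_mul _) (fun n => ae_of_all _ fun x => ?_)
      ?_
    · rw [Real.norm_eq_abs, abs_of_nonneg (le_max_right _ _)]
      refine max_le ?_ (by positivity)
      have t1 : |F n x - F' x| ≤ |F n x| + |F' x| := abs_sub _ _
      have t2 : |u n x| ≤ |u n x - v x| + |v x| := by
        have := abs_add_le (u n x - v x) (v x); simpa using this
      have t3 := mul_le_mul_of_nonneg_left t2 hD0
      linarith [bF n x, bF' x]
    · filter_upwards [aF, h2] with x hx hx'
      have t1 : Tendsto (fun n => |F n x - F' x| - D * |u n x - v x|) atTop (𝓝 0) := by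
        have a1 := (hx.sub_const (F' x)).abs
        have a2 := ((hx'.sub_const (v x)).abs).const_mul D
        simpa using a1.sub a2
      simpa using t1.max (tendsto_const_nhds (x := (0:ℝ)))
  rw [integral_zero] at hz0
  have hsq : Tendsto (fun n => (∫ x, z n x) + D * ∫ x, |u n x - v x|) atTop (𝓝 0) := by
    simpa using hz0.add (h1.const_mul D)
  rw [tendsto_iff_dist_tendsto_zero]
  refine squeeze_zero (fun n => dist_nonneg) (fun n => ?_) hsq
  rw [Real.dist_eq]
  refine (L1_abs_integral_sub_le (iF n) iF').trans ?_
  have i1 : Integrable (fun x => D * |u n x - v x|) := ((hu n).sub hv).abs.const_mul D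
  rw [← integral_const_mul, ← integral_add (iz n) i1]
  refine integral_mono ((iF n).sub iF').abs ((iz n).add i1) fun x => ?_
  have := le_max_left (|F n x - F' x| - D * |u n x - v x|) 0
  show |F n x - F' x| ≤ z n x + D * |u n x - v x|
  linarith

lemma Agr.comp (hA : Agr A B A' B') {σ : ℕ → ℕ} (hσ : Tendsto σ atTop atTop) :
    Agr (fun n => A (σ n)) (fun n => B (σ n)) A' B' := fun R => hσ.eventually (hA R)

lemma Lop_conv (H : ∀ n, Cf (A n) (B n) L) (H' : Cf A' B' L) (hA : Agr A B A' B')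
    {ψ C0 C1} (hC1 : 0 ≤ C1) (hψ : Tst ψ C0 C1) {u : ℕ → (Fin d → ℝ) → ℝ} {v : (Fin d → ℝ) → ℝ}
    (hu : ∀ n, Integrable (u n)) (hv : Integrable v)
    (h1 : Tendsto (fun n => ∫ x, |u n x - v x|) atTop (𝓝 0)) :
    Tendsto (fun n => ∫ x, Lop (A n) (B n) ψ x (u n x)) atTop (𝓝 (∫ x, Lop A' B' ψ x (v x))) := by
  refine tendsto_of_subseq_tendsto fun ns hns => ?_
  obtain ⟨s, hs, hs1, hs2⟩ := L1_subseq le_rfl (u := fun n => u (ns n)) (fun n => hu _) hv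
    (h1.comp hns)
  exact ⟨s, Lop_conv_ae (fun n => H (ns (s n))) H' (hA.comp (hns.comp hs)) hC1 hψ
    (fun n => hu (ns (s n))) hv hs1 hs2⟩

/-- data for the limiting equation -/
structure Lim (A : ℕ → Fin d → Fin d → (Fin d → ℝ) → ℝ → ℝ)
    (B : ℕ → Fin d → (Fin d → ℝ) → ℝ → ℝ)
    (A' : Fin d → Fin d → (Fin d → ℝ) → ℝ → ℝ) (B' : Fin d → (Fin d → ℝ) → ℝ → ℝ)
    (h : ℕ → ℝ) (L c κ : ℝ) (J : ℕ → ((Fin d → ℝ) → ℝ) → (Fin d → ℝ) → ℝ)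
    (f : ℕ → (Fin d → ℝ) → ℝ) (u₀ : (Fin d → ℝ) → ℝ) (v : ℝ → (Fin d → ℝ) → ℝ) : Prop where
  dat : Dat A B h L c κ J f u₀
  cf : Cf A' B' L
  agr : Agr A B A' B'
  iv : ∀ t, 0 ≤ t → Integrable (v t)
  mod : ∀ ε > 0, ∃ δ > 0, ∀ s t, 0 ≤ s → 0 ≤ t → |t - s| ≤ δ → ∫ x, |v t x - v s x| ≤ ε
  uni : ∀ T : ℝ, ∀ ε > 0, ∀ᶠ m in atTop, ∀ t, 0 ≤ t → t ≤ T →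
        ∫ x, |ws J h f m t x - v t x| ≤ ε

variable {v : ℝ → (Fin d → ℝ) → ℝ}

lemma Lim.pt (D : Lim A B A' B' h L c κ J f u₀ v) {t : ℝ} (ht : 0 ≤ t) :
    Tendsto (fun n => ∫ x, |ws J h f n t x - v t x|) atTop (𝓝 0) := by
  rw [Metric.tendsto_nhds]
  intro ε hε
  filter_upwards [D.uni t (ε / 2) (by positivity)] with n hn
  rw [Real.dist_eq, sub_zero, abs_of_nonneg (integral_nonneg fun x => abs_nonneg _)]
  linarith [hn t ht le_rfl]

lemma Lim.norm (D : Lim A B A' B' h L c κ J f u₀ v) {t : ℝ} (ht : 0 ≤ t) :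
    ∫ x, |v t x| ≤ ∫ x, |u₀ x| := by
  have h1 : Tendsto (fun n => ∫ x, |ws J h f n t x|) atTop (𝓝 (∫ x, |v t x|)) := by
    have := tendsto_bdd_mul (φ := fun _ => (1:ℝ)) (fun n => (D.dat.wi n t).abs) (D.iv t ht).abs
      (tendsto_abs_L1 (fun n => D.dat.wi n t) (D.iv t ht) (D.pt ht))
      aestronglyMeasurable_const (C := 1) (by simp)
    simpa using this
  have h2 : Tendsto (fun n => ∫ x, |f n x|) atTop (𝓝 (∫ x, |u₀ x|)) := by
    have := tendsto_bdd_mul (φ := fun _ => (1:ℝ)) (fun n => (D.dat.i n).abs) D.dat.u0.abs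
      (tendsto_abs_L1 D.dat.i D.dat.u0 D.dat.lim)
      aestronglyMeasurable_const (C := 1) (by simp)
    simpa using this
  exact le_of_tendsto_of_tendsto' h1 h2 fun n =>
    (D.dat.fam.lev n).itL1 (D.dat.i n) (D.dat.m n) _

lemma Lim.mass (D : Lim A B A' B' h L c κ J f u₀ v) {t : ℝ} (ht : 0 ≤ t) :
    ∫ x, v t x = ∫ x, u₀ x := by
  have h1 : Tendsto (fun n => ∫ x, ws J h f n t x) atTop (𝓝 (∫ x, v t x)) := by
    have := tendsto_bdd_mul (φ := fun _ => (1:ℝ)) (fun n => D.dat.wi n t) (D.iv t ht)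
      (D.pt ht) aestronglyMeasurable_const (C := 1) (by simp)
    simpa using this
  have h2 : Tendsto (fun n => ∫ x, f n x) atTop (𝓝 (∫ x, u₀ x)) := by
    have := tendsto_bdd_mul (φ := fun _ => (1:ℝ)) D.dat.i D.dat.u0
      D.dat.lim aestronglyMeasurable_const (C := 1) (by simp)
    simpa using this
  refine tendsto_nhds_unique h1 (h2.congr fun n => ?_)
  exact ((D.dat.fam.lev n).itmass (D.dat.i n) (D.dat.m n) _).symm

lemma Lim.pos (D : Lim A B A' B' h L c κ J f u₀ v) (h0 : 0 ≤ᵐ[volume] u₀) {t : ℝ} (ht : 0 ≤ t) :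
    0 ≤ᵐ[volume] v t := by
  have h1 := D.norm ht
  have h2 := D.mass ht
  have h3 : ∫ x, |u₀ x| = ∫ x, u₀ x := integral_congr_ae (by
    filter_upwards [h0] with x hx using abs_of_nonneg hx)
  have i1 : Integrable (fun x => |v t x|) := (D.iv t ht).abs
  have i2 : Integrable (fun x => |v t x| - v t x) := i1.sub (D.iv t ht)
  have h4 : ∫ x, (|v t x| - v t x) = 0 := by
    refine le_antisymm ?_ (integral_nonneg fun x => sub_nonneg.2 (le_abs_self _))
    rw [integral_sub i1 (D.iv t ht)]
    linarith
  rw [integral_eq_zero_iff_of_nonneg (fun x => sub_nonneg.2 (le_abs_self _)) i2] at h4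
  filter_upwards [h4] with x hx
  have : |v t x| - v t x = 0 := hx
  show 0 ≤ v t x
  linarith [abs_nonneg (v t x)]

/-- joint convergence of the discrete generators -/
lemma Lim.gen (D : Lim A B A' B' h L c κ J f u₀ v) {ψ C0 C1} (hC1 : 0 ≤ C1) (hψ : Tst ψ C0 C1)
    {t : ℝ} (ht : 0 ≤ t) {ε : ℝ} (hε : 0 < ε) : ∃ δ > 0, ∃ m0 : ℕ, ∀ m ≥ m0, ∀ s, 0 ≤ s →
      |s - t| ≤ δ → |(∫ x, Lop (A m) (B m) ψ x (ws J h f m s x)) -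
        (∫ x, Lop A' B' ψ x (v t x))| ≤ ε := by
  by_contra hcon
  push Not at hcon
  have key : ∀ k : ℕ, ∃ m ≥ k, ∃ s, 0 ≤ s ∧ |s - t| ≤ 1 / ((k : ℝ) + 1) ∧
      ε < |(∫ x, Lop (A m) (B m) ψ x (ws J h f m s x)) - (∫ x, Lop A' B' ψ x (v t x))| := fun k =>
    hcon (1 / ((k : ℝ) + 1)) (by positivity) k
  choose m hm s hs0 hst hbig using key
  have hmt : Tendsto m atTop atTop := tendsto_atTop_mono hm tendsto_id
  have hst0 : Tendsto (fun k => |s k - t|) atTop (𝓝 0) :=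
    squeeze_zero (fun k => abs_nonneg _) hst tendsto_one_div_add_atTop_nhds_zero_nat
  have hconv : Tendsto (fun k => ∫ x, |ws J h f (m k) (s k) x - v t x|) atTop (𝓝 0) := by
    rw [Metric.tendsto_nhds]
    intro η hη
    obtain ⟨δ, hδ, hmod⟩ := D.mod (η / 3) (by positivity)
    filter_upwards [hmt.eventually (D.uni (t + 1) (η / 3) (by positivity)),
      hst0.eventually (gt_mem_nhds hδ), hst0.eventually (gt_mem_nhds one_pos)] with k k1 k2 k3
    rw [Real.dist_eq, sub_zero, abs_of_nonneg (integral_nonneg fun x => abs_nonneg _)]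
    have a1 := k1 (s k) (hs0 k) (by linarith [le_of_abs_le k3.le])
    have a2 := hmod t (s k) ht (hs0 k) k2.le
    have a3 := L1_triangle (D.dat.wi (m k) (s k)) (D.iv _ (hs0 k)) (D.iv t ht)
    linarith
  have := Lop_conv (fun k => (D.dat.fam.lev (m k)).cf) D.cf (D.agr.comp hmt) hC1 hψ
    (fun k => D.dat.wi (m k) (s k)) (D.iv t ht) hconv
  obtain ⟨k, hk⟩ := ((Metric.tendsto_nhds.1 this) ε hε).exists
  rw [Real.dist_eq] at hk
  exact absurd hk (not_lt.2 (hbig k).le)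

lemma floor_tendsto {h : ℕ → ℝ} (hp : ∀ n, 0 < h n) (h0 : Tendsto h atTop (𝓝 0)) {t : ℝ}
    (ht : 0 ≤ t) : Tendsto (fun n => (⌊t / h n⌋₊ : ℝ) * h n) atTop (𝓝 t) := by
  have h1 : Tendsto (fun n => t - h n) atTop (𝓝 t) := by
    simpa using (tendsto_const_nhds (x := t)).sub h0
  refine tendsto_of_tendsto_of_tendsto_of_le_of_le h1 tendsto_const_nhds (fun n => ?_) fun n => ?_
  · have := Nat.lt_floor_add_one (t / h n)
    rw [div_lt_iff₀ (hp n)] at this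
    show t - h n ≤ _
    linarith
  · have hh := hp n
    have := Nat.floor_le (a := t / h n) (by positivity)
    rwa [le_div_iff₀ hh] at this

lemma Lim.incr (D : Lim A B A' B' h L c κ J f u₀ v) {ψ C0 C1} (hC1 : 0 ≤ C1) (hψ : Tst ψ C0 C1)
    {t : ℝ} (ht : 0 ≤ t) {ε : ℝ} (hε : 0 < ε) : ∃ δ > 0, ∀ s s', 0 ≤ s → s ≤ s' →
      |s - t| ≤ δ → |s' - t| ≤ δ →
      |(∫ x, ψ x * v s' x) - (∫ x, ψ x * v s x) - (s' - s) * ∫ x, Lop A' B' ψ x (v t x)| ≤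
        (s' - s) * ε := by
  obtain ⟨δ, hδ, m0, hgen⟩ := D.gen hC1 hψ ht hε
  refine ⟨δ, hδ, fun s s' hs hss h1 h2 => ?_⟩
  set g := ∫ x, Lop A' B' ψ x (v t x) with hg
  have hp : ∀ n, 0 < h n := fun n => (D.dat.fam.lev n).hh
  have hψm : AEStronglyMeasurable ψ volume := hψ.smooth.continuous.aestronglyMeasurable
  have l1 := tendsto_bdd_mul (fun n => D.dat.wi n s) (D.iv s hs) (D.pt hs) hψm hψ.b0
  have l2 := tendsto_bdd_mul (fun n => D.dat.wi n s') (D.iv s' (hs.trans hss))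
    (D.pt (hs.trans hss)) hψm hψ.b0
  have f1 := floor_tendsto hp D.dat.fam.h0 hs
  have f2 := floor_tendsto hp D.dat.fam.h0 (hs.trans hss)
  refine le_of_tendsto_of_tendsto (((l2.sub l1).sub ((f2.sub f1).mul_const g)).abs)
    ((f2.sub f1).mul_const ε) ?_
  filter_upwards [eventually_ge_atTop m0] with n hn
  have hh := hp n
  have hmono : ⌊s / h n⌋₊ ≤ ⌊s' / h n⌋₊ := Nat.floor_mono (by gcongr)
  obtain ⟨k, hk⟩ := Nat.exists_eq_add_of_le hmono
  set j := ⌊s / h n⌋₊ with hj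
  have hs' : 0 ≤ s' := hs.trans hss
  have a1 := Nat.floor_le (a := s' / h n) (by positivity)
  have a2 := Nat.lt_floor_add_one (s / h n)
  rw [hk, le_div_iff₀ hh] at a1
  rw [div_lt_iff₀ hh, ← hj] at a2
  push_cast at a1
  have e := (D.dat.fam.lev n).itweak (D.dat.i n) (D.dat.m n) hC1 hψ j k
  have e' : (∫ x, ψ x * ws J h f n s' x) - (∫ x, ψ x * ws J h f n s x) =
      ∑ i ∈ Finset.range k, h n * ∫ x, Lop (A n) (B n) ψ x (((J n)^[j + i + 1] (f n)) x) := by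
    rw [← e]; unfold ws; rw [hk, ← hj]
  rw [e', hk]
  push_cast
  have e2 : ((j : ℝ) + k) * h n - j * h n = ∑ i ∈ Finset.range k, h n := by
    simp; ring
  rw [e2, Finset.sum_mul, Finset.sum_mul, ← Finset.sum_sub_distrib]
  refine (Finset.abs_sum_le_sum_abs _ _).trans (Finset.sum_le_sum fun i hi => ?_)
  rw [← mul_sub, abs_mul, abs_of_pos hh]
  refine mul_le_mul_of_nonneg_left ?_ hh.le
  rw [Finset.mem_range] at hi
  have hi' : (i : ℝ) + 1 ≤ k := by exact_mod_cast hi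
  set r : ℝ := ((j + i + 1 : ℕ) : ℝ) * h n with hr
  have hr0 : 0 ≤ r := by positivity
  have hrs : s ≤ r := by
    rw [hr]; push_cast
    have : (0:ℝ) ≤ i * h n := by positivity
    linarith
  have hrs' : r ≤ s' := by
    rw [hr]; push_cast
    have := mul_le_mul_of_nonneg_right hi' hh.le
    linarith
  have hw : ws J h f n r = (J n)^[j + i + 1] (f n) := by
    unfold ws
    rw [hr, mul_div_assoc, div_self hh.ne', mul_one, Nat.floor_natCast]
  rw [← hw]
  refine hgen n hn r hr0 ?_
  rw [abs_le] at h1 h2 ⊢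
  constructor <;> linarith

lemma Lim.deriv (D : Lim A B A' B' h L c κ J f u₀ v) {ψ C0 C1} (hC1 : 0 ≤ C1) (hψ : Tst ψ C0 C1)
    {t : ℝ} (ht : 0 < t) :
    HasDerivAt (fun s => ∫ x, ψ x * v s x) (∫ x, Lop A' B' ψ x (v t x)) t := by
  rw [hasDerivAt_iff_isLittleO, Asymptotics.isLittleO_iff]
  intro ε hε
  obtain ⟨δ, hδ, hinc⟩ := D.incr hC1 hψ ht.le hε
  have e1 : ∀ᶠ s in 𝓝 t, |s - t| < δ := by
    have := Metric.ball_mem_nhds t hδ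
    filter_upwards [this] with s hs
    rwa [Metric.mem_ball, Real.dist_eq] at hs
  filter_upwards [e1, lt_mem_nhds ht] with s hs hs0
  rw [smul_eq_mul, Real.norm_eq_abs, Real.norm_eq_abs]
  have h0 : |t - t| ≤ δ := by simpa using hδ.le
  rcases le_total t s with hts | hts
  · have := hinc t s ht.le hts h0 hs.le
    rw [abs_of_nonneg (sub_nonneg.2 hts)]
    linarith
  · have := hinc s t hs0.le hts hs.le h0
    rw [abs_of_nonpos (sub_nonpos.2 hts), ← abs_neg]
    have e : -((∫ x, ψ x * v s x) - (∫ x, ψ x * v t x) - (s - t) * ∫ x, Lop A' B' ψ x (v t x)) =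
      (∫ x, ψ x * v t x) - (∫ x, ψ x * v s x) - (t - s) * ∫ x, Lop A' B' ψ x (v t x) := by ring
    rw [e]
    linarith

end
end FPE

namespace FPE
open Set Topology

section
variable {d : ℕ}

noncomputable def dd (w : ℝ × (Fin d → ℝ)) (φ : ℝ × (Fin d → ℝ) → ℝ) (p : ℝ × (Fin d → ℝ)) : ℝ :=
  fderiv ℝ φ p w

/-- smooth compactly supported -/
structure Cc (φ : ℝ × (Fin d → ℝ) → ℝ) : Prop where
  s : ContDiff ℝ (⊤ : ℕ∞) φ
  c : HasCompactSupport φ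

lemma Cc.dd {φ : ℝ × (Fin d → ℝ) → ℝ} (H : Cc φ) (w : ℝ × (Fin d → ℝ)) : Cc (dd w φ) := by
  refine ⟨?_, ?_⟩
  · unfold FPE.dd
    exact (H.s.fderiv_right (m := (⊤ : ℕ∞)) (by simp)).clm_apply contDiff_const
  · have h1 : HasCompactSupport (fun x => fderiv ℝ φ x) := H.c.fderiv ℝ
    exact h1.comp_left (g := fun L : (ℝ × (Fin d → ℝ)) →L[ℝ] ℝ => L w) (by simp)

lemma Cc.diff {φ : ℝ × (Fin d → ℝ) → ℝ} (H : Cc φ) : Differentiable ℝ φ :=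
  H.s.differentiable (by simp)

lemma Cc.bound {φ : ℝ × (Fin d → ℝ) → ℝ} (H : Cc φ) : ∃ K, 0 ≤ K ∧ (∀ p, |φ p| ≤ K) ∧
    ∀ p q, |φ p - φ q| ≤ K * ‖p - q‖ := by
  obtain ⟨K1, h1⟩ := H.c.exists_bound_of_continuous H.s.continuous
  obtain ⟨K2, h2⟩ := ContDiff.lipschitzWith_of_hasCompactSupport H.c H.s (by simp)
  have h0 : 0 ≤ K1 := (norm_nonneg _).trans (h1 0)
  refine ⟨K1 + K2, by positivity, fun p => ?_, fun p q => ?_⟩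
  · have := h1 p
    rw [Real.norm_eq_abs] at this
    have h3 : (0:ℝ) ≤ K2 := K2.2
    linarith
  · have := h2.dist_le_mul p q
    rw [Real.dist_eq, dist_eq_norm] at this
    have h3 := mul_nonneg h0 (norm_nonneg (p - q))
    linarith

lemma dd_supp {φ : ℝ × (Fin d → ℝ) → ℝ} (w : ℝ × (Fin d → ℝ)) : tsupport (dd w φ) ⊆ tsupport φ := by
  refine subset_trans ?_ (tsupport_fderiv_subset ℝ)
  refine closure_mono fun p hp => ?_
  rw [Function.mem_support] at hp ⊢
  intro h0
  exact hp (by rw [dd, h0]; rfl)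

lemma pdx_eq {φ : ℝ × (Fin d → ℝ) → ℝ} (H : Differentiable ℝ φ) (i : Fin d) (t : ℝ)
    (x : Fin d → ℝ) : pdx i φ (t, x) = pd i (fun y => φ (t, y)) x := by
  have h1 : HasFDerivAt (fun y : Fin d → ℝ => (t, y)) (ContinuousLinearMap.inr ℝ ℝ (Fin d → ℝ)) x :=
    hasFDerivAt_prodMk_right t x
  have h2 : HasFDerivAt (fun y => φ (t, y)) _ x := (H (t, x)).hasFDerivAt.comp x h1
  rw [pd, h2.fderiv, pdx]
  rfl

lemma pdxx_eq {φ : ℝ × (Fin d → ℝ) → ℝ} (H : Cc φ) (i j : Fin d) (t : ℝ)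
    (x : Fin d → ℝ) : pdxx i j φ (t, x) = pd2 i j (fun y => φ (t, y)) x := by
  have h1 : Differentiable ℝ (pdx j φ) := (H.dd _).diff
  rw [pdxx, pdx_eq h1, pd2]
  congr 1
  funext y
  exact pdx_eq H.diff j t y

lemma slice_tst {φ : ℝ × (Fin d → ℝ) → ℝ} (H : Cc φ) :
    ∃ C0 C1, 0 ≤ C1 ∧ ∀ t, Tst (fun x => φ (t, x)) C0 C1 := by
  obtain ⟨C0, -, hC0, -⟩ := H.bound
  have c1 : ∀ i, Cc (pdx i φ) := fun i => H.dd _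
  have c2 : ∀ i j, Cc (pdxx i j φ) := fun i j => (c1 j).dd _
  choose a ha0 ha using fun i => (c1 i).bound
  choose b hb0 hb using fun i j => (c2 i j).bound
  have a0 : 0 ≤ ∑ i, a i := Finset.sum_nonneg fun i _ => ha0 i
  have b0 : 0 ≤ ∑ i, ∑ j, b i j :=
    Finset.sum_nonneg fun i _ => Finset.sum_nonneg fun j _ => hb0 i j
  have hbs : ∀ i j, b i j ≤ ∑ i, ∑ j, b i j := fun i j => by
    have h1 := Finset.single_le_sum (f := fun i => ∑ j, b i j)
      (fun i _ => Finset.sum_nonneg fun j _ => hb0 i j) (Finset.mem_univ i)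
    have h3 := Finset.single_le_sum (f := fun j => b i j) (fun j _ => hb0 i j)
      (Finset.mem_univ j)
    exact h3.trans h1
  refine ⟨C0, ∑ i, a i + ∑ i, ∑ j, b i j, by positivity, fun t => ⟨?_, fun x => hC0 _,
    fun i x => ?_, fun i j x => ?_, fun i j x y => ?_⟩⟩
  · have h1 : ContDiff ℝ 2 φ := contDiff_infty.1 H.s 2
    exact h1.comp (contDiff_const.prodMk contDiff_id)
  · rw [← pdx_eq H.diff]
    have h1 := Finset.single_le_sum (f := a) (fun i _ => ha0 i) (Finset.mem_univ i)
    linarith [(ha i).1 (t, x)]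
  · rw [← pdxx_eq H]
    linarith [(hb i j).1 (t, x), hbs i j]
  · rw [← pdxx_eq H, ← pdxx_eq H]
    refine ((hb i j).2 (t, x) (t, y)).trans ?_
    have e : ‖((t, x) : ℝ × (Fin d → ℝ)) - (t, y)‖ = ‖x - y‖ := by
      rw [Prod.mk_sub_mk, sub_self, Prod.norm_mk, norm_zero, max_eq_right (norm_nonneg _)]
    rw [e]
    refine mul_le_mul_of_nonneg_right ?_ (norm_nonneg _)
    linarith [hbs i j]

lemma time_taylor {φ : ℝ × (Fin d → ℝ) → ℝ} (H : Cc φ) : ∃ K, 0 ≤ K ∧ ∀ s t x,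
    |φ (s, x) - φ (t, x) - (s - t) * pdt φ (t, x)| ≤ K * |s - t| * |s - t| := by
  obtain ⟨K, hK, -, hl⟩ := (H.dd ((1:ℝ), (0 : Fin d → ℝ))).bound
  refine ⟨K, hK, fun s t x => ?_⟩
  have hder : ∀ r, HasDerivAt (fun r => φ (r, x) - r * pdt φ (t, x))
      (pdt φ (r, x) - pdt φ (t, x)) r := by
    intro r
    have h1 : HasDerivAt (fun r : ℝ => (r, x)) ((1:ℝ), (0 : Fin d → ℝ)) r :=
      (hasDerivAt_id r).prodMk (hasDerivAt_const r x)
    have h2 : HasDerivAt (fun r => φ (r, x)) (pdt φ (r, x)) r :=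
      (H.diff (r, x)).hasFDerivAt.comp_hasDerivAt r h1
    have h3 := h2.sub ((hasDerivAt_id r).mul_const (pdt φ (t, x)))
    rw [one_mul] at h3
    exact h3
  have := Convex.norm_image_sub_le_of_norm_hasDerivWithin_le (s := uIcc t s) (x := t) (y := s)
    (fun r _ => (hder r).hasDerivWithinAt) (C := K * |s - t|) (fun r hr => by
      rw [Real.norm_eq_abs]
      refine (hl (r, x) (t, x)).trans (mul_le_mul_of_nonneg_left ?_ hK)
      rw [Prod.mk_sub_mk, sub_self, Prod.norm_mk, norm_zero, max_eq_left (norm_nonneg _),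
        Real.norm_eq_abs]
      exact abs_sub_left_of_mem_uIcc hr) (convex_uIcc t s) left_mem_uIcc right_mem_uIcc
  rw [Real.norm_eq_abs, Real.norm_eq_abs] at this
  refine le_trans (le_of_eq ?_) this
  congr 1
  ring

variable {A : ℕ → Fin d → Fin d → (Fin d → ℝ) → ℝ → ℝ} {B : ℕ → Fin d → (Fin d → ℝ) → ℝ → ℝ}
  {A' : Fin d → Fin d → (Fin d → ℝ) → ℝ → ℝ} {B' : Fin d → (Fin d → ℝ) → ℝ → ℝ}
  {h : ℕ → ℝ} {L L' c κ : ℝ} {J : ℕ → ((Fin d → ℝ) → ℝ) → (Fin d → ℝ) → ℝ}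
  {f : ℕ → (Fin d → ℝ) → ℝ} {u₀ : (Fin d → ℝ) → ℝ} {v : ℝ → (Fin d → ℝ) → ℝ}

lemma slice_cont {φ : ℝ × (Fin d → ℝ) → ℝ} (H : Continuous φ) (t : ℝ) :
    AEStronglyMeasurable (fun x => φ (t, x)) volume := by
  have h1 : Continuous fun x : Fin d → ℝ => (t, x) := by fun_prop
  exact (H.comp h1).aestronglyMeasurable

lemma slice_int {φ : ℝ × (Fin d → ℝ) → ℝ} (H : Cc φ) (t : ℝ) {u : (Fin d → ℝ) → ℝ}
    (hu : Integrable u) : Integrable (fun x => φ (t, x) * u x) := by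
  obtain ⟨K, -, hK, -⟩ := H.bound
  exact integrable_bdd_mul hu (slice_cont H.s.continuous t) (fun x => hK (t, x))

lemma Lim.rem (D : Lim A B A' B' h L c κ J f u₀ v) {φ : ℝ × (Fin d → ℝ) → ℝ} (H : Cc φ) {t : ℝ}
    (ht : 0 < t) : HasDerivAt (fun s => ∫ x, (φ (s, x) - φ (t, x)) * v s x)
      (∫ x, pdt φ (t, x) * v t x) t := by
  obtain ⟨K, hK, hT⟩ := time_taylor H
  have Hd : Cc (pdt φ) := H.dd _
  obtain ⟨K0, hK0, hb, -⟩ := Hd.bound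
  set M := ∫ x, |u₀ x|
  have hM : 0 ≤ M := integral_nonneg fun x => abs_nonneg _
  rw [hasDerivAt_iff_isLittleO, Asymptotics.isLittleO_iff]
  intro ε hε
  obtain ⟨δ, hδ, hmod⟩ := D.mod (ε / (2 * (K0 + 1))) (by positivity)
  have hδ2 : 0 < ε / (2 * (K * M + 1)) := by positivity
  have e1 : ∀ {η : ℝ}, 0 < η → ∀ᶠ s in 𝓝 t, |s - t| < η := fun {η} hη => by
    filter_upwards [Metric.ball_mem_nhds t hη] with s hs
    rwa [Metric.mem_ball, Real.dist_eq] at hs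
  filter_upwards [e1 hδ, e1 hδ2, lt_mem_nhds ht] with s hs hs2 hs0
  simp only [sub_self, zero_mul, integral_zero, sub_zero]
  rw [smul_eq_mul, Real.norm_eq_abs, Real.norm_eq_abs]
  have ivs := D.iv s hs0.le
  have ivt := D.iv t ht.le
  have i1 : Integrable (fun x => (φ (s, x) - φ (t, x)) * v s x) := by
    simp only [sub_mul]
    exact (slice_int H s ivs).sub (slice_int H t ivs)
  have i2 : Integrable (fun x => pdt φ (t, x) * v s x) := slice_int Hd t ivs
  have i3 : Integrable (fun x => pdt φ (t, x) * v t x) := slice_int Hd t ivt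
  have i4 : Integrable (fun x => (φ (s, x) - φ (t, x) - (s - t) * pdt φ (t, x)) * v s x) := by
    refine (i1.sub (i2.const_mul (s - t))).congr (ae_of_all _ fun x => ?_)
    show (φ (s, x) - φ (t, x)) * v s x - (s - t) * (pdt φ (t, x) * v s x) = _
    ring
  have i5 : Integrable (fun x => pdt φ (t, x) * (v s x - v t x)) := by
    simp only [mul_sub]
    exact i2.sub i3
  have e : (∫ x, (φ (s, x) - φ (t, x)) * v s x) - (s - t) * ∫ x, pdt φ (t, x) * v t x =
      (∫ x, (φ (s, x) - φ (t, x) - (s - t) * pdt φ (t, x)) * v s x) +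
        (s - t) * ∫ x, pdt φ (t, x) * (v s x - v t x) := by
    have i3' : Integrable (fun x => (s - t) * (pdt φ (t, x) * v t x)) := i3.const_mul _
    have i5' : Integrable (fun x => (s - t) * (pdt φ (t, x) * (v s x - v t x))) := i5.const_mul _
    rw [← integral_const_mul, ← integral_const_mul, ← integral_sub i1 i3', ← integral_add i4 i5']
    refine integral_congr_ae (ae_of_all _ fun x => ?_)
    show _ = _
    ring
  rw [e]
  have a1 : |∫ x, (φ (s, x) - φ (t, x) - (s - t) * pdt φ (t, x)) * v s x| ≤
      K * |s - t| * |s - t| * M := by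
    refine abs_integral_le_integral_abs.trans ?_
    have : ∫ x, |(φ (s, x) - φ (t, x) - (s - t) * pdt φ (t, x)) * v s x| ≤
        ∫ x, K * |s - t| * |s - t| * |v s x| := by
      refine integral_mono i4.abs (ivs.abs.const_mul _) fun x => ?_
      show |_ * _| ≤ _
      rw [abs_mul]
      exact mul_le_mul_of_nonneg_right (hT s t x) (abs_nonneg _)
    rw [integral_const_mul] at this
    exact this.trans (mul_le_mul_of_nonneg_left (D.norm hs0.le) (by positivity))
  have a2 : |∫ x, pdt φ (t, x) * (v s x - v t x)| ≤ K0 * (ε / (2 * (K0 + 1))) := by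
    refine abs_integral_le_integral_abs.trans ?_
    have iv2 : Integrable (fun x => K0 * |v s x - v t x|) := (ivs.sub ivt).abs.const_mul _
    have : ∫ x, |pdt φ (t, x) * (v s x - v t x)| ≤ ∫ x, K0 * |v s x - v t x| := by
      refine integral_mono i5.abs iv2 fun x => ?_
      show |_ * _| ≤ _
      rw [abs_mul]
      exact mul_le_mul_of_nonneg_right (hb _) (abs_nonneg _)
    rw [integral_const_mul] at this
    exact this.trans (mul_le_mul_of_nonneg_left (hmod t s ht.le hs0.le hs.le) hK0)
  have b1 : K0 * (ε / (2 * (K0 + 1))) ≤ ε / 2 := by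
    rw [mul_div_assoc', div_le_div_iff₀ (by positivity) (by norm_num)]
    nlinarith
  have b2 : K * |s - t| * M ≤ ε / 2 := by
    have : K * |s - t| * M ≤ (K * M) * (ε / (2 * (K * M + 1))) := by
      calc K * |s - t| * M = (K * M) * |s - t| := by ring
        _ ≤ _ := mul_le_mul_of_nonneg_left hs2.le (by positivity)
    refine this.trans ?_
    have hKM : 0 ≤ K * M := by positivity
    rw [mul_div_assoc', div_le_div_iff₀ (by positivity) (by norm_num)]
    nlinarith
  refine (abs_add_le _ _).trans ?_
  rw [abs_mul]
  have c1 := mul_le_mul_of_nonneg_left (a2.trans b1) (abs_nonneg (s - t))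
  have c2 := mul_le_mul_of_nonneg_left b2 (abs_nonneg (s - t))
  linarith

lemma Lim.derivF (D : Lim A B A' B' h L c κ J f u₀ v) {φ : ℝ × (Fin d → ℝ) → ℝ} (H : Cc φ) {t : ℝ}
    (ht : 0 < t) : HasDerivAt (fun s => ∫ x, φ (s, x) * v s x)
      ((∫ x, Lop A' B' (fun y => φ (t, y)) x (v t x)) + ∫ x, pdt φ (t, x) * v t x) t := by
  obtain ⟨C0, C1, hC1, hψ⟩ := slice_tst H
  refine ((D.deriv hC1 (hψ t) ht).add (D.rem H ht)).congr_of_eventuallyEq ?_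
  filter_upwards [lt_mem_nhds ht] with s hs
  have ivs := D.iv s hs.le
  have i1 : Integrable (fun x => φ (t, x) * v s x) := slice_int H t ivs
  have i2 : Integrable (fun x => (φ (s, x) - φ (t, x)) * v s x) := by
    simp only [sub_mul]
    exact (slice_int H s ivs).sub (slice_int H t ivs)
  show _ = (∫ x, φ (t, x) * v s x) + ∫ x, (φ (s, x) - φ (t, x)) * v s x
  rw [← integral_add i1 i2]
  refine integral_congr_ae (ae_of_all _ fun x => ?_)
  show _ = _
  ring

theorem Lim.sol (D : Lim A B A' B' h L c κ J f u₀ v)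
    {a : Fin d → Fin d → (Fin d → ℝ) → ℝ → ℝ} {b : Fin d → (Fin d → ℝ) → ℝ → ℝ}
    (hA : ∀ i j x s, A' i j x s = a i j x s * s) (hB : ∀ i x s, B' i x s = b i x s * s) :
    IsFPESol a b v := by
  intro φ hs hc hsup
  have H : Cc φ := ⟨hs, hc⟩
  obtain ⟨C0, C1, hC1, hψ⟩ := slice_tst H
  have Hd : Cc (pdt φ) := H.dd _
  obtain ⟨K0, hK0, hb, -⟩ := Hd.bound
  set q : ℝ → ℝ := fun t => ∫ x, (v t x * pdt φ (t, x)
      + ∑ i, ∑ j, a i j x (v t x) * v t x * pdxx i j φ (t, x)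
      + v t x * ∑ i, b i x (v t x) * pdx i φ (t, x)) with hq
  have hqe : ∀ t, 0 < t → q t = (∫ x, Lop A' B' (fun y => φ (t, y)) x (v t x)) +
      ∫ x, pdt φ (t, x) * v t x := by
    intro t ht
    rw [← integral_add (D.cf.int (hψ t) (D.iv t ht.le)) (slice_int Hd t (D.iv t ht.le))]
    refine integral_congr_ae (ae_of_all _ fun x => ?_)
    simp only [Lop, hA, hB, pdxx_eq H, pdx_eq H.diff, Finset.mul_sum]
    have e : ∀ i, v t x * (b i x (v t x) * pd i (fun y => φ (t, y)) x) =
        b i x (v t x) * v t x * pd i (fun y => φ (t, y)) x := fun i => by ring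
    simp only [e]
    ring
  obtain ⟨t1, T, ht1, htT, hsupp⟩ : ∃ t1 T : ℝ, 0 < t1 ∧ t1 ≤ T ∧
      ∀ p ∈ tsupport φ, t1 < p.1 ∧ p.1 < T := by
    have hcomp : IsCompact (tsupport φ) := hc
    rcases (tsupport φ).eq_empty_or_nonempty with h0 | h0
    · exact ⟨1, 1, one_pos, le_rfl, fun p hp => by rw [h0] at hp; exact absurd hp (notMem_empty _)⟩
    · obtain ⟨p, hp, hmin⟩ := hcomp.exists_isMinOn h0 (continuous_fst.continuousOn)
      obtain ⟨p', hp', hmax⟩ := hcomp.exists_isMaxOn h0 (continuous_fst.continuousOn)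
      have hp0 : 0 < p.1 := hsup hp
      have hpp : p.1 ≤ p'.1 := hmax hp
      refine ⟨p.1 / 2, p'.1 + 1, by positivity, by linarith, fun z hz => ?_⟩
      have h1 : p.1 ≤ z.1 := hmin hz
      have h2 : z.1 ≤ p'.1 := hmax hz
      constructor <;> linarith
  have hq0 : ∀ t, (t ≤ t1 ∨ T ≤ t) → q t = 0 := by
    intro t ht
    have hnot : ∀ x, (t, x) ∉ tsupport φ := by
      intro x hx
      have := hsupp _ hx
      simp only at this
      rcases ht with ht | ht <;> linarith
    have z1 : ∀ w x, dd w φ (t, x) = 0 := fun w x =>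
      image_eq_zero_of_notMem_tsupport fun hx => hnot x (dd_supp w hx)
    have z2 : ∀ w w' x, dd w (dd w' φ) (t, x) = 0 := fun w w' x =>
      image_eq_zero_of_notMem_tsupport fun hx => hnot x (dd_supp w' (dd_supp w hx))
    have e1 : ∀ x, pdt φ (t, x) = 0 := fun x => z1 _ x
    have e2 : ∀ i x, pdx i φ (t, x) = 0 := fun i x => z1 _ x
    have e3 : ∀ i j x, pdxx i j φ (t, x) = 0 := fun i j x => z2 _ _ x
    simp [hq, e1, e2, e3]
  set F : ℝ → ℝ := fun s => ∫ x, φ (s, x) * v s x with hF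
  have hF0 : ∀ t, (t ≤ t1 ∨ T ≤ t) → F t = 0 := by
    intro t ht
    have e1 : ∀ x, φ (t, x) = 0 := fun x => by
      refine image_eq_zero_of_notMem_tsupport fun hx => ?_
      have := hsupp _ hx
      simp only at this
      rcases ht with ht | ht <;> linarith
    simp [hF, e1]
  have hder : ∀ t, 0 < t → HasDerivAt F (q t) t := fun t ht => by
    rw [hqe t ht]; exact D.derivF H ht
  set M := ∫ x, |u₀ x|
  have hL := D.cf.hL
  have hbd : ∀ t, 0 < t → |q t| ≤ ((d : ℝ) ^ 2 + d) * L * C1 * M + K0 * M := by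
    intro t ht
    have ivt := D.iv t ht.le
    rw [hqe t ht]
    refine (abs_add_le _ _).trans (add_le_add ?_ ?_)
    · refine abs_integral_le_integral_abs.trans ?_
      have : ∫ x, |Lop A' B' (fun y => φ (t, y)) x (v t x)| ≤
          ∫ x, ((d : ℝ) ^ 2 + d) * L * C1 * |v t x| :=
        integral_mono (D.cf.int (hψ t) ivt).abs (ivt.abs.const_mul _)
          fun x => Lop_abs hL D.cf.bA D.cf.bB (hψ t) x _
      rw [integral_const_mul] at this
      exact this.trans (mul_le_mul_of_nonneg_left (D.norm ht.le) (by positivity))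
    · refine abs_integral_le_integral_abs.trans ?_
      have : ∫ x, |pdt φ (t, x) * v t x| ≤ ∫ x, K0 * |v t x| := by
        refine integral_mono (slice_int Hd t ivt).abs (ivt.abs.const_mul _) fun x => ?_
        show |_ * _| ≤ _
        rw [abs_mul]
        exact mul_le_mul_of_nonneg_right (hb _) (abs_nonneg _)
      rw [integral_const_mul] at this
      exact this.trans (mul_le_mul_of_nonneg_left (D.norm ht.le) hK0)
  have hqint : IntervalIntegrable q volume t1 T := by
    rw [intervalIntegrable_iff_integrableOn_Ioc_of_le htT]
    have hi : IntegrableOn (_root_.deriv F) (Ioc t1 T) := by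
      refine Measure.integrableOn_of_bounded (M := ((d : ℝ) ^ 2 + d) * L * C1 * M + K0 * M)
        (by simp) (measurable_deriv F).aestronglyMeasurable ?_
      refine (ae_restrict_iff' measurableSet_Ioc).2 (ae_of_all _ fun t ht => ?_)
      rw [(hder t (ht1.trans ht.1)).deriv]
      exact hbd t (ht1.trans ht.1)
    exact hi.congr_fun (fun t ht => (hder t (ht1.trans ht.1)).deriv) measurableSet_Ioc
  have hftc := intervalIntegral.integral_eq_sub_of_hasDerivAt (f := F) (f' := q) (a := t1) (b := T)
    (fun t ht => by
      rw [uIcc_of_le htT] at ht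
      exact hder t (ht1.trans_le ht.1)) hqint
  rw [hF0 T (Or.inr le_rfl), hF0 t1 (Or.inl le_rfl), sub_zero,
    intervalIntegral.integral_of_le htT] at hftc
  show ∫ t in Ioi (0:ℝ), q t = 0
  refine Eq.trans ?_ hftc
  refine setIntegral_eq_of_subset_of_forall_diff_eq_zero measurableSet_Ioi
    (fun t ht => ht1.trans ht.1) fun t ht => ?_
  refine hq0 t ?_
  have := ht.2
  rw [mem_Ioc, not_and_or, not_lt, not_le] at this
  exact this.imp id le_of_lt

end
end FPE

/-- under (H1)–(H3), for every `u₀ ∈ L¹(ℝ^d)` there is an `L¹`-continuous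
distributional solution of the nonlinear Fokker–Planck equation with `u(0) = u₀`,
which is nonnegative if `u₀` is and conserves mass. -/
theorem statement9 (d : ℕ) (a : Fin d → Fin d → (Fin d → ℝ) → ℝ → ℝ)
    (b : Fin d → (Fin d → ℝ) → ℝ → ℝ) (γ : ℝ)
    (hd : 1 ≤ d)
    (ha_smooth : ∀ i j, ContDiff ℝ 2 (fun p : (Fin d → ℝ) × ℝ => a i j p.1 p.2))
    (ha_bdd : ∀ i j, ∃ M : ℝ, ∀ (x : Fin d → ℝ) (r : ℝ), |a i j x r| ≤ M)
    (hax_cont : ∀ i j,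
      Continuous (fun p : (Fin d → ℝ) × ℝ => fderiv ℝ (fun y => a i j y p.2) p.1))
    (hax_bdd : ∀ i j, ∃ M : ℝ, ∀ (x : Fin d → ℝ) (r : ℝ),
      ‖fderiv ℝ (fun y => a i j y r) x‖ ≤ M)
    (ha_symm : ∀ i j x r, a i j x r = a j i x r)
    (hγ : 0 < γ)
    (hH2 : ∀ (x ξ : Fin d → ℝ) (r : ℝ),
      γ * ∑ i, ξ i ^ 2 ≤ ∑ i, ∑ j, (a i j x r + r * deriv (fun s => a i j x s) r) * ξ i * ξ j)
    (hb_smooth : ∀ i, ContDiff ℝ 1 (fun p : (Fin d → ℝ) × ℝ => b i p.1 p.2))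
    (hb_bdd : ∀ i, ∃ M : ℝ, ∀ (x : Fin d → ℝ) (r : ℝ), |b i x r| ≤ M)
    (hb_zero : ∀ i x, b i x 0 = 0)
    (u₀ : (Fin d → ℝ) → ℝ) (hu₀ : Integrable u₀) :
    ∃ u : ℝ → (Fin d → ℝ) → ℝ,
      (∀ t : ℝ, 0 ≤ t → Integrable (u t)) ∧
      (u 0 =ᵐ[volume] u₀) ∧
      (∀ t ∈ Set.Ici (0 : ℝ),
        Tendsto (fun s => ∫ x, |u s x - u t x|) (nhdsWithin t (Set.Ici 0)) (nhds 0)) ∧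
      IsFPESol a b u ∧
      ((0 ≤ᵐ[volume] u₀) → ∀ t : ℝ, 0 ≤ t → 0 ≤ᵐ[volume] u t) ∧
      (∀ t : ℝ, 0 ≤ t → (∫ x, u t x) = ∫ x, u₀ x) := by
  choose K1 hK1 using ha_bdd
  choose K2 hK2 using hax_bdd
  choose K3 hK3 using hb_bdd
  have s2 : ∀ (F : Fin d → Fin d → ℝ) i j, F i j ≤ ∑ i, ∑ j, |F i j| := fun F i j =>
    (le_abs_self _).trans ((Finset.single_le_sum (f := fun j => |F i j|)
      (fun _ _ => abs_nonneg _) (Finset.mem_univ j)).trans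
      (Finset.single_le_sum (f := fun i => ∑ j, |F i j|)
      (fun _ _ => Finset.sum_nonneg fun _ _ => abs_nonneg _) (Finset.mem_univ i)))
  have s1 : ∀ (F : Fin d → ℝ) i, F i ≤ ∑ i, |F i| := fun F i =>
    (le_abs_self _).trans (Finset.single_le_sum (f := fun j => |F j|)
      (fun _ _ => abs_nonneg _) (Finset.mem_univ i))
  have p1 : 0 ≤ ∑ i, ∑ j, |K1 i j| :=
    Finset.sum_nonneg fun _ _ => Finset.sum_nonneg fun _ _ => abs_nonneg _
  have p2 : 0 ≤ ∑ i, ∑ j, |K2 i j| :=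
    Finset.sum_nonneg fun _ _ => Finset.sum_nonneg fun _ _ => abs_nonneg _
  have p3 : 0 ≤ ∑ i, |K3 i| := Finset.sum_nonneg fun _ _ => abs_nonneg _
  have H : FPE.Hyp a b γ (∑ i, ∑ j, |K1 i j| + ∑ i, ∑ j, |K2 i j| + ∑ i, |K3 i|) :=
    ⟨ha_smooth, fun i j x r => by linarith [hK1 i j x r, s2 K1 i j],
      fun i j x r => by linarith [hK2 i j x r, s2 K2 i j], ha_symm, hγ, by linarith, hH2, hb_smooth,
      fun i x r => by linarith [hK3 i x r, s1 K3 i], hb_zero⟩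
  obtain ⟨L, C, hL, hC, hlev⟩ := FPE.levels H hd
  choose A M P B L' hN hAd eA eB using hlev
  have hex : ∀ n : ℕ, ∃ J, FPE.Lev (A n) (B n) (1 / ((n : ℝ) + 1)) L (γ / 2)
      (d * ((d + 1) * C) ^ 2 / (γ / 2)) J := fun n =>
    FPE.exists_lev (hN n) (hAd n) hL (by positivity) hC (by positivity)
  choose J hJ using hex
  obtain ⟨f, f1, f2, f3, f4⟩ := FPE.exists_approx hu₀
  have D : FPE.Dat A B (fun n : ℕ => 1 / ((n : ℝ) + 1)) L (γ / 2)
      (d * ((d + 1) * C) ^ 2 / (γ / 2)) J f u₀ :=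
    ⟨⟨hJ, tendsto_one_div_add_atTop_nhds_zero_nat⟩, hu₀, f1, f2, f4⟩
  obtain ⟨v, v1, v2, v3, σ, hσ, v4⟩ := D.limit f3
  have D' : FPE.Lim (fun m => A (σ m)) (fun m => B (σ m)) (fun i j x s => a i j x s * s)
      (fun i x s => b i x s * s) (fun m => 1 / ((σ m : ℝ) + 1)) L (γ / 2)
      (d * ((d + 1) * C) ^ 2 / (γ / 2)) (fun m => J (σ m)) (fun m => f (σ m)) u₀ v := by
    refine ⟨⟨⟨fun m => hJ (σ m), tendsto_one_div_add_atTop_nhds_zero_nat.comp hσ⟩, hu₀,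
      fun m => f1 _, fun m => f2 _, f4.comp hσ⟩, ⟨hL, fun i j => ?_, fun i => ?_,
      fun i j x s => ?_, fun i x s => ?_⟩, fun R => ?_, v1, v3, v4⟩
    · exact (ha_smooth i j).continuous.mul continuous_snd
    · exact (hb_smooth i).continuous.mul continuous_snd
    · obtain ⟨n, hn⟩ := exists_nat_ge (max ‖x‖ |s|)
      rw [← eA n i j x s ((le_max_left _ _).trans hn) ((le_max_right _ _).trans hn)]
      exact (hN n).bA i j x s
    · obtain ⟨n, hn⟩ := exists_nat_ge (max ‖x‖ |s|)
      rw [← eB n i x s ((le_max_left _ _).trans hn) ((le_max_right _ _).trans hn)]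
      exact (hN n).bB i x s
    · obtain ⟨n, hn⟩ := exists_nat_ge R
      filter_upwards [hσ.eventually (eventually_ge_atTop n)] with m hm x s hx hs
      have hR : R ≤ (σ m : ℝ) := hn.trans (by exact_mod_cast hm)
      exact ⟨fun i j => eA _ i j x s (hx.trans hR) (hs.trans hR),
        fun i => eB _ i x s (hx.trans hR) (hs.trans hR)⟩
  refine ⟨v, v1, v2, fun t ht => ?_, D'.sol (fun _ _ _ _ => rfl) (fun _ _ _ => rfl),
    fun h0 t ht => D'.pos h0 ht, fun t ht => D'.mass ht⟩
  rw [Metric.tendsto_nhds]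
  intro ε hε
  obtain ⟨δ, hδ, hm⟩ := v3 (ε / 2) (by positivity)
  filter_upwards [self_mem_nhdsWithin, nhdsWithin_le_nhds (Metric.ball_mem_nhds t hδ)] with s hs hs2
  rw [Metric.mem_ball, Real.dist_eq] at hs2
  rw [Real.dist_eq, sub_zero, abs_of_nonneg (integral_nonneg fun x => abs_nonneg _)]
  linarith [hm t s ht hs hs2.le]
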